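/- Let S be a set and let R be a symmetrized subset of the free group F(S) satisfying the C(6) small-cancellation condition, and let G = ⟨S | R⟩ be the presented group. Then there is no injective group homomorphism from F₂ × F₂ into G, where F₂ denotes the free group on two generators. -/

import Mathlib

/-- Length of the reduced word of an element of a free group. -/
def FG.len {S : Type*} [DecidableEq S] (g : FreeGroup S) : ℕ :=
  g.toWord.length

/-- `r` is cyclically reduced: every conjugate is at least as long. -/
def FG.CyclicallyReduced {S : Type*} [DecidableEq S] (r : FreeGroup S) : Prop :=
  ∀ g : FreeGroup S, FG.len r ≤ FG.len (g⁻¹ * r * g)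

/-- `R` is a symmetrized subset: every element is nontrivial and cyclically
reduced, `R` is closed under inversion and under cyclic permutation. -/
def FG.Symmetrized {S : Type*} [DecidableEq S] (R : Set (FreeGroup S)) : Prop :=
  (∀ r ∈ R, r ≠ 1 ∧ FG.CyclicallyReduced r) ∧
  (∀ r ∈ R, r⁻¹ ∈ R) ∧
  (∀ r ∈ R, ∀ u v : FreeGroup S,
      r = u * v → FG.len r = FG.len u + FG.len v → v * u ∈ R)

/-- `p` is a piece relative to `R`. -/
def FG.IsPiece {S : Type*} [DecidableEq S] (R : Set (FreeGroup S))
    (p : FreeGroup S) : Prop :=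
  p ≠ 1 ∧
  ∃ r₁ ∈ R, ∃ r₂ ∈ R, r₁ ≠ r₂ ∧
    (∃ v₁ : FreeGroup S, r₁ = p * v₁ ∧ FG.len r₁ = FG.len p + FG.len v₁) ∧
    (∃ v₂ : FreeGroup S, r₂ = p * v₂ ∧ FG.len r₂ = FG.len p + FG.len v₂)

/-- The C(6) small-cancellation condition: no relator is a reduced
concatenation of at most 5 pieces. -/
def FG.C6 {S : Type*} [DecidableEq S] (R : Set (FreeGroup S)) : Prop :=
  ¬ ∃ r ∈ R, ∃ ps : List (FreeGroup S),
      ps.length ≤ 5 ∧ (∀ p ∈ ps, FG.IsPiece R p) ∧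
      r = ps.prod ∧ FG.len r = (ps.map FG.len).sum

/-- Abstract pointed-cell structure. -/
structure CX (P V L : Type*) where
  nx : Equiv.Perm P
  rv : P → P
  lab : P → L
  vtx : P → V
  len : P → ℤ
  iv : L → L
  iv_iv : ∀ l, iv (iv l) = l
  iv_ne : ∀ l, iv l ≠ l
  rv_rv : ∀ c, rv (rv c) = c
  rv_nx : ∀ c, rv (nx c) = nx.symm (rv c)
  rv_ne : ∀ c, rv c ≠ c
  vtx_rv : ∀ c, vtx (rv c) = vtx c
  lab_rv : ∀ c, lab (rv (nx c)) = iv (lab c)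
  red : ∀ c, lab (nx c) ≠ iv (lab c)
  det : ∀ c c', vtx c = vtx c' → lab c = lab c' → vtx (nx c) = vtx (nx c')
  len_pos : ∀ c, 0 < len c
  len_nx : ∀ c, len (nx c) = len c
  len_rv : ∀ c, len (rv c) = len c
  per : ∀ c, (nx ^ (len c)) c = c

namespace CX
variable {P V L : Type*} (X : CX P V L)

def at' (c : P) (i : ℤ) : P := (X.nx ^ i) c

@[simp] theorem at_zero (c : P) : X.at' c 0 = c := by simp [at']
@[simp] theorem at_at (c : P) (i j : ℤ) : X.at' (X.at' c i) j = X.at' c (i + j) := by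
  simp only [at']; rw [add_comm, zpow_add]; rfl
theorem at_one (c : P) : X.at' c 1 = X.nx c := by simp [at']
theorem nx_at (c : P) (i : ℤ) : X.nx (X.at' c i) = X.at' c (i + 1) := by
  rw [← at_one, at_at]
theorem at_neg_one (c : P) : X.at' c (-1) = X.nx.symm c := by simp [at']
theorem at_inj {c c' : P} {i : ℤ} (h : X.at' c i = X.at' c' i) : c = c' := (X.nx ^ i).injective h
theorem at_eq_iff {c c' : P} {i : ℤ} : X.at' c i = c' ↔ c = X.at' c' (-i) := by
  constructor
  · rintro rfl; simp
  · rintro rfl; simp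

theorem at_ind (Q : P → Prop) (h1 : ∀ c, Q c → Q (X.nx c)) (h2 : ∀ c, Q c → Q (X.nx.symm c))
    (c : P) (hc : Q c) (i : ℤ) : Q (X.at' c i) := by
  induction i using Int.induction_on with
  | zero => simpa
  | succ i ih => rw [← nx_at]; exact h1 _ ih
  | pred i ih =>
    have := h2 _ ih
    rw [← at_neg_one, at_at] at this
    simpa [sub_eq_add_neg] using this

theorem rv_at (c : P) (i : ℤ) : X.rv (X.at' c i) = X.at' (X.rv c) (-i) := by
  induction i using Int.induction_on with
  | zero => simp
  | succ i ih => rw [← nx_at, rv_nx, ih, ← at_neg_one, at_at]; congr 1; ring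
  | pred i ih =>
    have h := X.rv_nx (X.at' c (-(i:ℤ) - 1))
    rw [nx_at, sub_add_cancel, ih, ← at_neg_one] at h
    have h2 := congrArg (fun z => X.at' z 1) h
    simp only [at_at] at h2
    simp at h2
    rw [← h2]; congr 1; ring

theorem len_at (c : P) (i : ℤ) : X.len (X.at' c i) = X.len c := by
  refine X.at_ind (fun d => X.len d = X.len c) ?_ ?_ c rfl i
  · intro d hd; rw [X.len_nx, hd]
  · intro d hd; rw [← hd, ← X.len_nx (X.nx.symm d)]; simp

theorem at_len (c : P) : X.at' c (X.len c) = c := X.per c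
theorem at_add_len (c : P) (i : ℤ) : X.at' c (i + X.len c) = X.at' c i := by
  rw [add_comm, ← at_at, at_len]
theorem at_sub_len (c : P) (i : ℤ) : X.at' c (i - X.len c) = X.at' c i := by
  rw [← X.at_add_len c (i - X.len c), sub_add_cancel]
theorem at_mul_len (c : P) (i k : ℤ) : X.at' c (i + k * X.len c) = X.at' c i := by
  induction k using Int.induction_on with
  | zero => simp
  | succ k ih => rw [add_mul, ← add_assoc, one_mul, at_add_len, ih]
  | pred k ih => rw [sub_mul, ← add_sub_assoc, one_mul, at_sub_len, ih]
theorem at_emod (c : P) (i : ℤ) : X.at' c (i % X.len c) = X.at' c i := by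
  conv_rhs => rw [← Int.emod_add_mul_ediv i (X.len c), mul_comm, at_mul_len]

theorem lab_rv_at (c : P) (t : ℤ) :
    X.lab (X.at' (X.rv c) t) = X.iv (X.lab (X.at' c (-t - 1))) := by
  rw [← X.lab_rv, nx_at, rv_at]; congr 2; ring

theorem lab_bar (c : P) (n t : ℤ) :
    X.lab (X.at' (X.rv (X.at' c n)) t) = X.iv (X.lab (X.at' c (n - t - 1))) := by
  rw [lab_rv_at, at_at]; congr 3; ring

theorem bar_bar (c : P) (n : ℤ) : X.rv (X.at' (X.rv (X.at' c n)) n) = c := by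
  rw [X.rv_at, X.rv_rv, X.at_at]; simp

theorem iv_inj {a b : L} (h : X.iv a = X.iv b) : a = b := by
  rw [← X.iv_iv a, h, X.iv_iv]

theorem red_at (c : P) (i : ℤ) : X.lab (X.at' c (i + 1)) ≠ X.iv (X.lab (X.at' c i)) := by
  rw [← nx_at]; exact X.red _

theorem bar_ne (c : P) (n : ℤ) : X.rv (X.at' c n) ≠ c := by
  intro h
  rcases Int.even_or_odd' n with ⟨m, hm | hm⟩
  · apply X.rv_ne (X.at' c m)
    conv_rhs => rw [← h, rv_at]
    rw [rv_at, at_at]; congr 1; omega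
  · have h1 := X.lab_bar c n m
    rw [h] at h1
    have : n - m - 1 = m := by omega
    rw [this] at h1
    exact X.iv_ne _ h1.symm

/-- `det` iterated. -/
theorem det_at {a b : P} (hv : X.vtx a = X.vtx b) {n : ℤ} (hn : 0 ≤ n)
    (hl : ∀ t, 0 ≤ t → t < n → X.lab (X.at' a t) = X.lab (X.at' b t)) :
    X.vtx (X.at' a n) = X.vtx (X.at' b n) := by
  induction n, hn using Int.leInduction with
  | base => simpa
  | succ n hn ih =>
    rw [← nx_at, ← nx_at]
    exact X.det _ _ (ih fun t h0 h1 => hl t h0 (by omega)) (hl n hn (by omega))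

/-- sharing -/
def Sh (a b : P) (m : ℤ) : Prop :=
  X.vtx a = X.vtx b ∧ ∀ t, 0 ≤ t → t < m → X.lab (X.at' a t) = X.lab (X.at' b t)

variable {X}
theorem Sh.refl (a : P) (m : ℤ) : X.Sh a a m := ⟨rfl, fun _ _ _ => rfl⟩
theorem Sh.symm {a b : P} {m : ℤ} (h : X.Sh a b m) : X.Sh b a m :=
  ⟨h.1.symm, fun t h0 h1 => (h.2 t h0 h1).symm⟩
theorem Sh.trans {a b c : P} {m : ℤ} (h : X.Sh a b m) (h' : X.Sh b c m) : X.Sh a c m :=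
  ⟨h.1.trans h'.1, fun t h0 h1 => (h.2 t h0 h1).trans (h'.2 t h0 h1)⟩
theorem Sh.mono {a b : P} {m n : ℤ} (h : X.Sh a b m) (hn : n ≤ m) : X.Sh a b n :=
  ⟨h.1, fun t h0 h1 => h.2 t h0 (by omega)⟩
theorem Sh.vtx_at {a b : P} {m : ℤ} (h : X.Sh a b m) {n : ℤ} (h0 : 0 ≤ n) (hn : n ≤ m) :
    X.vtx (X.at' a n) = X.vtx (X.at' b n) :=
  X.det_at h.1 h0 fun t h0 h1 => h.2 t h0 (by omega)
theorem Sh.shift {a b : P} {m : ℤ} (h : X.Sh a b m) {i n : ℤ} (h0 : 0 ≤ i) (hi : i ≤ m)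
    (hn : i + n ≤ m) : X.Sh (X.at' a i) (X.at' b i) n :=
  ⟨h.vtx_at h0 hi, fun t ht0 ht1 => by
    rw [at_at, at_at]; exact h.2 _ (by omega) (by omega)⟩
theorem Sh.rev {a b : P} {m : ℤ} (h : X.Sh a b m) (hm : 0 ≤ m) :
    X.Sh (X.rv (X.at' a m)) (X.rv (X.at' b m)) m := by
  refine ⟨?_, fun t h0 h1 => ?_⟩
  · rw [X.vtx_rv, X.vtx_rv]; exact h.vtx_at hm le_rfl
  · rw [X.lab_bar, X.lab_bar, h.2 _ (by omega) (by omega)]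
theorem Sh.ext {a b : P} {m : ℤ} (h : X.Sh a b m)
    (h' : X.lab (X.at' a m) = X.lab (X.at' b m)) : X.Sh a b (m+1) :=
  ⟨h.1, fun t h0 h1 => by
    rcases lt_or_eq_of_le (show t ≤ m by omega) with h2 | rfl
    · exact h.2 t h0 h2
    · exact h'⟩
theorem Sh.append {a b : P} {m n : ℤ} (h : X.Sh a b m) (hm : 0 ≤ m)
    (h' : X.Sh (X.at' a m) (X.at' b m) n) : X.Sh a b (m+n) :=
  ⟨h.1, fun t h0 h1 => by
    rcases lt_or_ge t m with h2 | h2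
    · exact h.2 t h0 h2
    · have := h'.2 (t - m) (by omega) (by omega)
      simpa using this⟩
theorem Sh.zero {a b : P} (h : X.vtx a = X.vtx b) {m : ℤ} (hm : m ≤ 0) : X.Sh a b m :=
  ⟨h, fun t h0 h1 => by omega⟩
variable (X)

def Pc (c : P) (m : ℤ) : Prop := ∃ c', c' ≠ c ∧ X.Sh c c' m

variable {X}
theorem Pc.mono {c : P} {m n : ℤ} (h : X.Pc c m) (hn : n ≤ m) : X.Pc c n := by
  obtain ⟨c', h1, h2⟩ := h; exact ⟨c', h1, h2.mono hn⟩
theorem Pc.shift {c : P} {m : ℤ} (h : X.Pc c m) {i n : ℤ} (h0 : 0 ≤ i) (hi : i ≤ m)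
    (hn : i + n ≤ m) : X.Pc (X.at' c i) n := by
  obtain ⟨c', h1, h2⟩ := h
  exact ⟨X.at' c' i, fun h => h1 (X.at_inj h), h2.shift h0 hi hn⟩
theorem rv_inj {a b : P} (h : X.rv a = X.rv b) : a = b := by
  rw [← X.rv_rv a, h, X.rv_rv]
theorem Pc.rev {c : P} {m : ℤ} (h : X.Pc c m) (hm : 0 ≤ m) : X.Pc (X.rv (X.at' c m)) m := by
  obtain ⟨c', h1, h2⟩ := h
  exact ⟨_, fun h => h1 (X.at_inj (rv_inj h)), h2.rev hm⟩
theorem Pc.zero (c : P) {m : ℤ} (hm : m ≤ 0) : X.Pc c m :=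
  ⟨X.rv c, X.rv_ne c, Sh.zero (X.vtx_rv c).symm hm⟩
variable (X)

def Cov : ℕ → P → ℤ → Prop
  | 0, _, n => n ≤ 0
  | q+1, c, n => ∃ m, 0 ≤ m ∧ X.Pc c m ∧ Cov q (X.at' c m) (n - m)

def C6 : Prop := ∀ c, ¬ X.Cov 5 c (X.len c)

variable {X}
theorem Cov.mono {q : ℕ} {c : P} {n n' : ℤ} (h : X.Cov q c n) (hn : n' ≤ n) : X.Cov q c n' := by
  induction q generalizing c n n' with
  | zero => exact le_trans hn h
  | succ q ih =>
    obtain ⟨m, h0, h1, h2⟩ := h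
    exact ⟨m, h0, h1, ih h2 (by omega)⟩
theorem Cov.succ {q : ℕ} {c : P} {n : ℤ} (h : X.Cov q c n) : X.Cov (q+1) c n :=
  ⟨0, le_rfl, Pc.zero c le_rfl, by simpa using h⟩
theorem Cov.le {q q' : ℕ} {c : P} {n : ℤ} (h : X.Cov q c n) (hq : q ≤ q') : X.Cov q' c n := by
  induction q', hq using Nat.le_induction with
  | base => exact h
  | succ k _ ih => exact ih.succ
theorem Cov.suffix {q : ℕ} {c : P} {n i : ℤ} (h : X.Cov q c n) (hi : 0 ≤ i) :
    X.Cov q (X.at' c i) (n - i) := by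
  induction q generalizing c n i with
  | zero => have : n ≤ 0 := h; show n - i ≤ 0; omega
  | succ q ih =>
    obtain ⟨m, h0, h1, h2⟩ := h
    rcases le_total i m with him | him
    · refine ⟨m - i, by omega, h1.shift hi him (by omega), ?_⟩
      rw [at_at, show i + (m - i) = m by ring, show n - i - (m - i) = n - m by ring]; exact h2
    · have := (ih h2 (show 0 ≤ i - m by omega)).succ
      rw [at_at, show m + (i - m) = i by ring, show n - m - (i - m) = n - i by ring] at this
      exact this
theorem Cov.append {p q : ℕ} {c : P} {m n : ℤ} (h : X.Cov p c m) (h' : X.Cov q (X.at' c m) n) :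
    X.Cov (p+q) c (m+n) := by
  induction p generalizing c m with
  | zero =>
    have hm : m ≤ 0 := h
    have := h'.suffix (show 0 ≤ -m by omega)
    simp at this
    rw [zero_add, add_comm]; exact this
  | succ p ih =>
    obtain ⟨k, h0, h1, h2⟩ := h
    have := ih h2 (by simpa using h')
    rw [show p + 1 + q = (p+q)+1 by omega]
    exact ⟨k, h0, h1, by convert this using 1; ring⟩
theorem Pc.cov {c : P} {m : ℤ} (h : X.Pc c m) : X.Cov 1 c m := by
  rcases le_total 0 m with hm | hm
  · exact ⟨m, hm, h, by show m - m ≤ 0; omega⟩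
  · exact ⟨0, le_rfl, Pc.zero c le_rfl, by show m - 0 ≤ 0; omega⟩
theorem Cov.rev {q : ℕ} {c : P} {n : ℤ} (h : X.Cov q c n) (hn : 0 ≤ n) :
    X.Cov q (X.rv (X.at' c n)) n := by
  induction q generalizing c n with
  | zero => exact h
  | succ q ih =>
    obtain ⟨m, h0, h1, h2⟩ := h
    rcases le_total m n with hm | hm
    · have h3 := ih h2 (by omega)
      have h4 := (h1.rev h0).cov
      have h5 : X.at' (X.rv (X.at' (X.at' c m) (n - m))) (n - m) = X.rv (X.at' c m) := by
        rw [rv_at, at_at]; simp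
      rw [← h5] at h4
      have h6 := (h3.append h4).mono (show n ≤ n - m + m by omega)
      rwa [at_at, show m + (n - m) = n by ring] at h6
    · exact ((h1.mono hm).rev hn).cov.le (by omega)
end CX

section words
variable {S : Type*} [DecidableEq S]

def RW (R : Set (FreeGroup S)) : Set (List (S × Bool)) := {w | ∃ r ∈ R, r.toWord = w}

variable {R : Set (FreeGroup S)}

theorem RW.mk_mem {w} (h : w ∈ RW R) : FreeGroup.mk w ∈ R := by
  obtain ⟨r, hr, rfl⟩ := h; rwa [FreeGroup.mk_toWord]
theorem RW.red {w} (h : w ∈ RW R) : FreeGroup.reduce w = w := by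
  obtain ⟨r, hr, rfl⟩ := h; exact FreeGroup.reduce_toWord r
theorem RW.isRed {w} (h : w ∈ RW R) : FreeGroup.IsReduced w :=
  FreeGroup.IsReduced.of_reduce_eq (RW.red h)
theorem RW.of {w} (h : FreeGroup.mk w ∈ R) (h' : FreeGroup.reduce w = w) : w ∈ RW R :=
  ⟨_, h, by rw [FreeGroup.toWord_mk, h']⟩

theorem FG.len_mk_le (w : List (S × Bool)) : FG.len (FreeGroup.mk w) ≤ w.length := by
  exact FreeGroup.norm_mk_le
theorem FG.len_mk {w : List (S × Bool)} (h : FreeGroup.IsReduced w) :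
    FG.len (FreeGroup.mk w) = w.length := by
  rw [FG.len, FreeGroup.toWord_mk, h.reduce_eq]


theorem RW.ne (hS : FG.Symmetrized R) {w} (h : w ∈ RW R) : w ≠ [] := by
  rintro rfl
  obtain ⟨r, hr, h⟩ := h
  exact (hS.1 r hr).1 (FreeGroup.toWord_eq_nil_iff.1 h)

theorem RW.inv (hS : FG.Symmetrized R) {w} (h : w ∈ RW R) : FreeGroup.invRev w ∈ RW R := by
  obtain ⟨r, hr, rfl⟩ := h
  exact ⟨r⁻¹, hS.2.1 r hr, FreeGroup.toWord_inv r⟩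

theorem RW.rot (hS : FG.Symmetrized R) {u v : List (S × Bool)} (h : u ++ v ∈ RW R) : v ++ u ∈ RW R := by
  have hr := RW.isRed h
  have hu : FreeGroup.IsReduced u := (List.isChain_append.1 hr).1
  have hv : FreeGroup.IsReduced v := (List.isChain_append.1 hr).2.1
  have hm := (RW.mk_mem h)
  have h1 := hS.2.2 _ hm (FreeGroup.mk u) (FreeGroup.mk v) (by simp)
    (by rw [FG.len_mk hr, FG.len_mk hu, FG.len_mk hv, List.length_append])
  rw [FreeGroup.mul_mk] at h1
  refine RW.of h1 ?_
  have h2 := (hS.1 _ hm).2 (FreeGroup.mk u)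
  rw [FG.len_mk hr, ← FreeGroup.mul_mk, mul_assoc, mul_assoc, inv_mul_cancel_left,
    FreeGroup.mul_mk, FG.len, FreeGroup.toWord_mk] at h2
  have h3 : (FreeGroup.reduce (v ++ u)).Sublist (v ++ u) := FreeGroup.Red.sublist FreeGroup.reduce.red
  apply h3.eq_of_length_le
  simpa [add_comm] using h2

theorem RW.rotate (hS : FG.Symmetrized R) {w} (h : w ∈ RW R) (n : ℕ) : w.rotate n ∈ RW R := by
  rw [List.rotate_eq_drop_append_take_mod]
  apply RW.rot hS
  rwa [List.take_append_drop]

/-- inverse letter -/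
def ivL (l : S × Bool) : S × Bool := (l.1, !l.2)

def WX (hS : FG.Symmetrized R) : CX (RW R) Unit (S × Bool) where
  nx := ⟨fun w => ⟨w.1.rotate 1, RW.rotate hS w.2 1⟩,
    fun w => ⟨w.1.rotate (w.1.length - 1), RW.rotate hS w.2 _⟩,
    fun w => by
      have := List.length_pos_of_ne_nil (RW.ne hS w.2)
      ext1; simp only [List.length_rotate, List.rotate_rotate]
      rw [Nat.add_sub_cancel' this, List.rotate_length],
    fun w => by
      have := List.length_pos_of_ne_nil (RW.ne hS w.2)
      ext1; simp only [List.rotate_rotate]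
      rw [Nat.sub_add_cancel this, List.rotate_length]⟩
  rv w := ⟨FreeGroup.invRev w.1, RW.inv hS w.2⟩
  lab w := w.1.head (RW.ne hS w.2)
  vtx _ := ()
  len w := w.1.length
  iv := ivL
  iv_iv l := by simp [ivL]
  iv_ne l := by
    intro h
    have := congrArg Prod.snd h
    simp [ivL] at this
  rv_rv c := by ext1; simp
  rv_nx c := by
    rw [Equiv.eq_symm_apply]
    obtain ⟨w, hw⟩ := c
    ext1
    rcases w with _ | ⟨a, t⟩
    · exact absurd rfl (RW.ne hS hw)
    · simp [FreeGroup.invRev]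
  rv_ne c := by
    obtain ⟨w, hw⟩ := c
    intro h
    have h := congrArg Subtype.val h
    simp only at h
    have h1 : FreeGroup.mk w * FreeGroup.mk w = 1 := by
      nth_rewrite 2 [← h]
      rw [← FreeGroup.inv_mk, mul_inv_cancel]
    have h2 : FreeGroup.mk w = 1 := by
      rw [← sq] at h1
      exact (pow_eq_one_iff_left two_ne_zero).1 h1
    exact (hS.1 _ (RW.mk_mem hw)).1 h2
  vtx_rv _ := rfl
  lab_rv c := by
    obtain ⟨w, hw⟩ := c
    rcases w with _ | ⟨a, t⟩
    · exact absurd rfl (RW.ne hS hw)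
    · simp [FreeGroup.invRev, ivL]
  red c := by
    obtain ⟨w, hw⟩ := c
    rcases w with _ | ⟨a, _ | ⟨b, t⟩⟩
    · exact absurd rfl (RW.ne hS hw)
    · intro h
      have := congrArg Prod.snd h
      simp [ivL] at this
    · have := (RW.isRed hw)
      rw [FreeGroup.isReduced_cons_cons] at this
      intro h
      simp [ivL] at h
      have h1 := this.1 (by rw [h])
      rw [h] at h1; simp at h1
  det _ _ _ _ := rfl
  len_pos c := by
    have := List.length_pos_of_ne_nil (RW.ne hS c.2)
    exact_mod_cast this
  len_nx c := by simp
  len_rv c := by simp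
  per c := by
    have key : ∀ n : ℕ, ∀ e : Equiv.Perm (RW R), (∀ w, (e w).1 = w.1.rotate 1) →
        ((e ^ n) c).1 = c.1.rotate n := by
      intro n e he
      induction n with
      | zero => simp
      | succ n ih => rw [pow_succ', Equiv.Perm.mul_apply, he, ih, List.rotate_rotate]
    ext1
    rw [zpow_natCast, key _ _ (fun w => rfl), List.rotate_length]

variable (hS : FG.Symmetrized R)

theorem WX.at_nat (c : RW R) (n : ℕ) : ((WX hS).at' c n).1 = c.1.rotate n := by
  induction n with
  | zero => simp
  | succ n ih =>
    push_cast
    rw [← CX.nx_at]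
    show List.rotate _ 1 = _
    rw [ih, List.rotate_rotate]

theorem WX.lab_at (c : RW R) (n : ℕ) (hn : n < c.1.length) :
    (WX hS).lab ((WX hS).at' c n) = c.1[n] := by
  show List.head _ _ = _
  rw [List.head_eq_getElem]
  have : ∀ l : List (S × Bool), ∀ h, l = c.1.rotate n → l[0]'h = c.1[n] := by
    rintro l h rfl
    rw [List.getElem_rotate]
    congr 1
    rw [zero_add, Nat.mod_eq_of_lt hn]
  exact this _ _ (WX.at_nat hS c n)

/-- piece as a word -/
def PcW (R : Set (FreeGroup S)) (p : List (S × Bool)) : Prop :=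
  p ≠ [] ∧ ∃ w₁ ∈ RW R, ∃ w₂ ∈ RW R, w₁ ≠ w₂ ∧ p <+: w₁ ∧ p <+: w₂

theorem PcW.isRed {p} (h : PcW R p) : FreeGroup.IsReduced p := by
  obtain ⟨_, w, hw, _, _, _, h, _⟩ := h
  obtain ⟨v, rfl⟩ := h
  exact (List.isChain_append.1 (RW.isRed hw)).1

theorem PcW.isPiece {p} (h : PcW R p) : FG.IsPiece R (FreeGroup.mk p) := by
  have hr := h.isRed
  obtain ⟨hp, w₁, h1, w₂, h2, hne, ⟨v₁, rfl⟩, ⟨v₂, rfl⟩⟩ := h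
  refine ⟨?_, FreeGroup.mk (p ++ v₁), (RW.mk_mem h1), FreeGroup.mk (p ++ v₂), (RW.mk_mem h2), ?_, ?_, ?_⟩
  · intro h
    have := congrArg FreeGroup.toWord h
    rw [FreeGroup.toWord_mk, hr.reduce_eq] at this
    exact hp (by simpa using this)
  · intro h
    have := congrArg FreeGroup.toWord h
    rw [FreeGroup.toWord_mk, FreeGroup.toWord_mk, RW.red h1, RW.red h2] at this
    exact hne this
  · refine ⟨FreeGroup.mk v₁, by simp, ?_⟩
    rw [FG.len_mk (RW.isRed h1), FG.len_mk hr, FG.len_mk (List.isChain_append.1 (RW.isRed h1)).2.1,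
      List.length_append]
  · refine ⟨FreeGroup.mk v₂, by simp, ?_⟩
    rw [FG.len_mk (RW.isRed h2), FG.len_mk hr, FG.len_mk (List.isChain_append.1 (RW.isRed h2)).2.1,
      List.length_append]

theorem RW.c6 (hC : FG.C6 R) {w} (hw : w ∈ RW R) (ps : List (List (S × Bool)))
    (hps : ps.length ≤ 5) (hp : ∀ p ∈ ps, PcW R p) : ps.flatten ≠ w := by
  intro h
  apply hC
  refine ⟨FreeGroup.mk w, (RW.mk_mem hw), ps.map FreeGroup.mk, by simpa, ?_, ?_, ?_⟩
  · intro p h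
    obtain ⟨q, hq, rfl⟩ := List.mem_map.1 h
    exact (hp q hq).isPiece
  · rw [← h]
    clear h hps hp
    induction ps with
    | nil => rfl
    | cons p ps ih => simp [← ih, FreeGroup.mul_mk]
  · rw [FG.len_mk (RW.isRed hw), ← h, List.length_flatten, List.map_map]
    congr 1
    apply List.map_congr_left
    intro p h
    exact (FG.len_mk (hp p h).isRed).symm

theorem WX.take_eq {c c' : RW R} {m : ℕ} (h : (WX hS).Sh c c' m) (hm : m ≤ c.1.length)
    (hm' : m ≤ c'.1.length) : c.1.take m = c'.1.take m := by
  apply List.ext_getElem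
  · simp [hm, hm']
  · intro i h1 h2
    simp only [List.length_take, lt_min_iff] at h1 h2
    simp only [List.getElem_take]
    have := h.2 i (by omega) (by omega)
    rwa [WX.lab_at hS _ _ (by omega), WX.lab_at hS _ _ (by omega)] at this

theorem WX.pcW (hC : FG.C6 R) {c : RW R} {m : ℕ} (h : (WX hS).Pc c m) (hm : m ≤ c.1.length)
    (h0 : 0 < m) : PcW R (c.1.take m) := by
  obtain ⟨c', hne, h⟩ := h
  have hne' : c.1 ≠ c'.1 := fun h => hne (Subtype.ext h.symm)
  rcases le_or_gt m c'.1.length with h1 | h1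
  · refine ⟨?_, c.1, c.2, c'.1, c'.2, hne', ⟨_, List.take_append_drop _ _⟩, ?_⟩
    · rw [← List.length_pos_iff]; simp; exact ⟨h0, List.length_pos_of_ne_nil (RW.ne hS c.2)⟩
    · rw [WX.take_eq hS h hm h1]; exact ⟨_, List.take_append_drop _ _⟩
  · exfalso
    have h2 := WX.take_eq hS (m := c'.1.length) (h.mono (by omega)) (by omega) le_rfl
    rw [List.take_length] at h2
    refine RW.c6 hC c'.2 [c'.1] (by simp) ?_ (by simp)
    simp only [List.mem_singleton, forall_eq]
    exact ⟨RW.ne hS c'.2, c.1, c.2, c'.1, c'.2, hne', h2 ▸ ⟨_, List.take_append_drop _ _⟩, List.prefix_rfl⟩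

theorem WX.cov (hC : FG.C6 R) {q : ℕ} {c : RW R} {n : ℕ} (h : (WX hS).Cov q c n)
    (hn : n ≤ c.1.length) : ∃ ps : List (List (S × Bool)), ps.length ≤ q ∧ (∀ p ∈ ps, PcW R p) ∧
      ps.flatten = c.1.take n := by
  induction q generalizing c n with
  | zero =>
    have : (n : ℤ) ≤ 0 := h
    have : n = 0 := by omega
    exact ⟨[], by simp, by simp, by simp [this]⟩
  | succ q ih =>
    obtain ⟨m, h0, h1, h2⟩ := h
    lift m to ℕ using h0
    rcases Nat.eq_zero_or_pos n with rfl | hn0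
    · exact ⟨[], by simp, by simp, by simp⟩
    rcases le_or_gt n m with hnm | hnm
    · exact ⟨[c.1.take n], by simp, by simpa using WX.pcW hS hC (h1.mono (by omega)) hn hn0, by simp⟩
    rcases Nat.eq_zero_or_pos m with rfl | hm0
    · obtain ⟨ps, h3, h4, h5⟩ := ih (c := c) (n := n) (by simpa using h2) hn
      exact ⟨ps, by omega, h4, h5⟩
    · obtain ⟨ps, h3, h4, h5⟩ := ih (c := (WX hS).at' c m) (n := n - m)
        (by rw [Nat.cast_sub hnm.le]; exact h2) (by rw [WX.at_nat]; simp; omega)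
      refine ⟨c.1.take m :: ps, by simp; omega, ?_, ?_⟩
      · simp only [List.mem_cons, forall_eq_or_imp]
        exact ⟨WX.pcW hS hC h1 (by omega) hm0, h4⟩
      · rw [List.flatten_cons, h5, WX.at_nat, List.rotate_eq_drop_append_take (by omega),
          List.take_append_of_le_length (by simp; omega)]
        rw [← List.drop_take]
        conv_rhs => rw [← List.take_append_drop m (c.1.take n)]
        rw [List.take_take, min_eq_left hnm.le]

theorem WX.c6 (hC : FG.C6 R) : (WX hS).C6 := by
  intro c h
  obtain ⟨ps, h1, h2, h3⟩ := WX.cov hS hC (n := c.1.length) h le_rfl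
  rw [List.take_length] at h3
  exact RW.c6 hC c.2 ps h1 h2 h3
end words

namespace CX
section pi
variable {P V L : Type*} (X : CX P V L)

/-- first index not shared with another element of `A` -/
noncomputable def pi (A : Set P) (c : P) : ℤ :=
  ((sInf {i : ℕ | ∀ c' ∈ A, c' ≠ c → ¬ X.Sh c c' (i + 1)} : ℕ) : ℤ)

variable {X}
theorem pi_nonneg (A : Set P) (c : P) : 0 ≤ X.pi A c := Int.natCast_nonneg _

theorem not_pc_len (hC : X.C6) (c : P) : ¬ X.Pc c (X.len c) := fun h =>
  hC c (h.cov.le (by omega))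

theorem pi_spec (hC : X.C6) {A : Set P} {c c' : P} (hc' : c' ∈ A) {m : ℤ} (hm : X.pi A c < m)
    (h : X.Sh c c' m) : c' = c := by
  by_contra hne
  have hmem : sInf {i : ℕ | ∀ c' ∈ A, c' ≠ c → ¬ X.Sh c c' (i + 1)} ∈
      {i : ℕ | ∀ c' ∈ A, c' ≠ c → ¬ X.Sh c c' (i + 1)} := by
    apply Nat.sInf_mem
    refine ⟨(X.len c).toNat, fun d _ hd hs => not_pc_len hC c ⟨d, hd, hs.mono ?_⟩⟩
    have := X.len_pos c
    omega
  exact hmem c' hc' hne (h.mono (by unfold pi at hm; omega))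

theorem pi_share (A : Set P) (c : P) :
    X.pi A c = 0 ∨ ∃ c' ∈ A, c' ≠ c ∧ X.Sh c c' (X.pi A c) := by
  by_cases h0 : X.pi A c = 0
  · exact Or.inl h0
  right
  unfold pi at h0 ⊢
  set k := sInf {i : ℕ | ∀ c' ∈ A, c' ≠ c → ¬ X.Sh c c' (i + 1)} with hk
  have hk0 : k ≠ 0 := by exact_mod_cast h0
  have : k - 1 ∉ {i : ℕ | ∀ c' ∈ A, c' ≠ c → ¬ X.Sh c c' (i + 1)} :=
    Nat.notMem_of_lt_sInf (by omega)
  simp only [Set.mem_ofPred_eq, not_forall, not_not] at this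
  obtain ⟨c', h1, h2, h3⟩ := this
  exact ⟨c', h1, h2, h3.mono (by omega)⟩

theorem pi_pc (A : Set P) (c : P) : X.Pc c (X.pi A c) := by
  rcases X.pi_share A c with h | ⟨c', _, h1, h2⟩
  · exact Pc.zero c h.le
  · exact ⟨c', h1, h2⟩
end pi
end CX

section stage
variable {W L : Type*} (X : CX W Unit L)

def Pth (E : List L → L → List L → Prop) (p : ℤ → List L) (w : W) (i j : ℤ) : Prop :=
  ∀ t, i ≤ t → t < j → E (p t) (X.lab (X.at' w t)) (p (t + 1))

def Lp (E : List L → L → List L → Prop) (y : List L) (w : W) : Prop :=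
  ∃ p : ℤ → List L, p 0 = y ∧ (∀ t, E (p t) (X.lab (X.at' w t)) (p (t + 1))) ∧
    ∀ t, p (t + X.len w) = p t

structure Stage where
  V : Set (List L)
  E : List L → L → List L → Prop
  sym : ∀ {u l v}, E u l v → E v (X.iv l) u
  det : ∀ {u l v v'}, E u l v → E u l v' → v = v'
  memV : ∀ {u l v}, E u l v → u ∈ V
  tree : ∀ {z l}, z ++ [l] ∈ V → z ∈ V ∧ ∃ v, E z l v
  conv : ∀ {p w n}, n ≤ X.len w → Pth X E p w 0 n → Lp X E (p 0) w ∨ X.Cov 2 w n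

variable {X}

theorem Lp.mono {E E' : List L → L → List L → Prop} (hE : ∀ u l v, E u l v → E' u l v)
    {y : List L} {w : W} (h : Lp X E y w) : Lp X E' y w := by
  obtain ⟨p, h0, h1, h2⟩ := h
  exact ⟨p, h0, fun t => hE _ _ _ (h1 t), h2⟩

theorem Lp.shift {E : List L → L → List L → Prop} {p : ℤ → List L} {w : W}
    (h1 : ∀ t, E (p t) (X.lab (X.at' w t)) (p (t + 1)))
    (h2 : ∀ t, p (t + X.len w) = p t) (s : ℤ) : Lp X E (p s) (X.at' w s) := by
  refine ⟨fun t => p (s + t), by simp, fun t => ?_, fun t => ?_⟩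
  · show E (p (s + t)) _ (p (s + (t + 1)))
    rw [X.at_at, ← add_assoc]; exact h1 _
  · show p (s + (t + _)) = _
    rw [X.len_at, ← add_assoc]; exact h2 _

theorem Lp.mk' {E : List L → L → List L → Prop} {p : ℤ → List L} {w : W}
    (h : Pth X E p w 0 (X.len w)) (hp : p (X.len w) = p 0) :
    ∃ q : ℤ → List L, (∀ t, 0 ≤ t → t ≤ X.len w → q t = p t) ∧
    (∀ t, E (q t) (X.lab (X.at' w t)) (q (t + 1))) ∧ ∀ t, q (t + X.len w) = q t := by
  have hl := X.len_pos w
  refine ⟨fun t => p (t % X.len w), fun t h0 h1 => ?_, fun t => ?_, fun t => ?_⟩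
  · rcases lt_or_eq_of_le h1 with h1 | h1
    · show p _ = _
      rw [Int.emod_eq_of_lt h0 h1]
    · subst h1; simp [hp]
  · have h3 := h (t % X.len w) (Int.emod_nonneg _ hl.ne') (Int.emod_lt_of_pos _ hl)
    rw [X.at_emod] at h3
    convert h3 using 1
    rcases lt_or_eq_of_le (show t % X.len w + 1 ≤ X.len w by
      have := Int.emod_lt_of_pos t hl; omega) with h4 | h4
    · rw [← Int.emod_eq_of_lt (a := t % X.len w + 1) (b := X.len w)
        (by have := Int.emod_nonneg t hl.ne'; omega) h4]
      rw [Int.emod_add_emod]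
    · show p ((t + 1) % X.len w) = _
      rw [h4, hp, Int.add_emod]
      have : (t % X.len w + 1 % X.len w) % X.len w = 0 := by
        rw [Int.add_emod_emod, h4]; simp
      rw [this]
  · show p _ = p _
    simp

namespace Stage
variable (B : Stage X)

theorem memV' {u l v} (h : B.E u l v) : v ∈ B.V := B.memV (B.sym h)

theorem sym_iff {u l v} : B.E u l v ↔ B.E v (X.iv l) u :=
  ⟨B.sym, fun h => by simpa [X.iv_iv] using B.sym h⟩

variable {B}
theorem pth_eq {p q : ℤ → List L} {w : W} {i j : ℤ} (hp : Pth X B.E p w i j)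
    (hq : Pth X B.E q w i j) {s : ℤ} (hs : i ≤ s) (hs' : s ≤ j) (h : p s = q s) :
    ∀ t, i ≤ t → t ≤ j → p t = q t := by
  have fwd : ∀ k : ℕ, s + k ≤ j → p (s + k) = q (s + k) := by
    intro k
    induction k with
    | zero => intro _; simpa
    | succ k ih =>
      intro hk
      push_cast at hk
      have h1 := hp (s + k) (by omega) (by omega)
      have h2 := hq (s + k) (by omega) (by omega)
      rw [ih (by omega)] at h1
      have := B.det h1 h2
      push_cast; rwa [← add_assoc]
  have bwd : ∀ k : ℕ, i ≤ s - k → p (s - k) = q (s - k) := by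
    intro k
    induction k with
    | zero => intro _; simpa
    | succ k ih =>
      intro hk
      push_cast at hk
      have h1 := B.sym (hp (s - (k + 1)) (by omega) (by omega))
      have h2 := B.sym (hq (s - (k + 1)) (by omega) (by omega))
      rw [show s - (k + 1 : ℤ) + 1 = s - k by ring] at h1 h2
      rw [ih (by omega)] at h1
      have := B.det h1 h2
      push_cast; exact this
  intro t h0 h1
  rcases le_total s t with h2 | h2
  · have := fwd (t - s).toNat (by omega)
    rwa [Int.toNat_of_nonneg (by omega), add_sub_cancel] at this
  · have := bwd (s - t).toNat (by omega)
    rwa [Int.toNat_of_nonneg (by omega), sub_sub_cancel] at this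

theorem pth_sub {p : ℤ → List L} {w : W} {i j i' j' : ℤ} (hp : Pth X B.E p w i j)
    (hi : i ≤ i') (hj : j' ≤ j) : Pth X B.E p w i' j' :=
  fun t h0 h1 => hp t (by omega) (by omega)

theorem pth_shift {E : List L → L → List L → Prop} {p : ℤ → List L} {w : W} {i j : ℤ}
    (hp : Pth X E p w i j) (s : ℤ) :
    Pth X E (fun t => p (t + s)) (X.at' w s) (i - s) (j - s) := by
  intro t h0 h1
  have := hp (t + s) (by omega) (by omega)
  rw [X.at_at, add_comm s t]
  simpa [add_right_comm] using this

theorem pth_rev {p : ℤ → List L} {w : W} {i j : ℤ} (hp : Pth X B.E p w i j) (s : ℤ) :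
    Pth X B.E (fun t => p (s - t)) (X.rv (X.at' w s)) (s - j) (s - i) := by
  intro t h0 h1
  have := B.sym (hp (s - t - 1) (by omega) (by omega))
  rw [X.lab_bar]
  rw [sub_add_cancel] at this
  show B.E (p (s - t)) _ (p (s - (t + 1)))
  rwa [← sub_sub s t 1]

theorem Lp_rv {y w} (h : Lp X B.E y w) : Lp X B.E y (X.rv w) := by
  obtain ⟨p, h0, h1, h2⟩ := h
  refine ⟨fun t => p (-t), by simpa, fun t => ?_, fun t => ?_⟩
  · have := B.sym (h1 (-t - 1))
    rw [X.lab_rv_at]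
    simpa [sub_eq_add_neg, add_comm] using this
  · have := h2 (-t - X.len w)
    rw [X.len_rv]
    simp at this
    show p _ = p _
    rw [this]; congr 1; ring

/-- a looping cell contains every path of the cell -/
theorem Lp_pth {p : ℤ → List L} {w : W} {i j s : ℤ} (hp : Pth X B.E p w i j) (hs : i ≤ s)
    (hs' : s ≤ j) (h : Lp X B.E (p s) (X.at' w s)) {t : ℤ} (ht : i ≤ t) (ht' : t ≤ j) :
    Lp X B.E (p t) (X.at' w t) := by
  obtain ⟨q, h0, h1, h2⟩ := h
  have hq : Pth X B.E (fun t => q (t - s)) w i j := by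
    intro t _ _
    have := h1 (t - s)
    rw [X.at_at, add_sub_cancel] at this
    show B.E (q (t - s)) _ (q (t + 1 - s))
    rwa [show t + 1 - s = t - s + 1 by ring]
  have := pth_eq hp hq hs hs' (by simp [h0]) t ht ht'
  rw [this]
  have := Lp.shift h1 h2 (t - s)
  rwa [X.at_at, add_sub_cancel] at this
variable (B)

/-- arcs of a stage -/
structure Arc where
  y : List L
  w : W
  n : ℤ
  x : List L
  hy : y ∈ B.V
  hx : x ∈ B.V
  hn : 0 < n
  hn' : n ≤ X.len w
  sy : ∀ z, ¬ B.E y (X.lab w) z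
  sx : ∀ z, ¬ B.E x (X.iv (X.lab (X.at' w (n - 1)))) z
  hp : ∃ p : ℤ → List L, p n = x ∧ p (X.len w) = y ∧ Pth X B.E p w n (X.len w)

variable {B}
namespace Arc

theorem not_lp (a : B.Arc) : ¬ Lp X B.E a.y a.w := by
  rintro ⟨p, h0, h1, h2⟩
  have := h1 0
  rw [h0] at this
  exact a.sy _ (by simpa using this)

theorem cov (a : B.Arc) : X.Cov 2 (X.at' a.w a.n) (X.len a.w - a.n) := by
  obtain ⟨p, h1, h2, h3⟩ := a.hp
  have hn := a.hn'
  have hn0 := a.hn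
  rcases B.conv (p := fun t => p (t + a.n)) (w := X.at' a.w a.n) (n := X.len a.w - a.n)
    (by rw [X.len_at]; omega) (by simpa using pth_shift h3 a.n) with h | h
  · exfalso
    apply a.not_lp
    have := Lp_pth (s := a.n) (t := X.len a.w) h3 le_rfl hn (by simpa using h) hn le_rfl
    rwa [X.at_len, h2] at this
  · exact h

def bar (a : B.Arc) : B.Arc where
  y := a.x
  w := X.rv (X.at' a.w a.n)
  n := a.n
  x := a.y
  hy := a.hx
  hx := a.hy
  hn := a.hn
  hn' := by rw [X.len_rv, X.len_at]; exact a.hn'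
  sy z := by
    have := a.sx z
    rw [← X.lab_rv, X.nx_at, sub_add_cancel] at this
    exact this
  sx z := by
    rw [X.lab_bar, X.iv_iv]
    simpa using a.sy z
  hp := by
    obtain ⟨p, h1, h2, h3⟩ := a.hp
    refine ⟨fun t => p (X.len a.w + a.n - t), by simpa, by simp [X.len_rv, X.len_at, h1], ?_⟩
    have := pth_rev h3 (X.len a.w + a.n)
    rw [add_comm (X.len a.w) a.n, X.at_add_len] at this
    rw [X.len_rv, X.len_at]
    simpa [add_comm] using this

@[simp] theorem bar_y (a : B.Arc) : a.bar.y = a.x := rfl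
@[simp] theorem bar_x (a : B.Arc) : a.bar.x = a.y := rfl
@[simp] theorem bar_n (a : B.Arc) : a.bar.n = a.n := rfl
theorem bar_w (a : B.Arc) : a.bar.w = X.rv (X.at' a.w a.n) := rfl

theorem uniq_n {a b : B.Arc} (hy : a.y = b.y) (hw : a.w = b.w) : b.n ≤ a.n := by
  by_contra hlt
  obtain ⟨p, p1, p2, p3⟩ := a.hp
  obtain ⟨q, q1, q2, q3⟩ := b.hp
  have hb := b.hn'
  rw [← hw] at q2 q3 hb
  have h3 := pth_eq (pth_sub p3 (i' := b.n) (by omega) le_rfl) q3 (s := X.len a.w) hb le_rfl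
    (by rw [p2, q2, hy]) b.n le_rfl hb
  have := B.sym (p3 (b.n - 1) (by omega) (by omega))
  rw [sub_add_cancel, h3, q1, hw] at this
  exact b.sx _ this

@[ext] theorem ext' {a b : B.Arc} (hy : a.y = b.y) (hw : a.w = b.w) : a = b := by
  have hn : a.n = b.n := le_antisymm (uniq_n hy.symm hw.symm) (uniq_n hy hw)
  have hx : a.x = b.x := by
    obtain ⟨p, p1, p2, p3⟩ := a.hp
    obtain ⟨q, q1, q2, q3⟩ := b.hp
    have hb := b.hn'
    rw [← hw] at q2 q3 hb
    have := pth_eq (i := b.n) (hn ▸ p3) q3 (s := X.len a.w) hb le_rfl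
      (by rw [p2, q2, hy]) b.n le_rfl hb
    rw [← q1, ← this, ← hn, p1]
  cases a; cases b; simp_all

@[simp] theorem bar_bar (a : B.Arc) : a.bar.bar = a := by
  refine ext' (a := a.bar.bar) (b := a) rfl ?_
  rw [bar_w, bar_w, bar_n]; exact X.bar_bar _ _

theorem bar_ne (a : B.Arc) : a.bar ≠ a := fun h =>
  X.bar_ne a.w a.n (congrArg Arc.w h)
end Arc

/-- every nonlooping cell contains an arc -/
theorem arc_exists (hC : X.C6) {y : List L} {w : W} (hy : y ∈ B.V) (h : ¬ Lp X B.E y w) :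
    ∃ (a : B.Arc) (i : ℤ) (p : ℤ → List L), a.w = X.at' w i ∧ 0 ≤ i ∧ i ≤ X.len w - a.n ∧
      p (X.len w - i) = y ∧
      p a.n = a.x ∧ p (X.len w) = a.y ∧ Pth X B.E p a.w a.n (X.len w) := by
  have hl := X.len_pos w
  let Q : ℕ → Prop := fun m => ∃ (i : ℤ) (p : ℤ → List L), 0 ≤ i ∧ i ≤ m ∧ p 0 = y ∧
    Pth X B.E p w (i - m) i
  have hb : ∀ m : ℕ, Q m → (m : ℤ) < X.len w := by
    rintro m ⟨i, p, h0, h1, h2, h3⟩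
    by_contra hm
    have h4 := pth_sub (i' := i - m) (j' := i - m + X.len w) h3 le_rfl (by omega)
    have h5 := pth_shift h4 (i - m)
    rw [sub_self, add_sub_cancel_left] at h5
    rcases B.conv (n := X.len w) (by rw [X.len_at]) h5 with h6 | h6
    · apply h
      have := Lp_pth (s := i - m) (t := 0) h3 le_rfl (by omega) (by simpa using h6) (by omega) h0
      simpa [h2] using this
    · exact hC _ (by rw [X.len_at]; exact h6.le (by omega))
  have hQ0 : Q 0 := ⟨0, fun _ => y, le_rfl, by simp, rfl, fun t h0 h1 => by simp at h0; omega⟩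
  obtain ⟨m, hm, hmax⟩ : ∃ m, Q m ∧ ∀ k, Q k → k ≤ m := by
    classical
    have hfin : ∀ k, Q k → k ≤ (X.len w).toNat := fun k hk => by have := hb k hk; omega
    exact ⟨Nat.findGreatest Q (X.len w).toNat, Nat.findGreatest_spec (hfin 0 hQ0) hQ0,
      fun k hk => Nat.le_findGreatest (hfin k hk) hk⟩
  have hmb := hb m hm
  obtain ⟨i, p, h0, h1, h2, h3⟩ := hm
  have hpv : ∀ t, i - m ≤ t → t ≤ i → p t ∈ B.V := by
    intro t ht ht'
    rcases lt_or_eq_of_le ht' with h4 | h4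
    · exact B.memV (h3 t ht h4)
    · rcases Nat.eq_zero_or_pos m with h5 | h5
      · have : t = 0 := by omega
        rw [this, h2]; exact hy
      · have := B.memV' (h3 (t - 1) (by omega) (by omega))
        simpa using this
  have hpth : Pth X B.E (fun t => p (t + i - X.len w)) (X.at' w i) (X.len w - m) (X.len w) := by
    have := pth_shift h3 (i - X.len w)
    rw [X.at_sub_len] at this
    rw [show i - ↑m - (i - X.len w) = X.len w - m by ring, sub_sub_cancel] at this
    convert this using 3
    ring
  refine ⟨⟨p i, X.at' w i, X.len w - m, p (i - m), hpv _ (by omega) le_rfl,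
    hpv _ le_rfl (by omega), by omega, by rw [X.len_at]; omega, ?_, ?_,
      ⟨_, ?_, ?_, by rw [X.len_at]; exact hpth⟩⟩, i, _, rfl, h0, ?_, ?_, ?_, ?_, hpth⟩
  · intro z hz
    have : Q (m + 1) := by
      refine ⟨i + 1, fun t => if t = i + 1 then z else p t, by omega, by push_cast; omega, ?_, ?_⟩
      · beta_reduce; rw [if_neg (by omega), h2]
      · intro t ht ht'
        push_cast at ht
        beta_reduce
        rw [if_neg (by omega : t ≠ i + 1)]
        by_cases h4 : t = i
        · subst h4; simpa using hz
        · rw [if_neg (by omega)]; exact h3 t (by omega) (by omega)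
    have := hmax _ this
    omega
  · intro z hz
    have : Q (m + 1) := by
      refine ⟨i, fun t => if t = i - m - 1 then z else p t, by omega, by push_cast; omega, ?_, ?_⟩
      · beta_reduce; rw [if_neg (by omega), h2]
      · intro t ht ht'
        push_cast at ht
        beta_reduce
        rw [if_neg (by omega : t + 1 ≠ i - m - 1)]
        by_cases h4 : t = i - m - 1
        · subst h4
          rw [if_pos rfl]
          rw [B.sym_iff]
          rw [X.at_at, show i + (X.len w - m - 1) = i - m - 1 + X.len w by ring,
            X.at_add_len] at hz
          simpa using hz
        · rw [if_neg (by omega)]; exact h3 t (by omega) (by omega)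
    have := hmax _ this
    omega
  · congr 1; ring
  · rw [X.len_at]; congr 1; ring
  · show i ≤ X.len w - (X.len w - m); omega
  · rw [← h2]; congr 1; ring
  · congr 1; ring
  · show p _ = p i; congr 1; ring
end Stage
end stage

section stage2
variable {W L : Type*} {X : CX W Unit L}

def pre (X : CX W Unit L) (w : W) (k : ℕ) : List L :=
  (List.range k).map fun t : ℕ => X.lab (X.at' w (t : ℤ))

theorem pre_length (w : W) (k : ℕ) : (pre X w k).length = k := by simp [pre]
theorem pre_succ (w : W) (k : ℕ) : pre X w (k+1) = pre X w k ++ [X.lab (X.at' w k)] := by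
  simp [pre, List.range_succ]
theorem pre_one (w : W) : pre X w 1 = [X.lab w] := by simp [pre]
theorem pre_pos (w : W) {k : ℕ} (hk : 0 < k) : ∃ t, pre X w k = X.lab w :: t := by
  induction k with
  | zero => omega
  | succ k ih =>
    rcases Nat.eq_zero_or_pos k with rfl | h
    · exact ⟨[], pre_one w⟩
    · obtain ⟨t, ht⟩ := ih h
      exact ⟨t ++ [X.lab (X.at' w k)], by rw [pre_succ, ht]; rfl⟩
theorem pre_sh {w w' : W} {k k' : ℕ} (h : pre X w k = pre X w' k') :
    k = k' ∧ X.Sh w w' k := by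
  have hk : k = k' := by
    have := congrArg List.length h
    simpa [pre_length] using this
  subst hk
  refine ⟨rfl, rfl, fun t h0 h1 => ?_⟩
  lift t to ℕ using h0
  have h2 : t < k := by omega
  simp only [pre] at h
  have := List.map_inj_left.1 h t (by simpa using h2)
  exact this
theorem sh_pre {w w' : W} {k : ℕ} (h : X.Sh w w' k) : pre X w k = pre X w' k := by
  simp only [pre]
  refine List.map_inj_left.2 fun t ht => h.2 t (by omega) ?_
  rw [List.mem_range] at ht; exact_mod_cast ht

namespace Stage
variable {B : Stage X}

def As (B : Stage X) (y : List L) : Set W := {w | ∃ a : B.Arc, a.y = y ∧ a.w = w}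

namespace Arc
noncomputable def pi (a : B.Arc) : ℤ := X.pi (B.As a.y) a.w

theorem pi_nonneg (a : B.Arc) : 0 ≤ a.pi := CX.pi_nonneg _ _

theorem sh_le (hC : X.C6) {a b : B.Arc} (hy : a.y = b.y) {m : ℤ} (h : X.Sh a.w b.w m) :
    a = b ∨ m ≤ a.pi := by
  by_contra hn
  push Not at hn
  exact hn.1 (ext' hy (CX.pi_spec hC (A := B.As a.y) ⟨b, hy.symm, rfl⟩ hn.2 h).symm)

theorem overlap (hC : X.C6) (a : B.Arc) : a.pi + a.bar.pi < a.n := by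
  by_contra hn
  push Not at hn
  have h0 := a.pi_nonneg
  have h0' := a.bar.pi_nonneg
  have h1 : X.Cov 1 a.w a.pi := (CX.pi_pc (B.As a.y) a.w : X.Pc a.w a.pi).cov
  have h2 := ((CX.pi_pc (B.As a.bar.y) a.bar.w : X.Pc a.bar.w a.bar.pi).rev h0').cov
  change X.Cov 1 (X.rv (X.at' (X.rv (X.at' a.w a.n)) a.bar.pi)) a.bar.pi at h2
  rw [X.rv_at (X.rv _), X.rv_rv, X.at_at, ← sub_eq_add_neg] at h2
  have h3 := h2.suffix (i := a.pi - (a.n - a.bar.pi)) (by omega)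
  rw [X.at_at, add_sub_cancel] at h3
  have h4 := (h1.append h3).append (q := 2) (n := X.len a.w - a.n) (by
    convert a.cov using 2; ring)
  exact hC a.w ((h4.mono (by omega)).le (by omega))

open Classical in
noncomputable def kap (a : B.Arc) : ℤ :=
  if WellOrderingRel (a.y, a.w) (a.bar.y, a.bar.w) then a.pi else a.n - 1 - a.bar.pi

theorem kap_bar (a : B.Arc) : a.bar.kap = a.n - 1 - a.kap := by
  unfold kap
  rw [bar_bar]
  by_cases h1 : WellOrderingRel (a.y, a.w) (a.bar.y, a.bar.w)
  · rw [if_pos h1, if_neg (asymm_of WellOrderingRel h1)]; rfl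
  · rw [if_neg h1, if_pos]
    · ring
    · rcases trichotomous_of WellOrderingRel (a.y, a.w) (a.bar.y, a.bar.w) with h | h | h
      · exact absurd h h1
      · rw [Prod.mk.injEq] at h
        exact absurd (ext' h.1 h.2).symm a.bar_ne
      · exact h

theorem pi_le_kap (hC : X.C6) (a : B.Arc) : a.pi ≤ a.kap := by
  have := a.overlap hC
  unfold kap; split_ifs <;> omega
theorem kap_le (hC : X.C6) (a : B.Arc) : a.kap ≤ a.n - 1 - a.bar.pi := by
  have := a.bar.pi_le_kap hC
  rw [kap_bar] at this; omega
theorem kap_nonneg (hC : X.C6) (a : B.Arc) : 0 ≤ a.kap := a.pi_nonneg.trans (a.pi_le_kap hC)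
theorem kap_lt (hC : X.C6) (a : B.Arc) : a.kap < a.n := by
  have := a.kap_le hC; have := a.bar.pi_nonneg; omega

noncomputable def pt (a : B.Arc) (i : ℤ) : List L :=
  if i ≤ a.kap then a.y ++ pre X a.w i.toNat else a.x ++ pre X a.bar.w (a.n - i).toNat

theorem pt_near {a : B.Arc} {i : ℤ} (h : i ≤ a.kap) : a.pt i = a.y ++ pre X a.w i.toNat :=
  if_pos h

theorem pt_bar (a : B.Arc) (i : ℤ) : a.bar.pt i = a.pt (a.n - i) := by
  unfold pt
  rw [bar_bar, kap_bar, bar_n, bar_y, bar_x, sub_sub_cancel]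
  by_cases h : i ≤ a.n - 1 - a.kap
  · rw [if_pos h, if_neg (by omega)]
  · rw [if_neg h, if_pos (by omega)]

theorem pt_bar' (a : B.Arc) (i : ℤ) : a.bar.pt (a.n - i) = a.pt i := by
  rw [pt_bar, sub_sub_cancel]

theorem pt_zero (hC : X.C6) (a : B.Arc) : a.pt 0 = a.y := by
  rw [pt_near (a.kap_nonneg hC)]; simp [pre]
theorem pt_n (hC : X.C6) (a : B.Arc) : a.pt a.n = a.x := by
  rw [← pt_bar', sub_self, pt_zero hC, bar_y]

/-- either `(a,i)` or its reverse is near -/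
theorem near_or (a : B.Arc) (i : ℤ) : i ≤ a.kap ∨ a.n - i ≤ a.bar.kap := by
  rw [kap_bar]; omega
end Arc

theorem prefix_mem {u v : List L} (h : u ++ v ∈ B.V) : u ∈ B.V := by
  induction v using List.reverseRecOn with
  | nil => simpa using h
  | append_singleton v l ih =>
    rw [← List.append_assoc] at h
    exact ih (B.tree h).1

theorem not_mem_of_stuck {y : List L} {l : L} {t : List L} (h : ∀ z, ¬ B.E y l z) :
    y ++ l :: t ∉ B.V := by
  intro hm
  have : (y ++ [l]) ++ t ∈ B.V := by simpa using hm
  obtain ⟨_, v, hv⟩ := B.tree (prefix_mem this)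
  exact h v hv

namespace Arc
theorem pre_not_mem (a : B.Arc) {k : ℕ} (hk : 0 < k) : a.y ++ pre X a.w k ∉ B.V := by
  obtain ⟨t, ht⟩ := pre_pos (X := X) a.w hk
  rw [ht]; exact not_mem_of_stuck a.sy

theorem pt_not_mem (a : B.Arc) {i : ℤ} (h0 : 0 < i) (h1 : i < a.n) : a.pt i ∉ B.V := by
  rcases a.near_or i with h | h
  · rw [pt_near h]; exact a.pre_not_mem (by omega)
  · rw [← pt_bar', pt_near h]; exact a.bar.pre_not_mem (by omega)

theorem base_eq_aux {a b : B.Arc} {k k' : ℕ} (hk : 0 < k)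
    (h : a.y ++ pre X a.w k = b.y ++ pre X b.w k') (hl : a.y.length ≤ b.y.length) : a.y = b.y := by
  obtain ⟨s, hs⟩ := List.prefix_of_prefix_length_le (List.prefix_append a.y (pre X a.w k))
    (h ▸ List.prefix_append b.y (pre X b.w k')) hl
  rcases s with _ | ⟨l, s⟩
  · simpa using hs
  · exfalso
    obtain ⟨t, ht⟩ := pre_pos (X := X) a.w hk
    rw [← hs, ht] at h
    simp at h
    have := b.hy
    rw [← hs, ← h.1] at this
    exact not_mem_of_stuck a.sy this

theorem near_inj {a b : B.Arc} {k k' : ℕ} (hk : 0 < k) (hk' : 0 < k')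
    (h : a.y ++ pre X a.w k = b.y ++ pre X b.w k') :
    a.y = b.y ∧ k = k' ∧ X.Sh a.w b.w k := by
  have hy : a.y = b.y := by
    rcases le_total a.y.length b.y.length with hl | hl
    · exact base_eq_aux hk h hl
    · exact (base_eq_aux hk' h.symm hl).symm
  rw [hy] at h
  exact ⟨hy, pre_sh (List.append_cancel_left h)⟩

theorem near_inj' {a b : B.Arc} {i j : ℤ} (hi : 0 < i) (hj : 0 < j) (ha : i ≤ a.kap)
    (hb : j ≤ b.kap) (h : a.pt i = b.pt j) : a.y = b.y ∧ i = j ∧ X.Sh a.w b.w i := by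
  rw [pt_near ha, pt_near hb] at h
  obtain ⟨h1, h2, h3⟩ := near_inj (by omega) (by omega) h
  exact ⟨h1, by omega, h3.mono (by omega)⟩

/-- interior points: the four coincidence patterns -/
theorem KV {a b : B.Arc} {i j : ℤ} (hi : 0 < i) (hi' : i < a.n) (hj : 0 < j) (hj' : j < b.n)
    (h : a.pt i = b.pt j) :
    (a.y = b.y ∧ i = j ∧ X.Sh a.w b.w i) ∨
    (a.x = b.x ∧ a.n - i = b.n - j ∧ X.Sh a.bar.w b.bar.w (a.n - i)) ∨
    (a.y = b.x ∧ i = b.n - j ∧ X.Sh a.w b.bar.w i) ∨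
    (a.x = b.y ∧ a.n - i = j ∧ X.Sh a.bar.w b.w j) := by
  rcases a.near_or i with h1 | h1 <;> rcases b.near_or j with h2 | h2
  · exact Or.inl (near_inj' hi hj h1 h2 h)
  · rw [← b.pt_bar'] at h
    exact Or.inr (Or.inr (Or.inl (near_inj' hi (by omega) h1 h2 h)))
  · rw [← a.pt_bar'] at h
    obtain ⟨h3, h4, h5⟩ := near_inj' (by omega) hj h1 h2 h
    exact Or.inr (Or.inr (Or.inr ⟨h3, h4, h4 ▸ h5⟩))
  · rw [← a.pt_bar', ← b.pt_bar'] at h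
    exact Or.inr (Or.inl (near_inj' (by omega) (by omega) h1 h2 h))

theorem pt_eq_of_sh (hC : X.C6) {a b : B.Arc} (hy : a.y = b.y) {i : ℤ} (h : X.Sh a.w b.w i) :
    a.pt i = b.pt i := by
  rcases le_total i 0 with hi | hi
  · rw [pt_near (hi.trans (a.kap_nonneg hC)), pt_near (hi.trans (b.kap_nonneg hC)), hy,
      Int.toNat_of_nonpos hi]; rfl
  rcases sh_le hC hy h with rfl | h1
  · rfl
  rcases sh_le hC hy.symm h.symm with rfl | h2
  · rfl
  rw [pt_near (h1.trans (a.pi_le_kap hC)), pt_near (h2.trans (b.pi_le_kap hC)), hy]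
  congr 1
  apply sh_pre
  exact h.mono (by omega)

/-- backtracking pattern is impossible for darts -/
theorem lab_bar' (a : B.Arc) (t : ℤ) :
    X.lab (X.at' a.bar.w t) = X.iv (X.lab (X.at' a.w (a.n - t - 1))) := X.lab_bar _ _ _

theorem back_ne {a b : B.Arc} {i j : ℤ} (hi : 0 < i) (h1 : i = b.n - j)
    (h : X.Sh a.w b.bar.w i) : X.lab (X.at' a.w i) ≠ X.lab (X.at' b.w j) := by
  intro h2
  have h3 := h.2 (i - 1) (by omega) (by omega)
  rw [lab_bar', show b.n - (i - 1) - 1 = j by omega, ← h2] at h3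
  have := X.red_at a.w (i - 1)
  rw [sub_add_cancel] at this
  exact this (by rw [h3, X.iv_iv])

theorem KD (hC : X.C6) {a b : B.Arc} {i j : ℤ} (hi : 0 ≤ i) (hi' : i < a.n) (hj : 0 ≤ j)
    (hj' : j < b.n) (h : a.pt i = b.pt j) (hl : X.lab (X.at' a.w i) = X.lab (X.at' b.w j)) :
    (a.y = b.y ∧ i = j ∧ X.Sh a.w b.w (i+1)) ∨
    (a.x = b.x ∧ a.n - i = b.n - j ∧ X.Sh a.bar.w b.bar.w (a.n - i)) := by
  rcases hi.eq_or_lt with h0 | h0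
  · subst h0
    rw [pt_zero hC] at h
    rcases hj.eq_or_lt with h1 | h1
    · subst h1
      rw [pt_zero hC] at h
      exact Or.inl ⟨h, rfl, (show X.Sh a.w b.w 0 from ⟨rfl, fun t _ _ => by omega⟩).ext hl⟩
    · exact absurd (h ▸ a.hy) (b.pt_not_mem h1 hj')
  · rcases hj.eq_or_lt with h1 | h1
    · subst h1
      rw [pt_zero hC] at h
      exact absurd (h ▸ b.hy) (a.pt_not_mem h0 hi')
    · rcases KV h0 hi' h1 hj' h with ⟨h2, h3, h4⟩ | h2 | ⟨h2, h3, h4⟩ | ⟨h2, h3, h4⟩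
      · subst h3; exact Or.inl ⟨h2, rfl, h4.ext hl⟩
      · exact Or.inr h2
      · exact absurd hl (back_ne h0 h3 h4)
      · exact absurd hl.symm (back_ne h1 h3.symm h4.symm)

theorem pt_succ_eq (hC : X.C6) {a b : B.Arc} {i j : ℤ} (hi : 0 ≤ i) (hi' : i < a.n) (hj : 0 ≤ j)
    (hj' : j < b.n) (h : a.pt i = b.pt j) (hl : X.lab (X.at' a.w i) = X.lab (X.at' b.w j)) :
    a.pt (i+1) = b.pt (j+1) := by
  rcases KD hC hi hi' hj hj' h hl with ⟨h1, rfl, h3⟩ | ⟨h1, h2, h3⟩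
  · exact pt_eq_of_sh hC h1 h3
  · rw [← a.pt_bar', ← b.pt_bar', show b.n - (j + 1) = a.n - (i+1) by omega]
    exact pt_eq_of_sh hC h1 (h3.mono (by omega))
end Arc

/-- edges of the next stage -/
def nE (B : Stage X) (u : List L) (l : L) (v : List L) : Prop :=
  B.E u l v ∨ ∃ (a : B.Arc) (i : ℤ), 0 ≤ i ∧ i < a.n ∧ u = a.pt i ∧
    l = X.lab (X.at' a.w i) ∧ v = a.pt (i+1)

def nV (B : Stage X) : Set (List L) :=
  B.V ∪ {u | ∃ (a : B.Arc) (i : ℤ), 0 ≤ i ∧ i ≤ a.n ∧ u = a.pt i}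

theorem nE_sym {u l v} (h : B.nE u l v) : B.nE v (X.iv l) u := by
  rcases h with h | ⟨a, i, h0, h1, rfl, rfl, rfl⟩
  · exact Or.inl (B.sym h)
  · refine Or.inr ⟨a.bar, a.n - 1 - i, by omega, by rw [Arc.bar_n]; omega, ?_, ?_, ?_⟩
    · rw [Arc.pt_bar]; congr 1; ring
    · rw [Arc.lab_bar']; congr 4; ring
    · rw [Arc.pt_bar]; congr 1; ring

theorem old_of_mem (hC : X.C6) {u l v} (h : B.nE u l v) (hv : u ∈ B.V) :
    B.E u l v ∨ ∃ a : B.Arc, a.y = u ∧ X.lab a.w = l ∧ v = a.pt 1 := by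
  rcases h with h | ⟨a, i, h0, h1, rfl, rfl, rfl⟩
  · exact Or.inl h
  · rcases h0.eq_or_lt with h2 | h2
    · subst h2
      exact Or.inr ⟨a, (a.pt_zero hC).symm, by simp, by simp⟩
    · exact absurd hv (a.pt_not_mem h2 h1)

theorem nE_det (hC : X.C6) {u l v v'} (h : B.nE u l v) (h' : B.nE u l v') : v = v' := by
  rcases h with h | ⟨a, i, h0, h1, h2, h3, h4⟩
  · rcases old_of_mem hC h' (B.memV h) with h' | ⟨a, rfl, rfl, _⟩
    · exact B.det h h'
    · exact absurd h (a.sy _)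
  · rcases h' with h' | ⟨b, j, g0, g1, g2, g3, g4⟩
    · rcases old_of_mem hC (Or.inr ⟨a, i, h0, h1, h2, h3, h4⟩) (B.memV h') with h | ⟨a, rfl, rfl, _⟩
      · exact B.det h h'
      · exact absurd h' (a.sy _)
    · rw [h4, g4]
      exact Arc.pt_succ_eq hC h0 h1 g0 g1 (h2.symm.trans g2) (h3.symm.trans g3)

theorem nE_mem {u l v} (h : B.nE u l v) : u ∈ B.nV := by
  rcases h with h | ⟨a, i, h0, h1, rfl, rfl, rfl⟩
  · exact Or.inl (B.memV h)
  · exact Or.inr ⟨a, i, h0, h1.le, rfl⟩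

theorem nV_cases (hC : X.C6) {u} (h : u ∈ B.nV) (hu : u ∉ B.V) :
    ∃ (a : B.Arc) (i : ℤ), 0 < i ∧ i < a.n ∧ u = a.pt i := by
  rcases h with h | ⟨a, i, h0, h1, rfl⟩
  · exact absurd h hu
  · refine ⟨a, i, lt_of_le_of_ne h0 ?_, lt_of_le_of_ne h1 ?_, rfl⟩
    · rintro rfl; exact hu (a.pt_zero hC ▸ a.hy)
    · rintro rfl; exact hu (a.pt_n hC ▸ a.hx)

theorem nE_tree (hC : X.C6) {z : List L} {l : L} (h : z ++ [l] ∈ B.nV) :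
    z ∈ B.nV ∧ ∃ v, B.nE z l v := by
  by_cases hv : z ++ [l] ∈ B.V
  · obtain ⟨h1, v, h2⟩ := B.tree hv
    exact ⟨Or.inl h1, v, Or.inl h2⟩
  have key : ∀ (a : B.Arc) (i : ℤ), 0 < i → i < a.n → i ≤ a.kap → z ++ [l] = a.pt i →
      z ∈ B.nV ∧ ∃ v, B.nE z l v := by
    intro a i h0 h1 h2 h3
    have e : i.toNat = (i-1).toNat + 1 := by omega
    rw [Arc.pt_near h2, e, pre_succ, ← List.append_assoc] at h3
    have h4 := List.append_inj' h3 rfl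
    have h5 : z = a.pt (i - 1) := by rw [Arc.pt_near (by omega)]; exact h4.1
    have h6 : l = X.lab (X.at' a.w (i - 1)) := by
      have := h4.2
      rw [Int.toNat_of_nonneg (by omega)] at this
      simpa using this
    have : B.nE z l (a.pt (i - 1 + 1)) := Or.inr ⟨a, i - 1, by omega, by omega, h5, h6, rfl⟩
    exact ⟨nE_mem this, _, this⟩
  obtain ⟨a, i, h0, h1, h2⟩ := nV_cases hC h hv
  rcases a.near_or i with h3 | h3
  · exact key a i h0 h1 h3 h2
  · exact key a.bar (a.n - i) (by omega) (by rw [Arc.bar_n]; omega) h3 (by rw [h2, Arc.pt_bar'])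

/-- the cell of an arc loops in the next stage -/
theorem arc_loop (hC : X.C6) (a : B.Arc) {p : ℤ → List L} (h1 : p a.n = a.x)
    (h2 : p (X.len a.w) = a.y) (h3 : Pth X B.E p a.w a.n (X.len a.w)) :
    ∃ q : ℤ → List L, (∀ t, 0 ≤ t → t ≤ a.n → q t = a.pt t) ∧
      (∀ t, a.n ≤ t → t ≤ X.len a.w → q t = p t) ∧
    (∀ t, B.nE (q t) (X.lab (X.at' a.w t)) (q (t + 1))) ∧ ∀ t, q (t + X.len a.w) = q t := by
  have hn := a.hn
  have hn' := a.hn'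
  obtain ⟨q, q1, q2, q3⟩ := Lp.mk' (X := X) (E := B.nE) (p := fun t => if t < a.n then a.pt t else p t)
    (w := a.w) (by
      intro t h0 h4
      beta_reduce
      by_cases h5 : t < a.n
      · rw [if_pos h5]
        by_cases h6 : t + 1 < a.n
        · rw [if_pos h6]; exact Or.inr ⟨a, t, h0, h5, rfl, rfl, rfl⟩
        · rw [if_neg h6]
          refine Or.inr ⟨a, t, h0, h5, rfl, rfl, ?_⟩
          rw [show t + 1 = a.n by omega, h1, a.pt_n hC]
      · rw [if_neg h5, if_neg (by omega)]
        exact Or.inl (h3 t (by omega) h4)) (by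
      beta_reduce
      rw [if_neg (by omega), if_pos hn, h2, a.pt_zero hC])
  refine ⟨q, fun t h0 h4 => ?_, fun t h0 h4 => ?_, q2, q3⟩
  · rw [q1 t h0 (by omega)]
    beta_reduce
    by_cases h5 : t < a.n
    · rw [if_pos h5]
    · rw [if_neg h5, show t = a.n by omega, h1, a.pt_n hC]
  · rw [q1 t (by omega) (by omega)]
    beta_reduce
    rw [if_neg (by omega)]

theorem pt_loop (hC : X.C6) (a : B.Arc) {i : ℤ} (h0 : 0 ≤ i) (h1 : i ≤ a.n) :
    Lp X B.nE (a.pt i) (X.at' a.w i) := by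
  obtain ⟨p, p1, p2, p3⟩ := a.hp
  obtain ⟨q, q1, q2, q3, q4⟩ := arc_loop hC a p1 p2 p3
  rw [← q1 i h0 h1]
  exact Lp.shift q3 q4 i

theorem old_loop (hC : X.C6) {y : List L} (hy : y ∈ B.V) (w : W) : Lp X B.nE y w := by
  by_cases h : Lp X B.E y w
  · exact h.mono fun _ _ _ => Or.inl
  · obtain ⟨a, i, p, h1, h2, h3, h4, h5, h6, h7⟩ := arc_exists hC hy h
    have hl : X.len a.w = X.len w := by rw [h1, X.len_at]
    obtain ⟨q, q1, q2, q3, q4⟩ := arc_loop hC a h5 (by rw [hl, h6]) (by rw [hl]; exact h7)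
    have := Lp.shift q3 q4 (X.len w - i)
    rw [q2 _ (by omega) (by omega), h4, h1, X.at_at, add_sub_cancel, X.at_len] at this
    exact this
end Stage
end stage2

section stage3
variable {W L : Type*} {X : CX W Unit L}

namespace Stage
variable {B : Stage X}

theorem pth_eqG {E : List L → L → List L → Prop} (sym : ∀ {u l v}, E u l v → E v (X.iv l) u)
    (det : ∀ {u l v v'}, E u l v → E u l v' → v = v')
    {p q : ℤ → List L} {w : W} {i j : ℤ} (hp : Pth X E p w i j)
    (hq : Pth X E q w i j) {s : ℤ} (hs : i ≤ s) (hs' : s ≤ j) (h : p s = q s) :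
    ∀ t, i ≤ t → t ≤ j → p t = q t := by
  have fwd : ∀ k : ℕ, s + k ≤ j → p (s + k) = q (s + k) := by
    intro k
    induction k with
    | zero => intro _; simpa
    | succ k ih =>
      intro hk
      push_cast at hk
      have h1 := hp (s + k) (by omega) (by omega)
      have h2 := hq (s + k) (by omega) (by omega)
      rw [ih (by omega)] at h1
      have := det h1 h2
      push_cast; rwa [← add_assoc]
  have bwd : ∀ k : ℕ, i ≤ s - k → p (s - k) = q (s - k) := by
    intro k
    induction k with
    | zero => intro _; simpa
    | succ k ih =>
      intro hk
      push_cast at hk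
      have h1 := sym (hp (s - (k + 1)) (by omega) (by omega))
      have h2 := sym (hq (s - (k + 1)) (by omega) (by omega))
      rw [show s - (k + 1 : ℤ) + 1 = s - k by ring] at h1 h2
      rw [ih (by omega)] at h1
      have := det h1 h2
      push_cast; exact this
  intro t h0 h1
  rcases le_total s t with h2 | h2
  · have := fwd (t - s).toNat (by omega)
    rwa [Int.toNat_of_nonneg (by omega), add_sub_cancel] at this
  · have := bwd (s - t).toNat (by omega)
    rwa [Int.toNat_of_nonneg (by omega), sub_sub_cancel] at this

theorem Lp_pthG {E : List L → L → List L → Prop} (sym : ∀ {u l v}, E u l v → E v (X.iv l) u)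
    (det : ∀ {u l v v'}, E u l v → E u l v' → v = v')
    {p : ℤ → List L} {w : W} {i j s : ℤ} (hp : Pth X E p w i j) (hs : i ≤ s)
    (hs' : s ≤ j) (h : Lp X E (p s) (X.at' w s)) {t : ℤ} (ht : i ≤ t) (ht' : t ≤ j) :
    Lp X E (p t) (X.at' w t) := by
  obtain ⟨q, h0, h1, h2⟩ := h
  have hq : Pth X E (fun t => q (t - s)) w i j := by
    intro t _ _
    have := h1 (t - s)
    rw [X.at_at, add_sub_cancel] at this
    show E (q (t - s)) _ (q (t + 1 - s))
    rwa [show t + 1 - s = t - s + 1 by ring]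
  have := pth_eqG (E := E) sym det hp hq hs hs' (by simp [h0]) t ht ht'
  rw [this]
  have := Lp.shift h1 h2 (t - s)
  rwa [X.at_at, add_sub_cancel] at this

def TO (B : Stage X) (p : ℤ → List L) (w : W) (n : ℤ) : Prop :=
  ∃ (a : B.Arc) (k : ℤ), 1 ≤ k ∧ k + n < a.n ∧ p 0 = a.pt k ∧ p n = a.pt (k + n) ∧
    X.Sh (X.at' a.w k) w n

def TT (B : Stage X) (p : ℤ → List L) (w : W) (n : ℤ) : Prop :=
  ∃ (a b : B.Arc) (k ja jb : ℤ), a.y = b.y ∧ X.Sh a.w b.w k ∧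
    X.lab (X.at' a.w k) ≠ X.lab (X.at' b.w k) ∧ 1 ≤ k ∧ k < ja ∧ ja < a.n ∧ k < jb ∧ jb < b.n ∧
    n = (ja - k) + (jb - k) ∧ p 0 = a.pt ja ∧ p n = b.pt jb ∧
    X.Sh (X.rv (X.at' a.w ja)) w (ja - k) ∧
    X.Sh (X.at' b.w k) (X.at' w (ja - k)) (jb - k)

/-- every new edge between new vertices -/
theorem new_edge (hC : X.C6) {u l v} (h : B.nE u l v) (hu : u ∉ B.V) (hv : v ∉ B.V) :
    ∃ (a : B.Arc) (i : ℤ), 0 < i ∧ i + 1 < a.n ∧ u = a.pt i ∧ l = X.lab (X.at' a.w i) ∧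
      v = a.pt (i+1) := by
  rcases h with h | ⟨a, i, h0, h1, h2, h3, h4⟩
  · exact absurd (B.memV h) hu
  · refine ⟨a, i, lt_of_le_of_ne h0 ?_, lt_of_le_of_ne h1 ?_, h2, h3, h4⟩
    · rintro rfl; exact hu (by rw [h2, a.pt_zero hC]; exact a.hy)
    · intro h; exact hv (by rw [h4, h, a.pt_n hC]; exact a.hx)

theorem turn_O (hC : X.C6) {p : ℤ → List L} {w : W} {n : ℤ} (hn : 0 ≤ n)
    {a' : B.Arc} {i' : ℤ} (h1 : 0 < i') (h2 : i' + 1 < a'.n) (h3 : p n = a'.pt i')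
    (h4 : X.lab (X.at' w n) = X.lab (X.at' a'.w i')) (h5 : p (n+1) = a'.pt (i'+1))
    (h : B.TO p w n) : B.TO p w (n+1) ∨ B.TT p w (n+1) := by
  rcases hn.eq_or_lt with h0 | h0
  · subst h0
    refine Or.inl ⟨a', i', h1, by omega, h3, by simpa using h5, rfl, fun t ht ht' => ?_⟩
    have : t = 0 := by omega
    subst this
    simpa using h4.symm
  obtain ⟨a, k, k1, k2, k3, k4, k5⟩ := h
  have hlast : X.lab (X.at' w (n-1)) = X.lab (X.at' a.w (k + n - 1)) := by
    have := k5.2 (n-1) (by omega) (by omega)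
    rw [X.at_at] at this
    rw [← this]; congr 2; ring
  have hred := X.red_at w (n-1)
  rw [sub_add_cancel] at hred
  rcases Arc.KV (by omega) k2 h1 (by omega) (k4.symm.trans h3) with ⟨e1, e2, e3⟩ | ⟨e1, e2, e3⟩ |
    ⟨e1, e2, e3⟩ | ⟨e1, e2, e3⟩
  · left
    refine ⟨a', k, k1, by omega, ?_, ?_, ?_⟩
    · rw [k3]; exact Arc.pt_eq_of_sh hC e1 (e3.mono (by omega))
    · rw [h5]; congr 1 <;> omega
    · refine ((e3.shift (i := k) (n := n) (by omega) (by omega) (by omega)).symm.trans k5).ext ?_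
      rw [X.at_at, h4]; congr 2 <;> omega
  · left
    have hl : X.lab (X.at' a.w (k+n)) = X.lab (X.at' a'.w i') := by
      have := e3.2 (a.n - (k + n) - 1) (by omega) (by omega)
      rw [Arc.lab_bar', Arc.lab_bar'] at this
      have := X.iv_inj this
      convert this using 3 <;> omega
    refine ⟨a, k, k1, by omega, k3, ?_, ?_⟩
    · rw [h5, ← add_assoc]
      exact (Arc.pt_succ_eq hC (by omega) k2 h1.le (by omega) (k4.symm.trans h3) hl).symm
    · refine k5.ext ?_
      rw [X.at_at, h4, hl]
  · exfalso
    have := e3.2 (k + n - 1) (by omega) (by omega)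
    rw [Arc.lab_bar', ← hlast, show a'.n - (k+n-1) - 1 = i' by omega, ← h4] at this
    exact hred (by rw [this, X.iv_iv])
  · right
    refine ⟨a.bar, a', i', a.n - k, i' + 1, e1, e3, ?_, h1, by omega, by rw [Arc.bar_n]; omega,
      by omega, h2, by omega, ?_, h5, ?_, ?_⟩
    · rw [Arc.lab_bar', show a.n - i' - 1 = k + n - 1 by omega, ← hlast, ← h4]
      exact hred.symm
    · rw [k3, Arc.pt_bar']
    · rw [show a.n - k - i' = n by omega]
      have : X.rv (X.at' a.bar.w (a.n - k)) = X.at' a.w k := by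
        rw [Arc.bar_w, X.rv_at (X.rv _), X.rv_rv, X.at_at]; congr 1; ring
      rw [this]; exact k5
    · rw [show a.n - k - i' = n by omega]
      refine ⟨rfl, fun t t0 t1 => ?_⟩
      have : t = 0 := by omega
      subst this
      simpa using h4.symm

theorem turn_T (hC : X.C6) {p : ℤ → List L} {w : W} {n : ℤ} 
    {a' : B.Arc} {i' : ℤ} (h1 : 0 < i') (h2 : i' + 1 < a'.n) (h3 : p n = a'.pt i')
    (h4 : X.lab (X.at' w n) = X.lab (X.at' a'.w i')) (h5 : p (n+1) = a'.pt (i'+1))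
    (h : B.TT p w n) : B.TT p w (n+1) := by
  obtain ⟨a, b, k, ja, jb, k1, k2, k3, k4, k5, k6, k7, k8, k9, k10, k11, k12, k13⟩ := h
  have hlast : X.lab (X.at' w (n-1)) = X.lab (X.at' b.w (jb - 1)) := by
    have := k13.2 (jb - k - 1) (by omega) (by omega)
    rw [X.at_at, X.at_at] at this
    convert this.symm using 3 <;> omega
  have hred := X.red_at w (n-1)
  rw [sub_add_cancel] at hred
  rcases Arc.KV (by omega) k8 h1 (by omega) (k11.symm.trans h3) with ⟨e1, e2, e3⟩ | ⟨e1, e2, e3⟩ |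
    ⟨e1, e2, e3⟩ | ⟨e1, e2, e3⟩
  · refine ⟨a, a', k, ja, jb + 1, k1.trans e1, k2.trans (e3.mono (by omega)), ?_, k4, k5, k6,
      by omega, by omega, by omega, k10, ?_, k12, ?_⟩
    · rw [← e3.2 k (by omega) (by omega)]; exact k3
    · rw [h5, e2]
    · rw [show jb + 1 - k = (jb - k) + 1 by ring]
      refine ((e3.shift (i := k) (n := jb - k) (by omega) (by omega) (by omega)).symm.trans k13).ext ?_
      rw [X.at_at, X.at_at, show k + (jb - k) = i' by omega, ← h4]; congr 2 <;> omega
  · have hl : X.lab (X.at' b.w jb) = X.lab (X.at' a'.w i') := by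
      have := e3.2 (b.n - jb - 1) (by omega) (by omega)
      rw [Arc.lab_bar', Arc.lab_bar'] at this
      have := X.iv_inj this
      convert this using 3 <;> omega
    refine ⟨a, b, k, ja, jb + 1, k1, k2, k3, k4, k5, k6,
      by omega, by omega, by omega, k10, ?_, k12, ?_⟩
    · rw [h5]
      exact (Arc.pt_succ_eq hC (by omega) k8 h1.le (by omega) (k11.symm.trans h3) hl).symm
    · rw [show jb + 1 - k = (jb - k) + 1 by ring]
      refine k13.ext ?_
      rw [X.at_at, X.at_at, add_sub_cancel, hl, ← h4]; congr 2 <;> omega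
  · exfalso
    have := e3.2 (jb - 1) (by omega) (by omega)
    rw [Arc.lab_bar', ← hlast, show a'.n - (jb-1) - 1 = i' by omega, ← h4] at this
    exact hred (by rw [this, X.iv_iv])
  · exfalso
    have p1 : X.Pc b.w k := ⟨a.w, fun h => k3 (by rw [h]), k2.symm⟩
    have p2 : X.Pc (X.at' b.w k) (jb - k) := by
      refine ⟨_, fun h => ?_, k13⟩
      have h6 : X.at' w n = X.at' b.w jb := by
        have := congrArg (fun z => X.at' z (jb - k)) h
        simp only [X.at_at] at this
        rw [add_sub_cancel, ← k9] at this
        exact this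
      have h7 := e3.2 (i' - 1) (by omega) (by omega)
      rw [Arc.lab_bar', show b.n - (i' - 1) - 1 = jb by omega, ← h6, h4] at h7
      have := X.red_at a'.w (i' - 1)
      rw [sub_add_cancel] at this
      exact this (by rw [← h7, X.iv_iv])
    have p3 : X.Pc b.bar.w i' := by
      refine ⟨_, fun h => ?_, e3⟩
      have h7 := Arc.lab_bar' b i'
      rw [show b.n - i' - 1 = jb - 1 by omega, ← hlast, ← h, ← h4] at h7
      exact hred h7
    have p3' := p3.rev h1.le
    have e : X.rv (X.at' b.bar.w i') = X.at' b.w jb := by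
      rw [Arc.bar_w, X.rv_at (X.rv _), X.rv_rv, X.at_at]; congr 1 <;> omega
    rw [e] at p3'
    have c1 := (p1.cov.append p2.cov).append (q := 1) (n := i') (by
      rw [add_sub_cancel]; exact p3'.cov)
    have c2 := c1.append (q := 2) (n := X.len b.w - b.n) (by
      convert b.cov using 2; omega)
    exact hC b.w (c2.mono (by omega))

theorem turn (hC : X.C6) {p : ℤ → List L} {w : W} {n : ℤ} (hn : 0 ≤ n) (h0 : p 0 ∈ B.nV)
    (hp : Pth X B.nE p w 0 n) (hV : ∀ t, 0 ≤ t → t ≤ n → p t ∉ B.V) :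
    B.TO p w n ∨ B.TT p w n := by
  induction n, hn using Int.leInduction with
  | base =>
    obtain ⟨a, i, h1, h2, h3⟩ := nV_cases hC h0 (hV 0 le_rfl le_rfl)
    exact Or.inl ⟨a, i, h1, by omega, h3, by simpa using h3, rfl, fun t _ _ => by omega⟩
  | succ n hn ih =>
    have ih := ih (fun t t0 t1 => hp t t0 (by omega)) (fun t t0 t1 => hV t t0 (by omega))
    obtain ⟨a', i', h1, h2, h3, h4, h5⟩ := new_edge hC (hp n hn (by omega)) (hV n hn (by omega))
      (hV (n+1) (by omega) le_rfl)
    rcases ih with ih | ih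
    · exact turn_O hC hn h1 h2 h3 h4 h5 ih
    · exact Or.inr (turn_T hC h1 h2 h3 h4 h5 ih)

theorem next_conv (hC : X.C6) {p : ℤ → List L} {w : W} {n : ℤ}
    (hp : Pth X B.nE p w 0 n) : Lp X B.nE (p 0) w ∨ X.Cov 2 w n := by
  rcases le_or_gt n 0 with hn | hn
  · exact Or.inr (CX.Cov.le (q := 0) (show n ≤ 0 from hn) (by omega))
  have LP : ∀ s, 0 ≤ s → s ≤ n → Lp X B.nE (p s) (X.at' w s) → Lp X B.nE (p 0) w := by
    intro s s0 s1 h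
    have := Lp_pthG (E := B.nE) nE_sym (nE_det hC) hp s0 s1 h le_rfl hn.le
    simpa using this
  by_cases hV : ∀ t, 0 ≤ t → t ≤ n → p t ∉ B.V
  · rcases turn hC hn.le (nE_mem (hp 0 le_rfl hn)) hp hV with ⟨a, k, k1, k2, k3, k4, k5⟩ |
      ⟨a, b, k, ja, jb, k1, k2, k3, k4, k5, k6, k7, k8, k9, k10, k11, k12, k13⟩
    · by_cases h : X.at' a.w k = w
      · left
        rw [k3, ← h]
        exact pt_loop hC a (by omega) (by omega)
      · right
        exact CX.Cov.le (CX.Pc.cov ⟨_, h, k5.symm⟩) (by omega)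
    · by_cases h : X.rv (X.at' a.w ja) = w
      · left
        rw [k10, ← h, ← a.pt_bar']
        have := pt_loop hC a.bar (i := a.n - ja) (by omega) (by rw [Arc.bar_n]; omega)
        convert this using 1
        rw [Arc.bar_w, X.rv_at, X.rv_at, X.at_at]; congr 1; ring
      · by_cases h' : X.at' b.w k = X.at' w (ja - k)
        · left
          apply LP n hn.le le_rfl
          rw [k11]
          have := pt_loop hC b (i := jb) (by omega) (by omega)
          convert this using 1
          have := congrArg (fun z => X.at' z (jb - k)) h'
          simp only [X.at_at] at this
          rw [add_sub_cancel, ← k9] at this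
          exact this.symm
        · right
          have c1 := (CX.Pc.cov ⟨_, h, k12.symm⟩).append (CX.Pc.cov ⟨_, h', k13.symm⟩)
          rw [k9]; exact c1
  · push Not at hV
    obtain ⟨t, t0, t1, h⟩ := hV
    left
    exact LP t t0 t1 (old_loop hC h _)

def next (hC : X.C6) (B : Stage X) : Stage X where
  V := B.nV
  E := B.nE
  sym := nE_sym
  det := nE_det hC
  memV := nE_mem
  tree := nE_tree hC
  conv := fun _ hp => next_conv hC hp

end Stage
end stage3

/-- the level structure extracted from the stages -/
structure LS {P V L : Type*} (X : CX P V L) where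
  AS : P → Prop
  om : P → ℤ
  lv : P → ℕ
  om_pos : ∀ {a}, AS a → 0 < om a
  om_le : ∀ {a}, AS a → om a ≤ X.len a
  bar_AS : ∀ {a}, AS a → AS (X.rv (X.at' a (om a)))
  bar_om : ∀ {a}, AS a → om (X.rv (X.at' a (om a))) = om a
  ex : ∀ c, ∃ a i, AS a ∧ c = X.at' a i
  lv_nx : ∀ c, lv (X.nx c) = lv c
  lv_rv : ∀ c, lv (X.rv c) = lv c
  cov : ∀ {a}, AS a → X.Cov 2 (X.at' a (om a)) (X.len a - om a)
  K : ∀ {a b i j}, AS a → AS b → 0 ≤ i → i < om a → 0 ≤ j → j < om b →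
    X.vtx (X.at' a i) = X.vtx (X.at' b j) → X.lab (X.at' a i) = X.lab (X.at' b j) →
    lv a = lv b ∧ ((i = j ∧ X.Sh a b (i+1)) ∨ (om a - i = om b - j ∧
      X.Sh (X.rv (X.at' a (om a))) (X.rv (X.at' b (om b))) (om a - i)))
  KV : ∀ {a b i j}, AS a → AS b → 0 < i → i < om a → 0 < j → j < om b →
    X.vtx (X.at' a i) = X.vtx (X.at' b j) →
    lv a = lv b ∧ ((i = j ∧ X.Sh a b i) ∨ (om a - i = om b - j ∧
      X.Sh (X.rv (X.at' a (om a))) (X.rv (X.at' b (om b))) (om a - i)) ∨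
      (i = om b - j ∧ X.Sh a (X.rv (X.at' b (om b))) i) ∨
      (om a - i = j ∧ X.Sh (X.rv (X.at' a (om a))) b j))
  T : ∀ {E}, AS E → X.len E - om E = 0 ∨
    (∃ a k, AS a ∧ 1 ≤ k ∧ k + (X.len E - om E) < om a ∧ lv E = lv a + 1 ∧
      X.Sh (X.at' E (om E)) (X.at' a k) (X.len E - om E)) ∨
    (∃ a b k ja jb, AS a ∧ AS b ∧ lv a = lv b ∧ lv E = lv a + 1 ∧ X.Sh a b k ∧
      X.lab (X.at' a k) ≠ X.lab (X.at' b k) ∧ 1 ≤ k ∧ k < ja ∧ ja < om a ∧ k < jb ∧ jb < om b ∧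
      X.len E - om E = (ja - k) + (jb - k) ∧
      X.Sh (X.at' E (-(ja - k))) (X.at' a k) (ja - k) ∧
      X.Sh (X.at' (X.rv (X.at' E (om E))) (-(jb - k))) (X.at' b k) (jb - k) ∧
      X.vtx E = X.vtx (X.at' a ja) ∧ X.vtx (X.rv (X.at' E (om E))) = X.vtx (X.at' b jb))

section seq
variable {W L : Type*} {X : CX W Unit L}
open Stage

def stage0 (X : CX W Unit L) : Stage X where
  V := {[]}
  E := fun _ _ _ => False
  sym := fun h => h
  det := fun h => h.elim
  memV := fun h => h.elim
  tree := fun h => by simp at h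
  conv := fun {p w n} _ hp => by
    rcases le_or_gt n 0 with hn | hn
    · exact Or.inr (CX.Cov.le (q := 0) (show n ≤ 0 from hn) (by omega))
    · exact (hp 0 le_rfl hn).elim

def stg (hC : X.C6) : ℕ → Stage X
  | 0 => stage0 X
  | n+1 => Stage.next hC (stg hC n)

variable (hC : X.C6)

theorem stg_E_mono {n m : ℕ} (h : n ≤ m) {u l v} (hE : (stg hC n).E u l v) : (stg hC m).E u l v := by
  induction m, h using Nat.le_induction with
  | base => exact hE
  | succ k _ ih => exact Or.inl ih

theorem stg_V_mono {n m : ℕ} (h : n ≤ m) {u} (hE : u ∈ (stg hC n).V) : u ∈ (stg hC m).V := by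
  induction m, h using Nat.le_induction with
  | base => exact hE
  | succ k _ ih => exact Or.inl ih

def Ei (u : List L) (l : L) (v : List L) : Prop := ∃ n, (stg hC n).E u l v
def Vi : Set (List L) := {u | ∃ n, u ∈ (stg hC n).V}

theorem Ei_sym {u l v} (h : Ei hC u l v) : Ei hC v (X.iv l) u := by
  obtain ⟨n, h⟩ := h; exact ⟨n, (stg hC n).sym h⟩
theorem Ei_det {u l v v'} (h : Ei hC u l v) (h' : Ei hC u l v') : v = v' := by
  obtain ⟨n, h⟩ := h
  obtain ⟨m, h'⟩ := h'
  exact (stg hC (max n m)).det (stg_E_mono hC (le_max_left _ _) h) (stg_E_mono hC (le_max_right _ _) h')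
theorem Ei_mem {u l v} (h : Ei hC u l v) : u ∈ Vi hC := by
  obtain ⟨n, h⟩ := h; exact ⟨n, (stg hC n).memV h⟩
theorem Ei_Lp {u} (h : u ∈ Vi hC) (w : W) : ∃ n, Lp X (stg hC n).E u w := by
  obtain ⟨n, h⟩ := h
  exact ⟨n+1, old_loop hC h w⟩
theorem nil_Vi : [] ∈ Vi hC := ⟨0, rfl⟩

/-- a loop of the next stage meets the previous stage -/
theorem old_on_loop (hC : X.C6) {B : Stage X} {p : ℤ → List L} {w : W}
    (hp : ∀ t, B.nE (p t) (X.lab (X.at' w t)) (p (t + 1))) : ∃ t, p t ∈ B.V := by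
  by_contra hV
  push Not at hV
  have hl := X.len_pos w
  have arc : ∀ (a : B.Arc) (k s : ℤ), 0 ≤ k → k ≤ a.n → p s = a.pt k → X.at' w s = X.at' a.w k →
      False := by
    intro a k s k0 k1 h1 h2
    have e1 : Pth X B.nE a.pt a.w 0 a.n := fun t t0 t1 => Or.inr ⟨a, t, t0, t1, rfl, rfl, rfl⟩
    have e2 : Pth X B.nE (fun t => p (t + (s - k))) a.w 0 a.n := by
      intro t t0 t1
      have := hp (t + (s - k))
      beta_reduce
      rw [show t + 1 + (s - k) = t + (s - k) + 1 by ring]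
      convert this using 2
      rw [show t + (s-k) = s + (t - k) by ring, ← X.at_at, h2, X.at_at, add_sub_cancel]
    have := pth_eqG (E := B.nE) nE_sym (nE_det hC) e1 e2 k0 k1 (by beta_reduce; rw [← h1]; congr 1; ring)
      0 le_rfl a.hn.le
    rw [a.pt_zero hC] at this
    exact hV _ (this ▸ a.hy)
  rcases turn hC hl.le (nE_mem (hp 0)) (fun t _ _ => hp t) (fun t _ _ => hV t) with
      ⟨a, k, k1, k2, k3, k4, k5⟩ |
      ⟨a, b, k, ja, jb, k1, k2, k3, k4, k5, k6, k7, k8, k9, k10, k11, k12, k13⟩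
  · by_cases h : X.at' a.w k = w
    · exact arc a k 0 (by omega) (by omega) k3 (by simp [h])
    · exact hC w (CX.Cov.le (CX.Pc.cov ⟨_, h, k5.symm⟩) (by omega))
  · by_cases h : X.rv (X.at' a.w ja) = w
    · refine arc a.bar (a.n - ja) 0 (by omega) (by rw [Arc.bar_n]; omega) (by rw [k10, Arc.pt_bar']) ?_
      rw [← h, X.at_zero, Arc.bar_w, X.rv_at, X.rv_at, X.at_at]; congr 1; ring
    · by_cases h' : X.at' b.w k = X.at' w (ja - k)
      · refine arc b jb (X.len w) (by omega) (by omega) k11 ?_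
        have := congrArg (fun z => X.at' z (jb - k)) h'
        simp only [X.at_at] at this
        rw [add_sub_cancel, ← k9] at this
        exact this.symm
      · have c1 := (CX.Pc.cov ⟨_, h, k12.symm⟩).append (CX.Pc.cov ⟨_, h', k13.symm⟩)
        exact hC w ((c1.mono k9.le).le (by omega))
end seq

section lift
variable {W L : Type*} {X : CX W Unit L} (hC : X.C6)
open Stage

/-- `Y` lies over `X` and maps to the stages. -/
structure Lift {P V : Type*} (Y : CX P V L) where
  wd : P → W
  wd_nx : ∀ c, wd (Y.nx c) = X.nx (wd c)
  wd_rv : ∀ c, wd (Y.rv c) = X.rv (wd c)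
  wd_lab : ∀ c, X.lab (wd c) = Y.lab c
  wd_len : ∀ c, X.len (wd c) = Y.len c
  iv_eq : ∀ l, Y.iv l = X.iv l
  inj : ∀ {c c'}, Y.vtx c = Y.vtx c' → wd c = wd c' → c = c'
  surj : ∀ v w, ∃ c, Y.vtx c = v ∧ wd c = w
  ph : V → List L
  ph_E : ∀ c, Ei hC (ph (Y.vtx c)) (Y.lab c) (ph (Y.vtx (Y.nx c)))

variable {hC} {P V : Type*} {Y : CX P V L} (F : Lift hC Y)
namespace Lift

theorem wd_at (c : P) (i : ℤ) : F.wd (Y.at' c i) = X.at' (F.wd c) i := by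
  induction i using Int.induction_on with
  | zero => simp
  | succ i ih => rw [← Y.nx_at, F.wd_nx, ih, X.nx_at]
  | pred i ih =>
    have h := F.wd_nx (Y.at' c (-(i:ℤ) - 1))
    rw [Y.nx_at, sub_add_cancel, ih, ← X.at_one] at h
    rw [eq_comm, X.at_eq_iff] at h
    rw [h, X.at_at]; congr 1

theorem lab_at (c : P) (i : ℤ) : Y.lab (Y.at' c i) = X.lab (X.at' (F.wd c) i) := by
  rw [← F.wd_lab, F.wd_at]

theorem sh {a b : P} {m : ℤ} (hv : Y.vtx a = Y.vtx b) (h : X.Sh (F.wd a) (F.wd b) m) :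
    Y.Sh a b m := ⟨hv, fun t t0 t1 => by rw [F.lab_at, F.lab_at]; exact h.2 t t0 t1⟩

theorem sh' {a b : P} {m : ℤ} (h : Y.Sh a b m) : X.Sh (F.wd a) (F.wd b) m :=
  ⟨rfl, fun t t0 t1 => by rw [← F.lab_at, ← F.lab_at]; exact h.2 t t0 t1⟩

/-- reading back from a common vertex -/
theorem sh_back {a b : P} {i m : ℤ} (hi : 0 ≤ i) (hm : i ≤ m) (h : X.Sh (F.wd a) (F.wd b) m)
    (hv : Y.vtx (Y.at' a i) = Y.vtx (Y.at' b i)) : Y.Sh a b m := by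
  refine F.sh ?_ h
  have h1 : Y.Sh (Y.rv (Y.at' a i)) (Y.rv (Y.at' b i)) i := by
    refine F.sh (by rw [Y.vtx_rv, Y.vtx_rv, hv]) ?_
    rw [F.wd_rv, F.wd_rv, F.wd_at, F.wd_at]
    exact (h.mono hm).rev hi
  have := h1.vtx_at hi le_rfl
  rw [← Y.vtx_rv, ← Y.vtx_rv (Y.at' (Y.rv (Y.at' b i)) i), Y.bar_bar, Y.bar_bar] at this
  exact this

theorem pc {c : P} {m : ℤ} (h : Y.Pc c m) : X.Pc (F.wd c) m := by
  obtain ⟨c', h1, h2⟩ := h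
  exact ⟨F.wd c', fun h => h1 (F.inj h2.1.symm h), F.sh' h2⟩
theorem pc' {c : P} {m : ℤ} (h : X.Pc (F.wd c) m) : Y.Pc c m := by
  obtain ⟨w', h1, h2⟩ := h
  obtain ⟨c', h3, rfl⟩ := F.surj (Y.vtx c) w'
  exact ⟨c', fun h => h1 (by rw [h]), F.sh h3.symm h2⟩
theorem cov_iff {q : ℕ} {c : P} {n : ℤ} : Y.Cov q c n ↔ X.Cov q (F.wd c) n := by
  induction q generalizing c n with
  | zero => exact Iff.rfl
  | succ q ih =>
    constructor
    · rintro ⟨m, h0, h1, h2⟩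
      exact ⟨m, h0, F.pc h1, by rw [← F.wd_at]; exact ih.1 h2⟩
    · rintro ⟨m, h0, h1, h2⟩
      exact ⟨m, h0, F.pc' h1, by rw [← F.wd_at] at h2; exact ih.2 h2⟩
theorem c6 (F : Lift hC Y) : Y.C6 := fun c h => hC (F.wd c) (by rw [F.wd_len]; exact F.cov_iff.1 h)

def pos (c : P) : List L := F.ph (Y.vtx c)

theorem pos_E (c : P) (t : ℤ) : Ei hC (F.pos (Y.at' c t)) (X.lab (X.at' (F.wd c) t))
    (F.pos (Y.at' c (t+1))) := by
  have := F.ph_E (Y.at' c t)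
  rw [Y.nx_at, F.lab_at] at this
  exact this

theorem pos_mem (c : P) : F.pos c ∈ Vi hC := Ei_mem hC (F.ph_E c)

/-- following a path -/
theorem follow {c : P} {p : ℤ → List L} {n : ℕ} {i j s : ℤ}
    (hp : Pth X (stg hC n).E p (F.wd c) i j) (hs : i ≤ s) (hs' : s ≤ j) (h : p s = F.pos (Y.at' c s)) :
    ∀ t, i ≤ t → t ≤ j → p t = F.pos (Y.at' c t) :=
  pth_eqG (E := Ei hC) (Ei_sym hC) (Ei_det hC) (fun t t0 t1 => ⟨n, hp t t0 t1⟩)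
    (q := fun t => F.pos (Y.at' c t)) (fun t _ _ => F.pos_E c t) hs hs' h

/-- `a` is the start of the arc `e` -/
def IsA (c : P) (n : ℕ) (e : (stg hC n).Arc) : Prop := e.y = F.pos c ∧ e.w = F.wd c

def AS (c : P) : Prop := ∃ n, ∃ e : (stg hC n).Arc, F.IsA c n e

noncomputable def lv (c : P) : ℕ := sInf {n | Lp X (stg hC n).E (F.pos c) (F.wd c)}

theorem Lp_mono {n m : ℕ} (h : n ≤ m) {u w} (hl : Lp X (stg hC n).E u w) : Lp X (stg hC m).E u w :=
  hl.mono fun _ _ _ => stg_E_mono hC h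

theorem Lp_nx {n : ℕ} {c : P} (h : Lp X (stg hC n).E (F.pos c) (F.wd c)) (t : ℤ) :
    Lp X (stg hC n).E (F.pos (Y.at' c t)) (F.wd (Y.at' c t)) := by
  obtain ⟨p, h0, h1, h2⟩ := h
  have : p t = F.pos (Y.at' c t) := by
    rcases le_total 0 t with ht | ht
    · exact F.follow (s := 0) (i := 0) (j := t) (fun t _ _ => h1 t) le_rfl ht (by simpa) t ht le_rfl
    · exact F.follow (s := 0) (i := t) (j := 0) (fun t _ _ => h1 t) ht le_rfl (by simpa) t le_rfl ht
  rw [← this, F.wd_at]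
  exact Lp.shift h1 h2 t

theorem lv_le {n : ℕ} {c : P} (h : Lp X (stg hC n).E (F.pos c) (F.wd c)) : F.lv c ≤ n :=
  Nat.sInf_le h
theorem lv_mem (c : P) : Lp X (stg hC (F.lv c)).E (F.pos c) (F.wd c) :=
  Nat.sInf_mem (s := {n | Lp X (stg hC n).E (F.pos c) (F.wd c)}) (Ei_Lp hC (F.pos_mem c) _)

theorem lv_at (c : P) (t : ℤ) : F.lv (Y.at' c t) = F.lv c := by
  apply le_antisymm
  · exact F.lv_le (F.Lp_nx (F.lv_mem c) t)
  · have := F.lv_le (F.Lp_nx (F.lv_mem (Y.at' c t)) (-t))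
    simpa using this

theorem lv_rv_le (c : P) : F.lv (Y.rv c) ≤ F.lv c := by
  apply F.lv_le
  have := Lp_rv (F.lv_mem c)
  rw [F.wd_rv]
  unfold pos; rw [Y.vtx_rv]; exact this

theorem lv_rv (c : P) : F.lv (Y.rv c) = F.lv c := by
  apply le_antisymm (F.lv_rv_le c)
  have := F.lv_rv_le (Y.rv c)
  rwa [Y.rv_rv] at this

theorem lv_arc {c : P} {n : ℕ} {e : (stg hC n).Arc} (h : F.IsA c n e) : F.lv c = n + 1 := by
  obtain ⟨h1, h2⟩ := h
  apply le_antisymm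
  · apply F.lv_le
    rw [← h1, ← h2]
    have := pt_loop hC e le_rfl e.hn.le
    rw [e.pt_zero hC, X.at_zero] at this
    exact this
  · by_contra hlt
    have := Lp_mono (m := n) (by omega) (F.lv_mem c)
    rw [← h1, ← h2] at this
    exact e.not_lp this

theorem arc_uniq {c : P} {n m : ℕ} {e : (stg hC n).Arc} {e' : (stg hC m).Arc} (h : F.IsA c n e)
    (h' : F.IsA c m e') : e.n = e'.n := by
  have : n = m := by have := F.lv_arc h; have := F.lv_arc h'; omega
  subst this
  have : e = e' := Arc.ext' (h.1.trans h'.1.symm) (h.2.trans h'.2.symm)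
  rw [this]

open Classical in
noncomputable def om (c : P) : ℤ := if h : F.AS c then h.choose_spec.choose.n else 0

theorem om_eq {c : P} {n : ℕ} {e : (stg hC n).Arc} (h : F.IsA c n e) : F.om c = e.n := by
  have hh : F.AS c := ⟨n, e, h⟩
  unfold om
  rw [dif_pos hh]
  exact F.arc_uniq hh.choose_spec.choose_spec h

theorem pt_pth {n : ℕ} (e : (stg hC n).Arc) : Pth X (stg hC (n+1)).E e.pt e.w 0 e.n :=
  fun t t0 t1 => Or.inr ⟨e, t, t0, t1, rfl, rfl, rfl⟩

theorem pt_pos {c : P} {n : ℕ} {e : (stg hC n).Arc} (h : F.IsA c n e) {t : ℤ} (t0 : 0 ≤ t)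
    (t1 : t ≤ e.n) : e.pt t = F.pos (Y.at' c t) := by
  have := pt_pth e
  rw [h.2] at this
  exact F.follow this (s := 0) le_rfl e.hn.le (by rw [e.pt_zero hC, h.1, Y.at_zero]) t t0 t1

theorem isA_of_pt {c : P} {n : ℕ} {e : (stg hC n).Arc} (hw : e.w = F.wd c) {t : ℤ} (t0 : 0 ≤ t)
    (t1 : t ≤ e.n) (h : e.pt t = F.pos (Y.at' c t)) : F.IsA c n e := by
  have := pt_pth e
  rw [hw] at this
  have := F.follow this (s := t) t0 t1 h 0 le_rfl e.hn.le
  rw [e.pt_zero hC, Y.at_zero] at this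
  exact ⟨this, hw⟩

theorem isA_bar {c : P} {n : ℕ} {e : (stg hC n).Arc} (h : F.IsA c n e) :
    F.IsA (Y.rv (Y.at' c e.n)) n e.bar := by
  refine ⟨?_, ?_⟩
  · unfold pos
    rw [Y.vtx_rv, Arc.bar_y, ← e.pt_n hC, F.pt_pos h e.hn.le le_rfl]; rfl
  · rw [F.wd_rv, F.wd_at, ← h.2, Arc.bar_w]

theorem ex (c : P) : ∃ a i, F.AS a ∧ c = Y.at' a i := by
  have h := F.lv_mem c
  obtain ⟨n, hn⟩ : ∃ n, F.lv c = n + 1 := by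
    rcases h' : F.lv c with _ | n
    · rw [h'] at h
      obtain ⟨p, h0, h1, h2⟩ := h
      exact (h1 0).elim
    · exact ⟨n, rfl⟩
  have hmin : ∀ t, ¬ Lp X (stg hC n).E (F.pos (Y.at' c t)) (F.wd (Y.at' c t)) := fun t h => by
    have := F.lv_le h
    rw [F.lv_at] at this
    omega
  rw [hn] at h
  obtain ⟨p, h0, h1, h2⟩ := h
  obtain ⟨t, ht⟩ := old_on_loop hC (B := stg hC n) h1
  have hpt : p t = F.pos (Y.at' c t) := by
    rcases le_total 0 t with ht | ht
    · exact F.follow (n := n+1) (s := 0) (i := 0) (j := t) (fun t _ _ => h1 t) le_rfl ht (by simpa)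
        t ht le_rfl
    · exact F.follow (n := n+1) (s := 0) (i := t) (j := 0) (fun t _ _ => h1 t) ht le_rfl (by simpa)
        t le_rfl ht
  rw [hpt] at ht
  obtain ⟨e, i, q, e1, e2, e3, e4, e5, e6, e7⟩ := arc_exists hC ht (hmin t)
  refine ⟨Y.at' (Y.at' c t) i, -(t+i), ⟨n, e, ?_, ?_⟩, ?_⟩
  · have e7' := e7
    rw [e1, ← F.wd_at] at e7'
    have hl : F.wd (Y.at' c t) = F.wd (Y.at' c t) := rfl
    have hlen : X.len (F.wd (Y.at' c t)) = Y.len c := by rw [F.wd_len, Y.len_at]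
    have := F.follow e7' (s := X.len (F.wd (Y.at' c t)) - i) (by omega) (by omega) (by
      rw [e4, Y.at_at, add_sub_cancel, hlen, ← Y.len_at c t, Y.at_len])
      (X.len (F.wd (Y.at' c t))) (by omega) le_rfl
    rw [← e6, this]
    rw [Y.at_at, hlen, ← Y.len_at c t, Y.at_add_len]
  · rw [e1, ← F.wd_at]
  · simp

theorem K {a b i j} (ha : F.AS a) (hb : F.AS b) (i0 : 0 ≤ i) (i1 : i < F.om a) (j0 : 0 ≤ j)
    (j1 : j < F.om b) (hv : Y.vtx (Y.at' a i) = Y.vtx (Y.at' b j))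
    (hl : Y.lab (Y.at' a i) = Y.lab (Y.at' b j)) :
    F.lv a = F.lv b ∧ ((i = j ∧ Y.Sh a b (i+1)) ∨ (F.om a - i = F.om b - j ∧
      Y.Sh (Y.rv (Y.at' a (F.om a))) (Y.rv (Y.at' b (F.om b))) (F.om a - i))) := by
  obtain ⟨n, e, he⟩ := ha
  obtain ⟨m, f, hf⟩ := hb
  rw [F.om_eq he] at *
  rw [F.om_eq hf] at *
  have hne : ∀ {a b : P} {i j : ℤ} {n m : ℕ} {e : (stg hC n).Arc} {f : (stg hC m).Arc}, F.IsA a n e →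
     F.IsA b m f → 0 ≤ i → i < e.n → 0 ≤ j → j < f.n → Y.vtx (Y.at' a i) = Y.vtx (Y.at' b j) →
      Y.lab (Y.at' a i) = Y.lab (Y.at' b j) → ¬ n < m := by
    intro a b i j n m e f he hf i0 i1 j0 j1 hv hl hlt
    have h1 : (stg hC m).E (e.pt i) (X.lab (X.at' e.w i)) (e.pt (i+1)) :=
      stg_E_mono hC (show n + 1 ≤ m from hlt) (pt_pth e i i0 i1)
    have h2 : e.pt i = f.pt j := by
      rw [F.pt_pos he i0 i1.le, F.pt_pos hf j0 j1.le]; unfold pos; rw [hv]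
    have h3 : X.lab (X.at' e.w i) = X.lab (X.at' f.w j) := by
      rw [he.2, hf.2, ← F.lab_at, ← F.lab_at, hl]
    rw [h2, h3] at h1
    rcases j0.eq_or_lt with h4 | h4
    · subst h4
      rw [f.pt_zero hC, X.at_zero] at h1
      exact f.sy _ h1
    · exact f.pt_not_mem h4 j1 ((stg hC m).memV h1)
  have : n = m := by
    have h1 := hne he hf i0 i1 j0 j1 hv hl
    have h2 := hne hf he j0 j1 i0 i1 hv.symm hl.symm
    omega
  subst this
  refine ⟨by rw [F.lv_arc he, F.lv_arc hf], ?_⟩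
  rcases Arc.KD hC i0 i1 j0 j1 (by
    rw [F.pt_pos he i0 i1.le, F.pt_pos hf j0 j1.le]; unfold pos; rw [hv]) (by
    rw [he.2, hf.2, ← F.lab_at, ← F.lab_at, hl]) with ⟨h1, rfl, h3⟩ | ⟨h1, h2, h3⟩
  · refine Or.inl ⟨rfl, F.sh_back i0 (by omega) ?_ hv⟩
    rw [← he.2, ← hf.2]; exact h3
  · refine Or.inr ⟨h2, F.sh_back (i := e.n - i) (by omega) (by omega) ?_ ?_⟩
    · rw [← (F.isA_bar he).2, ← (F.isA_bar hf).2]; exact h3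
    · rw [Y.rv_at, Y.rv_at, Y.at_at, Y.at_at, show -e.n + (e.n - i) = -i by ring,
        show -f.n + (e.n - i) = -j by omega, ← Y.rv_at, ← Y.rv_at, Y.vtx_rv, Y.vtx_rv, hv]

theorem KV {a b i j} (ha : F.AS a) (hb : F.AS b) (i0 : 0 < i) (i1 : i < F.om a) (j0 : 0 < j)
    (j1 : j < F.om b) (hv : Y.vtx (Y.at' a i) = Y.vtx (Y.at' b j)) :
    F.lv a = F.lv b ∧ ((i = j ∧ Y.Sh a b i) ∨ (F.om a - i = F.om b - j ∧
      Y.Sh (Y.rv (Y.at' a (F.om a))) (Y.rv (Y.at' b (F.om b))) (F.om a - i)) ∨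
      (i = F.om b - j ∧ Y.Sh a (Y.rv (Y.at' b (F.om b))) i) ∨
      (F.om a - i = j ∧ Y.Sh (Y.rv (Y.at' a (F.om a))) b j)) := by
  obtain ⟨n, e, he⟩ := ha
  obtain ⟨m, f, hf⟩ := hb
  rw [F.om_eq he] at *
  rw [F.om_eq hf] at *
  have h2 : e.pt i = f.pt j := by
    rw [F.pt_pos he i0.le i1.le, F.pt_pos hf j0.le j1.le]; unfold pos; rw [hv]
  have hne : ∀ {i j : ℤ} {n m : ℕ} {e : (stg hC n).Arc} {f : (stg hC m).Arc}, 
     0 < i → i < e.n → 0 < j → j < f.n → e.pt i = f.pt j → ¬ n < m := by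
    intro i j n m e f i0 i1 j0 j1 hv hlt
    have h1 : (stg hC m).E (e.pt i) (X.lab (X.at' e.w i)) (e.pt (i+1)) :=
      stg_E_mono hC (show n + 1 ≤ m from hlt) (pt_pth e i i0.le i1)
    rw [hv] at h1
    exact f.pt_not_mem j0 j1 ((stg hC m).memV h1)
  have : n = m := by
    have h1 := hne i0 i1 j0 j1 h2
    have h2 := hne j0 j1 i0 i1 h2.symm
    omega
  subst this
  refine ⟨by rw [F.lv_arc he, F.lv_arc hf], ?_⟩
  have vb : ∀ (c : P) (n t : ℤ), Y.vtx (Y.at' (Y.rv (Y.at' c n)) (n - t)) = Y.vtx (Y.at' c t) := by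
    intro c n t
    rw [Y.rv_at, Y.at_at, show -n + (n - t) = -t by ring, ← Y.rv_at, Y.vtx_rv]
  rcases Arc.KV i0 i1 j0 j1 h2 with ⟨h1, h2, h3⟩ | ⟨h1, h2, h3⟩ | ⟨h1, h2, h3⟩ | ⟨h1, h2, h3⟩
  · subst h2
    refine Or.inl ⟨rfl, F.sh_back i0.le le_rfl ?_ hv⟩
    rw [← he.2, ← hf.2]; exact h3
  · refine Or.inr (Or.inl ⟨h2, F.sh_back (i := e.n - i) (by omega) (by omega) ?_ ?_⟩)
    · rw [← (F.isA_bar he).2, ← (F.isA_bar hf).2]; exact h3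
    · rw [vb, h2, vb, hv]
  · refine Or.inr (Or.inr (Or.inl ⟨h2, F.sh_back (i := i) (by omega) (by omega) ?_ ?_⟩))
    · rw [← he.2, ← (F.isA_bar hf).2]; exact h3
    · rw [hv, h2, vb]
  · refine Or.inr (Or.inr (Or.inr ⟨h2, F.sh_back (i := j) (by omega) (by omega) ?_ ?_⟩))
    · rw [← (F.isA_bar he).2, ← hf.2]; exact h3
    · rw [← hv, ← h2, vb]

theorem T {E} (hE : F.AS E) : Y.len E - F.om E = 0 ∨
    (∃ a k, F.AS a ∧ 1 ≤ k ∧ k + (Y.len E - F.om E) < F.om a ∧ F.lv E = F.lv a + 1 ∧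
      Y.Sh (Y.at' E (F.om E)) (Y.at' a k) (Y.len E - F.om E)) ∨
    (∃ a b k ja jb, F.AS a ∧ F.AS b ∧ F.lv a = F.lv b ∧ F.lv E = F.lv a + 1 ∧ Y.Sh a b k ∧
      Y.lab (Y.at' a k) ≠ Y.lab (Y.at' b k) ∧ 1 ≤ k ∧ k < ja ∧ ja < F.om a ∧ k < jb ∧ jb < F.om b ∧
      Y.len E - F.om E = (ja - k) + (jb - k) ∧
      Y.Sh (Y.at' E (-(ja - k))) (Y.at' a k) (ja - k) ∧
      Y.Sh (Y.at' (Y.rv (Y.at' E (F.om E))) (-(jb - k))) (Y.at' b k) (jb - k) ∧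
      Y.vtx E = Y.vtx (Y.at' a ja) ∧ Y.vtx (Y.rv (Y.at' E (F.om E))) = Y.vtx (Y.at' b jb)) := by
  obtain ⟨n, e, he⟩ := hE
  rw [F.om_eq he, F.lv_arc he]
  have hlen : X.len e.w = Y.len E := by rw [he.2, F.wd_len]
  have hn1 := e.hn'
  have hn0 := e.hn
  rw [hlen] at hn1
  by_cases hs : Y.len E - e.n = 0
  · exact Or.inl hs
  right
  obtain ⟨p, p1, p2, p3⟩ := e.hp
  rw [hlen] at p2 p3
  rcases n with _ | n
  · exact (p3 e.n le_rfl (by omega)).elim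
  have q3 := pth_shift p3 e.n
  rw [sub_self] at q3
  have hfol := F.follow (c := E) (by rw [← he.2]; exact p3) (s := Y.len E) hn1 le_rfl
    (by rw [p2, he.1, Y.at_len])
  have hV : ∀ t, 0 ≤ t → t ≤ Y.len E - e.n → p (t + e.n) ∉ (stg hC n).V := by
    intro t t0 t1 hm
    have h1 := old_loop hC hm (X.at' (X.at' e.w e.n) t)
    have := Lp_pth (B := stg hC (n+1)) (p := fun t => p (t + e.n)) (t := Y.len E - e.n) q3 t0 t1 h1
      (by omega) le_rfl
    rw [X.at_at, add_sub_cancel, ← hlen, X.at_len] at this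
    apply e.not_lp
    convert this using 1
    rw [hlen, sub_add_cancel, p2]
  rcases turn (B := stg hC n) (p := fun t => p (t + e.n)) hC (by omega) (nE_mem (B := stg hC n) (q3 0 le_rfl (by omega))) q3 hV with
      ⟨a, k, k1, k2, k3, k4, k5⟩ |
      ⟨a, b, k, ja, jb, k1, k2, k3, k4, k5, k6, k7, k8, k9, k10, k11, k12, k13⟩
  · left
    obtain ⟨c, c1, c2⟩ := F.surj (Y.vtx (Y.at' E e.n)) (X.at' a.w k)
    have hA : F.IsA (Y.at' c (-k)) n a := by
      refine F.isA_of_pt (t := k) ?_ (by omega) (by omega) ?_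
      · rw [F.wd_at, c2, X.at_at]; simp
      · rw [Y.at_at, neg_add_cancel, Y.at_zero, ← k3]
        beta_reduce
        rw [zero_add, hfol _ le_rfl hn1]
        unfold pos; rw [c1]
    refine ⟨Y.at' c (-k), k, ⟨n, a, hA⟩, k1, ?_, ?_, ?_⟩
    · rw [F.om_eq hA]; exact k2
    · rw [F.lv_arc hA]
    · rw [Y.at_at, neg_add_cancel, Y.at_zero]
      refine F.sh c1.symm ?_
      rw [c2, F.wd_at, ← he.2]; exact k5.symm
  · right
    obtain ⟨c, c1, c2⟩ := F.surj (Y.vtx (Y.at' E e.n)) (X.at' a.w ja)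
    obtain ⟨d, d1, d2⟩ := F.surj (Y.vtx E) (X.at' b.w jb)
    have hA : F.IsA (Y.at' c (-ja)) n a := by
      refine F.isA_of_pt (t := ja) ?_ (by omega) (by omega) ?_
      · rw [F.wd_at, c2, X.at_at]; simp
      · rw [Y.at_at, neg_add_cancel, Y.at_zero, ← k10]
        beta_reduce
        rw [zero_add, hfol _ le_rfl hn1]
        unfold pos; rw [c1]
    have hB : F.IsA (Y.at' d (-jb)) n b := by
      refine F.isA_of_pt (t := jb) ?_ (by omega) (by omega) ?_
      · rw [F.wd_at, d2, X.at_at]; simp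
      · rw [Y.at_at, neg_add_cancel, Y.at_zero, ← k11]
        beta_reduce
        rw [sub_add_cancel, hfol _ hn1 le_rfl, Y.at_len]
        unfold pos; rw [d1]
    obtain ⟨A, hAd⟩ : ∃ A, A = Y.at' c (-ja) := ⟨_, rfl⟩
    obtain ⟨Bb, hBd⟩ : ∃ A, A = Y.at' d (-jb) := ⟨_, rfl⟩
    rw [← hAd] at hA
    rw [← hBd] at hB
    have wA : F.wd A = a.w := hA.2.symm
    have wB : F.wd Bb = b.w := hB.2.symm
    have vA : Y.vtx (Y.at' A ja) = Y.vtx (Y.at' E e.n) := by rw [hAd, Y.at_at]; simpa using c1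
    have vB : Y.vtx (Y.at' Bb jb) = Y.vtx E := by rw [hBd, Y.at_at]; simpa using d1
    have s1 : Y.Sh (Y.rv (Y.at' A ja)) (Y.at' E e.n) (ja - k) := by
      refine F.sh (by rw [Y.vtx_rv, vA]) ?_
      rw [F.wd_rv, F.wd_at, F.wd_at, wA, ← he.2]; exact k12
    have s2 : Y.Sh (Y.at' Bb k) (Y.at' E (-(jb - k))) (jb - k) := by
      refine F.sh_back (i := jb - k) (by omega) le_rfl ?_ ?_
      · rw [F.wd_at, F.wd_at, wB, ← he.2]
        convert k13 using 1
        rw [X.at_at, ← X.at_add_len, hlen]; congr 1; omega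
      · rw [Y.at_at, Y.at_at, add_sub_cancel, neg_add_cancel, Y.at_zero, vB]
    have s1' := s1.rev (by omega)
    have e1 : Y.rv (Y.at' (Y.rv (Y.at' A ja)) (ja - k)) = Y.at' A k := by
      rw [Y.rv_at (Y.rv _), Y.rv_rv, Y.at_at]; congr 1; ring
    have e2 : Y.rv (Y.at' (Y.at' E e.n) (ja - k)) = Y.at' (Y.rv (Y.at' E e.n)) (-(ja - k)) := by
      rw [Y.rv_at]
    rw [e1, e2] at s1'
    have vk : Y.vtx (Y.at' Bb k) = Y.vtx (Y.at' A k) := by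
      rw [s2.1, s1'.1, ← e2, Y.vtx_rv, Y.at_at, ← Y.at_add_len]; congr 2; omega
    refine ⟨Bb, A, k, jb, ja, ⟨n, b, hB⟩, ⟨n, a, hA⟩, by rw [F.lv_arc hA, F.lv_arc hB],
      by rw [F.lv_arc hB], ?_, ?_, k4, k7, ?_, k5, ?_, by omega, s2.symm, s1'.symm, vB.symm, ?_⟩
    · refine F.sh_back (i := k) (by omega) le_rfl ?_ vk
      rw [wA, wB]; exact k2.symm
    · rw [F.lab_at, F.lab_at, wA, wB]; exact k3.symm
    · rw [F.om_eq hB]; exact k8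
    · rw [F.om_eq hA]; exact k6
    · rw [Y.vtx_rv, vA]

noncomputable def toLS : LS Y where
  AS := F.AS
  om := F.om
  lv := F.lv
  om_pos := by rintro a ⟨n, e, he⟩; rw [F.om_eq he]; exact e.hn
  om_le := by rintro a ⟨n, e, he⟩; rw [F.om_eq he, ← F.wd_len, ← he.2]; exact e.hn'
  bar_AS := by rintro a ⟨n, e, he⟩; rw [F.om_eq he]; exact ⟨n, e.bar, F.isA_bar he⟩
  bar_om := by rintro a ⟨n, e, he⟩; rw [F.om_eq he, F.om_eq (F.isA_bar he)]; rfl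
  ex := F.ex
  lv_nx := fun c => by rw [← Y.at_one, F.lv_at]
  lv_rv := F.lv_rv
  cov := by
    rintro a ⟨n, e, he⟩
    rw [F.om_eq he, F.cov_iff, F.wd_at, ← he.2, ← F.wd_len, ← he.2]
    exact e.cov
  K := F.K
  KV := F.KV
  T := F.T
end Lift
end lift

section gcx
variable {S : Type*} [DecidableEq S] {R : Set (FreeGroup S)} (hS : FG.Symmetrized R)

theorem pre_full (w : RW R) : pre (WX hS) w w.1.length = w.1 := by
  apply List.ext_getElem
  · rw [pre_length]
  · intro i h1 h2
    simp only [pre, List.getElem_map, List.getElem_range]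
    exact WX.lab_at hS w i h2

/-- value of a letter -/
def ev (R : Set (FreeGroup S)) (l : S × Bool) : PresentedGroup R :=
  PresentedGroup.mk R (FreeGroup.mk [l])

theorem ev_iv (l : S × Bool) : ev R (ivL l) = (ev R l)⁻¹ := by
  unfold ev; rw [← map_inv, FreeGroup.inv_mk]; rfl

def evs (R : Set (FreeGroup S)) (l : List (S × Bool)) : PresentedGroup R :=
  PresentedGroup.mk R (FreeGroup.mk l)

theorem evs_append (l l' : List (S × Bool)) : evs R (l ++ l') = evs R l * evs R l' := by
  unfold evs; rw [← map_mul, FreeGroup.mul_mk]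
theorem evs_rel {w} (h : w ∈ RW R) : evs R w = 1 := by
  unfold evs
  exact PresentedGroup.one_of_mem (RW.mk_mem h)

theorem WX_lab_symm_rv (w : RW R) :
    (WX hS).lab ((WX hS).nx.symm ((WX hS).rv w)) = ivL ((WX hS).lab w) := by
  rw [← (WX hS).rv_nx, (WX hS).lab_rv]; rfl

def gnx : Equiv.Perm (PresentedGroup R × RW R) where
  toFun c := (c.1 * ev R ((WX hS).lab c.2), (WX hS).nx c.2)
  invFun c := (c.1 * (ev R ((WX hS).lab ((WX hS).nx.symm c.2)))⁻¹, (WX hS).nx.symm c.2)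
  left_inv c := by simp
  right_inv c := by simp

theorem gnx_pow (c : PresentedGroup R × RW R) (n : ℕ) :
    (gnx hS ^ n) c = (c.1 * evs R (pre (WX hS) c.2 n), (WX hS).at' c.2 n) := by
  induction n with
  | zero => 
    have : evs R ([] : List (S × Bool)) = 1 := by
      unfold evs; exact map_one _
    simp [pre, this]
  | succ n ih =>
    rw [pow_succ', Equiv.Perm.mul_apply, ih, pre_succ, evs_append, ← mul_assoc]
    ext1
    · rfl
    · show (WX hS).nx _ = _
      rw [(WX hS).nx_at]; rfl

def GX : CX (PresentedGroup R × RW R) (PresentedGroup R) (S × Bool) where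
  nx := gnx hS
  rv c := (c.1, (WX hS).rv c.2)
  lab c := (WX hS).lab c.2
  vtx c := c.1
  len c := (WX hS).len c.2
  iv := ivL
  iv_iv := (WX hS).iv_iv
  iv_ne := (WX hS).iv_ne
  rv_rv c := by rw [(WX hS).rv_rv]
  rv_nx c := by
    show (c.1 * ev R ((WX hS).lab c.2), (WX hS).rv ((WX hS).nx c.2)) =
      (c.1 * (ev R ((WX hS).lab ((WX hS).nx.symm ((WX hS).rv c.2))))⁻¹, (WX hS).nx.symm ((WX hS).rv c.2))
    rw [WX_lab_symm_rv, ev_iv, inv_inv, (WX hS).rv_nx]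
  rv_ne c h := (WX hS).rv_ne c.2 (congrArg Prod.snd h)
  vtx_rv _ := rfl
  lab_rv c := (WX hS).lab_rv c.2
  red c := (WX hS).red c.2
  det c c' h1 h2 := by
    show c.1 * ev R ((WX hS).lab c.2) = c'.1 * ev R ((WX hS).lab c'.2)
    rw [show c.1 = c'.1 from h1, show (WX hS).lab c.2 = (WX hS).lab c'.2 from h2]
  len_pos c := (WX hS).len_pos c.2
  len_nx c := (WX hS).len_nx c.2
  len_rv c := (WX hS).len_rv c.2
  per c := by
    have := gnx_pow hS c c.2.1.length
    rw [pre_full, evs_rel c.2.2, mul_one] at this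
    have h2 : (WX hS).at' c.2 c.2.1.length = c.2 := (WX hS).at_len c.2
    rw [h2] at this
    rw [← zpow_natCast] at this
    exact this

theorem GX_vtx_nx (c : PresentedGroup R × RW R) :
    (GX hS).vtx ((GX hS).nx c) = (GX hS).vtx c * ev R ((GX hS).lab c) := rfl

variable (hC : (WX hS).C6)

theorem Ei_letter {W L : Type*} {X : CX W Unit L} (hC : X.C6) {u l v} (h : Ei hC u l v) :
    ∃ w, X.lab w = l := by
  obtain ⟨n, h⟩ := h
  induction n with
  | zero => exact h.elim
  | succ n ih =>
    rcases h with h | ⟨a, i, _, _, _, h, _⟩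
    · exact ih h
    · exact ⟨_, h.symm⟩

theorem Ei_ex {W L : Type*} {X : CX W Unit L} (hC : X.C6) {u} (hu : u ∈ Vi hC) {l}
    (hl : ∃ w, X.lab w = l) : ∃ v, Ei hC u l v := by
  obtain ⟨w, rfl⟩ := hl
  obtain ⟨n, p, h0, h1, h2⟩ := Ei_Lp hC hu w
  refine ⟨p 1, n, ?_⟩
  have := h1 0
  rwa [h0, X.at_zero, zero_add] at this

section act
variable {W L : Type*} {X : CX W Unit L} (hC : X.C6)

open Classical in
noncomputable def act (l : L) (u : Vi hC) : Vi hC :=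
  if h : ∃ v : Vi hC, Ei hC u.1 l v.1 then h.choose else u

theorem act_eq {l : L} {u : Vi hC} {v} (h : Ei hC u.1 l v) : (act hC l u).1 = v := by
  have hh : ∃ v : Vi hC, Ei hC u.1 l v.1 := ⟨⟨v, Ei_mem hC (Ei_sym hC h)⟩, h⟩
  unfold act
  rw [dif_pos hh]
  exact Ei_det hC hh.choose_spec h

theorem act_id {l : L} {u : Vi hC} (h : ¬ ∃ w, X.lab w = l) : act hC l u = u := by
  unfold act
  rw [dif_neg]
  rintro ⟨v, hv⟩
  exact h (Ei_letter hC hv)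

theorem act_iv (l : L) (u : Vi hC) : act hC (X.iv l) (act hC l u) = u := by
  by_cases h : ∃ w, X.lab w = l
  · obtain ⟨v, hv⟩ := Ei_ex hC u.2 h
    have h1 := act_eq hC hv
    have h2 := Ei_sym hC hv
    rw [← h1] at h2
    ext1
    exact act_eq hC h2
  · rw [act_id hC h, act_id]
    rintro ⟨w, hw⟩
    exact h ⟨X.rv (X.nx w), by rw [X.lab_rv, hw, X.iv_iv]⟩

noncomputable def actP (l : L) : Equiv.Perm (Vi hC) where
  toFun := act hC l
  invFun := act hC (X.iv l)
  left_inv := act_iv hC l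
  right_inv u := by
    have := act_iv hC (X.iv l) u
    rwa [X.iv_iv] at this

end act

noncomputable def psF : FreeGroup S →* (Equiv.Perm (Vi hC))ᵐᵒᵖ :=
  FreeGroup.lift fun s => MulOpposite.op (actP hC (s, true))

theorem psF_letter (l : S × Bool) : psF hS hC (FreeGroup.mk [l]) = MulOpposite.op (actP hC l) := by
  obtain ⟨s, b⟩ := l
  unfold psF
  rw [FreeGroup.lift_mk]
  cases b
  · simp only [List.map_cons, List.map_nil, List.prod_cons, List.prod_nil, mul_one, cond_false]
    rw [← MulOpposite.op_inv]
    congr 1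
  · simp

theorem psF_list (l : List (S × Bool)) (u : Vi hC) :
    (MulOpposite.unop (psF hS hC (FreeGroup.mk l))) u = l.foldl (fun u x => act hC x u) u := by
  induction l generalizing u with
  | nil => 
    have : psF hS hC (FreeGroup.mk []) = 1 := map_one _
    rw [this]; rfl
  | cons x l ih =>
    have : FreeGroup.mk (x :: l) = FreeGroup.mk [x] * FreeGroup.mk l := by
      rw [FreeGroup.mul_mk]; rfl
    rw [this, map_mul, MulOpposite.unop_mul, Equiv.Perm.mul_apply, psF_letter, ih]
    rfl

theorem psF_rel : ∀ r ∈ R, psF hS hC r = 1 := by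
  intro r hr
  have hw : r.toWord ∈ RW R := ⟨r, hr, rfl⟩
  rw [← FreeGroup.mk_toWord (x := r)]
  apply MulOpposite.unop_injective
  ext1 u
  rw [psF_list]
  obtain ⟨n, p, h0, h1, h2⟩ := Ei_Lp hC u.2 ⟨r.toWord, hw⟩
  have key : ∀ k : ℕ, ((pre (WX hS) ⟨r.toWord, hw⟩ k).foldl (fun u x => act hC x u) u).1 = p k := by
    intro k
    induction k with
    | zero => simp [pre, h0]
    | succ k ih =>
      rw [pre_succ, List.foldl_append]
      simp only [List.foldl_cons, List.foldl_nil]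
      apply act_eq
      rw [ih]
      exact ⟨n, by have := h1 k; push_cast; exact this⟩
  have := key r.toWord.length
  rw [pre_full hS ⟨r.toWord, hw⟩] at this
  ext1
  rw [this]
  have h3 := h2 0
  rw [zero_add, h0] at h3
  exact h3

noncomputable def psG : PresentedGroup R →* (Equiv.Perm (Vi hC))ᵐᵒᵖ :=
  PresentedGroup.toGroup (f := fun s => MulOpposite.op (actP hC (s, true))) (psF_rel hS hC)

theorem psG_mk (x : FreeGroup S) : psG hS hC (PresentedGroup.mk R x) = psF hS hC x := rfl

noncomputable def phG (g : PresentedGroup R) : Vi hC :=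
  MulOpposite.unop (psG hS hC g) ⟨[], nil_Vi hC⟩

theorem phG_mul (g : PresentedGroup R) (l : S × Bool) :
    phG hS hC (g * ev R l) = act hC l (phG hS hC g) := by
  unfold phG
  rw [map_mul, MulOpposite.unop_mul, Equiv.Perm.mul_apply]
  unfold ev
  rw [psG_mk, psF_letter]; rfl

noncomputable def GLift : Lift hC (GX hS) where
  wd c := c.2
  wd_nx _ := rfl
  wd_rv _ := rfl
  wd_lab _ := rfl
  wd_len _ := rfl
  iv_eq _ := rfl
  inj h1 h2 := Prod.ext h1 h2
  surj v w := ⟨(v, w), rfl, rfl⟩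
  ph g := (phG hS hC g).1
  ph_E c := by
    rw [GX_vtx_nx, phG_mul]
    obtain ⟨v, hv⟩ := Ei_ex hC (phG hS hC ((GX hS).vtx c)).2 (l := (GX hS).lab c) ⟨c.2, rfl⟩
    rw [act_eq hC hv]; exact hv
end gcx

namespace CX
variable {P V L : Type*} (X : CX P V L)

/-- same dart -/
def SD (a b : P) : Prop := X.vtx a = X.vtx b ∧ X.lab a = X.lab b

variable {X}
theorem SD.refl (a : P) : X.SD a a := ⟨rfl, rfl⟩
theorem SD.symm {a b : P} (h : X.SD a b) : X.SD b a := ⟨h.1.symm, h.2.symm⟩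
theorem SD.trans {a b c : P} (h : X.SD a b) (h' : X.SD b c) : X.SD a c :=
  ⟨h.1.trans h'.1, h.2.trans h'.2⟩
theorem SD.rev {a b : P} (h : X.SD a b) : X.SD (X.rv (X.nx a)) (X.rv (X.nx b)) := by
  refine ⟨?_, ?_⟩
  · rw [X.vtx_rv, X.vtx_rv]; exact X.det _ _ h.1 h.2
  · rw [X.lab_rv, X.lab_rv, h.2]
theorem SD.rev_at {a b : P} {i j : ℤ} (h : X.SD (X.at' a i) (X.at' b j)) :
    X.SD (X.rv (X.at' a (i+1))) (X.rv (X.at' b (j+1))) := by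
  have := h.rev
  rwa [X.nx_at, X.nx_at] at this
theorem Sh.sd {a b : P} {m t : ℤ} (h : X.Sh a b m) (h0 : 0 ≤ t) (h1 : t < m) :
    X.SD (X.at' a t) (X.at' b t) := ⟨h.vtx_at h0 h1.le, h.2 t h0 h1⟩
theorem Sh.sd' {a b : P} {m : ℤ} {i j : ℤ} (h : X.Sh (X.at' a i) (X.at' b j) m) {u v : ℤ}
    (h0 : i ≤ u) (h1 : u < i + m) (h2 : u - i = v - j) :
    X.SD (X.at' a u) (X.at' b v) := by
  have := h.sd (t := u - i) (by omega) (by omega)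
  rw [X.at_at, X.at_at] at this
  convert this using 2 <;> omega
theorem nx_rv (c : P) : X.nx (X.rv c) = X.rv (X.nx.symm c) := by
  have := X.rv_nx (X.rv (X.rv (X.nx.symm c)))
  rw [X.rv_rv] at this
  simp only [Equiv.apply_symm_apply] at this
  rw [this]; simp
end CX

namespace LS
open CX
variable {P V L : Type*} {X : CX P V L} (D : LS X)

def bar (a : P) : P := X.rv (X.at' a (D.om a))
noncomputable def pi (a : P) : ℤ := X.pi {a | D.AS a} a

variable {D}
theorem bar_at (a : P) (n : ℤ) : X.at' (D.bar a) n = X.rv (X.at' a (D.om a - n)) := by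
  rw [bar, X.rv_at, X.rv_at, X.at_at]; congr 1; ring
theorem rv_bar_at (a : P) (n : ℤ) : X.rv (X.at' (D.bar a) n) = X.at' a (D.om a - n) := by
  rw [bar_at, X.rv_rv]
theorem bar_mem {a : P} (h : D.AS a) : D.AS (D.bar a) := D.bar_AS h
theorem om_bar {a : P} (h : D.AS a) : D.om (D.bar a) = D.om a := D.bar_om h
theorem bar_bar {a : P} (h : D.AS a) : D.bar (D.bar a) = a := by
  have := D.om_bar h
  unfold bar at this ⊢
  rw [this]; exact X.bar_bar _ _
theorem bar_neq (a : P) : D.bar a ≠ a := X.bar_ne _ _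
theorem len_bar (a : P) : X.len (D.bar a) = X.len a := by
  rw [bar, X.len_rv, X.len_at]
theorem lv_at (a : P) (i : ℤ) : D.lv (X.at' a i) = D.lv a := by
  refine X.at_ind (fun d => D.lv d = D.lv a) ?_ ?_ a rfl i
  · intro d hd; rw [D.lv_nx, hd]
  · intro d hd; rw [← hd, ← D.lv_nx (X.nx.symm d)]; simp
theorem lv_bar (a : P) : D.lv (D.bar a) = D.lv a := by rw [bar, D.lv_rv, lv_at]
theorem pi_nonneg (a : P) : 0 ≤ D.pi a := X.pi_nonneg _ _
theorem pi_spec (hC : X.C6) {a b : P} (hb : D.AS b) {m : ℤ} (hm : D.pi a < m) (h : X.Sh a b m) : b = a :=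
  X.pi_spec hC (A := {a | D.AS a}) hb hm h
theorem pi_pc (a : P) : X.Pc a (D.pi a) := X.pi_pc _ _
theorem le_pi (hC : X.C6) {a b : P} (hb : D.AS b) (hne : b ≠ a) {m : ℤ} (h : X.Sh a b m) : m ≤ D.pi a := by
  by_contra hh
  exact hne (D.pi_spec hC hb (by omega) h)

theorem K' {a b : P} {i j : ℤ} (ha : D.AS a) (hb : D.AS b) (hi : 0 ≤ i) (hi' : i < D.om a) (hj : 0 ≤ j)
    (hj' : j < D.om b) (h : X.SD (X.at' a i) (X.at' b j)) :
    (i = j ∧ X.Sh a b (i+1)) ∨ (D.om a - i = D.om b - j ∧ X.Sh (D.bar a) (D.bar b) (D.om a - i)) :=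
  (D.K ha hb hi hi' hj hj' h.1 h.2).2

theorem bar_inj {a b : P} (ha : D.AS a) (hb : D.AS b) (h : D.bar a = D.bar b) : a = b := by
  rw [← D.bar_bar ha, h, D.bar_bar hb]

theorem Kmid (hC : X.C6) {a b : P} {i j : ℤ} (ha : D.AS a) (hb : D.AS b) (hi : D.pi a ≤ i)
    (hi' : i + D.pi (D.bar a) < D.om a) (hj : 0 ≤ j)
    (hj' : j < D.om b) (h : X.SD (X.at' a i) (X.at' b j)) : b = a ∧ j = i := by
  have h0 := D.pi_nonneg a
  have h0' := D.pi_nonneg (D.bar a)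
  rcases D.K' ha hb (by omega) (by omega) hj hj' h with ⟨h1, h2⟩ | ⟨h1, h2⟩
  · exact ⟨D.pi_spec hC hb (by omega) h2, h1.symm⟩
  · have := D.pi_spec hC (D.bar_mem hb) (by omega) h2
    have := D.bar_inj hb ha this
    subst this
    exact ⟨rfl, by omega⟩

theorem mid5 (hC : X.C6) {a : P} {i m : ℤ} (ha : D.AS a) (hi : 0 ≤ i) (hi' : i ≤ D.pi a) (hm : 0 ≤ m)
    (h : X.Pc (X.at' a i) m) : i + m + D.pi (D.bar a) < D.om a := by
  by_contra hcon
  push Not at hcon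
  have h1 : X.Cov 1 a i := (D.pi_pc a |>.mono hi').cov
  have h2 : X.Cov 2 a (i + m) := h1.append h.cov
  have h3 : X.Pc (X.at' a (D.om a - D.pi (D.bar a))) (D.pi (D.bar a)) := by
    have := (D.pi_pc (D.bar a)).rev (D.pi_nonneg _)
    rwa [rv_bar_at] at this
  have h4 : X.Cov 3 a (D.om a) := by
    rcases le_or_gt (D.om a) (i + m) with hle | hgt
    · exact (h2.mono hle).succ
    · have h5 := h3.shift (i := i + m - (D.om a - D.pi (D.bar a))) (n := D.om a - (i + m))
        (by omega) (by omega) (by omega)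
      rw [X.at_at] at h5
      have h6 := h2.append (n := D.om a - (i + m)) (by
        convert h5.cov using 2; omega)
      convert h6 using 1; omega
  have h7 := h4.append (D.cov ha)
  apply hC a
  convert h7 using 1; omega

theorem mid (hC : X.C6) {a : P} (ha : D.AS a) : D.pi a + D.pi (D.bar a) < D.om a := by
  have := D.mid5 hC ha (D.pi_nonneg a) le_rfl le_rfl (Pc.zero _ le_rfl)
  omega

variable (D) in
def PR (E a : P) : Prop := ∃ t, 1 ≤ t ∧ t ≤ X.len E - D.om E ∧ X.SD (X.at' E (-t)) (X.at' a (D.pi a))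

variable (D) in
/-- two-arc attachment -/
structure Q0 (E a b : P) (k ja jb : ℤ) : Prop where
  aE : D.AS E
  aa : D.AS a
  ab : D.AS b
  lvab : D.lv a = D.lv b
  lvE : D.lv E = D.lv a + 1
  sh : X.Sh a b k
  ns : X.lab (X.at' a k) ≠ X.lab (X.at' b k)
  k1 : 1 ≤ k
  ka : k < ja
  ja' : ja < D.om a
  kb : k < jb
  jb' : jb < D.om b
  le : X.len E - D.om E = (ja - k) + (jb - k)
  sa : X.Sh (X.at' E (-(ja - k))) (X.at' a k) (ja - k)
  sb : X.Sh (X.at' (D.bar E) (-(jb - k))) (X.at' b k) (jb - k)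
  va : X.vtx E = X.vtx (X.at' a ja)
  vb : X.vtx (D.bar E) = X.vtx (X.at' b jb)

theorem T' {E : P} (hE : D.AS E) : X.len E - D.om E = 0 ∨
    (∃ a k, D.AS a ∧ 1 ≤ k ∧ k + (X.len E - D.om E) < D.om a ∧ D.lv E = D.lv a + 1 ∧
      X.Sh (X.at' E (D.om E)) (X.at' a k) (X.len E - D.om E)) ∨
    (∃ a b k ja jb, D.Q0 E a b k ja jb) := by
  rcases D.T hE with h | h | ⟨a, b, k, ja, jb, h1, h2, h3, h4, h5, h6, h7, h8, h9, h10, h11, h12, h13, h14, h15, h16⟩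
  · exact Or.inl h
  · exact Or.inr (Or.inl h)
  · exact Or.inr (Or.inr ⟨a, b, k, ja, jb, hE, h1, h2, h3, h4, h5, h6, h7, h8, h9, h10, h11, h12, h13, h14, h15, h16⟩)

namespace Q0
variable {E a b : P} {k ja jb : ℤ}
theorem symm (h : D.Q0 E a b k ja jb) : D.Q0 (D.bar E) b a k jb ja where
  aE := D.bar_mem h.aE
  aa := h.ab
  ab := h.aa
  lvab := h.lvab.symm
  lvE := by rw [lv_bar, h.lvE, h.lvab]
  sh := h.sh.symm
  ns := h.ns.symm
  k1 := h.k1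
  ka := h.kb
  ja' := h.jb'
  kb := h.ka
  jb' := h.ja'
  le := by rw [len_bar, om_bar h.aE, h.le]; ring
  sa := h.sb
  sb := by rw [bar_bar h.aE]; exact h.sa
  va := h.vb
  vb := by rw [bar_bar h.aE]; exact h.va

theorem ne (h : D.Q0 E a b k ja jb) : a ≠ b := fun e => h.ns (by rw [e])
theorem Ene (h : D.Q0 E a b k ja jb) (i j : ℤ) : X.at' E i ≠ X.at' a j := fun e => by
  have := congrArg D.lv e
  rw [lv_at, lv_at, h.lvE] at this; omega
theorem kpa (hC : X.C6) (h : D.Q0 E a b k ja jb) : k ≤ D.pi a := D.le_pi hC h.ab h.ne.symm h.sh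
theorem mida (hC : X.C6) (h : D.Q0 E a b k ja jb) : ja + D.pi (D.bar a) < D.om a := by
  have := D.mid5 hC h.aa (i := k) (m := ja - k) (by linarith [h.k1]) (h.kpa hC) (by linarith [h.ka])
    ⟨_, h.Ene _ _, h.sa.symm⟩
  linarith
theorem sd1 (h : D.Q0 E a b k ja jb) {t : ℤ} (h1 : 1 ≤ t) (h2 : t ≤ ja - k) :
    X.SD (X.at' E (-t)) (X.at' a (ja - t)) :=
  h.sa.sd' (by omega) (by omega) (by omega)
theorem sd2 (h : D.Q0 E a b k ja jb) {t : ℤ} (h1 : ja - k < t) (h2 : t ≤ X.len E - D.om E) :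
    X.SD (X.at' E (-t)) (X.at' (D.bar b) (D.om b - (k + t - (ja - k)))) := by
  have hle := h.le
  have h3 := (h.symm.sd1 (t := X.len E - D.om E - t + 1) (by omega) (by omega)).rev_at
  rw [rv_bar_at] at h3
  rw [bar_at]
  have : X.at' E (-t) = X.at' E (X.len E - t) := by
    rw [show X.len E - t = -t + X.len E by ring, X.at_add_len]
  rw [this]
  convert h3 using 2
  · omega
  · congr 1
    omega
/-- parents of a two-arc child -/
theorem pr (hC : X.C6) (h : D.Q0 E a b k ja jb) {z : P} (hz : D.AS z) (hp : D.PR E z) :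
    z = a ∧ D.pi a < ja := by
  obtain ⟨t, h1, h2, h3⟩ := hp
  have hm := D.mid hC hz
  have := h.k1
  have := h.ja'
  have := h.jb'
  have := h.kb
  rcases le_or_gt t (ja - k) with ht | ht
  · have := h3.symm.trans (h.sd1 h1 ht)
    obtain ⟨rfl, h5⟩ := D.Kmid hC hz h.aa le_rfl hm (by omega) (by omega) this
    exact ⟨rfl, by omega⟩
  · exfalso
    have h6 := h3.symm.trans (h.sd2 ht h2)
    have hle := h.le
    have h7 := h.symm.mida hC
    obtain ⟨e, h5⟩ := D.Kmid hC hz (D.bar_mem h.ab) le_rfl hm (by omega) (by rw [om_bar h.ab]; omega) h6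
    rw [e] at h7
    omega
end Q0

/-- if both `E` and `bar E` have parents then `E` is of two-arc type -/
theorem q0_of_pr (hC : X.C6) {E z z' : P} (hE : D.AS E) (hz : D.AS z) (hz' : D.AS z') (h : D.PR E z)
    (h' : D.PR (D.bar E) z') : ∃ k j j', D.Q0 E z z' k j j' ∧ D.pi z < j ∧ D.pi z' < j' := by
  rcases D.T' hE with h0 | ⟨a, k, ha, hk, hkm, hlv, hs⟩ | ⟨a, b, k, ja, jb, hq⟩
  · obtain ⟨t, h1, h2, _⟩ := h; omega
  · exfalso
    obtain ⟨t, h1, h2, h3⟩ := h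
    obtain ⟨t', h1', h2', h3'⟩ := h'
    have e1 : X.at' E (-t) = X.at' E (X.len E - t) := by
      rw [show X.len E - t = -t + X.len E by ring, X.at_add_len]
    have h4 : X.SD (X.at' z (D.pi z)) (X.at' a (k + (X.len E - D.om E) - t)) := by
      refine h3.symm.trans ?_
      rw [e1]
      exact hs.sd' (by omega) (by omega) (by omega)
    obtain ⟨rfl, h5⟩ := D.Kmid hC hz ha le_rfl (D.mid hC hz) (by omega) (by omega) h4
    rw [len_bar, om_bar hE] at h2'
    have h6 : X.SD (X.at' (D.bar E) (-t')) (X.at' (D.bar a) (D.om a - k - t')) := by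
      have := (hs.sd' (u := D.om E + t' - 1) (v := k + t' - 1) (by omega) (by omega) (by omega)).rev_at
      rw [bar_at, bar_at]
      convert this using 3 <;> omega
    obtain ⟨e, h7⟩ := D.Kmid hC hz' (D.bar_mem ha) le_rfl (D.mid hC hz') (by omega)
      (by rw [om_bar ha]; omega) (h3'.symm.trans h6)
    have h8 := D.mid5 hC ha (i := k) (m := X.len E - D.om E) (by omega) (by omega) (by omega)
      ⟨X.at' E (D.om E), fun e => by
        have := congrArg D.lv e
        rw [lv_at, lv_at, hlv] at this; omega, hs.symm⟩
    rw [e] at h8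
    omega
  · obtain ⟨rfl, h1⟩ := hq.pr hC hz h
    obtain ⟨rfl, h2⟩ := hq.symm.pr hC hz' h'
    exact ⟨k, ja, jb, hq, h1, h2⟩

theorem pr_uniq (hC : X.C6) {E z z' : P} (hE : D.AS E) (hz : D.AS z) (hz' : D.AS z') (h : D.PR E z)
    (h' : D.PR E z') : z = z' := by
  rcases D.T' hE with h0 | ⟨a, k, ha, hk, hkm, hlv, hs⟩ | ⟨a, b, k, ja, jb, hq⟩
  · obtain ⟨t, h1, h2, _⟩ := h; omega
  · have key : ∀ z, D.AS z → D.PR E z → z = a := by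
      rintro z hz ⟨t, h1, h2, h3⟩
      have e1 : X.at' E (-t) = X.at' E (X.len E - t) := by
        rw [show X.len E - t = -t + X.len E by ring, X.at_add_len]
      have h4 : X.SD (X.at' z (D.pi z)) (X.at' a (k + (X.len E - D.om E) - t)) := by
        refine h3.symm.trans ?_
        rw [e1]
        exact hs.sd' (by omega) (by omega) (by omega)
      exact (D.Kmid hC hz ha le_rfl (D.mid hC hz) (by omega) (by omega) h4).1.symm
    rw [key z hz h, key z' hz' h']
  · rw [(hq.pr hC hz h).1, (hq.pr hC hz' h').1]

theorem dart_inj (hC : X.C6) {a b : P} (ha : D.AS a) (hb : D.AS b)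
    (h : X.SD (X.at' a (D.pi a)) (X.at' b (D.pi b))) : b = a :=
  (D.Kmid hC ha hb le_rfl (D.mid hC ha) (D.pi_nonneg b) (by
    have := D.mid hC hb; have := D.pi_nonneg (D.bar b); omega) h).1

/-- invariant sets of pointed cells -/
structure _root_.CX.Inv (X : CX P V L) (F : P → Prop) : Prop where
  nx : ∀ c, F c → F (X.nx c)
  rv : ∀ c, F c → F (X.rv c)

theorem _root_.CX.Inv.at {F : P → Prop} (hF : X.Inv F) {c : P} (hc : F c) (i : ℤ) : F (X.at' c i) := by
  refine X.at_ind F hF.nx ?_ c hc i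
  intro c hc
  have := hF.rv _ (hF.nx _ (hF.rv _ hc))
  rwa [X.nx_rv, X.rv_rv] at this
theorem _root_.CX.Inv.at_iff {F : P → Prop} (hF : X.Inv F) {c : P} {i : ℤ} : F (X.at' c i) ↔ F c := by
  refine ⟨fun h => ?_, fun h => hF.at h i⟩
  have := hF.at h (-i)
  rw [X.at_at] at this
  simpa using this
theorem _root_.CX.Inv.rv_iff {F : P → Prop} (hF : X.Inv F) {c : P} : F (X.rv c) ↔ F c :=
  ⟨fun h => by have := hF.rv _ h; rwa [X.rv_rv] at this, hF.rv c⟩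
theorem inv_bar {F : P → Prop} (hF : X.Inv F) {c : P} (hc : F c) : F (D.bar c) := hF.rv _ (hF.at hc _)

/-- even dart -/
def _root_.CX.Ev (X : CX P V L) (F : P → Prop) (c : P) : Prop := Even {c' | F c' ∧ X.SD c' c}.ncard

theorem loc (c : P) : ∃ e s, D.AS e ∧ c = X.at' e s ∧ ((0 ≤ s ∧ s < D.om e) ∨
    ∃ t, s = -t ∧ 1 ≤ t ∧ t ≤ X.len e - D.om e) := by
  obtain ⟨e, s, he, rfl⟩ := D.ex c
  have hl := X.len_pos e
  have h1 := Int.emod_nonneg s hl.ne'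
  have h2 := Int.emod_lt_of_pos s hl
  rcases lt_or_ge (s % X.len e) (D.om e) with h | h
  · exact ⟨e, s % X.len e, he, (X.at_emod e s).symm, Or.inl ⟨h1, h⟩⟩
  · refine ⟨e, s % X.len e - X.len e, he, ?_, Or.inr ⟨X.len e - s % X.len e, by omega, by omega, by omega⟩⟩
    rw [X.at_sub_len, X.at_emod]

/-- existence of children at even darts -/
theorem child_ex (hC : X.C6) {F : P → Prop} (hF : X.Inv F) {a : P} (ha : D.AS a) (hFa : F a)
    (he : X.Ev F (X.at' a (D.pi a))) : ∃ E, F E ∧ D.AS E ∧ D.PR E a := by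
  by_contra hcon
  push Not at hcon
  have : {c' | F c' ∧ X.SD c' (X.at' a (D.pi a))} = {X.at' a (D.pi a)} := by
    ext c
    simp only [Set.mem_ofPred_eq, Set.mem_singleton_iff]
    constructor
    · rintro ⟨hc, hs⟩
      obtain ⟨e, s, hea, rfl, h | ⟨t, rfl, h1, h2⟩⟩ := D.loc c
      · obtain ⟨rfl, rfl⟩ := D.Kmid hC ha hea le_rfl (D.mid hC ha) h.1 h.2 hs.symm
        rfl
      · exact (hcon e (hF.at_iff.1 hc) hea ⟨t, h1, h2, hs⟩).elim
    · rintro rfl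
      exact ⟨hF.at hFa _, SD.refl _⟩
  unfold CX.Ev at he
  rw [this, Set.ncard_singleton] at he
  exact absurd he (by decide)

end LS

namespace LS
open CX
variable {P V L : Type*} {X : CX P V L} (D : LS X) (F : P → Prop)

def Good (a : P) : Prop :=
  (∃ d, F d ∧ D.AS d ∧ D.PR a d ∧ ∀ E, F E → D.AS E → D.PR E d → E = a) ∧
  (∃ E, F E ∧ D.AS E ∧ D.PR E a ∧ ∀ E', F E' → D.AS E' → D.PR E' a → E' = E)

def Reg : ℕ → P → Prop
  | 0, c => (D.AS c → D.Good F c) ∧ X.Ev F c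
  | r+1, c => ∀ c' i, F c' → X.vtx c' = X.vtx (X.at' c i) → Reg r c'

variable {D F}
theorem Reg.touch {r : ℕ} {c c' : P} {i : ℤ} (h : D.Reg F (r+1) c) (hc : F c')
    (hv : X.vtx c' = X.vtx (X.at' c i)) : D.Reg F r c' := h c' i hc hv
theorem Reg.down {r : ℕ} {c : P} (h : D.Reg F (r+1) c) (hc : F c) : D.Reg F r c :=
  h c 0 hc (by simp)
theorem Reg.move {r : ℕ} {c : P} (i : ℤ) (h : D.Reg F (r+1) c) : D.Reg F (r+1) (X.at' c i) := by
  intro c' j hc hv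
  rw [X.at_at] at hv
  exact h c' _ hc hv
theorem Reg.rv {r : ℕ} {c : P} (h : D.Reg F (r+1) c) : D.Reg F (r+1) (X.rv c) := by
  intro c' j hc hv
  refine h c' (-j) hc ?_
  rw [hv, ← X.vtx_rv, X.rv_at, X.rv_rv]
theorem Reg.bar {r : ℕ} {c : P} (h : D.Reg F (r+1) c) : D.Reg F (r+1) (D.bar c) := (h.move _).rv
theorem Reg.back (hF : X.Inv F) {r : ℕ} {c c' : P} {i j : ℤ} (h : D.Reg F (r+2) c) (hc : F c')
    (hv : X.vtx (X.at' c' j) = X.vtx (X.at' c i)) : D.Reg F (r+1) c' := by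
  have := (Reg.touch h (hF.at hc j) hv).move (-j)
  rw [X.at_at] at this
  simpa using this

variable (D F) in
structure Q (d b : P) (k : ℤ) (E : P) (j j' : ℤ) : Prop extends D.Q0 E d b k j j' where
  Fd : F d
  Fb : F b
  FE : F E
  pd : D.PR E d
  pb : D.PR (D.bar E) b
  ud : ∀ E', F E' → D.AS E' → D.PR E' d → E' = E
  ub : ∀ E', F E' → D.AS E' → D.PR E' b → E' = D.bar E
  pj : D.pi d < j
  pj' : D.pi b < j'

theorem Q.symm' (hF : X.Inv F) {d b E : P} {k j j' : ℤ} (h : D.Q F d b k E j j') :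
    D.Q F b d k (D.bar E) j' j where
  toQ0 := h.toQ0.symm
  Fd := h.Fb
  Fb := h.Fd
  FE := inv_bar hF h.FE
  pd := h.pb
  pb := by rw [bar_bar h.aE]; exact h.pd
  ud := h.ub
  ub := by rw [bar_bar h.aE]; exact h.ud
  pj := h.pj'
  pj' := h.pj

theorem Q_ex (hC : X.C6) (hF : X.Inv F) {d : P} (hr : D.Reg F 2 d) (hd : F d) (ha : D.AS d) :
    ∃ b k E j j', D.Q F d b k E j j' := by
  obtain ⟨-, E, hE, hEa, hp, hu⟩ := ((hr.down hd).down hd).1 ha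
  obtain ⟨t, -, -, h3⟩ := id hp
  have r1 : D.Reg F 1 (D.bar E) := (Reg.back hF hr hE h3.1).bar
  obtain ⟨⟨z, hz, hza, hp', -⟩, -⟩ := (r1.down (inv_bar hF hE)).1 (D.bar_mem hEa)
  obtain ⟨k, j, j', hq, h4, h5⟩ := D.q0_of_pr hC hEa ha hza hp hp'
  have r2 : D.Reg F 1 z := hr.touch (i := 0) hz (by simpa using hq.sh.1.symm)
  obtain ⟨-, E', hE', hEa', hp'', hu'⟩ := (r2.down hz).1 hza
  refine ⟨z, k, E, j, j', hq, hd, hz, hE, hp, hp', hu, ?_, h4, h5⟩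
  intro E'' h1 h2 h3
  rw [hu' _ h1 h2 h3, hu' _ (inv_bar hF hE) (D.bar_mem hEa) hp']

theorem Q_child (hC : X.C6) (hF : X.Inv F) {d : P} (hr : D.Reg F 3 d) (hd : F d) (ha : D.AS d) :
    ∃ p q k j j', D.Q F p q k d j j' := by
  obtain ⟨⟨p, hp, hpa, hpr, -⟩, -⟩ := (((hr.down hd).down hd).down hd).1 ha
  obtain ⟨t, -, -, h3⟩ := id hpr
  have r1 : D.Reg F 2 p := Reg.back hF hr hp h3.1.symm
  obtain ⟨q, k, E, j, j', h⟩ := Q_ex hC hF r1 hp hpa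
  have := h.ud d hd ha hpr
  subst this
  exact ⟨p, q, k, j, j', h⟩

theorem Lam (hC : X.C6) (hF : X.Inv F) {d : P} (hr : D.Reg F 4 d) {p q : P} {k j j' : ℤ}
    (h : D.Q F p q k d j j') {e : P} (he : F e) (hea : D.AS e) (hv : X.vtx e = X.vtx d) (hne : e ≠ d) :
    ∃ q' k' j1 j1', D.Q F (D.bar p) q' k' e j1 j1' := by
  have re : D.Reg F 3 e := hr.touch (i := 0) he (by simpa using hv)
  obtain ⟨p', q', k', i, i', h'⟩ := Q_child hC hF re he hea
  have hv' : X.vtx (X.at' p j) = X.vtx (X.at' p' i) := by rw [← h.va, ← h'.va, hv]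
  have := h.k1
  have := h.ka
  have := h.ja'
  have := h'.k1
  have := h'.ka
  have := h'.ja'
  have := h.pj
  have hm := h.mida hC
  have same : p' = p → False := fun e => by
    subst e
    exact hne (h.ud _ he hea h'.pd)
  have opp : D.bar p' = p → p' = D.bar p := fun e => by rw [← e, bar_bar h'.aa]
  have key : p' = p ∨ p' = D.bar p := by
    rcases (D.KV h.aa h'.aa (by omega) h.ja' (by omega) h'.ja' hv').2 with
      ⟨_, h2⟩ | ⟨_, h2⟩ | ⟨_, h2⟩ | ⟨_, h2⟩
    · exact Or.inl (D.pi_spec hC h'.aa (by omega) h2)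
    · exact Or.inl (D.bar_inj h'.aa h.aa (D.pi_spec hC (D.bar_mem h'.aa) (by omega) h2))
    · exact Or.inr (opp (D.pi_spec hC (D.bar_mem h'.aa) (by omega) h2))
    · exact Or.inr (D.pi_spec hC h'.aa (by omega) h2)
  rcases key with e | e
  · exact (same e).elim
  · rw [e] at h'
    exact ⟨_, _, _, _, h'⟩

theorem two (hC : X.C6) (hF : X.Inv F) {d : P} (hr : D.Reg F 4 d) (hd : F d) (ha : D.AS d) {b e : P}
    (hb : F b) (hba : D.AS b) (hbv : X.vtx b = X.vtx d) (hbn : b ≠ d)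
    (he : F e) (hea : D.AS e) (hev : X.vtx e = X.vtx d) (hen : e ≠ d) : e = b := by
  obtain ⟨p, q, k, j, j', h⟩ := Q_child hC hF (hr.down hd) hd ha
  obtain ⟨_, _, _, _, h1⟩ := Lam hC hF hr h hb hba hbv hbn
  obtain ⟨_, _, _, _, h2⟩ := Lam hC hF hr h he hea hev hen
  exact h1.ud e he hea h2.pd

theorem Q_uniq (hC : X.C6) (hF : X.Inv F) {d : P} (hr : D.Reg F 4 d) {b b2 E E2 : P} {k k2 j j' i i' : ℤ}
    (h : D.Q F d b k E j j') (h2 : D.Q F d b2 k2 E2 i i') : b2 = b ∧ k2 = k ∧ E2 = E ∧ i = j := by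
  have hb := two hC hF hr h.Fd h.aa h.Fb h.ab h.sh.1.symm h.ne.symm h2.Fb h2.ab h2.sh.1.symm h2.ne.symm
  subst hb
  have hE := h.ud _ h2.FE h2.aE h2.pd
  subst hE
  have := h.k1
  have := h2.k1
  refine ⟨rfl, ?_, rfl, ?_⟩
  · rcases lt_trichotomy k k2 with hk | hk | hk
    · exact (h.ns (h2.sh.2 k (by omega) hk)).elim
    · exact hk.symm
    · exact (h2.ns (h.sh.2 k2 (by omega) hk)).elim
  · have hv' : X.vtx (X.at' d j) = X.vtx (X.at' d i) := by rw [← h.va, ← h2.va]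
    have := h.ka
    have := h.ja'
    have := h2.ka
    have := h2.ja'
    have := h.pj
    have hm := h.mida hC
    rcases (D.KV h.aa h.aa (by omega) h.ja' (by omega) h2.ja' hv').2 with
      ⟨h3, h4⟩ | ⟨h3, h4⟩ | ⟨_, h4⟩ | ⟨_, h4⟩
    · exact h3.symm
    · omega
    · exact (D.bar_neq d (D.pi_spec hC (D.bar_mem h.aa) (by omega) h4)).elim
    · exact (D.bar_neq d (D.pi_spec (a := D.bar d) hC h.aa (by omega) h4).symm).elim

theorem half (hC : X.C6) (hF : X.Inv F) {d : P} (hr : D.Reg F 5 d) {b E1 : P} {k j1 j1' : ℤ}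
    (h : D.Q F d b k E1 j1 j1') {p q e : P} {kp jp jq : ℤ} (h' : D.Q F p q kp e jp jq) {i t : ℤ}
    (hi : 0 ≤ i) (hi' : i < D.om d) (ht : 1 ≤ t) (ht' : t ≤ jp - kp)
    (hs : X.SD (X.at' e (-t)) (X.at' d i)) : e = E1 ∧ i = j1 - t ∧ k ≤ i := by
  have r4 := hr.down h.Fd
  have hs' := hs.symm.trans (h'.sd1 ht ht')
  have := h.k1
  have := h'.k1
  have := h'.ka
  have := h'.ja'
  have := h'.mida hC
  have same : p = d → i = jp - t → e = E1 ∧ i = j1 - t ∧ k ≤ i := by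
    intro e1 e2
    rw [e1] at h'
    obtain ⟨-, rfl, rfl, rfl⟩ := Q_uniq hC hF r4 h h'
    exact ⟨rfl, e2, by omega⟩
  rcases D.K' h.aa h'.aa hi hi' (by omega) (by omega) hs' with ⟨h1, h2⟩ | ⟨h1, h2⟩
  · by_cases hpd : p = d
    · exact same hpd h1
    · exfalso
      have hpb := two hC hF r4 h.Fd h.aa h.Fb h.ab h.sh.1.symm h.ne.symm h'.Fd h'.aa h2.1.symm hpd
      rw [hpb] at h' h2
      have rb : D.Reg F 4 b := hr.touch (i := 0) h.Fb (by simpa using h.sh.1.symm)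
      obtain ⟨-, rfl, -, -⟩ := Q_uniq hC hF rb (h.symm' hF) h'
      exact h.ns (h2.2 _ (by omega) (by omega))
  · have e1 := D.bar_inj h.aa h'.aa (D.pi_spec hC (D.bar_mem h.aa) (by omega) h2.symm)
    subst e1
    exact same rfl (by omega)

/-- classification of the cells of `F` along a new arc -/
theorem cls (hC : X.C6) (hF : X.Inv F) {d : P} (hr : D.Reg F 6 d) {b E1 b2 E2 : P} {k j1 j1' k2 j2 j2' : ℤ}
    (h : D.Q F d b k E1 j1 j1') (hb : D.Q F (D.bar d) b2 k2 E2 j2 j2') {i : ℤ} {c : P}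
    (hi : 0 ≤ i) (hi' : i < D.om d) (hc : F c) (hs : X.SD c (X.at' d i)) :
    c = X.at' d i ∨ (i < k ∧ c = X.at' b i) ∨ (k ≤ i ∧ i < j1 ∧ c = X.at' E1 (i - j1)) ∨
    (D.om d - j2 ≤ i ∧ i < D.om d - k2 ∧ c = X.rv (X.at' E2 (D.om d - j2 - i))) ∨
    (D.om d - k2 ≤ i ∧ c = X.rv (X.at' b2 (D.om d - i))) := by
  have r5 := hr.down h.Fd
  have r4 := r5.down h.Fd
  have rb5 : D.Reg F 5 (D.bar d) := r5.bar
  have rb4 := rb5.down hb.Fd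
  have := h.k1
  have := hb.k1
  obtain ⟨e, s, hea, rfl, hss | ⟨t, rfl, ht1, ht2⟩⟩ := D.loc c
  · have hFe := hF.at_iff.1 hc
    rcases D.K' h.aa hea hi hi' hss.1 hss.2 hs.symm with ⟨rfl, h2⟩ | ⟨h1, h2⟩
    · by_cases hed : e = d
      · subst hed; exact Or.inl rfl
      · have := two hC hF r4 h.Fd h.aa h.Fb h.ab h.sh.1.symm h.ne.symm hFe hea h2.1.symm hed
        subst this
        right; left
        refine ⟨?_, rfl⟩
        by_contra hk
        exact h.ns (h2.2 _ (by omega) (by omega))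
    · by_cases hed : D.bar e = D.bar d
      · have := D.bar_inj hea h.aa hed
        subst this
        left; congr 1; omega
      · have := two hC hF rb4 hb.Fd hb.aa hb.Fb hb.ab hb.sh.1.symm hb.ne.symm (inv_bar hF hFe)
          (D.bar_mem hea) h2.1.symm hed
        rw [this] at h2
        right; right; right; right
        refine ⟨?_, ?_⟩
        · by_contra hk
          exact hb.ns (h2.2 _ (by omega) (by omega))
        · rw [← this, rv_bar_at]; congr 1; omega
  · have hFe := hF.at_iff.1 hc
    have re : D.Reg F 5 e := Reg.back hF hr hFe hs.1
    obtain ⟨p, q, kp, jp, jq, h'⟩ := Q_child hC hF ((re.down hFe).down hFe) hFe hea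
    rcases le_or_gt t (jp - kp) with ht | ht
    · obtain ⟨rfl, h5, h6⟩ := half hC hF r5 h h' hi hi' ht1 ht hs
      right; right; left
      exact ⟨h6, by omega, by congr 1; omega⟩
    · have hle := h'.le
      have hs2 := hs.rev_at
      have e1 : X.rv (X.at' e (-t+1)) = X.at' (D.bar e) (-(X.len e - D.om e - t + 1)) := by
        rw [bar_at, ← X.at_add_len e (-t+1)]; congr 2; ring
      have e2 : X.rv (X.at' d (i + 1)) = X.at' (D.bar d) (D.om d - i - 1) := by
        rw [bar_at]; congr 2; ring
      rw [e1, e2] at hs2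
      obtain ⟨h4, h5, h6⟩ := half hC hF rb5 hb (h'.symm' hF) (by omega) (by rw [om_bar h.aa]; omega)
        (by omega) (by omega) hs2
      right; right; right; left
      refine ⟨by omega, by omega, ?_⟩
      rw [← h4, rv_bar_at, ← X.at_add_len]; congr 1; omega

theorem jsum (hC : X.C6) (hF : X.Inv F) {d : P} (hr : D.Reg F 6 d) {b E1 b2 E2 : P} {k j1 j1' k2 j2 j2' : ℤ}
    (h : D.Q F d b k E1 j1 j1') (hb : D.Q F (D.bar d) b2 k2 E2 j2 j2') : j1 + j2 = D.om d := by
  have := h.k1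
  have := h.ka
  have := h.ja'
  have := hb.k1
  have := hb.ka
  have := hb.ja'
  rw [om_bar h.aa] at this
  have hm := h.mida hC
  have hm2 := hb.mida hC
  rw [bar_bar h.aa, om_bar h.aa] at hm2
  have hk := h.kpa hC
  have hk2 := hb.kpa hC
  have ev : ∀ i, X.Ev F (X.at' d i) := fun i => by
    have r1 : D.Reg F 1 d := by
      have := h.Fd
      exact ((((hr.down this).down this).down this).down this).down this
    exact (r1.touch (i := i) (hF.at h.Fd i) rfl).2
  rcases lt_trichotomy j1 (D.om d - j2) with hlt | heq | hgt
  · exfalso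
    have he := ev j1
    unfold CX.Ev at he
    have : {c | F c ∧ X.SD c (X.at' d j1)} = {X.at' d j1} := by
      ext c
      simp only [Set.mem_ofPred_eq, Set.mem_singleton_iff]
      constructor
      · rintro ⟨hc, hs⟩
        rcases cls hC hF hr h hb (by omega) (by omega) hc hs with
          h1 | ⟨h1, -⟩ | ⟨_, h1, -⟩ | ⟨h1, -⟩ | ⟨h1, -⟩
        · exact h1
        all_goals omega
      · rintro rfl; exact ⟨hF.at h.Fd _, SD.refl _⟩
    rw [this, Set.ncard_singleton] at he
    exact absurd he (by decide)
  · omega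
  · exfalso
    obtain ⟨i, hi⟩ : ∃ i, i = D.om d - j2 := ⟨_, rfl⟩
    have he := ev i
    unfold CX.Ev at he
    have hne1 : X.at' d i ≠ X.at' E1 (i - j1) := (h.Ene _ _).symm
    have hne2 : X.at' d i ≠ X.rv E2 := fun e => by
      have := congrArg D.lv e
      rw [lv_at, D.lv_rv, hb.lvE, lv_bar] at this; omega
    have sh2 : X.Sh (X.rv E2) (X.at' d i) (j2 - k2) := by
      have := hb.sa.rev (by omega)
      rw [X.at_at, X.at_at, rv_bar_at, show -(j2 - k2) + (j2 - k2) = 0 by ring, X.at_zero] at this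
      convert this using 2; omega
    have hne3 : X.at' E1 (i - j1) ≠ X.rv E2 := fun e => by
      have s1 : X.Sh (X.at' E1 (-(j1-k))) (X.at' d k) (i - k) := h.sa.mono (by omega)
      have s2 := s1.append (n := j2 - k2) (by omega) (by
        rw [X.at_at, X.at_at, show -(j1-k) + (i-k) = i - j1 by ring, e, show k + (i-k) = i by ring]
        exact sh2)
      have := D.mid5 hC h.aa (i := k) (m := i - k + (j2 - k2)) (by omega) hk (by omega)
        ⟨_, h.Ene _ _, s2.symm⟩
      omega
    have : {c | F c ∧ X.SD c (X.at' d i)} = {X.at' d i, X.at' E1 (i - j1), X.rv E2} := by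
      ext c
      simp only [Set.mem_ofPred_eq, Set.mem_singleton_iff, Set.mem_insert_iff]
      constructor
      · rintro ⟨hc, hs⟩
        rcases cls hC hF hr h hb (by omega) (by omega) hc hs with
          h1 | ⟨h1, -⟩ | ⟨_, _, h1⟩ | ⟨_, _, h1⟩ | ⟨h1, -⟩
        · exact Or.inl h1
        · omega
        · exact Or.inr (Or.inl h1)
        · rw [hi, sub_self, X.at_zero] at h1
          exact Or.inr (Or.inr h1)
        · omega
      · rintro (rfl | rfl | rfl)
        · exact ⟨hF.at h.Fd _, SD.refl _⟩
        · refine ⟨hF.at h.FE _, ?_⟩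
          have := h.sd1 (t := j1 - i) (by omega) (by omega)
          convert this using 2 <;> ring
        · have := sh2.sd (t := 0) le_rfl (by omega)
          simp only [X.at_zero] at this
          exact ⟨hF.rv _ hb.FE, this⟩
    rw [this, Set.ncard_insert_of_notMem, Set.ncard_pair hne3] at he
    · exact absurd he (by decide)
    · simp only [Set.mem_insert_iff, Set.mem_singleton_iff, not_or]
      exact ⟨hne1, hne2⟩

end LS

namespace CX
variable {P V L : Type*} (X : CX P V L) (F : P → Prop)

/-- another cell of `F` at the same dart -/
def O (c c' : P) : Prop := F c' ∧ c' ≠ c ∧ X.SD c' c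

def H3 (c : P) : Prop := ∀ c' c'', X.O F c c' → X.O F (X.nx c) c'' → c'' ≠ X.nx c' →
  X.O F (X.nx c') (X.rv c'')

structure Honey (c : P) : Prop where
  h1 : ∀ i, ∃ c', X.O F (X.at' c i) c' ∧ ∀ c'', X.O F (X.at' c i) c'' → c'' = c'
  h2 : ∃ B : Finset ℤ, B.card ≤ 6 ∧ ∀ i, (∀ j ∈ B, ¬ X.len c ∣ i - j) → ∀ c', X.O F (X.at' c i) c' →
    X.O F (X.at' c (i+1)) (X.nx c')
  h3 : ∀ i, X.H3 F (X.at' c i)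

variable {X F}
theorem O.symm {a b : P} (h : X.O F a b) (ha : F a) : X.O F b a := ⟨ha, h.2.1.symm, h.2.2.symm⟩
theorem O.rev (hF : X.Inv F) {a b : P} (h : X.O F a b) : X.O F (X.rv (X.nx a)) (X.rv (X.nx b)) :=
  ⟨hF.rv _ (hF.nx _ h.1), fun e => h.2.1 (X.nx.injective (X.rv_inj e)), h.2.2.rev⟩
theorem rv_nx_rv_nx (a : P) : X.rv (X.nx (X.rv (X.nx a))) = a := by
  rw [nx_rv, X.rv_rv]; simp
theorem O.rev_iff (hF : X.Inv F) {a b : P} : X.O F (X.rv (X.nx a)) (X.rv (X.nx b)) ↔ X.O F a b := by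
  refine ⟨fun h => ?_, fun h => h.rev hF⟩
  have := h.rev hF
  rwa [rv_nx_rv_nx, rv_nx_rv_nx] at this

theorem H3.mirror (hF : X.Inv F) {c : P} (h : X.H3 F c) : X.H3 F (X.rv (X.nx (X.nx c))) := by
  intro e' e'' h1 h2 hne
  have g1 := h1.rev hF
  rw [rv_nx_rv_nx] at g1
  have g2 := h2.rev hF
  rw [nx_rv, Equiv.symm_apply_apply, rv_nx_rv_nx] at g2
  have e1 : X.nx (X.rv (X.nx e'')) = X.rv e'' := by rw [nx_rv, Equiv.symm_apply_apply]
  have := h _ _ g2 g1 (by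
    rw [e1]
    exact fun e => hne (X.rv_inj e).symm)
  rw [e1, X.rv_rv] at this
  exact this.symm (hF.rv _ h2.1)

variable (X F) in
def Seg (d : P) (lo hi : ℤ) (f : P) : Prop :=
  ∀ i, lo ≤ i → i < hi → ∀ c', X.O F (X.at' d i) c' ↔ c' = X.at' f i
end CX

namespace LS
open CX
variable {P V L : Type*} {X : CX P V L} {D : LS X} {F : P → Prop}

theorem Reg.le {m n : ℕ} (h : m ≤ n) {c : P} (hr : D.Reg F n c) (hc : F c) : D.Reg F m c := by
  induction n, h using Nat.le_induction with
  | base => exact hr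
  | succ n _ ih => exact ih (hr.down hc)

theorem seg_mirror (hF : X.Inv F) {d f : P} {lo hi : ℤ} (h : X.Seg F (D.bar d) lo hi f) :
    X.Seg F d (D.om d - hi) (D.om d - lo) (X.rv (X.at' f (D.om d))) := by
  intro i h1 h2 c'
  have := h (D.om d - i - 1) (by omega) (by omega) (X.rv (X.nx c'))
  rw [← O.rev_iff hF, X.nx_at]
  have e1 : X.rv (X.at' d (i+1)) = X.at' (D.bar d) (D.om d - i - 1) := by
    rw [bar_at]; congr 2; ring
  rw [e1, this]
  have e2 : X.at' (X.rv (X.at' f (D.om d))) i = X.rv (X.nx (X.at' f (D.om d - i - 1))) := by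
    rw [X.nx_at, X.rv_at, X.rv_at, X.at_at]; congr 1; ring
  rw [e2]
  constructor
  · intro e; rw [← e, rv_nx_rv_nx]
  · rintro rfl; rw [rv_nx_rv_nx]

section
variable (hC : X.C6) (hF : X.Inv F) {d : P} {b E1 b2 E2 : P} {k j1 j1' k2 j2 j2' : ℤ}

theorem seg1 (hC : X.C6) (hF : X.Inv F) (hr : D.Reg F 6 d) (h : D.Q F d b k E1 j1 j1')
    (hb : D.Q F (D.bar d) b2 k2 E2 j2 j2') : X.Seg F d 0 k b := by
  have := h.k1
  have := h.ka
  have hm := h.mida hC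
  have hm2 := hb.mida hC
  rw [bar_bar h.aa, om_bar h.aa] at hm2
  have hk := h.kpa hC
  have hk2 := hb.kpa hC
  have := hb.ka
  have := h.ja'
  intro i hi hi' c'
  constructor
  · rintro ⟨h1, h2, h3⟩
    rcases cls hC hF hr h hb hi (by omega) h1 h3 with
      h1 | ⟨-, h1⟩ | ⟨_, _, h1⟩ | ⟨_, _, h1⟩ | ⟨h1, -⟩
    · exact (h2 h1).elim
    · exact h1
    all_goals omega
  · rintro rfl
    exact ⟨hF.at h.Fb _, fun e => h.ne.symm (X.at_inj e), (h.sh.sd hi hi').symm⟩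

theorem seg2 (hC : X.C6) (hF : X.Inv F) (hr : D.Reg F 6 d) (h : D.Q F d b k E1 j1 j1')
    (hb : D.Q F (D.bar d) b2 k2 E2 j2 j2') : X.Seg F d k j1 (X.at' E1 (-j1)) := by
  have := h.k1
  have := h.ka
  have hm := h.mida hC
  have hk2 := hb.kpa hC
  have hj := jsum hC hF hr h hb
  have := h.ja'
  intro i hi hi' c'
  rw [X.at_at]
  constructor
  · rintro ⟨h1, h2, h3⟩
    rcases cls hC hF hr h hb (by omega) (by omega) h1 h3 with
      h1 | ⟨_, h1⟩ | ⟨_, _, h1⟩ | ⟨_, _, h1⟩ | ⟨h1, -⟩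
    · exact (h2 h1).elim
    · omega
    · rw [h1]; congr 1; ring
    all_goals omega
  · rintro rfl
    refine ⟨hF.at h.FE _, h.Ene _ _, ?_⟩
    have := h.sd1 (t := j1 - i) (by omega) (by omega)
    convert this using 2 <;> ring

theorem seg3 (hC : X.C6) (hF : X.Inv F) (hr : D.Reg F 6 d) (h : D.Q F d b k E1 j1 j1')
    (hb : D.Q F (D.bar d) b2 k2 E2 j2 j2') : X.Seg F d j1 (D.om d - k2) (X.rv (X.at' E2 j1)) := by
  have hj := jsum hC hF hr h hb
  have := seg_mirror hF (seg2 hC hF hr.bar hb (by rw [bar_bar h.aa]; exact h))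
  rw [X.at_at] at this
  convert this using 1
  · omega
  · congr 2; omega

theorem seg4 (hC : X.C6) (hF : X.Inv F) (hr : D.Reg F 6 d) (h : D.Q F d b k E1 j1 j1')
    (hb : D.Q F (D.bar d) b2 k2 E2 j2 j2') :
    X.Seg F d (D.om d - k2) (D.om d) (X.rv (X.at' b2 (D.om d))) := by
  have := seg_mirror hF (seg1 hC hF hr.bar hb (by rw [bar_bar h.aa]; exact h))
  convert this using 1
  omega

theorem seg0 (hC : X.C6) (hF : X.Inv F) {p q : P} {k j j' : ℤ} (hr : D.Reg F 7 d)
    (h : D.Q F p q k d j j') : X.Seg F d (-(j - k)) 0 (X.at' p j) := by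
  have rp : D.Reg F 6 p := Reg.back (i := 0) (j := j) hF hr h.Fd (by simpa using h.va.symm)
  obtain ⟨b2, k2, E2, j2, j2', hb⟩ := Q_ex hC hF
    (rp.bar.le (by omega) (inv_bar hF h.Fd)) (inv_bar hF h.Fd) (D.bar_mem h.aa)
  have hs := seg2 hC hF rp h hb
  intro i hi hi' c'
  rw [X.at_at]
  have h1 := hs (j + i) (by omega) (by omega)
  rw [X.at_at, show -j + (j + i) = i by ring] at h1
  have h2 := (h1 _).2 rfl
  constructor
  · rintro ⟨g1, g2, g3⟩
    by_contra hne
    exact g2 ((h1 c').1 ⟨g1, hne, g3.trans h2.2.2⟩)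
  · rintro rfl
    exact h2.symm (hF.at h.Fd _)

theorem seg5 (hC : X.C6) (hF : X.Inv F) {p q : P} {k j j' : ℤ} (hr : D.Reg F 7 d)
    (h : D.Q F p q k d j j') :
    X.Seg F d (D.om d) (D.om d + (j' - k)) (X.rv (X.at' q (j' + D.om d))) := by
  have := seg_mirror hF (seg0 hC hF hr.bar (h.symm' hF))
  rw [X.at_at] at this
  convert this using 1 <;> omega

theorem bre0 (hC : X.C6) (hF : X.Inv F) (hr : D.Reg F 7 d) (h : D.Q F d b k E1 j1 j1')
    (hb : D.Q F (D.bar d) b2 k2 E2 j2 j2') {p q : P} {kp jp jq : ℤ} (hp : D.Q F p q kp d jp jq) :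
    X.H3 F (X.at' d (-1)) := by
  have s1 := seg1 hC hF (hr.down h.Fd) h hb
  have s0 := seg0 hC hF hr hp
  have rp : D.Reg F 6 p := Reg.back (i := 0) (j := jp) hF hr hp.Fd (by simpa using hp.va.symm)
  obtain ⟨q', k', i, i', hq'⟩ := Lam hC hF (hr.le (by omega) h.Fd) hp h.Fb h.ab h.sh.1.symm h.ne.symm
  have s3 := seg3 hC hF rp hp hq'
  have := h.k1
  have := hp.ka
  have := hp.mida hC
  have := hq'.kpa hC
  intro c' c'' g1 g2 _
  rw [s0 _ (by omega) (by omega), X.at_at] at g1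
  rw [X.nx_at, s1 _ (by omega) (by omega)] at g2
  simp only [neg_add_cancel, X.at_zero] at g2
  subst g1 g2
  rw [X.nx_at, s3 _ (by omega) (by omega), X.rv_at, X.at_at]
  simp

theorem brek (hC : X.C6) (hF : X.Inv F) (hr : D.Reg F 7 d) (h : D.Q F d b k E1 j1 j1')
    (hb : D.Q F (D.bar d) b2 k2 E2 j2 j2') : X.H3 F (X.at' d (k-1)) := by
  have s1 := seg1 hC hF (hr.down h.Fd) h hb
  have s2 := seg2 hC hF (hr.down h.Fd) h hb
  have rb : D.Reg F 6 b := hr.touch (i := 0) h.Fb (by simpa using h.sh.1.symm)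
  obtain ⟨_, _, _, _, _, hbb⟩ := Q_ex hC hF
    (rb.bar.le (by omega) (inv_bar hF h.Fb)) (inv_bar hF h.Fb) (D.bar_mem h.ab)
  have s3 := seg2 hC hF rb (h.symm' hF) hbb
  have := h.k1
  have := h.ka
  have := h.kb
  have hle := h.le
  intro c' c'' g1 g2 _
  rw [s1 _ (by omega) (by omega)] at g1
  rw [X.nx_at, s2 _ (by omega) (by omega), X.at_at] at g2
  subst g1 g2
  rw [X.nx_at, s3 _ (by omega) (by omega), X.at_at, bar_at]
  congr 1
  rw [← X.at_add_len]
  congr 1; omega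

theorem brej (hC : X.C6) (hF : X.Inv F) (hr : D.Reg F 8 d) (h : D.Q F d b k E1 j1 j1')
    (hb : D.Q F (D.bar d) b2 k2 E2 j2 j2') : X.H3 F (X.at' d (j1-1)) := by
  have r6 : D.Reg F 6 d := hr.le (by omega) h.Fd
  have s2 := seg2 hC hF r6 h hb
  have s3 := seg3 hC hF r6 h hb
  have hj := jsum hC hF r6 h hb
  have rE : D.Reg F 7 E1 := hr.touch (i := j1) h.FE h.va
  obtain ⟨e, _, _, _, _, hE⟩ := Q_ex hC hF (rE.le (by omega) h.FE) h.FE h.aE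
  obtain ⟨_, _, _, _, _, hEb⟩ := Q_ex hC hF
    (rE.bar.le (by omega) (inv_bar hF h.FE)) (inv_bar hF h.FE) (D.bar_mem h.aE)
  have s1 := seg1 hC hF (rE.down h.FE) hE hEb
  have hne : E2 ≠ E1 := fun e => D.bar_neq d (D.pr_uniq hC h.aE hb.aa h.aa (e ▸ hb.pd) h.pd)
  have hv : X.vtx E2 = X.vtx E1 := by
    rw [hb.va, h.va, bar_at, X.vtx_rv]; congr 2; omega
  have he := two hC hF (rE.le (by omega) h.FE) h.FE h.aE hE.Fb hE.ab hE.sh.1.symm hE.ne.symm hb.FE hb.aE hv hne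
  subst he
  have := h.k1
  have := hE.k1
  have := h.ka
  have := h.mida hC
  have := hb.kpa hC
  intro c' c'' g1 g2 _
  rw [s2 _ (by omega) (by omega), X.at_at] at g1
  rw [X.nx_at, s3 _ (by omega) (by omega), X.rv_at, X.at_at] at g2
  have e1 : X.nx c' = E1 := by rw [g1, X.nx_at, show -j1 + (j1 - 1) + 1 = 0 by ring, X.at_zero]
  have e2 : X.rv c'' = E2 := by
    rw [g2, show -j1 + (j1 - 1 + 1) = 0 by ring, X.at_zero, X.rv_rv]
  rw [e1, e2]
  have := (s1 0 le_rfl (by omega) E2).2 (by simp)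
  simpa using this

theorem brem (hC : X.C6) (hF : X.Inv F) (hr : D.Reg F 8 d) {p q : P} {kp jp jq : ℤ}
    (hp : D.Q F p q kp d jp jq) : X.H3 F (X.at' d (D.om d + (jq - kp) - 1)) := by
  have hd := hp.FE
  have s0 := seg0 hC hF (hr.down hd) hp
  have s5 := seg5 hC hF (hr.down hd) hp
  have rp : D.Reg F 7 p := Reg.back (i := 0) (j := jp) hF hr hp.Fd (by simpa using hp.va.symm)
  obtain ⟨_, _, _, _, _, hpb⟩ := Q_ex hC hF
    (rp.bar.le (by omega) (inv_bar hF hp.Fd)) (inv_bar hF hp.Fd) (D.bar_mem hp.aa)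
  have s1 := seg1 hC hF (rp.down hp.Fd) hp hpb
  have := hp.k1
  have := hp.ka
  have := hp.kb
  have hle := hp.le
  intro c' c'' g1 g2 _
  rw [s5 _ (by omega) (by omega)] at g1
  rw [X.nx_at, ← X.at_sub_len, s0 _ (by omega) (by omega), X.at_at] at g2
  have g3 := ((s1 (kp-1) (by omega) (by omega) _).2 rfl).symm (hF.at hp.Fd _)
  have g4 := g3.rev hF
  rw [X.nx_at, X.nx_at] at g4
  have e1 : X.nx c' = X.rv (X.at' q (kp - 1 + 1)) := by
    rw [g1, X.nx_at, X.rv_at, X.rv_at, X.at_at]; congr 1; omega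
  have e2 : X.rv c'' = X.rv (X.at' p (kp - 1 + 1)) := by
    rw [g2]; congr 2; omega
  rw [e1, e2]; exact g4

theorem honey_arc (hC : X.C6) (hF : X.Inv F) (hr : D.Reg F 9 d) (hd : F d) (ha : D.AS d) :
    X.Honey F d := by
  have r8 := hr.down hd
  have r7 := r8.down hd
  have r6 := r7.down hd
  obtain ⟨b, k, E1, j1, j1', h⟩ := Q_ex hC hF (hr.le (by omega) hd) hd ha
  obtain ⟨b2, k2, E2, j2, j2', hb⟩ := Q_ex hC hF
    (hr.bar.le (by omega) (inv_bar hF hd)) (inv_bar hF hd) (D.bar_mem ha)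
  obtain ⟨p, q, kp, jp, jq, hp⟩ := Q_child hC hF (hr.le (by omega) hd) hd ha
  have hb' : D.Q F (D.bar (D.bar d)) b k E1 j1 j1' := by rw [bar_bar ha]; exact h
  have s0 := seg0 hC hF r7 hp
  have s1 := seg1 hC hF r6 h hb
  have s2 := seg2 hC hF r6 h hb
  have s3 := seg3 hC hF r6 h hb
  have s4 := seg4 hC hF r6 h hb
  have s5 := seg5 hC hF r7 hp
  have b0 := bre0 hC hF r7 h hb hp
  have b1 := brek hC hF r7 h hb
  have b2 := brej hC hF r8 h hb
  have b5 := brem hC hF r8 hp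
  have b3 := (brek hC hF r7.bar hb hb').mirror hF
  have b4 := (bre0 hC hF r7.bar hb hb' (hp.symm' hF)).mirror hF
  have e3 : X.rv (X.nx (X.nx (X.at' (D.bar d) (k2 - 1)))) = X.at' d (D.om d - k2 - 1) := by
    rw [X.nx_at, X.nx_at, rv_bar_at]; congr 1; omega
  have e4 : X.rv (X.nx (X.nx (X.at' (D.bar d) (-1)))) = X.at' d (D.om d - 1) := by
    rw [X.nx_at, X.nx_at, rv_bar_at]; congr 1
  rw [e3] at b3
  rw [e4] at b4
  have hle := hp.le
  have hkp := hp.ka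
  have hkq := hp.kb
  have hlen := X.len_pos d
  have key : ∀ i, ∃ i' lo hi f, X.len d ∣ i - i' ∧ X.at' d i = X.at' d i' ∧ lo ≤ i' ∧ i' < hi ∧ X.Seg F d lo hi f ∧
      X.H3 F (X.at' d (hi - 1)) ∧ (hi - 1) ∈ ({-1, k-1, j1-1, D.om d - k2 - 1, D.om d - 1,
        D.om d + (jq - kp) - 1} : Finset ℤ) := by
    intro i
    obtain ⟨i', hi'⟩ : ∃ i', i' = (i + (jp - kp)) % X.len d - (jp - kp) := ⟨_, rfl⟩
    have h1 := Int.emod_nonneg (i + (jp - kp)) hlen.ne'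
    have h2 := Int.emod_lt_of_pos (i + (jp - kp)) hlen
    have hdv : X.len d ∣ i - i' := by
      have := Int.dvd_self_sub_emod (x := i + (jp - kp)) (m := X.len d)
      rw [hi']
      convert this using 1; ring
    have hat : X.at' d i = X.at' d i' := by
      obtain ⟨m, hm⟩ := hdv
      rw [← X.at_mul_len d i' m]; congr 1; linarith
    refine ⟨i', ?_⟩
    rcases lt_or_ge i' 0 with g | g
    · exact ⟨-(jp - kp), 0, _, hdv, hat, by omega, g, s0, b0, by simp⟩
    rcases lt_or_ge i' k with g1 | g1
    · exact ⟨_, _, _, hdv, hat, by omega, g1, s1, b1, by simp⟩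
    rcases lt_or_ge i' j1 with g2 | g2
    · exact ⟨_, _, _, hdv, hat, by omega, g2, s2, b2, by simp⟩
    rcases lt_or_ge i' (D.om d - k2) with g3 | g3
    · exact ⟨_, _, _, hdv, hat, by omega, g3, s3, b3, by simp⟩
    rcases lt_or_ge i' (D.om d) with g4 | g4
    · exact ⟨_, _, _, hdv, hat, by omega, g4, s4, b4, by simp⟩
    · exact ⟨_, _, _, hdv, hat, by omega, by omega, s5, b5, by simp⟩
  refine ⟨fun i => ?_, ⟨({-1, k-1, j1-1, D.om d - k2 - 1, D.om d - 1,
        D.om d + (jq - kp) - 1} : Finset ℤ), Finset.card_le_six, fun i hi c' hc' => ?_⟩, fun i => ?_⟩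
  · obtain ⟨i', lo, hi, f, -, hat, h1, h2, hs, -, -⟩ := key i
    rw [hat]
    exact ⟨_, (hs i' h1 h2 _).2 rfl, fun c'' h => (hs i' h1 h2 _).1 h⟩
  · obtain ⟨i', lo, hi', f, hdv, hat, h1, h2, hs, -, hm⟩ := key i
    have hne : i' ≠ hi' - 1 := fun e => hi _ hm (e ▸ hdv)
    rw [hat, hs i' h1 h2] at hc'
    rw [hc', ← X.nx_at, hat, X.nx_at, X.nx_at]
    exact (hs _ (by omega) (by omega) _).2 rfl
  · obtain ⟨i', lo, hi', f, hdv, hat, h1, h2, hs, h3, hm⟩ := key i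
    rw [hat]
    by_cases hne : i' = hi' - 1
    · rw [hne]; exact h3
    · intro c' c'' g1 g2 g3
      rw [hs i' h1 h2] at g1
      rw [X.nx_at, hs _ (by omega) (by omega)] at g2
      rw [g1, X.nx_at] at g3
      exact (g3 g2).elim

theorem honey_of_reg (hC : X.C6) (hF : X.Inv F) {c : P} (hr : D.Reg F 9 c) (hc : F c) : X.Honey F c := by
  obtain ⟨d, n, ha, rfl⟩ := D.ex c
  have hr' : D.Reg F 9 d := by
    have := hr.move (-n)
    rw [X.at_at] at this
    simpa using this
  have h := honey_arc hC hF hr' (hF.at_iff.1 hc) ha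
  obtain ⟨B, hB, h2⟩ := h.h2
  refine ⟨fun i => ?_, ⟨B.image (fun j => j - n), Finset.card_image_le.trans hB, fun i hi c' hc' => ?_⟩,
    fun i => ?_⟩
  · rw [X.at_at]; exact h.h1 _
  · rw [X.at_at] at hc' ⊢
    rw [← add_assoc]
    refine h2 _ (fun j hj hd => hi (j - n) (Finset.mem_image_of_mem _ hj) ?_) _ hc'
    rw [X.len_at]
    convert hd using 1; ring
  · rw [X.at_at]; exact h.h3 _
end
end LS

theorem rel_count {α : Type*} (A : Finset α) (R : α → α → Prop)
    (hR : ∀ E ∈ A, ∀ a ∈ A, ∀ a' ∈ A, R E a → R E a' → a = a') (u : ℕ)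
    (Z : Finset α) (hZ : ∀ a ∈ A, a ∉ Z → ∃ E ∈ A, R E a) (hZA : Z ⊆ A) (hu : Z.card ≤ u)
    (B : Finset α) (hBA : B ⊆ A)
    (hB : ∀ a ∈ B, ¬ ((∃ d ∈ A, R a d ∧ ∀ E ∈ A, R E d → E = a) ∧
      (∃ E ∈ A, R E a ∧ ∀ E' ∈ A, R E' a → E' = E))) : B.card ≤ 4 * u := by
  classical
  have hch : ∃ ch : α → α, ∀ a ∈ A, a ∉ Z → ch a ∈ A ∧ R (ch a) a := by
    refine ⟨fun a => if h : a ∈ A ∧ a ∉ Z then (hZ a h.1 h.2).choose else a, fun a h1 h2 => ?_⟩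
    beta_reduce; rw [dif_pos (⟨h1, h2⟩ : a ∈ A ∧ a ∉ Z)]
    exact (hZ a h1 h2).choose_spec
  obtain ⟨ch, hch⟩ := hch
  obtain ⟨I, hI⟩ : ∃ I, I = (A \ Z).image ch := ⟨_, rfl⟩
  have hIA : I ⊆ A := by
    intro x hx
    rw [hI, Finset.mem_image] at hx
    obtain ⟨a, ha, rfl⟩ := hx
    rw [Finset.mem_sdiff] at ha
    exact (hch a ha.1 ha.2).1
  have hIc : I.card = A.card - Z.card := by
    rw [hI, Finset.card_image_of_injOn, Finset.card_sdiff_of_subset hZA]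
    intro a ha b hb e
    simp only [Finset.coe_sdiff, Set.mem_sdiff, Finset.mem_coe] at ha hb
    have h1 := hch a ha.1 ha.2
    have h2 := hch b hb.1 hb.2
    exact hR _ h1.1 _ ha.1 _ hb.1 h1.2 (by rw [e]; exact h2.2)
  obtain ⟨J, hJ⟩ : ∃ J, J = A \ I := ⟨_, rfl⟩
  have hJc : J.card ≤ u := by
    have h0 := Finset.card_le_card hZA
    rw [hJ, Finset.card_sdiff_of_subset hIA, hIc]; omega
  have notI : ∀ E ∈ A, ∀ d ∈ A, d ∉ Z → R E d → E ≠ ch d → E ∈ J := by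
    intro E hE d hd hdz hr hne
    rw [hJ, Finset.mem_sdiff]
    refine ⟨hE, fun h => ?_⟩
    rw [hI, Finset.mem_image] at h
    obtain ⟨a, ha, rfl⟩ := h
    rw [Finset.mem_sdiff] at ha
    have := hR _ hE _ ha.1 _ hd (hch a ha.1 ha.2).2 hr
    exact hne (by rw [this])
  obtain ⟨B3, hB3⟩ : ∃ B3, B3 = B.filter (fun a => ∃ d ∈ A, d ∉ Z ∧ a = ch d ∧ ∃ E ∈ J, R E d) := ⟨_, rfl⟩
  obtain ⟨B4, hB4⟩ : ∃ B4, B4 = B.filter (fun a => ∃ E ∈ J, R E a) := ⟨_, rfl⟩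
  have hJA : J ⊆ A := by rw [hJ]; exact Finset.sdiff_subset
  have c3 : B3.card ≤ J.card := by
    apply Finset.card_le_card_of_forall_subsingleton (fun a E => ∃ d ∈ A, d ∉ Z ∧ a = ch d ∧ R E d)
    · intro a ha
      rw [hB3, Finset.mem_filter] at ha
      obtain ⟨-, d, h1, h2, h3, E, h4, h5⟩ := ha
      exact ⟨E, h4, d, h1, h2, h3, h5⟩
    · rintro E hE a ⟨-, d, h1, h2, rfl, h3⟩ b ⟨-, d', h1', h2', rfl, h3'⟩
      rw [hR _ (hJA hE) _ h1 _ h1' h3 h3']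
  have c4 : B4.card ≤ J.card := by
    apply Finset.card_le_card_of_forall_subsingleton (fun a E => R E a)
    · intro a ha
      rw [hB4, Finset.mem_filter] at ha
      exact ha.2
    · rintro E hE a ⟨h0, h1⟩ b ⟨h0', h1'⟩
      rw [hB4, Finset.mem_filter] at h0 h0'
      exact hR _ (hJA hE) _ (hBA h0.1) _ (hBA h0'.1) h1 h1'
  have hsub : B ⊆ (Z ∪ J) ∪ (B3 ∪ B4) := by
    intro a ha
    by_contra hcon
    simp only [Finset.mem_union, not_or] at hcon
    obtain ⟨⟨hz, hj⟩, h3, h4⟩ := hcon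
    have haA := hBA ha
    refine hB a ha ⟨?_, ch a, (hch a haA hz).1, (hch a haA hz).2, fun E' hE' hr => ?_⟩
    · have haI : a ∈ I := by
        by_contra h
        exact hj (by rw [hJ, Finset.mem_sdiff]; exact ⟨haA, h⟩)
      rw [hI, Finset.mem_image] at haI
      obtain ⟨d, hd, rfl⟩ := haI
      rw [Finset.mem_sdiff] at hd
      refine ⟨d, hd.1, (hch d hd.1 hd.2).2, fun E hE hr => ?_⟩
      by_contra hne
      apply h3
      rw [hB3, Finset.mem_filter]
      exact ⟨ha, d, hd.1, hd.2, rfl, E, notI E hE d hd.1 hd.2 hr hne, hr⟩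
    · by_contra hne
      apply h4
      rw [hB4, Finset.mem_filter]
      exact ⟨ha, E', notI E' hE' a haA hz hr hne, hr⟩
  have h1 := Finset.card_le_card hsub
  have h2 := Finset.card_union_le (Z ∪ J) (B3 ∪ B4)
  have h3 := Finset.card_union_le Z J
  have h4 := Finset.card_union_le B3 B4
  omega

namespace LS
open CX
variable {P V L : Type*} {X : CX P V L} {D : LS X} {F : P → Prop}

theorem bad_count (hC : X.C6) (hF : X.Inv F) (hfin : {c | F c}.Finite) (U : Finset (V × L))
    (hU : ∀ c, F c → (X.vtx c, X.lab c) ∉ U → X.Ev F c) (B : Finset P)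
    (hB : ∀ a ∈ B, F a ∧ D.AS a ∧ ¬ D.Good F a) : B.card ≤ 4 * U.card := by
  classical
  obtain ⟨A, hA⟩ : ∃ A : Finset P, ∀ a, a ∈ A ↔ F a ∧ D.AS a :=
    ⟨hfin.toFinset.filter D.AS, fun a => by simp⟩
  refine rel_count A D.PR ?_ U.card
    (A.filter fun a => (X.vtx (X.at' a (D.pi a)), X.lab (X.at' a (D.pi a))) ∈ U) ?_ (Finset.filter_subset _ _) ?_ B ?_ ?_
  · intro E hE a ha a' ha' h h'
    rw [hA] at hE ha ha'
    exact D.pr_uniq hC hE.2 ha.2 ha'.2 h h'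
  · intro a ha hz
    rw [Finset.mem_filter, not_and] at hz
    have h1 := hz ha
    rw [hA] at ha
    obtain ⟨E, h2, h3, h4⟩ := D.child_ex hC hF ha.2 ha.1 (hU _ (hF.at ha.1 _) h1)
    exact ⟨E, (hA E).2 ⟨h2, h3⟩, h4⟩
  · apply Finset.card_le_card_of_injOn (fun a => (X.vtx (X.at' a (D.pi a)), X.lab (X.at' a (D.pi a))))
    · intro a ha
      simp only [Finset.coe_filter, Set.mem_ofPred_eq] at ha
      exact ha.2
    · intro a ha b hb e
      simp only [Finset.coe_filter, Set.mem_ofPred_eq, hA] at ha hb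
      simp only [Prod.mk.injEq] at e
      exact (D.dart_inj hC ha.1.2 hb.1.2 e).symm
  · intro a ha
    have := hB a ha
    exact (hA a).2 ⟨this.1, this.2.1⟩
  · rintro a ha ⟨⟨d, h1, h2, h3⟩, E, h4, h5, h6⟩
    refine (hB a ha).2.2 ⟨⟨d, ((hA d).1 h1).1, ((hA d).1 h1).2, h2, fun E hE hEa => h3 E ((hA E).2 ⟨hE, hEa⟩)⟩,
      E, ((hA E).1 h4).1, ((hA E).1 h4).2, h5, fun E hE hEa => h6 E ((hA E).2 ⟨hE, hEa⟩)⟩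
end LS

namespace CX
variable {P V L : Type*} {X : CX P V L}

theorem cnt_congr {p q : ℕ → Prop} [DecidablePred p] [DecidablePred q] (h : ∀ n, p n ↔ q n) (d : ℕ) :
    Nat.count p d = Nat.count q d := by
  simp only [Nat.count_eq_card_filter_range]
  congr 1; ext n; simp [h]

section cover
variable {F : P → Prop} {c : P} {o : ℤ → P}

open Classical in
theorem cover1 (ho : ∀ i, X.O F (X.at' c i) (o i)) (d : ℕ) (a : ℤ) :
    ∃ m : ℤ, 1 ≤ m ∧ X.Sh (X.at' c a) (o a) m ∧
      X.Cov (Nat.count (fun n : ℕ => o (a + n + 1) ≠ X.nx (o (a + n))) d) (X.at' c (a + m)) (d + 1 - m) := by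
  have one : ∀ a : ℤ, X.Sh (X.at' c a) (o a) 1 := fun a =>
    ⟨(ho a).2.2.1.symm, fun t h0 h1 => by
      have : t = 0 := by omega
      subst this; rw [at_zero, at_zero]; exact (ho a).2.2.2.symm⟩
  induction d generalizing a with
  | zero => exact ⟨1, le_rfl, one a, by simp [Cov]⟩
  | succ d ih =>
    obtain ⟨m, h1, h2, h3⟩ := ih (a+1)
    rw [Nat.count_succ']
    rw [cnt_congr (p := fun k : ℕ => o (a + ((k+1 : ℕ) : ℤ) + 1) ≠ X.nx (o (a + ((k+1 : ℕ) : ℤ))))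
      (q := fun n : ℕ => o (a + 1 + n + 1) ≠ X.nx (o (a + 1 + n))) (fun k => by
        push_cast; rw [show a + ((k:ℤ)+1) = a + 1 + k by ring])]
    by_cases hb : o (a + 1) = X.nx (o a)
    · refine ⟨m + 1, by omega, ?_, ?_⟩
      · rw [add_comm]
        refine (one a).append (by norm_num) ?_
        rw [X.at_at, X.at_one, ← hb]; exact h2
      · have : ¬ (o (a + ((0:ℕ):ℤ) + 1) ≠ X.nx (o (a + ((0:ℕ):ℤ)))) := by simpa using hb
        rw [if_neg this]
        rw [add_zero, show a + (m + 1) = a + 1 + m by ring,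
          show (((d + 1 : ℕ) : ℤ) + 1 - (m + 1)) = (d:ℤ) + 1 - m by push_cast; ring]
        exact h3
    · refine ⟨1, le_rfl, one a, ?_⟩
      have : (o (a + ((0:ℕ):ℤ) + 1) ≠ X.nx (o (a + ((0:ℕ):ℤ)))) := by simpa using hb
      rw [if_pos this]
      refine ⟨m, by omega, ⟨o (a+1), (ho (a+1)).2.1, h2⟩, ?_⟩
      rw [X.at_at]
      convert h3 using 1
      push_cast; ring

open Classical in
theorem cover2 (ho : ∀ i, X.O F (X.at' c i) (o i)) (d : ℕ) (a : ℤ) :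
    X.Cov (Nat.count (fun n : ℕ => o (a + n + 1) ≠ X.nx (o (a + n))) d + 1) (X.at' c a) (d + 1) := by
  obtain ⟨m, h1, h2, h3⟩ := cover1 ho d a
  exact ⟨m, by omega, ⟨o a, (ho a).2.1, h2⟩, by rw [X.at_at]; exact h3⟩

open Classical in
theorem breaks_le (hH : X.Honey F c) (ho : ∀ i, X.O F (X.at' c i) (o i))
    (hu : ∀ i c', X.O F (X.at' c i) c' → c' = o i) :
    Nat.count (fun n : ℕ => o (n + 1) ≠ X.nx (o n)) (X.len c).toNat ≤ 6 := by
  obtain ⟨B, hB, h⟩ := hH.h2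
  rw [Nat.count_eq_card_filter_range]
  refine le_trans (Finset.card_le_card_of_forall_subsingleton (fun (n : ℕ) (j : ℤ) => X.len c ∣ n - j) ?_ ?_) hB
  · intro n hn
    rw [Finset.mem_filter] at hn
    by_contra hcon
    push Not at hcon
    exact hn.2 (hu _ _ (h n hcon _ (ho n))).symm
  · rintro j hj n ⟨hn, h1⟩ m ⟨hm, h2⟩
    simp only [Finset.mem_filter, Finset.mem_range] at hn hm
    have h3 := dvd_sub h1 h2
    have e : (n:ℤ) - j - (m - j) = n - m := by ring
    rw [e] at h3
    have h4 := Int.eq_zero_of_abs_lt_dvd h3 (by rw [abs_lt]; omega)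
    omega

open Classical in
/-- comparison between breaks of two planes -/
theorem breaks_cmp (hC : X.C6) {F' : P → Prop} {o' : ℤ → P}
    (hH : X.Honey F c) (ho : ∀ i, X.O F (X.at' c i) (o i))
    (hu : ∀ i c', X.O F (X.at' c i) c' → c' = o i)
    (ho' : ∀ i, X.O F' (X.at' c i) (o' i)) (hb : o 0 ≠ X.nx (o (-1)))
    (t : ℕ) (ht : (t:ℤ) < X.len c) :
    Nat.count (fun n : ℕ => o (n + 1) ≠ X.nx (o n)) (t+1) ≤
      Nat.count (fun n : ℕ => o' (n + 1) ≠ X.nx (o' n)) t + 1 := by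
  have hle := breaks_le hH ho hu
  have hpos := X.len_pos c
  have hper : ∀ i, o (i + X.len c) = o i := fun i => by
    symm; apply hu; have := ho i; rwa [← X.at_add_len] at this
  obtain ⟨l, hl⟩ : ∃ l : ℕ, (l:ℤ) + 1 = X.len c := ⟨(X.len c - 1).toNat, by omega⟩
  have hll : (X.len c).toNat = l + 1 := by omega
  rw [hll, Nat.count_succ] at hle
  have hbl : o (l + 1) ≠ X.nx (o l) := by
    have e1 := hper 0
    have e2 := hper (-1)
    rw [show (0:ℤ) + X.len c = l + 1 by omega] at e1
    rw [show (-1:ℤ) + X.len c = l by omega] at e2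
    rwa [e1, e2]
  rw [if_pos hbl] at hle
  have c1 := cover2 ho' t 0
  simp only [zero_add, at_zero] at c1
  rcases Nat.lt_or_ge t l with htl | htl
  · obtain ⟨d, rfl⟩ : ∃ d, l = (t + 1) + d := ⟨l - t - 1, by omega⟩
    rw [Nat.count_add] at hle
    have c2 := cover2 ho d (t+1)
    rw [cnt_congr (p := fun n : ℕ => o (((t:ℤ) + 1) + n + 1) ≠ X.nx (o (((t:ℤ) + 1) + n)))
      (q := fun k : ℕ => o (((t + 1 + k : ℕ) : ℤ) + 1) ≠ X.nx (o ((t + 1 + k : ℕ) : ℤ)))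
      (fun k => by push_cast; rfl)] at c2
    have c3 := c1.append c2
    by_contra hcon
    apply hC c
    refine (c3.le ?_).mono ?_
    · omega
    · push_cast at hl; omega
  · have : t = l := by omega
    subst this
    by_contra hcon
    rw [Nat.count_succ, if_pos hbl] at hcon
    apply hC c
    refine (c1.le ?_).mono ?_
    · omega
    · omega
end cover

structure Tri (X : CX P V L) (K : Fin 3 → P → Prop) : Prop where
  inv : ∀ i, X.Inv (K i)
  dis : ∀ i j c, K i c → K j c → i = j
  hon : ∀ i j, i ≠ j → ∀ c, K i c ∨ K j c → X.Honey (fun c => K i c ∨ K j c) c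

/-- a branch state -/
def St (X : CX P V L) (K : Fin 3 → P → Prop) : Type _ :=
  {s : Fin 3 → P // (∀ i, K i (s i)) ∧ ∀ i j, X.SD (s i) (s j)}

theorem third (i j : Fin 3) : ∃ k, k ≠ i ∧ k ≠ j := by
  revert i j; decide
theorem fin3 {i j k : Fin 3} (h1 : i ≠ j) (h2 : i ≠ k) (h3 : j ≠ k) (l : Fin 3) : l = i ∨ l = j ∨ l = k := by
  revert i j k l; decide

namespace Tri
variable {K : Fin 3 → P → Prop} (T : X.Tri K)

theorem K_ne (T : X.Tri K) {i j : Fin 3} (hij : i ≠ j) {a b : P} (ha : K i a) (hb : K j b) : a ≠ b := by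
  rintro rfl; exact hij (T.dis _ _ _ ha hb)

theorem uniq (T : X.Tri K) {i j : Fin 3} (hij : i ≠ j) {a a' b : P} (ha : K i a) (ha' : K i a') (hb : K j b)
    (h : X.SD a b) (h' : X.SD a' b) : a = a' := by
  obtain ⟨o, h1, h2⟩ := (T.hon i j hij b (Or.inr hb)).h1 0
  rw [at_zero] at h1 h2
  rw [h2 a ⟨Or.inl ha, T.K_ne hij ha hb, h⟩, h2 a' ⟨Or.inl ha', T.K_ne hij ha' hb, h'⟩]

theorem ext_third (T : X.Tri K) {i j k : Fin 3} (hij : i ≠ j) (hik : k ≠ i) {a b : P} (ha : K i a) (hb : K j b)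
    (h : X.SD a b) : ∃ c, K k c ∧ X.SD c a := by
  obtain ⟨o, h1, h2⟩ := (T.hon i k hik.symm a (Or.inl ha)).h1 0
  rw [at_zero] at h1 h2
  rcases h1.1 with h3 | h3
  · exact absurd (T.uniq hij h3 ha hb (h1.2.2.trans h) h) h1.2.1
  · exact ⟨o, h3, h1.2.2⟩

theorem st_ext (T : X.Tri K) {s t : X.St K} (i : Fin 3) (h : s.1 i = t.1 i) : s = t := by
  apply Subtype.ext; funext j
  by_cases hj : j = i
  · rw [hj, h]
  · exact T.uniq hj (s.2.1 j) (t.2.1 j) (s.2.1 i) (s.2.2 j i) (h ▸ t.2.2 j i)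

def Nxt (s t : X.St K) : Prop := ∃ i j, i ≠ j ∧ t.1 i = X.nx (s.1 i) ∧ t.1 j = X.nx (s.1 j)

theorem nxt_of_sd (T : X.Tri K) (s : X.St K) {i j : Fin 3} (hij : i ≠ j) (h : X.SD (X.nx (s.1 i)) (X.nx (s.1 j))) :
    ∃ t, Nxt s t := by
  obtain ⟨k, hki, hkj⟩ := third i j
  obtain ⟨c, h1, h2⟩ := T.ext_third hij hki ((T.inv i).nx _ (s.2.1 i)) ((T.inv j).nx _ (s.2.1 j)) h
  have key : ∀ l, X.SD (Function.update (fun l => X.nx (s.1 l)) k c l) (X.nx (s.1 i)) := by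
    intro l
    rcases fin3 hij hki.symm hkj.symm l with rfl | rfl | rfl
    · rw [Function.update_of_ne hki.symm]; exact SD.refl _
    · rw [Function.update_of_ne hkj.symm]; exact h.symm
    · rw [Function.update_self]; exact h2
  refine ⟨⟨Function.update (fun l => X.nx (s.1 l)) k c, fun l => ?_, fun l m => (key l).trans (key m).symm⟩,
    i, j, hij, ?_, ?_⟩
  · rcases fin3 hij hki.symm hkj.symm l with rfl | rfl | rfl
    · rw [Function.update_of_ne hki.symm]; exact (T.inv _).nx _ (s.2.1 _)
    · rw [Function.update_of_ne hkj.symm]; exact (T.inv _).nx _ (s.2.1 _)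
    · rw [Function.update_self]; exact h1
  · exact Function.update_of_ne hki.symm c (fun l => X.nx (s.1 l))
  · exact Function.update_of_ne hkj.symm c (fun l => X.nx (s.1 l))

theorem h3 (T : X.Tri K) (s : X.St K) {i j : Fin 3} (hij : i ≠ j) {c : P}
    (hc : X.O (fun c => K i c ∨ K j c) (X.nx (s.1 i)) c) (hne : c ≠ X.nx (s.1 j)) :
    X.O (fun c => K i c ∨ K j c) (X.nx (s.1 j)) (X.rv c) := by
  have := (T.hon i j hij _ (Or.inl (s.2.1 i))).h3 0
  rw [at_zero] at this
  exact this _ _ ⟨Or.inr (s.2.1 j), T.K_ne hij.symm (s.2.1 j) (s.2.1 i), s.2.2 j i⟩ hc hne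

theorem nxt_aux (T : X.Tri K) (s : X.St K) (hn : ∀ i j, i ≠ j → ¬ X.SD (X.nx (s.1 i)) (X.nx (s.1 j)))
    {i j : Fin 3} (hij : i ≠ j) {c : P} (hc : K j c) (hsd : X.SD c (X.nx (s.1 i))) : False := by
  obtain ⟨k, hki, hkj⟩ := third i j
  have ki := (T.inv i).nx _ (s.2.1 i)
  have kj := (T.inv j).nx _ (s.2.1 j)
  have kk := (T.inv k).nx _ (s.2.1 k)
  obtain ⟨d, hd, hd2⟩ := T.ext_third hij hki ki hc hsd.symm
  have n1 : c ≠ X.nx (s.1 j) := by rintro rfl; exact hn i j hij hsd.symm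
  have a1 := T.h3 s hij ⟨Or.inr hc, T.K_ne hij.symm hc ki, hsd⟩ n1
  have krc : K j (X.rv c) := (T.inv j).rv _ hc
  have a2 : X.O (fun c => K j c ∨ K k c) (X.nx (s.1 j)) (X.rv c) := ⟨Or.inl krc, a1.2.1, a1.2.2⟩
  have a3 := T.h3 s hkj.symm a2 (T.K_ne hkj.symm krc kk)
  rw [X.rv_rv] at a3
  exact hn i k hki.symm (hsd.symm.trans a3.2.2)

theorem nxt_ex (T : X.Tri K) (s : X.St K) : ∃ t, Nxt s t := by
  by_cases h : ∃ i j, i ≠ j ∧ X.SD (X.nx (s.1 i)) (X.nx (s.1 j))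
  · obtain ⟨i, j, hij, h⟩ := h
    exact T.nxt_of_sd s hij h
  · push Not at h
    exfalso
    have h01 : (0 : Fin 3) ≠ 1 := by decide
    obtain ⟨o, h1, -⟩ := (T.hon 0 1 h01 _ (Or.inl ((T.inv 0).nx _ (s.2.1 0)))).h1 0
    rw [at_zero] at h1
    rcases h1.1 with h2 | h2
    · have h3 := T.h3 s h01 h1 (T.K_ne h01 h2 ((T.inv 1).nx _ (s.2.1 1)))
      exact T.nxt_aux s h h01.symm ((T.inv 0).rv _ h2) h3.2.2
    · exact T.nxt_aux s h h01 h2 h1.2.2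

theorem nxt_uniq (T : X.Tri K) {s t t' : X.St K} (h : Nxt s t) (h' : Nxt s t') : t = t' := by
  obtain ⟨i, j, hij, h1, h2⟩ := h
  obtain ⟨i', j', hij', h1', h2'⟩ := h'
  by_cases e : i = i' ∨ i = j'
  · rcases e with rfl | rfl
    · exact T.st_ext i (h1.trans h1'.symm)
    · exact T.st_ext i (h1.trans h2'.symm)
  · push Not at e
    have : j = i' ∨ j = j' := by
      rcases fin3 hij' e.1.symm e.2.symm j with rfl | rfl | rfl
      · left; rfl
      · right; rfl
      · exact absurd rfl hij
    rcases this with rfl | rfl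
    · exact T.st_ext j (h2.trans h1'.symm)
    · exact T.st_ext j (h2.trans h2'.symm)

noncomputable def step (T : X.Tri K) (s : X.St K) : X.St K := (T.nxt_ex s).choose
theorem step_nxt (s : X.St K) : Nxt s (T.step s) := (T.nxt_ex s).choose_spec

def rs (T : X.Tri K) (s : X.St K) : X.St K :=
  ⟨fun i => X.rv (X.nx (s.1 i)), fun i => (T.inv i).rv _ ((T.inv i).nx _ (s.2.1 i)), fun i j => (s.2.2 i j).rev⟩

theorem rs_rs (s : X.St K) : T.rs (T.rs s) = s := by
  apply Subtype.ext; funext i; exact rv_nx_rv_nx _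

def Ev (s : X.St K) (i : Fin 3) : Prop := (T.step s).1 i ≠ X.nx (s.1 i)

theorem nx_rs (s : X.St K) (i) : X.nx ((T.rs s).1 i) = X.rv (s.1 i) := by
  show X.nx (X.rv (X.nx (s.1 i))) = _
  rw [nx_rv]; simp

theorem step_rs (s : X.St K) : T.step (T.rs (T.step s)) = T.rs s := by
  refine T.nxt_uniq (T.step_nxt _) ?_
  obtain ⟨i, j, hij, h1, h2⟩ := T.step_nxt s
  refine ⟨i, j, hij, ?_, ?_⟩
  · rw [nx_rs, h1]; rfl
  · rw [nx_rs, h2]; rfl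

theorem ev_rs (s : X.St K) (i) : T.Ev (T.rs (T.step s)) i ↔ T.Ev s i := by
  unfold Ev
  rw [step_rs, nx_rs]
  show X.rv (X.nx (s.1 i)) ≠ _ ↔ _
  constructor
  · intro h e; exact h (by rw [e])
  · intro h e; exact h (X.rv_inj e).symm

theorem ev_uniq {s : X.St K} {i j : Fin 3} (h : T.Ev s i) (h' : T.Ev s j) : i = j := by
  obtain ⟨a, b, hab, h1, h2⟩ := T.step_nxt s
  have n1 : a ≠ i := by rintro rfl; exact h h1
  have n2 : b ≠ i := by rintro rfl; exact h h2
  rcases fin3 hab n1 n2 j with rfl | rfl | rfl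
  · exact absurd h1 h'
  · exact absurd h2 h'
  · rfl

theorem ev_sd {s : X.St K} {i j : Fin 3} (hij : j ≠ i) (h : T.Ev s i) : ¬ X.SD (X.nx (s.1 i)) (X.nx (s.1 j)) := by
  intro hs
  have hj : (T.step s).1 j = X.nx (s.1 j) := by
    by_contra hc; exact hij (T.ev_uniq (s := s) hc h)
  apply h
  rw [← hj] at hs
  exact T.uniq hij.symm ((T.step s).2.1 i) ((T.inv i).nx _ (s.2.1 i)) ((T.step s).2.1 j) ((T.step s).2.2 i j) hs
end Tri
end CX

namespace CX
namespace Tri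
variable {P V L : Type*} {X : CX P V L} {K : Fin 3 → P → Prop} (T : X.Tri K)

/-- iterated step -/
noncomputable def it (s : X.St K) (n : ℕ) : X.St K := T.step^[n] s
theorem it_zero (s : X.St K) : T.it s 0 = s := rfl
theorem it_succ (s : X.St K) (n : ℕ) : T.it s (n+1) = T.step (T.it s n) := Function.iterate_succ_apply' _ _ _
theorem it_add (s : X.St K) (m n : ℕ) : T.it (T.it s m) n = T.it s (m + n) := by
  rw [it, it, it, add_comm, Function.iterate_add_apply]
theorem it_one (s : X.St K) : T.it s 1 = T.step s := rfl

theorem it_rs (x : X.St K) (n m : ℕ) : T.it (T.rs (T.it x (n + m))) n = T.rs (T.it x m) := by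
  induction n generalizing m with
  | zero => rw [it_zero, zero_add]
  | succ n ih =>
    rw [it_succ, show n + 1 + m = n + (m + 1) by ring, ih, it_succ, step_rs]

theorem ev_it_rs (x : X.St K) (n m : ℕ) (i) : T.Ev (T.it (T.rs (T.it x (n + m + 1))) n) i ↔ T.Ev (T.it x m) i := by
  rw [add_assoc, it_rs, it_succ, ev_rs]

theorem run {s : X.St K} {i : Fin 3} {N : ℕ} (h : ∀ n < N, ¬ T.Ev (T.it s n) i) (n : ℕ) (hn : n ≤ N) :
    (T.it s n).1 i = X.at' (s.1 i) n := by
  induction n with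
  | zero => simp [it_zero]
  | succ n ih =>
    have h1 := h n hn
    unfold Ev at h1
    push Not at h1
    rw [it_succ, h1, ih (by omega), X.nx_at]; push_cast; rfl

theorem nbr (T : X.Tri K) {i j : Fin 3} (hij : i ≠ j) {c : P} (hc : K i c) :
    ∃ o : ℤ → P, (∀ n, X.O (fun c => K i c ∨ K j c) (X.at' c n) (o n)) ∧
      ∀ n c', X.O (fun c => K i c ∨ K j c) (X.at' c n) c' → c' = o n := by
  choose o h1 h2 using (T.hon i j hij c (Or.inl hc)).h1
  exact ⟨o, h1, h2⟩

section blk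
variable {s : X.St K} {i j : Fin 3} {N : ℕ} {o : ℤ → P}

theorem o_eq (hij : i ≠ j) (h : ∀ n < N, ¬ T.Ev (T.it s n) i)
    (hu : ∀ n c', X.O (fun c => K i c ∨ K j c) (X.at' (s.1 i) n) c' → c' = o n) (n : ℕ) (hn : n ≤ N) :
    o n = (T.it s n).1 j := by
  symm; apply hu
  rw [← T.run h n hn]
  exact ⟨Or.inr ((T.it s n).2.1 j), T.K_ne hij.symm ((T.it s n).2.1 j) ((T.it s n).2.1 i), (T.it s n).2.2 j i⟩

theorem br_iff (hij : i ≠ j) (h : ∀ n < N, ¬ T.Ev (T.it s n) i)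
    (hu : ∀ n c', X.O (fun c => K i c ∨ K j c) (X.at' (s.1 i) n) c' → c' = o n) (n : ℕ) (hn : n < N) :
    o (n+1) ≠ X.nx (o n) ↔ T.Ev (T.it s n) j := by
  have h1 := T.o_eq hij h hu n hn.le
  have h2 := T.o_eq hij h hu (n+1) hn
  push_cast at h2
  rw [h1, h2, it_succ]; rfl

theorem br_end (hij : i ≠ j) (h : ∀ n < N, ¬ T.Ev (T.it s n) i) (hN : T.Ev (T.it s N) i)
    (ho : ∀ n, X.O (fun c => K i c ∨ K j c) (X.at' (s.1 i) n) (o n))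
    (hu : ∀ n c', X.O (fun c => K i c ∨ K j c) (X.at' (s.1 i) n) c' → c' = o n) :
    o (N+1) ≠ X.nx (o N) := by
  intro e
  apply T.ev_sd hij.symm hN
  have h1 := T.o_eq hij h hu N le_rfl
  rw [← h1, ← e, T.run h N le_rfl, X.nx_at]
  exact (ho (N+1)).2.2.symm

theorem br_start (hij : i ≠ j) (hp : T.Ev (T.rs s) i)
    (ho : ∀ n, X.O (fun c => K i c ∨ K j c) (X.at' (s.1 i) n) (o n))
    (hu : ∀ n c', X.O (fun c => K i c ∨ K j c) (X.at' (s.1 i) n) c' → c' = o n) :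
    o 0 ≠ X.nx (o (-1)) := by
  intro e
  apply T.ev_sd hij.symm hp
  have h1 := T.o_eq (N := 0) hij (by simp) hu 0 le_rfl
  rw [it_zero] at h1
  push_cast at h1
  rw [nx_rs, nx_rs, ← h1, e]
  have h2 := (ho (-1)).2.2.rev
  rw [X.nx_at] at h2
  simp only [neg_add_cancel, at_zero] at h2
  exact h2.symm
end blk

open Classical in
noncomputable def cnt (s : X.St K) (i : Fin 3) (t : ℕ) : ℕ := Nat.count (fun n => T.Ev (T.it s n) i) t

theorem cnt_succ (s : X.St K) (i : Fin 3) (t : ℕ) :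
    (T.Ev (T.it s t) i ∧ T.cnt s i (t+1) = T.cnt s i t + 1) ∨ (¬ T.Ev (T.it s t) i ∧ T.cnt s i (t+1) = T.cnt s i t) := by
  classical
  unfold cnt
  rw [Nat.count_succ]
  by_cases h : T.Ev (T.it s t) i
  · left; exact ⟨h, by rw [if_pos h]⟩
  · right; exact ⟨h, by rw [if_neg h, add_zero]⟩

theorem cnt_mono (s : X.St K) (i : Fin 3) {t t' : ℕ} (h : t ≤ t') : T.cnt s i t ≤ T.cnt s i t' := by
  classical
  exact Nat.count_monotone _ h

theorem cnt_const {s : X.St K} {i : Fin 3} {a b : ℕ} (hab : a ≤ b) (h : ∀ n, a ≤ n → n < b → ¬ T.Ev (T.it s n) i) :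
    T.cnt s i b = T.cnt s i a := by
  induction b, hab using Nat.le_induction with
  | base => rfl
  | succ b hb ih =>
    rcases T.cnt_succ s i b with ⟨h1, -⟩ | ⟨-, h1⟩
    · exact absurd h1 (h b hb (by omega))
    · rw [h1]; exact ih fun n h2 h3 => h n h2 (by omega)

theorem cnt_zero (s : X.St K) (i : Fin 3) : T.cnt s i 0 = 0 := by
  classical
  exact Nat.count_zero _

theorem cnt_pos {s : X.St K} {i : Fin 3} {n t : ℕ} (h : n < t) (he : T.Ev (T.it s n) i) : 0 < T.cnt s i t := by
  have h1 := T.cnt_mono s i (show n + 1 ≤ t from h)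
  rcases T.cnt_succ s i n with ⟨-, h2⟩ | ⟨h2, -⟩
  · omega
  · exact absurd he h2

theorem blk_ex {s : X.St K} {i : Fin 3} (hp : T.Ev (T.rs s) i) : ∃ N : ℕ, (N:ℤ) < X.len (s.1 i) ∧ T.Ev (T.it s N) i ∧
    ∀ n < N, ¬ T.Ev (T.it s n) i := by
  classical
  obtain ⟨j, hj, -⟩ := third i i
  obtain ⟨k, hki, hkj⟩ := third i j
  have hpos := X.len_pos (s.1 i)
  have key : ∃ N : ℕ, (N:ℤ) < X.len (s.1 i) ∧ T.Ev (T.it s N) i := by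
    by_contra hcon
    push Not at hcon
    obtain ⟨l, hl⟩ : ∃ l : ℕ, (l:ℤ) + 1 = X.len (s.1 i) := ⟨(X.len (s.1 i) - 1).toNat, by omega⟩
    have h : ∀ n < l + 1, ¬ T.Ev (T.it s n) i := fun n hn => hcon n (by omega)
    have main : ∀ j, i ≠ j → T.Ev (T.it s l) j := by
      intro j hij
      obtain ⟨o, ho, hu⟩ := T.nbr hij (s.2.1 i)
      rw [← T.br_iff hij h hu l (by omega)]
      have hper : ∀ n, o (n + X.len (s.1 i)) = o n := fun n => by
        symm; apply hu; have := ho n; rwa [← X.at_add_len] at this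
      have e1 := hper 0
      have e2 := hper (-1)
      rw [show (0:ℤ) + X.len (s.1 i) = l + 1 by omega] at e1
      rw [show (-1:ℤ) + X.len (s.1 i) = l by omega] at e2
      rw [e1, e2]
      exact T.br_start hij hp ho hu
    exact hkj (T.ev_uniq (main k hki.symm) (main j hj.symm))
  refine ⟨Nat.find key, (Nat.find_spec key).1, (Nat.find_spec key).2, fun n hn he => ?_⟩
  have h1 := (Nat.find_spec key).1
  exact Nat.find_min key hn ⟨by omega, he⟩

theorem first_uniq {s : X.St K} {i : Fin 3} {N N' : ℕ} (h1 : T.Ev (T.it s N) i) (h2 : ∀ n < N, ¬ T.Ev (T.it s n) i)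
    (h1' : T.Ev (T.it s N') i) (h2' : ∀ n < N', ¬ T.Ev (T.it s n) i) : N = N' := by
  rcases lt_trichotomy N N' with h | h | h
  · exact absurd h1 (h2' _ h)
  · exact h
  · exact absurd h1' (h2 _ h)

theorem blk_le (hC : X.C6) {s : X.St K} {i j k : Fin 3} (hij : i ≠ j) (hik : i ≠ k) (hp : T.Ev (T.rs s) i) {N : ℕ}
    (hN : T.Ev (T.it s N) i) (h : ∀ n < N, ¬ T.Ev (T.it s n) i) :
    T.cnt s j N ≤ T.cnt s k N ∧ ∀ t ≤ N, T.cnt s j t ≤ T.cnt s k t + 1 := by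
  classical
  obtain ⟨N', hl, h1', h2'⟩ := T.blk_ex hp
  have := T.first_uniq hN h h1' h2'
  subst this
  obtain ⟨o, ho, hu⟩ := T.nbr hij (s.2.1 i)
  obtain ⟨o', ho', hu'⟩ := T.nbr hik (s.2.1 i)
  have ce : ∀ t ≤ N, Nat.count (fun n : ℕ => o (n + 1) ≠ X.nx (o n)) t = T.cnt s j t := by
    intro t ht
    rw [cnt, Nat.count_eq_card_filter_range, Nat.count_eq_card_filter_range]
    congr 1
    apply Finset.filter_congr
    intro n hn
    rw [Finset.mem_range] at hn
    exact T.br_iff hij h hu n (by omega)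
  have ce' : ∀ t ≤ N, Nat.count (fun n : ℕ => o' (n + 1) ≠ X.nx (o' n)) t = T.cnt s k t := by
    intro t ht
    rw [cnt, Nat.count_eq_card_filter_range, Nat.count_eq_card_filter_range]
    congr 1
    apply Finset.filter_congr
    intro n hn
    rw [Finset.mem_range] at hn
    exact T.br_iff hik h hu' n (by omega)
  have hcmp := breaks_cmp hC (T.hon i j hij _ (Or.inl (s.2.1 i))) ho hu ho' (T.br_start hij hp ho hu)
  constructor
  · have := hcmp N hl
    rw [Nat.count_succ, if_pos (T.br_end hij h hN ho hu), ce N le_rfl, ce' N le_rfl] at this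
    omega
  · intro t ht
    have := hcmp t (by omega)
    rw [ce' t ht] at this
    have h3 := Nat.count_monotone (fun n : ℕ => o (n + 1) ≠ X.nx (o n)) (Nat.le_succ t)
    rw [ce t ht] at h3
    exact h3.trans this

/-- within an α-free stretch delimited by γ's there is no β -/
theorem nb (hC : X.C6) {α β γ : Fin 3} (hab : α ≠ β) (hag : α ≠ γ) (hbg : β ≠ γ) (M : ℕ) :
    ∀ w : X.St K, T.Ev (T.rs w) γ → (∀ n ≤ M, ¬ T.Ev (T.it w n) α) → T.Ev (T.it w M) γ →
      ∀ n ≤ M, ¬ T.Ev (T.it w n) β := by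
  induction M using Nat.strong_induction_on with
  | _ M ih =>
    intro w hp ha hM n hn hb
    obtain ⟨N, -, h1, h2⟩ := T.blk_ex hp
    have hNM : N ≤ M := by
      by_contra hc; exact h2 M (by omega) hM
    have hc0 : T.cnt w α N = 0 := by
      rw [T.cnt_const (Nat.zero_le N) fun n _ h => ha n (by omega), cnt_zero]
    have hc := (T.blk_le hC hbg.symm hag.symm hp h1 h2).1
    rcases lt_trichotomy n N with h | h | h
    · have := T.cnt_pos h hb; omega
    · subst h; exact hbg (T.ev_uniq hb h1)
    · refine ih (M - (N+1)) (by omega) (T.it w (N+1)) ?_ ?_ ?_ (n - (N+1)) (by omega) ?_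
      · rw [it_succ, ev_rs]; exact h1
      · intro m hm; rw [it_add]; exact ha _ (by omega)
      · rw [it_add, show N + 1 + (M - (N+1)) = M by omega]; exact hM
      · rw [it_add, show N + 1 + (n - (N+1)) = n by omega]; exact hb

theorem occ1 (hC : X.C6) {s : X.St K} {α β : Fin 3} (hab : α ≠ β) (ha : ∀ n, ¬ T.Ev (T.it s n) α) :
    ∃ n, T.Ev (T.it s n) β := by
  by_contra hcon
  push Not at hcon
  have hp := X.len_pos (s.1 α)
  apply hC (s.1 α)
  refine Cov.le (q := 1) (Pc.cov ⟨s.1 β, T.K_ne hab.symm (s.2.1 β) (s.2.1 α), (s.2.2 α β).1, fun t h0 h1 => ?_⟩) (by norm_num)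
  have e1 := T.run (N := t.toNat) (fun n _ => ha n) t.toNat le_rfl
  have e2 := T.run (N := t.toNat) (fun n _ => hcon n) t.toNat le_rfl
  rw [show ((t.toNat : ℕ):ℤ) = t by omega] at e1 e2
  rw [← e1, ← e2]
  exact ((T.it s t.toNat).2.2 α β).2

theorem occ (hC : X.C6) (s : X.St K) (α : Fin 3) : ∃ n, T.Ev (T.it s n) α := by
  by_contra hcon
  push Not at hcon
  obtain ⟨β, hb, -⟩ := third α α
  obtain ⟨γ, hg, hgb⟩ := third α β
  obtain ⟨a, h1⟩ := T.occ1 hC hg.symm hcon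
  obtain ⟨b, h2⟩ := T.occ1 hC (s := T.it s (a+1)) hb.symm (fun n => by rw [it_add]; exact hcon _)
  obtain ⟨c, h3⟩ := T.occ1 hC (s := T.it s (a+1+b)) hg.symm (fun n => by rw [it_add]; exact hcon _)
  refine T.nb hC hb.symm hg.symm hgb.symm (b + c) (T.it s (a+1)) ?_ ?_ ?_ b (by omega) h2
  · rw [it_succ, ev_rs]; exact h1
  · intro n _; rw [it_add]; exact hcon _
  · rw [it_add]; rw [it_add] at h3; rwa [← add_assoc]

theorem first (hC : X.C6) (s : X.St K) (α : Fin 3) : ∃ n, T.Ev (T.it s n) α ∧ ∀ m < n, ¬ T.Ev (T.it s m) α := by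
  classical
  exact ⟨Nat.find (T.occ hC s α), Nat.find_spec (T.occ hC s α), fun m hm => Nat.find_min _ hm⟩

theorem cnt_ex {s : X.St K} {i : Fin 3} {a b : ℕ} (h : T.cnt s i a < T.cnt s i b) : ∃ n, a ≤ n ∧ n < b ∧ T.Ev (T.it s n) i := by
  by_contra hcon
  push Not at hcon
  have hab : a ≤ b := by
    by_contra hc
    have := T.cnt_mono s i (show b ≤ a by omega)
    omega
  have := T.cnt_const hab hcon
  omega

theorem nz (hC : X.C6) {w : X.St K} {α β : Fin 3} (hab : α ≠ β) (hp : T.Ev (T.rs w) β) {M : ℕ}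
    (hM : T.Ev (T.it w M) β) : ∃ n < M, T.Ev (T.it w n) α := by
  obtain ⟨N, -, h1, h2⟩ := T.blk_ex hp
  have hNM : N ≤ M := by
    by_contra hc; exact h2 M (by omega) hM
  by_contra hcon
  push Not at hcon
  obtain ⟨γ, hg, hgb⟩ := third α β
  have hc0 : T.cnt w α N = 0 := by
    rw [T.cnt_const (Nat.zero_le N) fun n _ h => hcon n (by omega), cnt_zero]
  have hc1 := (T.blk_le hC hgb.symm hab.symm hp h1 h2).1
  have hgn : ∀ n < N, ¬ T.Ev (T.it w n) γ := fun n hn he => by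
    have := T.cnt_pos hn he; omega
  obtain ⟨m, g1, g2⟩ := T.first hC (T.rs w) α
  have hm : m ≠ 0 := by
    rintro rfl
    exact hab (T.ev_uniq g1 hp)
  obtain ⟨m, rfl⟩ := Nat.exists_eq_succ_of_ne_zero hm
  obtain ⟨u, hu⟩ : ∃ u, u = T.rs (T.it (T.rs w) (m+1)) := ⟨_, rfl⟩
  have uw : T.it u (m+1) = w := by
    have := T.it_rs (T.rs w) (m+1) 0
    rw [add_zero, it_zero, rs_rs] at this
    rw [hu, this]
  have hup : T.Ev (T.rs u) α := by rw [hu, rs_rs]; exact g1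
  have hum : ∀ a b, a + b = m → ∀ i, T.Ev (T.it u a) i ↔ T.Ev (T.it (T.rs w) b) i := by
    intro a b hab i
    rw [hu, ← T.ev_it_rs (T.rs w) a b, hab]
  have ua : ∀ n ≤ m + 1 + N, ¬ T.Ev (T.it u n) α := by
    intro n hn
    rcases Nat.lt_or_ge n (m+1) with h | h
    · rw [hum n (m - n) (by omega)]
      exact g2 _ (by omega)
    · have e : T.it u n = T.it w (n - (m+1)) := by
        rw [← uw, it_add]; congr 1; omega
      rw [e]
      rcases Nat.lt_or_ge (n - (m+1)) N with h' | h'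
      · exact hcon _ (by omega)
      · have : n - (m+1) = N := by omega
        rw [this]; exact fun he => hab (T.ev_uniq he h1)
  have ub : T.Ev (T.it u m) β := by
    rw [hum m 0 (by omega)]; exact hp
  have ub2 : T.Ev (T.it u (m + 1 + N)) β := by
    rw [← it_add, uw]; exact h1
  have ug : ∀ n, m ≤ n → n < m + 1 + N + 1 → ¬ T.Ev (T.it u n) γ := by
    intro n h3 h4 he
    rcases Nat.eq_or_lt_of_le h3 with h | h
    · subst h; exact hgb (T.ev_uniq he ub)
    rcases Nat.eq_or_lt_of_le (show n ≤ m + 1 + N by omega) with h' | h'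
    · subst h'; exact hgb (T.ev_uniq he ub2)
    have e : T.it u n = T.it w (n - (m+1)) := by
      rw [← uw, it_add]; congr 1; omega
    rw [e] at he
    exact hgn _ (by omega) he
  obtain ⟨N', -, k1, k2⟩ := T.blk_ex hup
  have hN' : m + 1 + N < N' := by
    by_contra hc; exact ua N' (by omega) k1
  have b1 := T.blk_le hC hab hg.symm hup k1 k2
  have b2 := T.blk_le hC hg.symm hab hup k1 k2
  have c1 := T.cnt_const (a := m) (b := m+1+N+1) (by omega) ug
  have c2 : T.cnt u β (m+1) = T.cnt u β m + 1 := by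
    rcases T.cnt_succ u β m with ⟨-, h⟩ | ⟨h, -⟩
    · exact h
    · exact absurd ub h
  have c3 : T.cnt u β (m+1+N+1) = T.cnt u β (m+1+N) + 1 := by
    rcases T.cnt_succ u β (m+1+N) with ⟨-, h⟩ | ⟨h, -⟩
    · exact h
    · exact absurd ub2 h
  have c4 := T.cnt_mono u β (show m + 1 ≤ m+1+N by omega)
  have c5 := b1.2 (m+1+N+1) (by omega)
  have c6 := b2.2 m (by omega)
  have c7 := T.cnt_mono u β (show m+1+N+1 ≤ N' by omega)
  obtain ⟨g, -, hgm, hge⟩ := T.cnt_ex (s := u) (i := γ) (a := 0) (b := m) (by rw [cnt_zero]; omega)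
  obtain ⟨g', hg1, hg2, hge'⟩ := T.cnt_ex (s := u) (i := γ) (a := m+1+N+1) (b := N') (by omega)
  refine T.nb hC hab hg.symm hgb.symm (g' - (g+1)) (T.it u (g+1)) ?_ ?_ ?_ (m - (g+1)) (by omega) ?_
  · rw [it_succ, ev_rs]; exact hge
  · intro n hn; rw [it_add]; exact k2 _ (by omega)
  · rw [it_add, show g + 1 + (g' - (g+1)) = g' by omega]; exact hge'
  · rw [it_add, show g + 1 + (m - (g+1)) = m by omega]; exact ub

theorem nz' (hC : X.C6) {s : X.St K} {α β : Fin 3} (hab : α ≠ β) {a b : ℕ} (h : a < b) (ha : T.Ev (T.it s a) β)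
    (hb : T.Ev (T.it s b) β) : ∃ n, a < n ∧ n < b ∧ T.Ev (T.it s n) α := by
  obtain ⟨n, h1, h2⟩ := T.nz hC (w := T.it s (a+1)) (M := b - (a+1)) hab (by rw [it_succ, ev_rs]; exact ha)
    (by rw [it_add, show a + 1 + (b - (a+1)) = b by omega]; exact hb)
  rw [it_add] at h2
  exact ⟨a + 1 + n, by omega, by omega, h2⟩

/-- first times of occurrence -/
def Fst (s : X.St K) (i : Fin 3) (n : ℕ) : Prop := T.Ev (T.it s n) i ∧ ∀ m < n, ¬ T.Ev (T.it s m) i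

def Cyc (s : X.St K) (i j k : Fin 3) : Prop := ∃ a b c, a < b ∧ b < c ∧ T.Fst s i a ∧ T.Fst s j b ∧ T.Fst s k c

theorem Fst.uniq {T : X.Tri K} {s : X.St K} {i : Fin 3} {n m : ℕ} (h : T.Fst s i n) (h' : T.Fst s i m) : n = m :=
  T.first_uniq h.1 h.2 h'.1 h'.2

theorem Fst.step {T : X.Tri K} {s : X.St K} {i : Fin 3} {n : ℕ} (h : T.Fst s i (n+1)) : T.Fst (T.step s) i n := by
  constructor
  · rw [← it_one, it_add, add_comm]; exact h.1
  · intro m hm; rw [← it_one, it_add, add_comm]; exact h.2 _ (by omega)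

theorem Cyc.step (hC : X.C6) {T : X.Tri K} {s : X.St K} {i j k : Fin 3} (hki : k ≠ i)
    (h : T.Cyc s i j k) : T.Cyc (T.step s) i j k ∨ T.Cyc (T.step s) j k i := by
  obtain ⟨a, b, c, hab, hbc, h1, h2, h3⟩ := h
  obtain ⟨b, rfl⟩ := Nat.exists_eq_succ_of_ne_zero (show b ≠ 0 by omega)
  obtain ⟨c, rfl⟩ := Nat.exists_eq_succ_of_ne_zero (show c ≠ 0 by omega)
  rcases Nat.eq_zero_or_pos a with rfl | ha
  · right
    obtain ⟨n, hn⟩ := T.first hC (T.step s) i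
    refine ⟨b, c, n, by omega, ?_, h2.step, h3.step, hn⟩
    have e : T.Ev (T.it s (n+1)) i := by
      have := hn.1
      rwa [← it_one, it_add, add_comm] at this
    obtain ⟨m, g1, g2, g3⟩ := T.nz' hC hki (show 0 < n+1 by omega) h1.1 e
    have : c + 1 ≤ m := by
      by_contra hc; exact h3.2 m (by omega) g3
    omega
  · left
    obtain ⟨a, rfl⟩ := Nat.exists_eq_succ_of_ne_zero (show a ≠ 0 by omega)
    exact ⟨a, b, c, by omega, by omega, h1.step, h2.step, h3.step⟩

/-- orientation of a state -/
def Sg (s : X.St K) (δ : Fin 3) : Prop := ∃ i, T.Cyc s i (i+δ) (i+δ+δ)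

theorem Sg.step (hC : X.C6) {T : X.Tri K} {s : X.St K} {δ : Fin 3} (hδ : δ ≠ 0) (h : T.Sg s δ) : T.Sg (T.step s) δ := by
  obtain ⟨i, hi⟩ := h
  rcases hi.step hC (by clear * - hδ; revert i δ; decide) with h | h
  · exact ⟨i, h⟩
  · refine ⟨i + δ, ?_⟩
    rw [show i + δ + δ + δ = i by clear * -; revert i δ; decide]
    exact h

theorem Sg.it (hC : X.C6) {T : X.Tri K} {s : X.St K} {δ : Fin 3} (hδ : δ ≠ 0) (h : T.Sg s δ) (n : ℕ) : T.Sg (T.it s n) δ := by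
  induction n with
  | zero => exact h
  | succ n ih => rw [it_succ]; exact ih.step hC hδ

theorem sg_ex (hC : X.C6) (s : X.St K) : T.Sg s 1 ∨ T.Sg s 2 := by
  obtain ⟨a, ha⟩ := T.first hC s 0
  obtain ⟨b, hb⟩ := T.first hC s 1
  obtain ⟨c, hc⟩ := T.first hC s 2
  have n1 : a ≠ b := by rintro rfl; exact absurd (T.ev_uniq ha.1 hb.1) (by decide)
  have n2 : a ≠ c := by rintro rfl; exact absurd (T.ev_uniq ha.1 hc.1) (by decide)
  have n3 : b ≠ c := by rintro rfl; exact absurd (T.ev_uniq hb.1 hc.1) (by decide)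
  rcases Nat.lt_or_ge a b with h1 | h1 <;> rcases Nat.lt_or_ge b c with h2 | h2 <;> rcases Nat.lt_or_ge a c with h3 | h3
  · left; exact ⟨0, a, b, c, h1, h2, ha, hb, hc⟩
  · omega
  · right; exact ⟨0, a, c, b, h3, by omega, ha, hc, hb⟩
  · left; exact ⟨2, c, a, b, by omega, h1, hc, ha, hb⟩
  · right; exact ⟨1, b, a, c, by omega, h3, hb, ha, hc⟩
  · left; exact ⟨1, b, c, a, h2, by omega, hb, hc, ha⟩
  · omega
  · right; exact ⟨2, c, b, a, by omega, by omega, hc, hb, ha⟩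

theorem sg_not {s : X.St K} (h1 : T.Sg s 1) (h2 : T.Sg s 2) : False := by
  obtain ⟨i, a, b, c, h3, h4, f1, f2, f3⟩ := h1
  obtain ⟨j, a', b', c', h3', h4', f1', f2', f3'⟩ := h2
  have key : j = i ∨ j = i + 1 ∨ j = i + 1 + 1 := by clear * -; revert i j; decide
  rcases key with rfl | rfl | rfl
  · rw [show j + 2 = j + 1 + 1 by clear * -; revert j; decide] at f2'
    rw [show j + 2 + 2 = j + 1 by clear * -; revert j; decide] at f3'
    have := f1.uniq f1'; have := f2.uniq f3'; have := f3.uniq f2'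
    omega
  · rw [show i + 1 + 2 = i by clear * -; revert i; decide] at f2'
    rw [show i + 1 + 2 + 2 = i + 1 + 1 by clear * -; revert i; decide] at f3'
    have := f1.uniq f2'; have := f2.uniq f1'; have := f3.uniq f3'
    omega
  · rw [show i + 1 + 1 + 2 = i + 1 by clear * -; revert i; decide] at f2'
    rw [show i + 1 + 1 + 2 + 2 = i by clear * -; revert i; decide] at f3'
    have := f1.uniq f3'; have := f2.uniq f2'; have := f3.uniq f1'
    omega

theorem Sg.rs (hC : X.C6) {T : X.Tri K} {s : X.St K} {δ : Fin 3} (hδ : δ ≠ 0) (h : T.Sg s δ) : T.Sg (T.rs s) (-δ) := by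
  obtain ⟨i, a, b, c, hab, hbc, h1, h2, h3⟩ := h
  obtain ⟨j, hj⟩ : ∃ j, j = i + δ := ⟨_, rfl⟩
  obtain ⟨k, hk⟩ : ∃ k, k = i + δ + δ := ⟨_, rfl⟩
  rw [← hj] at h2
  rw [← hk] at h3
  have hki : k ≠ i := by rw [hk]; clear * - hδ; revert i δ; decide
  have hkj : k ≠ j := by rw [hk, hj]; clear * - hδ; revert i δ; decide
  suffices hs : T.Sg (T.rs (T.it s (c+1))) (-δ) by
    have := hs.it hC (by simpa using hδ) (c+1)
    have e := T.it_rs s (c+1) 0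
    rw [add_zero] at e
    rwa [e, it_zero] at this
  have once : ∀ l, k ≠ l → ∀ x, T.Fst s l x → x < c → T.Fst (T.rs (T.it s (c+1))) l (c - x) := by
    intro l hl x hx hxc
    constructor
    · have := T.ev_it_rs s (c - x) x l
      rw [show c - x + x + 1 = c + 1 by omega] at this
      rw [this]; exact hx.1
    · intro m hm he
      have := T.ev_it_rs s m (c - m) l
      rw [show m + (c - m) + 1 = c + 1 by omega] at this
      rw [this] at he
      obtain ⟨n, g1, g2, g3⟩ := T.nz' hC hl (show x < c - m by omega) hx.1 he
      exact h3.2 n (by omega) g3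
  have hk0 : T.Fst (T.rs (T.it s (c+1))) k 0 := by
    refine ⟨?_, by simp⟩
    have := T.ev_it_rs s 0 c k
    rw [zero_add] at this
    rw [this]; exact h3.1
  refine ⟨k, 0, c - b, c - a, by omega, by omega, hk0, ?_, ?_⟩
  · rw [show k + -δ = j by rw [hk, hj]; simp]
    exact once j hkj b h2 hbc
  · rw [show k + -δ + -δ = i by rw [hk]; simp]
    exact once i hki a h1 (by omega)

theorem sg_rs_iff (hC : X.C6) (s : X.St K) : T.Sg (T.rs s) 1 ↔ ¬ T.Sg s 1 := by
  constructor
  · intro h h'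
    exact T.sg_not h (h'.rs hC (by decide))
  · intro h
    have := (T.sg_ex hC s).resolve_left h
    exact this.rs hC (by decide)

theorem sg_step_iff (hC : X.C6) (s : X.St K) : T.Sg (T.step s) 1 ↔ T.Sg s 1 := by
  constructor
  · intro h
    by_contra hn
    have := ((T.sg_ex hC s).resolve_left hn).step hC (by decide)
    exact T.sg_not h this
  · exact fun h => h.step hC (by decide)
end Tri
end CX

namespace CX
namespace Tri
variable {P V L : Type*} {X : CX P V L} {K K' : Fin 3 → P → Prop} (T : X.Tri K) (T' : X.Tri K')

theorem step_vtx (T : X.Tri K) (s : X.St K) (j i : Fin 3) : X.vtx ((T.step s).1 j) = X.vtx (X.nx (s.1 i)) := by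
  obtain ⟨a, b, -, h1, -⟩ := T.step_nxt s
  rw [((T.step s).2.2 j a).1, h1]
  exact X.det _ _ (s.2.2 a i).1 (s.2.2 a i).2

theorem st_uniq (T : X.Tri K) {s t : X.St K} (h : X.SD (s.1 0) (t.1 0)) : s = t := by
  apply T.st_ext 0
  exact T.uniq (show (0 : Fin 3) ≠ 1 by decide) (s.2.1 0) (t.2.1 0) (t.2.1 1) (h.trans (t.2.2 0 1)) (t.2.2 0 1)

open Classical in
noncomputable def lh (v : V) (l : L) : ℤ :=
  if ∃ s : X.St K, X.vtx (s.1 0) = v ∧ X.lab (s.1 0) = l ∧ T.Sg s 1 then 1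
  else if ∃ s : X.St K, X.vtx (s.1 0) = v ∧ X.lab (s.1 0) = l then -1 else 0

open Classical in
theorem lh_st (s : X.St K) {v : V} {l : L} (hv : X.vtx (s.1 0) = v) (hl : X.lab (s.1 0) = l) :
    T.lh v l = if T.Sg s 1 then 1 else -1 := by
  unfold lh
  by_cases h : T.Sg s 1
  · rw [if_pos h, if_pos ⟨s, hv, hl, h⟩]
  · rw [if_neg h, if_neg, if_pos ⟨s, hv, hl⟩]
    rintro ⟨t, h1, h2, h3⟩
    rw [T.st_uniq (s := t) (t := s) ⟨h1.trans hv.symm, h2.trans hl.symm⟩] at h3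
    exact h h3

theorem lh_ex {v : V} {l : L} (h : T.lh v l ≠ 0) : ∃ s : X.St K, X.vtx (s.1 0) = v ∧ X.lab (s.1 0) = l := by
  by_contra hc
  apply h
  unfold lh
  rw [if_neg, if_neg hc]
  rintro ⟨s, h1, h2, -⟩
  exact hc ⟨s, h1, h2⟩

theorem lh_st_ne (s : X.St K) {v : V} {l : L} (hv : X.vtx (s.1 0) = v) (hl : X.lab (s.1 0) = l) : T.lh v l ≠ 0 := by
  classical
  rw [T.lh_st s hv hl]
  split_ifs <;> norm_num

theorem lh_rev_st (hC : X.C6) (s : X.St K) : T.lh (X.vtx (X.nx (s.1 0))) (X.iv (X.lab (s.1 0))) =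
    - T.lh (X.vtx (s.1 0)) (X.lab (s.1 0)) := by
  classical
  rw [T.lh_st s rfl rfl, T.lh_st (T.rs s) (X.vtx_rv _) (X.lab_rv _)]
  by_cases h : T.Sg s 1
  · rw [if_pos h, if_neg]; rw [T.sg_rs_iff hC]; exact not_not.2 h
  · rw [if_neg h, if_pos]
    · rfl
    · rw [T.sg_rs_iff hC]; exact h

theorem lh_rev (hC : X.C6) (tg : V → L → V) (htg : ∀ c, X.vtx (X.nx c) = tg (X.vtx c) (X.lab c))
    (htt : ∀ v l, tg (tg v l) (X.iv l) = v) (v : V) (l : L) :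
    T.lh (tg v l) (X.iv l) = - T.lh v l := by
  by_cases h : T.lh v l = 0
  · by_cases h' : T.lh (tg v l) (X.iv l) = 0
    · rw [h, h']; rfl
    · obtain ⟨s, h1, h2⟩ := T.lh_ex h'
      have := T.lh_rev_st hC s
      rw [htg, h1, h2, htt, X.iv_iv] at this
      rw [this]; ring
  · obtain ⟨s, h1, h2⟩ := T.lh_ex h
    have := T.lh_rev_st hC s
    rwa [htg, h1, h2] at this

theorem lh_sum (hC : X.C6) (v : V) (A : Finset L) (hA : ∀ l, T.lh v l ≠ 0 → l ∈ A) : ∑ l ∈ A, T.lh v l = 0 := by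
  classical
  have key : ∀ l, T.lh v l ≠ 0 → ∃ s : X.St K, X.vtx (s.1 0) = v ∧ X.lab (s.1 0) = l := fun l h => T.lh_ex h
  rcases isEmpty_or_nonempty (X.St K) with hem | hne0
  · refine Finset.sum_eq_zero fun l _ => ?_
    by_contra hc
    exact hem.false (key l hc).choose
  choose! q hq1 hq2 using key
  have hv : ∀ l, T.lh v l ≠ 0 → X.vtx ((T.step (T.rs (q l))).1 0) = v := by
    intro l hl
    rw [T.step_vtx _ 0 0, T.nx_rs, X.vtx_rv, hq1 l hl]
  have hne : ∀ l, T.lh v l ≠ 0 → T.lh v (X.lab ((T.step (T.rs (q l))).1 0)) ≠ 0 := fun l hl =>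
    T.lh_st_ne (T.step (T.rs (q l))) (hv l hl) rfl
  rw [← Finset.sum_filter_ne_zero]
  refine Finset.sum_involution (fun l _ => X.lab ((T.step (T.rs (q l))).1 0)) ?_ ?_ ?_ ?_
  · intro l hl
    have hl := (Finset.mem_filter.1 hl).2
    rw [T.lh_st (T.step (T.rs (q l))) (hv l hl) rfl, T.lh_st (q l) (hq1 l hl) (hq2 l hl)]
    by_cases h : T.Sg (q l) 1
    · rw [if_pos h, if_neg]
      · rfl
      rw [T.sg_step_iff hC, T.sg_rs_iff hC]; exact not_not.2 h
    · rw [if_neg h, if_pos]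
      · rfl
      rw [T.sg_step_iff hC, T.sg_rs_iff hC]; exact h
  · intro l hl _ he
    have hl := (Finset.mem_filter.1 hl).2
    have e : T.step (T.rs (q l)) = q l := T.st_uniq ⟨(hv l hl).trans (hq1 l hl).symm, he.trans (hq2 l hl).symm⟩
    have h1 := T.sg_step_iff hC (T.rs (q l))
    rw [T.sg_rs_iff hC, e] at h1
    tauto
  · intro l hl
    have hl := (Finset.mem_filter.1 hl).2
    exact Finset.mem_filter.2 ⟨hA _ (hne l hl), hne l hl⟩
  · intro l hl
    have hl := (Finset.mem_filter.1 hl).2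
    have e : q (X.lab ((T.step (T.rs (q l))).1 0)) = T.step (T.rs (q l)) :=
      T.st_uniq ⟨(hq1 _ (hne l hl)).trans (hv l hl).symm, hq2 _ (hne l hl)⟩
    beta_reduce
    rw [e, T.step_rs, T.rs_rs]
    exact hq2 l hl

theorem loc_it (s : X.St K) (s' : X.St K') (hs : s'.1 = s.1) (k : Fin 3) (N : ℕ)
    (hN : ∀ n < N, ¬ T.Ev (T.it s n) k)
    (h : ∀ (n : ℕ) c, X.vtx c = X.vtx (X.at' (s.1 k) n) → ∀ l, (K l c → K' l c)) (m : ℕ) (hm : m ≤ N + 1) :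
    (T'.it s' m).1 = (T.it s m).1 := by
  induction m with
  | zero => exact hs
  | succ m ih =>
    have ih := ih (by omega)
    rw [it_succ, it_succ]
    have hr := T.run hN m (by omega)
    have hv : ∀ j, X.vtx ((T.step (T.it s m)).1 j) = X.vtx (X.at' (s.1 k) ((m+1 : ℕ) : ℤ)) := by
      intro j
      rw [T.step_vtx _ j k, hr, X.nx_at]; norm_cast
    let t : X.St K' := ⟨(T.step (T.it s m)).1, fun i => h (m+1) _ (hv i) i ((T.step (T.it s m)).2.1 i), (T.step (T.it s m)).2.2⟩
    have : T'.step (T'.it s' m) = t := by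
      refine T'.nxt_uniq (T'.step_nxt _) ?_
      obtain ⟨a, b, hab, h1, h2⟩ := T.step_nxt (T.it s m)
      refine ⟨a, b, hab, ?_, ?_⟩
      · rw [ih]; exact h1
      · rw [ih]; exact h2
    rw [this]

theorem loc_cyc (s : X.St K) (s' : X.St K') (hs : s'.1 = s.1) {i j k : Fin 3}
    (h : ∀ (n : ℕ) c, X.vtx c = X.vtx (X.at' (s.1 k) n) → ∀ l, (K l c → K' l c)) (hc : T.Cyc s i j k) : T'.Cyc s' i j k := by
  obtain ⟨a, b, c, hab, hbc, h1, h2, h3⟩ := hc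
  have key := T.loc_it T' s s' hs k c h3.2 h
  have hev : ∀ m ≤ c, ∀ l, T'.Ev (T'.it s' m) l ↔ T.Ev (T.it s m) l := by
    intro m hm l
    unfold Ev
    rw [← it_succ, ← it_succ, key m (by omega), key (m+1) (by omega)]
  have hf : ∀ l m, m ≤ c → T.Fst s l m → T'.Fst s' l m := fun l m hm hh =>
    ⟨(hev m hm l).2 hh.1, fun m' hm' => fun hx => hh.2 m' hm' ((hev m' (by omega) l).1 hx)⟩
  exact ⟨a, b, c, hab, hbc, hf _ _ (by omega) h1, hf _ _ (by omega) h2, hf _ _ le_rfl h3⟩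

theorem loc_sg (hC : X.C6) (s : X.St K) (s' : X.St K') (hs : s'.1 = s.1)
    (h : ∀ k (n : ℕ) c, X.vtx c = X.vtx (X.at' (s.1 k) n) → ∀ l, (K l c → K' l c)) : T'.Sg s' 1 ↔ T.Sg s 1 := by
  have key : ∀ δ, T.Sg s δ → T'.Sg s' δ := by
    rintro δ ⟨i, hi⟩
    exact ⟨i, T.loc_cyc T' s s' hs (h _) hi⟩
  constructor
  · intro h1
    rcases T.sg_ex hC s with h2 | h2
    · exact h2
    · exact absurd (key _ h2) (fun h2 => T'.sg_not h1 h2)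
  · exact key 1

theorem lh_local (hC : X.C6) (v : V)
    (h : ∀ c, X.vtx c = v → (∃ i, K i c ∨ K' i c) → ∀ (n : ℤ) c', X.vtx c' = X.vtx (X.at' c n) → ∀ l, (K l c' ↔ K' l c'))
    (l : L) : T.lh v l = T'.lh v l := by
  classical
  by_cases h0 : T.lh v l = 0
  · by_cases h0' : T'.lh v l = 0
    · rw [h0, h0']
    · exfalso
      obtain ⟨s, h1, h2⟩ := T'.lh_ex h0'
      refine T.lh_st_ne ⟨s.1, fun i => ?_, s.2.2⟩ h1 h2 h0
      refine (h (s.1 0) h1 ⟨0, Or.inr (s.2.1 0)⟩ 0 (s.1 i) ?_ i).2 (s.2.1 i)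
      rw [at_zero]; exact (s.2.2 i 0).1
  · obtain ⟨s, h1, h2⟩ := T.lh_ex h0
    have hi : ∀ i, K' i (s.1 i) := fun i => by
      refine (h (s.1 0) h1 ⟨0, Or.inl (s.2.1 0)⟩ 0 (s.1 i) ?_ i).1 (s.2.1 i)
      rw [at_zero]; exact (s.2.2 i 0).1
    have hs := T.loc_sg T' hC s ⟨s.1, hi, s.2.2⟩ rfl (fun k n c hc l =>
      (h (s.1 k) ((s.2.2 k 0).1.trans h1) ⟨k, Or.inl (s.2.1 k)⟩ n c hc l).1)
    rw [T.lh_st s h1 h2, T'.lh_st ⟨s.1, hi, s.2.2⟩ h1 h2]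
    by_cases hh : T.Sg s 1
    · rw [if_pos hh, if_pos (hs.2 hh)]
    · rw [if_neg hh, if_neg (fun hx => hh (hs.1 hx))]

theorem lh_par (v : V) (l : L) :
    ((T.lh v l : ℤ) : ZMod 2) = (({c | K 0 c ∧ X.vtx c = v ∧ X.lab c = l}.ncard : ℕ) : ZMod 2) := by
  classical
  have h01 : (0 : Fin 3) ≠ 1 := by decide
  by_cases h : T.lh v l = 0
  · by_cases he : ∃ c, K 0 c ∧ X.vtx c = v ∧ X.lab c = l
    · obtain ⟨c, hc, hv, hl⟩ := he
      have nst : ∀ o, K 1 o → ¬ X.SD o c := by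
        intro o ho hs
        obtain ⟨d, hd, hd2⟩ := T.ext_third (k := 2) h01 (by decide) hc ho hs.symm
        have key : ∀ i : Fin 3, X.SD ((![c, o, d] : Fin 3 → P) i) c := by
          intro i; fin_cases i
          · exact SD.refl _
          · exact hs
          · exact hd2
        refine T.lh_st_ne ⟨![c, o, d], fun i => ?_, fun i j => (key i).trans (key j).symm⟩ hv hl h
        fin_cases i
        · exact hc
        · exact ho
        · exact hd
      obtain ⟨o, h1, h2⟩ := (T.hon 0 1 h01 c (Or.inl hc)).h1 0
      rw [at_zero] at h1 h2
      have ho : K 0 o := h1.1.resolve_right (fun h => nst o h h1.2.2)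
      have : {c | K 0 c ∧ X.vtx c = v ∧ X.lab c = l} = {c, o} := by
        ext z
        simp only [Set.mem_ofPred_eq, Set.mem_insert_iff, Set.mem_singleton_iff]
        constructor
        · rintro ⟨z1, z2, z3⟩
          by_cases hz : z = c
          · left; exact hz
          · right; exact h2 z ⟨Or.inl z1, hz, z2.trans hv.symm, z3.trans hl.symm⟩
        · rintro (rfl | rfl)
          · exact ⟨hc, hv, hl⟩
          · exact ⟨ho, h1.2.2.1.trans hv, h1.2.2.2.trans hl⟩
      rw [this, Set.ncard_pair h1.2.1.symm, h]; rfl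
    · have : {c | K 0 c ∧ X.vtx c = v ∧ X.lab c = l} = ∅ := by
        ext z; simp only [Set.mem_ofPred_eq, Set.mem_empty_iff_false, iff_false]; exact fun hz => he ⟨z, hz⟩
      rw [this, h]; simp
  · obtain ⟨s, h1, h2⟩ := T.lh_ex h
    have : {c | K 0 c ∧ X.vtx c = v ∧ X.lab c = l} = {s.1 0} := by
      ext z
      simp only [Set.mem_ofPred_eq, Set.mem_singleton_iff]
      constructor
      · rintro ⟨z1, z2, z3⟩
        exact T.uniq h01 z1 (s.2.1 0) (s.2.1 1) (SD.trans ⟨z2.trans h1.symm, z3.trans h2.symm⟩ (s.2.2 0 1)) (s.2.2 0 1)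
      · rintro rfl; exact ⟨s.2.1 0, h1, h2⟩
    rw [this, Set.ncard_singleton, T.lh_st s h1 h2]
    split_ifs <;> rfl

end Tri
end CX

section conv
variable {G H Λ Λ' : Type*} [Group G] [Group H] (f : H →* G)

noncomputable def exf (φ : H → ZMod 2) : G → ZMod 2 := Function.extend f φ 0

variable {f} in
theorem exf_app (hf : Function.Injective f) (φ : H → ZMod 2) (h : H) : exf f φ (f h) = φ h := hf.extend_apply _ _ _
theorem exf_zero (φ : H → ZMod 2) (g : G) (hg : ¬ ∃ h, f h = g) : exf f φ g = 0 := Function.extend_apply' _ _ _ hg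
theorem exf_ne {φ : H → ZMod 2} {g : G} (h : exf f φ g ≠ 0) (hf : Function.Injective f) : ∃ x, f x = g ∧ φ x ≠ 0 := by
  by_cases hg : ∃ x, f x = g
  · obtain ⟨x, rfl⟩ := hg
    rw [exf_app hf] at h
    exact ⟨x, rfl, h⟩
  · exact absurd (exf_zero f φ g hg) h
variable {f} in
theorem exf_add (hf : Function.Injective f) (φ φ' : H → ZMod 2) (g : G) : exf f (φ + φ') g = exf f φ g + exf f φ' g := by
  by_cases hg : ∃ x, f x = g
  · obtain ⟨x, rfl⟩ := hg
    rw [exf_app hf, exf_app hf, exf_app hf]; rfl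
  · rw [exf_zero _ _ _ hg, exf_zero _ _ _ hg, exf_zero _ _ _ hg, add_zero]
variable {f} in
theorem exf_congr (hf : Function.Injective f) {φ φ' : H → ZMod 2} {g g' : G} (a : H) (hg : g' = f a * g)
    (h : ∀ x, f x = g → φ' (a * x) = φ x) : exf f φ' g' = exf f φ g := by
  by_cases hx : ∃ x, f x = g
  · obtain ⟨x, rfl⟩ := hx
    rw [hg, ← map_mul, exf_app hf, exf_app hf, h x rfl]
  · rw [exf_zero _ _ _ hx, exf_zero]
    rintro ⟨y, hy⟩
    exact hx ⟨a⁻¹ * y, by rw [map_mul, hy, hg]; simp⟩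
variable {f} in
theorem exf_right (hf : Function.Injective f) (φ : H → ZMod 2) (g : G) (a : H) :
    exf f (fun x => φ (x * a⁻¹)) g = exf f φ (g * (f a)⁻¹) := by
  by_cases hx : ∃ x, f x = g
  · obtain ⟨x, rfl⟩ := hx
    rw [← map_inv, ← map_mul, exf_app hf, exf_app hf]
  · rw [exf_zero _ _ _ hx, exf_zero]
    rintro ⟨y, hy⟩
    exact hx ⟨y * a, by rw [map_mul, hy]; simp⟩

/-- convolution of a function on `H` with a finite chain -/
noncomputable def cnv (φ : H → ZMod 2) : ((G × Λ) →₀ ZMod 2) →+ (G → (Λ →₀ ZMod 2)) :=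
  Finsupp.liftAddHom fun z =>
    { toFun := fun a g => Finsupp.single z.2 (a * exf f φ (g * z.1⁻¹))
      map_zero' := by funext g; simp
      map_add' := fun a b => by funext g; simp [add_mul] }

theorem cnv_single (φ : H → ZMod 2) (z : G × Λ) (a : ZMod 2) (g : G) :
    cnv f φ (Finsupp.single z a) g = Finsupp.single z.2 (a * exf f φ (g * z.1⁻¹)) := by
  unfold cnv; rw [Finsupp.liftAddHom_apply_single]; rfl

/-- induction principle over additive statements -/
theorem chain_ind {A : Type*} {Q : (A →₀ ZMod 2) → Prop} (h0 : Q 0) (hadd : ∀ u v, Q u → Q v → Q (u + v))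
    (hs : ∀ z a, Q (Finsupp.single z a)) (Z : A →₀ ZMod 2) : Q Z := by
  induction Z using Finsupp.induction_linear with
  | zero => exact h0
  | add u v hu hv => exact hadd u v hu hv
  | single z a => exact hs z a

variable {f} in
theorem cnv_add (hf : Function.Injective f) (φ φ' : H → ZMod 2) (Z : (G × Λ) →₀ ZMod 2) :
    cnv f (φ + φ') Z = cnv f φ Z + cnv f φ' Z := by
  induction Z using chain_ind with
  | h0 => simp
  | hadd u v hu hv => rw [map_add, map_add, map_add, hu, hv]; abel
  | hs z a =>
    funext g
    rw [Pi.add_apply, cnv_single, cnv_single, cnv_single, exf_add hf, mul_add, Finsupp.single_add]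

theorem cnv_zero (φ : H → ZMod 2) (hφ : ∀ x, φ x = 0) (Z : (G × Λ) →₀ ZMod 2) : cnv f φ Z = 0 := by
  have : φ = 0 := funext hφ
  subst this
  have h : exf f (0 : H → ZMod 2) = 0 := by
    unfold exf
    funext g
    by_cases hg : ∃ x, f x = g
    · simp only [Function.extend, hg, dif_pos]; rfl
    · rw [Function.extend_apply' _ _ _ hg]
  induction Z using chain_ind with
  | h0 => simp
  | hadd u v hu hv => rw [map_add, hu, hv, add_zero]
  | hs z a => funext g; rw [cnv_single, h]; simp

/-- left translation of finite chains -/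
noncomputable def tr (g : G) : ((G × Λ) →₀ ZMod 2) →+ ((G × Λ) →₀ ZMod 2) :=
  Finsupp.mapDomain.addMonoidHom fun z => (g * z.1, z.2)

theorem tr_single (g : G) (z : G × Λ) (a : ZMod 2) : tr g (Finsupp.single z a) = Finsupp.single (g * z.1, z.2) a := by
  unfold tr; simp [Finsupp.mapDomain_single]

theorem tr_tr (g g' : G) (Z : (G × Λ) →₀ ZMod 2) : tr g (tr g' Z) = tr (g * g') Z := by
  induction Z using chain_ind with
  | h0 => simp
  | hadd u v hu hv => simp only [map_add, hu, hv]
  | hs z a => rw [tr_single, tr_single, tr_single, mul_assoc]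
theorem tr_one (Z : (G × Λ) →₀ ZMod 2) : tr 1 Z = Z := by
  induction Z using chain_ind with
  | h0 => simp
  | hadd u v hu hv => simp only [map_add, hu, hv]
  | hs z a => rw [tr_single, one_mul]

variable {f} in
theorem cnv_tr (hf : Function.Injective f) (φ : H → ZMod 2) (a : H) (Z : (G × Λ) →₀ ZMod 2) :
    cnv f φ (tr (f a) Z) = cnv f (fun x => φ (x * a⁻¹)) Z := by
  induction Z using chain_ind with
  | h0 => simp
  | hadd u v hu hv => rw [map_add, map_add, map_add, hu, hv]
  | hs z b =>
    funext g
    rw [tr_single, cnv_single, cnv_single, exf_right hf]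
    congr 2
    simp [mul_assoc]

/-- boundary of a finite chain -/
noncomputable def bd (lab : Λ → Λ') : ((G × Λ) →₀ ZMod 2) →+ ((G × Λ') →₀ ZMod 2) :=
  Finsupp.mapDomain.addMonoidHom fun z => (z.1, lab z.2)

theorem bd_single (lab : Λ → Λ') (z : G × Λ) (a : ZMod 2) :
    bd lab (Finsupp.single z a) = Finsupp.single (z.1, lab z.2) a := by
  unfold bd; simp [Finsupp.mapDomain_single]

theorem bd_tr (lab : Λ → Λ') (g : G) (Z : (G × Λ) →₀ ZMod 2) : bd lab (tr g Z) = tr g (bd lab Z) := by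
  induction Z using chain_ind with
  | h0 => simp
  | hadd u v hu hv => simp only [map_add, hu, hv]
  | hs z a => rw [tr_single, bd_single, bd_single, tr_single]

theorem cnv_bd (lab : Λ → Λ') (φ : H → ZMod 2) (Z : (G × Λ) →₀ ZMod 2) (g : G) :
    Finsupp.mapDomain lab (cnv f φ Z g) = cnv f φ (bd lab Z) g := by
  induction Z using chain_ind with
  | h0 => simp
  | hadd u v hu hv => rw [map_add, map_add, map_add, Pi.add_apply, Pi.add_apply, Finsupp.mapDomain_add, hu, hv]
  | hs z a => rw [bd_single, cnv_single, cnv_single, Finsupp.mapDomain_single]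

theorem cnv_supp (hf : Function.Injective f) {φ : H → ZMod 2} {Z : (G × Λ) →₀ ZMod 2} {g : G} {l : Λ}
    (h : cnv f φ Z g l ≠ 0) : ∃ z ∈ Z.support, ∃ x, φ x ≠ 0 ∧ g = f x * z.1 ∧ l = z.2 := by
  have key : cnv f φ Z g l = ∑ z ∈ Z.support, (Finsupp.single z.2 (Z z * exf f φ (g * z.1⁻¹))) l := by
    conv_lhs => rw [← Finsupp.sum_single Z]
    rw [Finsupp.sum, map_sum, Finset.sum_apply, Finsupp.finsetSum_apply]
    simp only [cnv_single]
  rw [key] at h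
  obtain ⟨z, hz, hne⟩ := Finset.exists_ne_zero_of_sum_ne_zero h
  rw [Finsupp.single_apply_ne_zero] at hne
  obtain ⟨x, hx, hx2⟩ := exf_ne f (right_ne_zero_of_mul hne.2) hf
  exact ⟨z, hz, x, hx2, by rw [hx]; simp, hne.1⟩

variable {f} in
/-- locality and equivariance of convolution -/
theorem cnv_congr (hf : Function.Injective f) {φ φ' : H → ZMod 2} (Z : (G × Λ) →₀ ZMod 2) (a : H) (g : G)
    (h : ∀ z ∈ Z.support, ∀ x, f x = g * z.1⁻¹ → φ' (a * x) = φ x) : cnv f φ' Z (f a * g) = cnv f φ Z g := by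
  conv_lhs => rw [← Finsupp.sum_single Z]
  conv_rhs => rw [← Finsupp.sum_single Z]
  rw [Finsupp.sum, map_sum, map_sum, Finset.sum_apply, Finset.sum_apply]
  refine Finset.sum_congr rfl fun z hz => ?_
  rw [cnv_single, cnv_single, exf_congr hf a (mul_assoc _ _ _) (h z hz)]

/-- invariance under an equivariant permutation -/
theorem cnv_inv (φ : H → ZMod 2) (e : Λ → Λ) (he : Function.Injective e) (k : Λ → G) (Z : (G × Λ) →₀ ZMod 2)
    (hZ : Finsupp.mapDomain (fun z : G × Λ => (z.1 * k z.2, e z.2)) Z = Z) (g : G) (l : Λ) :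
    cnv f φ Z (g * k l) (e l) = cnv f φ Z g l := by
  have key : ∀ Z : (G × Λ) →₀ ZMod 2,
      cnv f φ (Finsupp.mapDomain (fun z : G × Λ => (z.1 * k z.2, e z.2)) Z) (g * k l) (e l) = cnv f φ Z g l := by
    intro Z
    induction Z using chain_ind with
    | h0 => simp
    | hadd u v hu hv => rw [Finsupp.mapDomain_add, map_add, map_add, Pi.add_apply, Pi.add_apply, Finsupp.add_apply,
        Finsupp.add_apply, hu, hv]
    | hs z a =>
      classical
      rw [Finsupp.mapDomain_single, cnv_single, cnv_single, Finsupp.single_apply, Finsupp.single_apply]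
      by_cases h : z.2 = l
      · rw [if_pos h, if_pos (by rw [h]), h]; congr 2; group
      · rw [if_neg h, if_neg (fun hh => h (he hh))]
  conv_lhs => rw [← hZ]
  exact key Z
end conv

section fill
variable {S : Type*} [DecidableEq S] {R : Set (FreeGroup S)} (hS : FG.Symmetrized R)

theorem chain_self {A : Type*} (u : A →₀ ZMod 2) : u + u = 0 := by
  ext a; rw [Finsupp.add_apply]; exact CharTwo.add_self_eq_zero _

noncomputable def ech (R : Set (FreeGroup S)) (l : S × Bool) : (PresentedGroup R × (S × Bool)) →₀ ZMod 2 :=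
  Finsupp.single (1, l) 1 + Finsupp.single (ev R l, ivL l) 1

theorem ech_iv (l : S × Bool) : tr (ev R l) (ech R (ivL l)) = ech R l := by
  unfold ech
  rw [map_add, tr_single, tr_single, ev_iv]
  have : ivL (ivL l) = l := by unfold ivL; simp
  rw [this]; simp only [mul_one, mul_inv_cancel]
  rw [add_comm]

theorem evs_nil : evs R ([] : List (S × Bool)) = 1 := by unfold evs; exact map_one _
theorem evs_cons (l : S × Bool) (w : List (S × Bool)) : evs R (l :: w) = ev R l * evs R w := by
  have := evs_append (R := R) [l] w
  exact this

noncomputable def pc (R : Set (FreeGroup S)) : List (S × Bool) → ((PresentedGroup R × (S × Bool)) →₀ ZMod 2)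
  | [] => 0
  | l :: w => ech R l + tr (ev R l) (pc R w)

theorem pc_append (u v : List (S × Bool)) : pc R (u ++ v) = pc R u + tr (evs R u) (pc R v) := by
  induction u with
  | nil => simp [pc, evs_nil, tr_one]
  | cons l u ih => rw [List.cons_append, pc, pc, ih, map_add, tr_tr, evs_cons, add_assoc]

theorem pc_step {u v : List (S × Bool)} (h : FreeGroup.Red.Step u v) : pc R u = pc R v := by
  cases h with
  | @not L1 L2 x b =>
    rw [pc_append, pc_append]
    congr 2
    rw [pc, pc, map_add, tr_tr]
    have h1 : ((x, !b) : S × Bool) = ivL (x, b) := rfl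
    rw [h1, ech_iv, ev_iv, mul_inv_cancel, tr_one, ← add_assoc, chain_self, zero_add]

theorem pc_red {u v : List (S × Bool)} (h : FreeGroup.Red u v) : pc R u = pc R v := by
  induction h with
  | refl => rfl
  | tail _ h ih => rw [ih, pc_step h]

noncomputable def pF (R : Set (FreeGroup S)) (x : FreeGroup S) : (PresentedGroup R × (S × Bool)) →₀ ZMod 2 := pc R x.toWord

theorem pF_mk (w : List (S × Bool)) : pF R (FreeGroup.mk w) = pc R w := by
  unfold pF
  rw [FreeGroup.toWord_mk]
  exact (pc_red FreeGroup.reduce.red).symm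

theorem pF_mul (x y : FreeGroup S) : pF R (x * y) = pF R x + tr (PresentedGroup.mk R x) (pF R y) := by
  conv_lhs => rw [← FreeGroup.mk_toWord (x := x), ← FreeGroup.mk_toWord (x := y), FreeGroup.mul_mk, pF_mk, pc_append]
  unfold pF evs
  rw [FreeGroup.mk_toWord]

theorem pF_one : pF R (1 : FreeGroup S) = 0 := by
  unfold pF; rw [FreeGroup.toWord_one]; rfl

theorem pF_inv (x : FreeGroup S) : pF R x⁻¹ = tr (PresentedGroup.mk R x)⁻¹ (pF R x) := by
  have h := pF_mul (R := R) x⁻¹ x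
  rw [inv_mul_cancel, pF_one, map_inv] at h
  have := congrArg (· + tr (PresentedGroup.mk R x)⁻¹ (pF R x)) h
  simp only [zero_add, add_assoc, chain_self, add_zero] at this
  exact this.symm

/-- an invariant 2-chain -/
def IC (Z : (PresentedGroup R × RW R) →₀ ZMod 2) : Prop :=
  Finsupp.mapDomain (GX hS).nx Z = Z ∧ Finsupp.mapDomain (GX hS).rv Z = Z

theorem GX_tr_nx (g : PresentedGroup R) (c : PresentedGroup R × RW R) :
    (GX hS).nx (g * c.1, c.2) = (g * ((GX hS).nx c).1, ((GX hS).nx c).2) := by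
  show (g * c.1 * ev R ((WX hS).lab c.2), (WX hS).nx c.2) = (g * (c.1 * ev R ((WX hS).lab c.2)), (WX hS).nx c.2)
  rw [mul_assoc]

variable {hS} in
theorem IC.tr {Z : (PresentedGroup R × RW R) →₀ ZMod 2} (h : IC hS Z) (g : PresentedGroup R) : IC hS (tr g Z) := by
  constructor
  · conv_rhs => rw [← h.1]
    unfold _root_.tr
    simp only [Finsupp.mapDomain.addMonoidHom, AddMonoidHom.coe_mk, ZeroHom.coe_mk]
    rw [← Finsupp.mapDomain_comp, ← Finsupp.mapDomain_comp]
    congr 1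
    funext c; exact GX_tr_nx hS g c
  · conv_rhs => rw [← h.2]
    unfold _root_.tr
    simp only [Finsupp.mapDomain.addMonoidHom, AddMonoidHom.coe_mk, ZeroHom.coe_mk]
    rw [← Finsupp.mapDomain_comp, ← Finsupp.mapDomain_comp]
    rfl

variable {hS} in
theorem IC.add {Z Z' : (PresentedGroup R × RW R) →₀ ZMod 2} (h : IC hS Z) (h' : IC hS Z') : IC hS (Z + Z') := by
  unfold IC at *
  rw [Finsupp.mapDomain_add, Finsupp.mapDomain_add, h.1, h.2, h'.1, h'.2]; exact ⟨rfl, rfl⟩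

theorem IC.zero : IC hS 0 := ⟨Finsupp.mapDomain_zero, Finsupp.mapDomain_zero⟩

theorem sum_cyc {M : Type*} [AddCommGroup M] (n : ℕ) (F : ℤ → M) (h : F n = F 0) :
    ∑ i ∈ Finset.range n, F ((i : ℤ) + 1) = ∑ i ∈ Finset.range n, F i := by
  have h1 := Finset.sum_range_succ (fun i : ℕ => F i) n
  have h2 := Finset.sum_range_succ' (fun i : ℕ => F i) n
  rw [h1] at h2
  simp only [Nat.cast_add, Nat.cast_one, Nat.cast_zero] at h2
  rw [h] at h2
  exact (add_right_cancel h2).symm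

theorem pc_pre (w : RW R) (n : ℕ) : pc R (pre (WX hS) w n) =
    ∑ i ∈ Finset.range n, (Finsupp.single (((GX hS).at' (1, w) i).1, (GX hS).lab ((GX hS).at' (1, w) i)) 1 +
      Finsupp.single (((GX hS).at' (1, w) (i+1)).1, (GX hS).lab ((GX hS).rv ((GX hS).at' (1, w) (i+1)))) 1) := by
  induction n with
  | zero => simp [pre, pc]
  | succ n ih =>
    rw [pre_succ, pc_append, ih, Finset.sum_range_succ]
    congr 1
    have h1 : (GX hS).at' (1, w) (n:ℤ) = (evs R (pre (WX hS) w n), (WX hS).at' w n) := by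
      have := gnx_pow hS (1, w) n
      rw [one_mul] at this
      rw [← this]
      show ((GX hS).nx ^ (n:ℤ)) (1, w) = _
      rw [zpow_natCast]; rfl
    have h2 : (GX hS).lab ((GX hS).rv ((GX hS).at' (1, w) ((n:ℤ)+1))) = ivL ((GX hS).lab ((GX hS).at' (1, w) n)) := by
      rw [← (GX hS).nx_at, (GX hS).lab_rv]; rfl
    have h3 : ((GX hS).at' (1, w) ((n:ℤ)+1)).1 = evs R (pre (WX hS) w n) * ev R ((WX hS).lab ((WX hS).at' w n)) := by
      rw [← (GX hS).nx_at, h1]; rfl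
    rw [h2, h3, h1]
    simp only [pc, map_zero, add_zero, ech, map_add]
    rw [tr_single, tr_single]
    simp only [mul_one]
    rfl

theorem fill_rel (w : RW R) : ∃ Z, IC hS Z ∧ bd (WX hS).lab Z = pc R w.1 := by
  let c : PresentedGroup R × RW R := (1, w)
  obtain ⟨A, hA⟩ : ∃ A : ℤ → ((PresentedGroup R × RW R) →₀ ZMod 2), A = fun i => Finsupp.single ((GX hS).at' c i) 1 := ⟨_, rfl⟩
  obtain ⟨B, hB⟩ : ∃ B : ℤ → ((PresentedGroup R × RW R) →₀ ZMod 2), B = fun i => Finsupp.single ((GX hS).rv ((GX hS).at' c i)) 1 := ⟨_, rfl⟩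
  have hl : (GX hS).at' c w.1.length = c := (GX hS).at_len c
  have hA0 : A w.1.length = A 0 := by rw [hA]; beta_reduce; rw [hl, (GX hS).at_zero]
  have hB0 : B w.1.length = B 0 := by rw [hB]; beta_reduce; rw [hl, (GX hS).at_zero]
  have nA : ∀ i, Finsupp.mapDomain (GX hS).nx (A i) = A (i+1) := by
    intro i; rw [hA]; beta_reduce; rw [Finsupp.mapDomain_single, (GX hS).nx_at]
  have nB : ∀ i, Finsupp.mapDomain (GX hS).nx (B (i+1)) = B i := by
    intro i; rw [hB]; beta_reduce; rw [Finsupp.mapDomain_single, CX.nx_rv, ← CX.at_neg_one, CX.at_at]; simp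
  have rA : ∀ i, Finsupp.mapDomain (GX hS).rv (A i) = B i := by
    intro i; rw [hA, hB]; beta_reduce; rw [Finsupp.mapDomain_single]
  have rB : ∀ i, Finsupp.mapDomain (GX hS).rv (B i) = A i := by
    intro i; rw [hA, hB]; beta_reduce; rw [Finsupp.mapDomain_single, (GX hS).rv_rv]
  refine ⟨∑ i ∈ Finset.range w.1.length, A i + ∑ i ∈ Finset.range w.1.length, B i, ⟨?_, ?_⟩, ?_⟩
  · rw [Finsupp.mapDomain_add, ← sum_cyc _ B hB0, Finsupp.mapDomain_finsetSum, Finsupp.mapDomain_finsetSum]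
    simp only [nA, nB]
    rw [sum_cyc _ A hA0, sum_cyc _ B hB0]
  · rw [Finsupp.mapDomain_add, Finsupp.mapDomain_finsetSum, Finsupp.mapDomain_finsetSum]
    simp only [rA, rB]
    exact add_comm _ _
  · rw [← sum_cyc _ B hB0, ← Finset.sum_add_distrib, map_sum]
    conv_rhs => rw [← pre_full hS w, pc_pre]
    refine Finset.sum_congr rfl fun i _ => ?_
    rw [hA, hB, map_add]; beta_reduce
    rw [bd_single, bd_single]
    rfl

theorem fill (x : FreeGroup S) (hx : PresentedGroup.mk R x = 1) : ∃ Z, IC hS Z ∧ bd (WX hS).lab Z = pF R x := by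
  let N : Subgroup (FreeGroup S) :=
    { carrier := {x | PresentedGroup.mk R x = 1 ∧ ∃ Z, IC hS Z ∧ bd (WX hS).lab Z = pF R x}
      one_mem' := ⟨map_one _, 0, IC.zero hS, by rw [pF_one, map_zero]⟩
      mul_mem' := by
        rintro a b ⟨ha, Z, h1, h2⟩ ⟨hb, Z', h3, h4⟩
        refine ⟨by rw [map_mul, ha, hb, mul_one], Z + Z', h1.add h3, ?_⟩
        rw [map_add, h2, h4, pF_mul, ha, tr_one]
      inv_mem' := by
        rintro a ⟨ha, Z, h1, h2⟩
        refine ⟨by rw [map_inv, ha, inv_one], Z, h1, ?_⟩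
        rw [pF_inv, ha, inv_one, tr_one, h2] }
  have hN : N.Normal := by
    constructor
    rintro a ⟨ha, Z, h1, h2⟩ g
    refine ⟨by rw [map_mul, map_mul, ha, mul_one, ← map_mul, mul_inv_cancel, map_one], tr (PresentedGroup.mk R g) Z, h1.tr _, ?_⟩
    rw [bd_tr, h2, pF_mul, pF_mul, map_mul, ha, mul_one, pF_inv, tr_tr, mul_inv_cancel, tr_one, add_comm (pF R g),
      add_assoc, chain_self, add_zero]
  have hle : Subgroup.normalClosure R ≤ N := by
    apply Subgroup.normalClosure_le_normal
    intro r hr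
    have hw : r.toWord ∈ RW R := ⟨r, hr, rfl⟩
    obtain ⟨Z, h1, h2⟩ := fill_rel hS ⟨r.toWord, hw⟩
    exact ⟨PresentedGroup.one_of_mem hr, Z, h1, h2⟩
  have hm : x ∈ Subgroup.normalClosure R := (QuotientGroup.eq_one_iff x).1 hx
  exact (hle hm).2

/-- filling of a commutator -/
theorem fill_comm (x y : FreeGroup S) (h : PresentedGroup.mk R x * PresentedGroup.mk R y = PresentedGroup.mk R y * PresentedGroup.mk R x) :
    ∃ Z, IC hS Z ∧ bd (WX hS).lab Z = pF R x + tr (PresentedGroup.mk R x) (pF R y) +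
      (tr (PresentedGroup.mk R y) (pF R x) + pF R y) := by
  obtain ⟨a, ha⟩ : ∃ a, a = PresentedGroup.mk R x := ⟨_, rfl⟩
  obtain ⟨b, hb⟩ : ∃ b, b = PresentedGroup.mk R y := ⟨_, rfl⟩
  rw [← ha, ← hb] at h
  obtain ⟨Z, h1, h2⟩ := fill hS (x * y * x⁻¹ * y⁻¹) (by
    simp only [map_mul, map_inv, ← ha, ← hb]; rw [h]; group)
  refine ⟨Z, h1, ?_⟩
  rw [h2, pF_mul, pF_mul, pF_mul, pF_inv, pF_inv]
  simp only [map_mul, map_inv, ← ha, ← hb, tr_tr]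
  rw [h]
  simp only [mul_assoc, mul_inv_cancel, mul_one, tr_one]
  exact add_assoc _ _ _
end fill

section prod
variable {S A : Type*} [DecidableEq S] [Group A] {R : Set (FreeGroup S)} {hS : FG.Symmetrized R}

theorem mapDomain_count {Λ Λ' : Type*} (p : Λ → Λ') (u : Λ →₀ ZMod 2) (b : Λ') :
    Finsupp.mapDomain p u b = (({a | u a ≠ 0 ∧ p a = b}.ncard : ℕ) : ZMod 2) := by
  classical
  have h1 : {a | u a ≠ 0 ∧ p a = b} = ↑(u.support.filter (fun a => p a = b)) := by
    ext a; simp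
  rw [h1, Set.ncard_coe_finset, Finsupp.mapDomain, Finsupp.sum_apply, Finsupp.sum]
  rw [Finset.card_eq_sum_ones, Nat.cast_sum, Finset.sum_filter]
  refine Finset.sum_congr rfl fun a ha => ?_
  have h2 : ∀ z : ZMod 2, z ≠ 0 → z = 1 := by decide
  rw [Finsupp.single_apply, h2 _ (Finsupp.mem_support_iff.1 ha), Nat.cast_one]

variable (hS) in
theorem ev_iff (C : PresentedGroup R → (RW R →₀ ZMod 2)) (c : PresentedGroup R × RW R) :
    (GX hS).Ev (fun c => C c.1 c.2 ≠ 0) c ↔ Finsupp.mapDomain (WX hS).lab (C c.1) ((WX hS).lab c.2) = 0 := by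
  rw [mapDomain_count, CX.Ev, ← ZMod.natCast_eq_zero_iff_even]
  have : {c' | C c'.1 c'.2 ≠ 0 ∧ (GX hS).SD c' c} =
      (fun w => (c.1, w)) '' {w | C c.1 w ≠ 0 ∧ (WX hS).lab w = (WX hS).lab c.2} := by
    ext ⟨g, w⟩
    simp only [Set.mem_ofPred_eq, Set.mem_image, Prod.mk.injEq]
    constructor
    · rintro ⟨h1, h2, h3⟩
      have h2 : g = c.1 := h2
      subst h2
      exact ⟨w, ⟨h1, h3⟩, rfl, rfl⟩
    · rintro ⟨w', ⟨h1, h2⟩, rfl, rfl⟩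
      exact ⟨h1, rfl, h2⟩
  rw [this, Set.ncard_image_of_injective _ (fun a b h => (Prod.mk.inj h).2)]

/-- the data of commuting families with fillings -/
structure Dat (hS : FG.Symmetrized R) (A : Type*) [Group A] where
  f : A × A →* PresentedGroup R
  inj : Function.Injective f
  gen : Fin 2 → A
  xw : Fin 2 → FreeGroup S
  yw : Fin 2 → FreeGroup S
  hx : ∀ s, PresentedGroup.mk R (xw s) = f (gen s, 1)
  hy : ∀ s, PresentedGroup.mk R (yw s) = f (1, gen s)
  cc : Fin 2 → Fin 2 → ((PresentedGroup R × RW R) →₀ ZMod 2)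
  ic : ∀ s t, IC hS (cc s t)
  bdc : ∀ s t, bd (WX hS).lab (cc s t) = pF R (xw s) + tr (f (gen s, 1)) (pF R (yw t)) +
      (tr (f (1, gen t)) (pF R (xw s)) + pF R (yw t))

theorem Dat.ex (hS : FG.Symmetrized R) (f : A × A →* PresentedGroup R) (hf : Function.Injective f) (gen : Fin 2 → A) :
    ∃ D : Dat hS A, D.f = f ∧ D.gen = gen := by
  have h1 : ∀ s, ∃ x, PresentedGroup.mk R x = f (gen s, 1) := fun s => PresentedGroup.mk_surjective R _
  have h2 : ∀ s, ∃ x, PresentedGroup.mk R x = f (1, gen s) := fun s => PresentedGroup.mk_surjective R _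
  choose xw hx using h1
  choose yw hy using h2
  have h3 : ∀ s t, ∃ Z, IC hS Z ∧ bd (WX hS).lab Z = pF R (xw s) + tr (f (gen s, 1)) (pF R (yw t)) +
      (tr (f (1, gen t)) (pF R (xw s)) + pF R (yw t)) := by
    intro s t
    have := fill_comm hS (xw s) (yw t) (by rw [hx, hy, ← map_mul, ← map_mul]; simp)
    rwa [hx, hy] at this
  choose cc ic bdc using h3
  exact ⟨⟨f, hf, gen, xw, yw, hx, hy, cc, ic, bdc⟩, rfl, rfl⟩

def tens (u v : A → ZMod 2) : A × A → ZMod 2 := fun h => u h.1 * v h.2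

namespace Dat
variable (D : Dat hS A)

noncomputable def PP (l m : Fin 2 → A → ZMod 2) : PresentedGroup R → (RW R →₀ ZMod 2) :=
  ∑ s, ∑ t, cnv D.f (tens (l s) (m t)) (D.cc s t)

def dl (l : Fin 2 → A → ZMod 2) : A → ZMod 2 := fun a => ∑ s, (l s a + l s (a * (D.gen s)⁻¹))

noncomputable def cnvH {Λ : Type*} (Z : (PresentedGroup R × Λ) →₀ ZMod 2) :
    (A × A → ZMod 2) →+ (PresentedGroup R → (Λ →₀ ZMod 2)) :=
  { toFun := fun φ => cnv D.f φ Z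
    map_zero' := cnv_zero _ _ (fun _ => rfl) _
    map_add' := fun a b => cnv_add D.inj a b Z }

theorem cnvH_app {Λ : Type*} (Z : (PresentedGroup R × Λ) →₀ ZMod 2) (φ : A × A → ZMod 2) :
  D.cnvH Z φ = cnv D.f φ Z := rfl

theorem PP_eq (l m : Fin 2 → A → ZMod 2) : D.PP l m = ∑ s, ∑ t, D.cnvH (D.cc s t) (tens (l s) (m t)) := rfl

theorem tens_add_left (u u' v : A → ZMod 2) : tens (u + u') v = tens u v + tens u' v := by
  funext h; simp [tens, add_mul]
theorem tens_add_right (u v v' : A → ZMod 2) : tens u (v + v') = tens u v + tens u v' := by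
  funext h; simp [tens, mul_add]

theorem PP_add_left (l l' m : Fin 2 → A → ZMod 2) : D.PP (l + l') m = D.PP l m + D.PP l' m := by
  simp only [PP_eq, Pi.add_apply, tens_add_left, map_add, Finset.sum_add_distrib]
theorem PP_add_right (l m m' : Fin 2 → A → ZMod 2) : D.PP l (m + m') = D.PP l m + D.PP l m' := by
  simp only [PP_eq, Pi.add_apply, tens_add_right, map_add, Finset.sum_add_distrib]

theorem PP_apply (l m : Fin 2 → A → ZMod 2) (g : PresentedGroup R) :
    D.PP l m g = ∑ s, ∑ t, cnv D.f (tens (l s) (m t)) (D.cc s t) g := by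
  unfold PP; simp only [Finset.sum_apply]

noncomputable def B1 (l m : Fin 2 → A → ZMod 2) : PresentedGroup R → ((S × Bool) →₀ ZMod 2) :=
  ∑ s, cnv D.f (tens (l s) (D.dl m)) (pF R (D.xw s))
noncomputable def B2 (l m : Fin 2 → A → ZMod 2) : PresentedGroup R → ((S × Bool) →₀ ZMod 2) :=
  ∑ t, cnv D.f (tens (D.dl l) (m t)) (pF R (D.yw t))

theorem bd_PP (l m : Fin 2 → A → ZMod 2) (g : PresentedGroup R) :
    Finsupp.mapDomain (WX hS).lab (D.PP l m g) = D.B1 l m g + D.B2 l m g := by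
  have key : ∀ s t, cnv D.f (tens (l s) (m t)) (bd (WX hS).lab (D.cc s t)) =
      D.cnvH (pF R (D.xw s)) (tens (l s) (fun a => m t a + m t (a * (D.gen t)⁻¹))) +
      D.cnvH (pF R (D.yw t)) (tens (fun a => l s a + l s (a * (D.gen s)⁻¹)) (m t)) := by
    intro s t
    rw [D.bdc, map_add, map_add, map_add, cnv_tr D.inj, cnv_tr D.inj]
    have h1 : tens (l s) (fun a => m t a + m t (a * (D.gen t)⁻¹)) = tens (l s) (m t) +
        (fun x => tens (l s) (m t) (x * ((1, D.gen t) : A × A)⁻¹)) := by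
      funext x; simp [tens, mul_add]
    have h2 : tens (fun a => l s a + l s (a * (D.gen s)⁻¹)) (m t) = tens (l s) (m t) +
        (fun x => tens (l s) (m t) (x * ((D.gen s, 1) : A × A)⁻¹)) := by
      funext x; simp [tens, add_mul]
    rw [h1, h2, map_add, map_add]
    simp only [cnvH_app]
    abel
  rw [PP_apply, Finsupp.mapDomain_finsetSum]
  simp only [Finsupp.mapDomain_finsetSum, cnv_bd, key, Pi.add_apply, Finset.sum_add_distrib]
  congr 1
  · unfold B1
    rw [Finset.sum_apply]
    refine Finset.sum_congr rfl fun s _ => ?_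
    have : tens (l s) (D.dl m) = ∑ t, tens (l s) (fun a => m t a + m t (a * (D.gen t)⁻¹)) := by
      funext x; simp only [tens, dl, Finset.sum_apply, Finset.mul_sum]
    rw [this, ← cnvH_app, map_sum, Finset.sum_apply]
  · unfold B2
    rw [Finset.sum_apply, Finset.sum_comm]
    refine Finset.sum_congr rfl fun t _ => ?_
    have : tens (D.dl l) (m t) = ∑ s, tens (fun a => l s a + l s (a * (D.gen s)⁻¹)) (m t) := by
      funext x; simp only [tens, dl, Finset.sum_apply, Finset.sum_mul]
    rw [this, ← cnvH_app, map_sum, Finset.sum_apply]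

theorem PP_nx (l m : Fin 2 → A → ZMod 2) (c : PresentedGroup R × RW R) :
    D.PP l m ((GX hS).nx c).1 ((GX hS).nx c).2 = D.PP l m c.1 c.2 := by
  rw [PP_apply, PP_apply]
  simp only [Finsupp.finsetSum_apply]
  refine Finset.sum_congr rfl fun s _ => Finset.sum_congr rfl fun t _ => ?_
  exact cnv_inv D.f _ (WX hS).nx (WX hS).nx.injective (fun w => ev R ((WX hS).lab w)) (D.cc s t) (D.ic s t).1 c.1 c.2

theorem PP_rv (l m : Fin 2 → A → ZMod 2) (c : PresentedGroup R × RW R) :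
    D.PP l m ((GX hS).rv c).1 ((GX hS).rv c).2 = D.PP l m c.1 c.2 := by
  rw [PP_apply, PP_apply]
  simp only [Finsupp.finsetSum_apply]
  refine Finset.sum_congr rfl fun s _ => Finset.sum_congr rfl fun t _ => ?_
  have := cnv_inv D.f (tens (l s) (m t)) (WX hS).rv (fun a b h => (WX hS).rv_inj h) (fun _ => 1) (D.cc s t) (by
    have := (D.ic s t).2
    simp only [mul_one]
    exact this) c.1 c.2
  rw [mul_one] at this
  exact this

/-- support cells -/
def Fs (l m : Fin 2 → A → ZMod 2) (c : PresentedGroup R × RW R) : Prop := D.PP l m c.1 c.2 ≠ 0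

theorem Fs_inv (l m : Fin 2 → A → ZMod 2) : (GX hS).Inv (D.Fs l m) := by
  constructor
  · intro c hc; unfold Fs at *; rwa [PP_nx]
  · intro c hc; unfold Fs at *; rwa [PP_rv]

theorem PP_congr {l l' m m' : Fin 2 → A → ZMod 2} (a b : A) (g : PresentedGroup R)
    (h : ∀ s t, ∀ z ∈ (D.cc s t).support, ∀ x, D.f x = g * z.1⁻¹ →
      (∀ s, l' s (a * x.1) = l s x.1) ∧ ∀ t, m' t (b * x.2) = m t x.2) :
    D.PP l' m' (D.f (a, b) * g) = D.PP l m g := by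
  rw [PP_apply, PP_apply]
  refine Finset.sum_congr rfl fun s _ => Finset.sum_congr rfl fun t _ => ?_
  apply cnv_congr D.inj
  intro z hz x hx
  obtain ⟨h1, h2⟩ := h s t z hz x hx
  simp only [tens, Prod.fst_mul, Prod.snd_mul, h1, h2]

theorem PP_supp {l m : Fin 2 → A → ZMod 2} {g : PresentedGroup R} {w : RW R} (h : D.PP l m g w ≠ 0) :
    ∃ s t, ∃ z ∈ (D.cc s t).support, ∃ x : A × A, l s x.1 ≠ 0 ∧ m t x.2 ≠ 0 ∧ g = D.f x * z.1 ∧ w = z.2 := by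
  rw [PP_apply] at h
  simp only [Finsupp.finsetSum_apply] at h
  obtain ⟨s, -, h⟩ := Finset.exists_ne_zero_of_sum_ne_zero h
  obtain ⟨t, -, h⟩ := Finset.exists_ne_zero_of_sum_ne_zero h
  obtain ⟨z, hz, x, hx, h1, h2⟩ := cnv_supp D.f D.inj h
  exact ⟨s, t, z, hz, x, left_ne_zero_of_mul hx, right_ne_zero_of_mul hx, h1, h2⟩

end Dat
end prod

namespace CX
variable {P V L : Type*} {X : CX P V L}

theorem T_at {T : Equiv.Perm P} (hn : ∀ c, T (X.nx c) = X.nx (T c)) (c : P) (i : ℤ) : T (X.at' c i) = X.at' (T c) i := by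
  induction i using Int.induction_on with
  | zero => simp
  | succ i ih => rw [← X.nx_at, hn, ih, X.nx_at]
  | pred i ih =>
    have : X.nx (T (X.at' c (-(i:ℤ) - 1))) = X.nx (X.at' (T c) (-(i:ℤ)-1)) := by
      rw [← hn, X.nx_at, X.nx_at, sub_add_cancel, ih]
    exact X.nx.injective this

theorem Honey.transfer {F F' : P → Prop} {c : P} (T : Equiv.Perm P) (hn : ∀ c, T (X.nx c) = X.nx (T c))
    (hr : ∀ c, T (X.rv c) = X.rv (T c)) (hsd : ∀ a b, X.SD (T a) (T b) ↔ X.SD a b) (hlen : ∀ c, X.len (T c) = X.len c)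
    (hF : ∀ j b, X.vtx b = X.vtx (X.at' c j) → (F' (T b) ↔ F b)) (h : X.Honey F' (T c)) : X.Honey F c := by
  have hO : ∀ j a b, X.vtx a = X.vtx (X.at' c j) → (X.O F' (T a) (T b) ↔ X.O F a b) := by
    intro j a b ha
    unfold O
    rw [hsd]
    constructor
    · rintro ⟨h1, h2, h3⟩
      exact ⟨(hF j b (h3.1.trans ha)).1 h1, fun e => h2 (by rw [e]), h3⟩
    · rintro ⟨h1, h2, h3⟩
      exact ⟨(hF j b (h3.1.trans ha)).2 h1, fun e => h2 (T.injective e), h3⟩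
  constructor
  · intro i
    obtain ⟨d, h1, h2⟩ := h.h1 i
    obtain ⟨d, rfl⟩ := T.surjective d
    rw [← T_at hn, hO i _ _ rfl] at h1
    refine ⟨d, h1, fun e he => ?_⟩
    apply T.injective
    apply h2
    rw [← T_at hn, hO i _ _ rfl]; exact he
  · obtain ⟨B, hB, h2⟩ := h.h2
    refine ⟨B, hB, fun i hi d hd => ?_⟩
    have := h2 i (by rwa [hlen]) (T d) (by rw [← T_at hn, hO i _ _ rfl]; exact hd)
    rwa [← T_at hn, ← hn, hO (i+1) _ _ rfl] at this
  · intro i d e hd he hne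
    have h3 := h.h3 i (T d) (T e) (by rw [← T_at hn, hO i _ _ rfl]; exact hd)
      (by rw [← T_at hn, ← hn, hO (i+1) _ _ (by rw [X.nx_at])]; exact he)
      (by rw [← hn]; exact fun hh => hne (T.injective hh))
    rwa [← hn, ← hr, hO (i+1)] at h3
    rw [← X.nx_at]
    exact X.det _ _ hd.2.2.1 hd.2.2.2

theorem vtx_fin (X : CX P V L) (c : P) : ∃ W : Finset V, ∀ i, X.vtx (X.at' c i) ∈ W := by
  classical
  refine ⟨(Finset.Ico 0 (X.len c)).image fun i => X.vtx (X.at' c i), fun i => ?_⟩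
  rw [Finset.mem_image]
  have hp := X.len_pos c
  exact ⟨i % X.len c, Finset.mem_Ico.2 ⟨Int.emod_nonneg _ hp.ne', Int.emod_lt_of_pos _ hp⟩, by rw [X.at_emod]⟩

end CX

namespace Dat
variable {S A : Type*} [DecidableEq S] [Group A] {R : Set (FreeGroup S)} {hS : FG.Symmetrized R} (D : Dat hS A)

def Per (l : Fin 2 → A → ZMod 2) : Prop := ∀ A0 : Finset A, ∃ (τ : A) (C : ℕ), (Function.Injective fun k : ℕ => τ ^ k) ∧
  ∀ n : ℕ, ∃ σ : Fin 2 → A → ZMod 2, (∃ E : Finset A, E.card ≤ C * n ∧ ∀ s a, σ s a ≠ 0 → a ∈ E) ∧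
    (∃ E : Finset A, E.card ≤ 2 ∧ ∀ a, D.dl σ a ≠ 0 → a ∈ E) ∧ ∀ j < n, ∀ a ∈ A0, ∀ s, σ s (τ ^ j * a) = l s a

theorem Per.of {l : Fin 2 → A → ZMod 2} (h : ∀ A0 : Finset A, ∃ (τ a0 : A) (sg : Fin 2 → A → ZMod 2) (E : Finset A),
    (Function.Injective fun k : ℕ => τ ^ k) ∧ (∀ s a, sg s a ≠ 0 → a ∈ E) ∧
    (∀ a, D.dl sg a = Set.indicator {a0} 1 a + Set.indicator {a0} 1 (τ⁻¹ * a)) ∧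
    (∀ a ∈ A0, ∀ s, sg s a = l s a) ∧ (∀ j : ℤ, j ≠ 0 → ∀ a ∈ A0, ∀ s, sg s (τ ^ j * a) = 0)) : D.Per l := by
  classical
  intro A0
  obtain ⟨τ, a0, sg, E, hi, h1, h2, h3, h4⟩ := h A0
  refine ⟨τ, E.card, hi, fun n => ⟨fun s a => ∑ k ∈ Finset.range n, sg s ((τ ^ k)⁻¹ * a), ?_, ?_, ?_⟩⟩
  · refine ⟨(E ×ˢ Finset.range n).image fun p => τ ^ p.2 * p.1, ?_, ?_⟩
    · refine Finset.card_image_le.trans ?_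
      rw [Finset.card_product, Finset.card_range]
    · intro s a ha
      obtain ⟨k, hk, hne⟩ := Finset.exists_ne_zero_of_sum_ne_zero ha
      exact Finset.mem_image.2 ⟨((τ ^ k)⁻¹ * a, k), Finset.mem_product.2 ⟨h1 _ _ hne, hk⟩, by simp⟩
  · refine ⟨{a0, τ ^ n * a0}, Finset.card_le_two, fun a => ?_⟩
    have key : D.dl (fun s a => ∑ k ∈ Finset.range n, sg s ((τ ^ k)⁻¹ * a)) a =
        Set.indicator {a0} 1 a + Set.indicator {a0} 1 ((τ ^ n)⁻¹ * a) := by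
      have e1 : D.dl (fun s a => ∑ k ∈ Finset.range n, sg s ((τ ^ k)⁻¹ * a)) a =
          ∑ k ∈ Finset.range n, D.dl sg ((τ ^ k)⁻¹ * a) := by
        unfold dl
        rw [Finset.sum_comm]
        refine Finset.sum_congr rfl fun s _ => ?_
        rw [Finset.sum_add_distrib]
        simp only [mul_assoc]
      rw [e1]
      clear e1
      induction n with
      | zero => simp [CharTwo.add_self_eq_zero]
      | succ n ih =>
        rw [Finset.sum_range_succ, ih, h2]
        have : τ⁻¹ * ((τ ^ n)⁻¹ * a) = (τ ^ (n+1))⁻¹ * a := by rw [pow_succ, mul_inv_rev, mul_assoc]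
        rw [this]
        have h5 : ∀ x y z : ZMod 2, x + y + (y + z) = x + z := by decide
        exact h5 _ _ _
    intro ha
    rw [key] at ha
    rw [Finset.mem_insert, Finset.mem_singleton]
    by_contra hc
    push Not at hc
    apply ha
    rw [Set.indicator_of_notMem, Set.indicator_of_notMem, add_zero]
    · rw [Set.mem_singleton_iff, inv_mul_eq_iff_eq_mul]; exact hc.2
    · rw [Set.mem_singleton_iff]; exact hc.1
  · intro j hj a ha s
    beta_reduce
    rw [Finset.sum_eq_single j, inv_mul_cancel_left, h3 a ha]
    · intro k _ hk
      have e : (τ ^ k)⁻¹ * (τ ^ j * a) = τ ^ ((j:ℤ) - k) * a := by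
        rw [← mul_assoc, ← zpow_natCast, ← zpow_natCast, ← zpow_neg, ← zpow_add]
        congr 2; ring
      rw [e]
      exact h4 ((j:ℤ) - k) (by omega) a ha s
    · intro hh; exact absurd (Finset.mem_range.2 hj) hh

variable {D}

theorem nextW (l m : Fin 2 → A → ZMod 2) (W : Finset (PresentedGroup R)) : ∃ W' : Finset (PresentedGroup R), W ⊆ W' ∧
    ∀ c, D.Fs l m c → c.1 ∈ W → ∀ i, ((GX hS).at' c i).1 ∈ W' := by
  classical
  have h : ∀ c : PresentedGroup R × RW R, ∃ W : Finset (PresentedGroup R), ∀ i, ((GX hS).at' c i).1 ∈ W := fun c => (GX hS).vtx_fin c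
  choose vf hvf using h
  refine ⟨W ∪ W.biUnion fun g => (D.PP l m g).support.biUnion fun w => vf (g, w), Finset.subset_union_left, ?_⟩
  intro c hc hw i
  refine Finset.mem_union_right _ (Finset.mem_biUnion.2 ⟨c.1, hw, Finset.mem_biUnion.2 ⟨c.2, ?_, hvf _ _⟩⟩)
  exact Finsupp.mem_support_iff.2 hc

/-- left translation of cells -/
def tc (g : PresentedGroup R) : Equiv.Perm (PresentedGroup R × RW R) where
  toFun c := (g * c.1, c.2)
  invFun c := (g⁻¹ * c.1, c.2)
  left_inv c := by simp
  right_inv c := by simp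

theorem tc_nx (g : PresentedGroup R) (c : PresentedGroup R × RW R) : tc g ((GX hS).nx c) = (GX hS).nx (tc g c) :=
  (GX_tr_nx hS g c).symm
theorem tc_at (g : PresentedGroup R) (c : PresentedGroup R × RW R) (i : ℤ) :
    tc g ((GX hS).at' c i) = (GX hS).at' (tc g c) i := CX.T_at (tc_nx g) c i

theorem B1_supp {l m : Fin 2 → A → ZMod 2} {g : PresentedGroup R} {b : S × Bool} (h : D.B1 l m g b ≠ 0) :
    ∃ s, ∃ z ∈ (pF R (D.xw s)).support, ∃ x : A × A, l s x.1 ≠ 0 ∧ D.dl m x.2 ≠ 0 ∧ g = D.f x * z.1 ∧ b = z.2 := by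
  unfold B1 at h
  rw [Finset.sum_apply, Finsupp.finsetSum_apply] at h
  obtain ⟨s, -, h⟩ := Finset.exists_ne_zero_of_sum_ne_zero h
  obtain ⟨z, hz, x, hx, h1, h2⟩ := cnv_supp D.f D.inj h
  exact ⟨s, z, hz, x, left_ne_zero_of_mul hx, right_ne_zero_of_mul hx, h1, h2⟩
theorem B2_supp {l m : Fin 2 → A → ZMod 2} {g : PresentedGroup R} {b : S × Bool} (h : D.B2 l m g b ≠ 0) :
    ∃ s, ∃ z ∈ (pF R (D.yw s)).support, ∃ x : A × A, D.dl l x.1 ≠ 0 ∧ m s x.2 ≠ 0 ∧ g = D.f x * z.1 ∧ b = z.2 := by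
  unfold B2 at h
  rw [Finset.sum_apply, Finsupp.finsetSum_apply] at h
  obtain ⟨s, -, h⟩ := Finset.exists_ne_zero_of_sum_ne_zero h
  obtain ⟨z, hz, x, hx, h1, h2⟩ := cnv_supp D.f D.inj h
  exact ⟨s, z, hz, x, left_ne_zero_of_mul hx, right_ne_zero_of_mul hx, h1, h2⟩

theorem Reg_aux (Q : LS (GX hS)) {l m σ μ : Fin 2 → A → ZMod 2} (g : PresentedGroup R) (W : ℕ → Finset (PresentedGroup R))
    (hW : ∀ q, W q ⊆ W (q+1) ∧ ∀ c, D.Fs l m c → c.1 ∈ W q → ∀ i, ((GX hS).at' c i).1 ∈ W (q+1))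
    (hag : ∀ v ∈ W 9, D.PP σ μ (g * v) = D.PP l m v)
    (h0 : ∀ c, D.Fs σ μ c → (∃ v ∈ W 9, c.1 = g * v) → Q.Reg (D.Fs σ μ) 0 c) (r : ℕ) :
    ∀ q c, q + r = 9 → D.Fs σ μ c → (∀ i, ∃ v ∈ W q, ((GX hS).at' c i).1 = g * v) → Q.Reg (D.Fs σ μ) r c := by
  have mono : ∀ q k, W q ⊆ W (q + k) := by
    intro q k
    induction k with
    | zero => exact subset_rfl
    | succ k ih => exact ih.trans (hW _).1
  induction r with
  | zero =>
    intro q c hq hc hv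
    obtain rfl : q = 9 := by omega
    refine h0 c hc ?_
    obtain ⟨v, h1, h2⟩ := hv 0
    rw [CX.at_zero] at h2
    exact ⟨v, h1, h2⟩
  | succ r ih =>
    intro q c hq hc hv c' i hc' hv'
    refine ih (q+1) c' (by omega) hc' fun j => ?_
    obtain ⟨v, h1, h2⟩ := hv i
    have h3 : c'.1 = g * v := (show c'.1 = ((GX hS).at' c i).1 from hv').trans h2
    have h4 : D.Fs l m (v, c'.2) := by
      unfold Fs at *
      have := hag v (by have := mono q (r+1) h1; rwa [hq] at this)
      rw [h3, this] at hc'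
      exact hc'
    refine ⟨_, (hW q).2 (v, c'.2) h4 h1 j, ?_⟩
    have h5 := congrArg Prod.fst (tc_at (hS := hS) g (v, c'.2) j)
    have h6 : tc g (v, c'.2) = c' := Prod.ext h3.symm rfl
    rw [h6] at h5
    exact h5.symm

end Dat

theorem grid_count {G : Type*} [Group G] [DecidableEq G] (n : ℕ) (φ : ℕ × ℕ → G) (hφ : Function.Injective φ) (W BV : Finset G)
    (h : ∀ p ∈ Finset.range n ×ˢ Finset.range n, ∃ v ∈ W, φ p * v ∈ BV) : n * n ≤ W.card * BV.card := by
  choose! v hv hv' using h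
  have : (Finset.range n ×ˢ Finset.range n).card ≤ (W ×ˢ BV).card := by
    refine Finset.card_le_card_of_injOn (fun p => (v p, φ p * v p)) ?_ ?_
    · intro p hp
      exact Finset.mem_coe.2 (Finset.mem_product.2 ⟨hv p hp, hv' p hp⟩)
    · intro p _ q _ hpq
      have h1 := congrArg Prod.fst hpq
      have h2 := congrArg Prod.snd hpq
      dsimp only at h1 h2
      rw [h1] at h2
      exact hφ (mul_right_cancel h2)
  simpa [Finset.card_product] using this

namespace Dat
variable {S A : Type*} [DecidableEq S] [Group A] {R : Set (FreeGroup S)} {hS : FG.Symmetrized R} {D : Dat hS A}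

theorem A0_ex (D : Dat hS A) (W : Finset (PresentedGroup R)) : ∃ A0 : Finset A, ∀ v ∈ W, ∀ s t, ∀ z ∈ (D.cc s t).support, ∀ x,
    D.f x = v * z.1⁻¹ → x.1 ∈ A0 ∧ x.2 ∈ A0 := by
  classical
  have hfin : {x : A × A | ∃ v ∈ W, ∃ s t, ∃ z ∈ (D.cc s t).support, D.f x = v * z.1⁻¹}.Finite := by
    refine Set.Finite.of_finite_image (f := D.f) ?_ D.inj.injOn
    refine Set.Finite.subset (Finset.finite_toSet (W.biUnion fun v => Finset.univ.biUnion fun s : Fin 2 =>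
      Finset.univ.biUnion fun t : Fin 2 => (D.cc s t).support.image fun z => v * z.1⁻¹)) ?_
    rintro _ ⟨x, ⟨v, hv, s, t, z, hz, hx⟩, rfl⟩
    simp only [Finset.coe_biUnion, Finset.coe_image, Set.mem_iUnion, Set.mem_image, Finset.mem_coe]
    exact ⟨v, hv, s, Finset.mem_univ _, t, Finset.mem_univ _, z, hz, hx.symm⟩
  refine ⟨hfin.toFinset.image Prod.fst ∪ hfin.toFinset.image Prod.snd, fun v hv s t z hz x hx => ?_⟩
  have hm : x ∈ hfin.toFinset := hfin.mem_toFinset.2 ⟨v, hv, s, t, z, hz, hx⟩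
  exact ⟨Finset.mem_union_left _ (Finset.mem_image_of_mem _ hm), Finset.mem_union_right _ (Finset.mem_image_of_mem _ hm)⟩

theorem U_ex (D : Dat hS A) : ∃ K : ℕ, ∀ (σ μ : Fin 2 → A → ZMod 2) (C C' n : ℕ) (E E2 E' E2' : Finset A), E.card ≤ C * n → E2.card ≤ 2 →
    E'.card ≤ C' * n → E2'.card ≤ 2 → (∀ s a, σ s a ≠ 0 → a ∈ E) → (∀ a, D.dl σ a ≠ 0 → a ∈ E2) →
    (∀ s a, μ s a ≠ 0 → a ∈ E') → (∀ a, D.dl μ a ≠ 0 → a ∈ E2') →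
    ({c | D.Fs σ μ c}.Finite) ∧ ∃ U : Finset (PresentedGroup R × (S × Bool)), U.card ≤ K * (C + C') * n ∧
      ∀ c, D.Fs σ μ c → ((GX hS).vtx c, (GX hS).lab c) ∉ U → (GX hS).Ev (D.Fs σ μ) c := by
  classical
  obtain ⟨Z1, hZ1⟩ : ∃ Z : Finset (PresentedGroup R × (S × Bool)), Z = Finset.univ.biUnion fun s => (pF R (D.xw s)).support := ⟨_, rfl⟩
  obtain ⟨Z2, hZ2⟩ : ∃ Z : Finset (PresentedGroup R × (S × Bool)), Z = Finset.univ.biUnion fun s => (pF R (D.yw s)).support := ⟨_, rfl⟩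
  refine ⟨2 * Z1.card + 2 * Z2.card, fun σ μ C C' n E E2 E' E2' c1 c2 c3 c4 h1 h2 h3 h4 => ⟨?_, ?_⟩⟩
  · refine Set.Finite.subset (Finset.finite_toSet (Finset.univ.biUnion fun s : Fin 2 =>
      Finset.univ.biUnion fun t : Fin 2 => ((E ×ˢ E') ×ˢ (D.cc s t).support).image fun z => (D.f z.1 * z.2.1, z.2.2))) ?_
    rintro ⟨g, w⟩ hc
    obtain ⟨s, t, z, hz, x, hx1, hx2, e1, e2⟩ := PP_supp D hc
    simp only [Finset.coe_biUnion, Finset.coe_image, Set.mem_iUnion, Set.mem_image, Finset.mem_coe]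
    exact ⟨s, Finset.mem_univ _, t, Finset.mem_univ _, (x, z), Finset.mem_product.2 ⟨Finset.mem_product.2 ⟨h1 _ _ hx1, h3 _ _ hx2⟩, hz⟩,
      Prod.ext e1.symm e2.symm⟩
  · refine ⟨(((E ×ˢ E2') ×ˢ Z1).image fun z => (D.f z.1 * z.2.1, z.2.2)) ∪ (((E2 ×ˢ E') ×ˢ Z2).image fun z => (D.f z.1 * z.2.1, z.2.2)), ?_, ?_⟩
    · refine (Finset.card_union_le _ _).trans ((add_le_add Finset.card_image_le Finset.card_image_le).trans ?_)
      simp only [Finset.card_product]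
      have a1 : E.card * E2'.card * Z1.card ≤ C * n * 2 * Z1.card := by gcongr
      have a2 : E2.card * E'.card * Z2.card ≤ 2 * (C' * n) * Z2.card := by gcongr
      nlinarith [Nat.zero_le (Z1.card * C' * n), Nat.zero_le (Z2.card * C * n)]
    · intro c hc hU
      refine (ev_iff hS (D.PP σ μ) c).2 ?_
      rw [bd_PP, Finsupp.add_apply]
      have b1 : D.B1 σ μ c.1 ((WX hS).lab c.2) = 0 := by
        by_contra hne
        obtain ⟨s, z, hz, x, hx1, hx2, e1, e2⟩ := B1_supp hne
        apply hU
        refine Finset.mem_union_left _ (Finset.mem_image.2 ⟨(x, z), Finset.mem_product.2 ⟨Finset.mem_product.2 ⟨h1 _ _ hx1, h4 _ hx2⟩, ?_⟩, ?_⟩)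
        · rw [hZ1]; exact Finset.mem_biUnion.2 ⟨s, Finset.mem_univ _, hz⟩
        · exact Prod.ext e1.symm e2.symm
      have b2 : D.B2 σ μ c.1 ((WX hS).lab c.2) = 0 := by
        by_contra hne
        obtain ⟨s, z, hz, x, hx1, hx2, e1, e2⟩ := B2_supp hne
        apply hU
        refine Finset.mem_union_right _ (Finset.mem_image.2 ⟨(x, z), Finset.mem_product.2 ⟨Finset.mem_product.2 ⟨h2 _ hx1, h3 _ _ hx2⟩, ?_⟩, ?_⟩)
        · rw [hZ2]; exact Finset.mem_biUnion.2 ⟨s, Finset.mem_univ _, hz⟩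
        · exact Prod.ext e1.symm e2.symm
      rw [b1, b2, add_zero]

theorem honey (Q : LS (GX hS)) (hC : (GX hS).C6) {l m : Fin 2 → A → ZMod 2} (hl : D.Per l) (hm : D.Per m)
    (c : PresentedGroup R × RW R) (hc : D.Fs l m c) : (GX hS).Honey (D.Fs l m) c := by
  classical
  obtain ⟨W0, hW0⟩ := (GX hS).vtx_fin c
  have hn := nextW (D := D) l m
  choose nW hnW using hn
  obtain ⟨W, hWz, hWs⟩ : ∃ W : ℕ → Finset (PresentedGroup R), W 0 = W0 ∧ ∀ q, W (q+1) = nW (W q) :=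
    ⟨fun q => Nat.rec W0 (fun _ x => nW x) q, rfl, fun _ => rfl⟩
  have hW : ∀ q, W q ⊆ W (q+1) ∧ ∀ c, D.Fs l m c → c.1 ∈ W q → ∀ i, ((GX hS).at' c i).1 ∈ W (q+1) := by
    intro q; rw [hWs]; exact hnW _
  obtain ⟨A0, hA0⟩ := A0_ex D (W 9)
  obtain ⟨τ, C, hτ, hl⟩ := hl A0
  obtain ⟨τ', C', hτ', hm⟩ := hm A0
  obtain ⟨K, hK⟩ := U_ex D
  obtain ⟨n, hnn⟩ : ∃ n, n = (W 9).card * (5 * (K * (C + C'))) + 1 := ⟨_, rfl⟩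
  obtain ⟨σ, ⟨E, c1, h1⟩, ⟨E2, c2, h2⟩, hσ⟩ := hl n
  obtain ⟨μ, ⟨E', c3, h3⟩, ⟨E2', c4, h4⟩, hμ⟩ := hm n
  obtain ⟨hfin, U, hUc, hU⟩ := hK σ μ C C' n E E2 E' E2' c1 c2 c3 c4 h1 h2 h3 h4
  obtain ⟨B, hB⟩ : ∃ B : Finset (PresentedGroup R × RW R), ∀ a, a ∈ B ↔ (D.Fs σ μ a ∧ Q.AS a ∧ ¬ Q.Good (D.Fs σ μ) a) :=
    ⟨hfin.toFinset.filter fun a => Q.AS a ∧ ¬ Q.Good (D.Fs σ μ) a, fun a => by simp⟩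
  have hBc := Q.bad_count hC (D.Fs_inv σ μ) hfin U hU B (fun a ha => (hB a).1 ha)
  obtain ⟨BV, hBV⟩ : ∃ BV : Finset (PresentedGroup R), BV = B.image Prod.fst ∪ U.image Prod.fst := ⟨_, rfl⟩
  have hBVc : BV.card ≤ 5 * (K * (C + C') * n) := by
    rw [hBV]
    refine (Finset.card_union_le _ _).trans ((add_le_add Finset.card_image_le Finset.card_image_le).trans ?_)
    omega
  have hex : ∃ p ∈ Finset.range n ×ˢ Finset.range n, ∀ v ∈ W 9, D.f (τ ^ p.1, τ' ^ p.2) * v ∉ BV := by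
    by_contra hcon
    push Not at hcon
    have := grid_count n (fun p => D.f (τ ^ p.1, τ' ^ p.2)) (by
      intro p q hpq
      have := D.inj hpq
      exact Prod.ext (hτ (congrArg Prod.fst this)) (hτ' (congrArg Prod.snd this))) (W 9) BV hcon
    have h5 : n * n ≤ ((W 9).card * (5 * (K * (C + C')))) * n := by
      refine this.trans ((Nat.mul_le_mul_left _ hBVc).trans (le_of_eq ?_))
      ring
    have h6 : 0 < n := by omega
    have := Nat.le_of_mul_le_mul_right h5 h6
    omega
  obtain ⟨⟨a, b⟩, hab, hgood⟩ := hex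
  rw [Finset.mem_product, Finset.mem_range, Finset.mem_range] at hab
  dsimp only at hab hgood
  obtain ⟨g, hg⟩ : ∃ g, g = D.f (τ ^ a, τ' ^ b) := ⟨_, rfl⟩
  have hag : ∀ v ∈ W 9, D.PP σ μ (g * v) = D.PP l m v := by
    intro v hv
    rw [hg]
    apply PP_congr
    intro s t z hz x hx
    obtain ⟨q1, q2⟩ := hA0 v hv s t z hz x hx
    exact ⟨fun s => hσ a hab.1 _ q1 s, fun t => hμ b hab.2 _ q2 t⟩
  rw [← hg] at hgood
  have h0 : ∀ c, D.Fs σ μ c → (∃ v ∈ W 9, c.1 = g * v) → Q.Reg (D.Fs σ μ) 0 c := by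
    rintro c hc ⟨v, hv, hcv⟩
    constructor
    · intro hA
      by_contra hG
      apply hgood v hv
      rw [hBV, ← hcv]
      exact Finset.mem_union_left _ (Finset.mem_image_of_mem _ ((hB c).2 ⟨hc, hA, hG⟩))
    · refine hU c hc fun hm => hgood v hv ?_
      rw [hBV, ← hcv]
      exact Finset.mem_union_right _ (Finset.mem_image.2 ⟨_, hm, rfl⟩)
  have mono : ∀ k, W 0 ⊆ W k := by
    intro k
    induction k with
    | zero => exact subset_rfl
    | succ k ih => exact ih.trans (hW _).1
  have hFt : ∀ v ∈ W 9, ∀ w, D.Fs σ μ (g * v, w) ↔ D.Fs l m (v, w) := by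
    intro v hv w
    unfold Fs
    rw [hag v hv]
  have hc1 : c.1 ∈ W 0 := by
    have := hW0 0
    rw [CX.at_zero] at this
    rw [hWz]; exact this
  have hFc : D.Fs σ μ (tc g c) := (hFt c.1 (mono 9 hc1) c.2).2 hc
  have hreg := Reg_aux Q g W hW hag h0 9 0 (tc g c) (by norm_num) hFc (fun i => ⟨((GX hS).at' c i).1, by
    rw [hWz]; exact hW0 i, by rw [← tc_at]; rfl⟩)
  have hh := Q.honey_of_reg hC (D.Fs_inv σ μ) hreg hFc
  refine CX.Honey.transfer (tc g) (fun c => tc_nx g c) (fun c => rfl) (fun a b => ?_) (fun c => rfl) ?_ hh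
  · unfold CX.SD
    exact and_congr (mul_right_inj g) Iff.rfl
  · intro j b hb
    have : b.1 ∈ W 9 := by
      apply mono 9
      rw [hWz]
      have h7 : b.1 = ((GX hS).at' c j).1 := hb
      rw [h7]
      exact hW0 j
    exact hFt b.1 this b.2

end Dat

namespace Ry
abbrev A2 := FreeGroup (Fin 2)

noncomputable def w : Fin 3 → A2 := ![FreeGroup.of 0, (FreeGroup.of 0)⁻¹, FreeGroup.of 1]
def si : Fin 3 → Fin 2 := ![0, 0, 1]
def e : Fin 3 → ℕ := ![0, 1, 0]
noncomputable def xi : A2 →* Multiplicative ℤ := FreeGroup.lift ![Multiplicative.ofAdd 1, 1]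
noncomputable def et : A2 →* Multiplicative ℤ := FreeGroup.lift ![1, Multiplicative.ofAdd 1]
noncomputable def ch (i : Fin 3) (a : A2) : ℤ := (![1, -1, 0] : Fin 3 → ℤ) i * Multiplicative.toAdd (xi a) +
  (![0, 0, 1] : Fin 3 → ℤ) i * Multiplicative.toAdd (et a)

theorem ch_mul (i : Fin 3) (a b : A2) : ch i (a * b) = ch i a + ch i b := by
  simp only [ch, map_mul, toAdd_mul]; ring
theorem ch_one (i : Fin 3) : ch i 1 = 0 := by simp [ch]
theorem ch_inv (i : Fin 3) (a : A2) : ch i a⁻¹ = - ch i a := by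
  have := ch_mul i a a⁻¹
  rw [mul_inv_cancel, ch_one] at this; linarith
theorem ch_pow (i : Fin 3) (a : A2) (k : ℕ) : ch i (a ^ k) = k * ch i a := by
  induction k with
  | zero => simp [ch_one]
  | succ k ih => rw [pow_succ, ch_mul, ih]; push_cast; ring
theorem ch_zpow (i : Fin 3) (a : A2) (k : ℤ) : ch i (a ^ k) = k * ch i a := by
  cases k with
  | ofNat k => simp [ch_pow]
  | negSucc k => rw [zpow_negSucc, ch_inv, ch_pow, Int.negSucc_eq]; push_cast; ring
theorem ch_w (i : Fin 3) : ch i (w i) = 1 := by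
  fin_cases i <;> simp [ch, w, xi, et]
theorem ch_w' {i j : Fin 3} (h : i ≠ j) : ch i (w j) = 0 ∨ ch i (w j) = -1 := by
  fin_cases i <;> fin_cases j <;> simp_all [ch, w, xi, et]
theorem ch_gen (i : Fin 3) (s : Fin 2) : |ch i (FreeGroup.of s)| ≤ 1 := by
  fin_cases i <;> fin_cases s <;> simp [ch, xi, et]
theorem e_le (i : Fin 3) : e i ≤ 1 := by fin_cases i <;> simp [e]
theorem w_gen (i : Fin 3) : (e i = 0 ∧ w i = FreeGroup.of (si i)) ∨ (e i = 1 ∧ w i = (FreeGroup.of (si i))⁻¹) := by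
  fin_cases i <;> simp [e, w, si]

open Classical in
noncomputable def dt (b a : A2) : ZMod 2 := if a = b then 1 else 0
noncomputable def seg (i : Fin 3) (N : ℕ) (s : Fin 2) (a : A2) : ZMod 2 :=
  if s = si i then ∑ k ∈ Finset.range N, dt (w i ^ (k + e i)) a else 0
open Classical in
noncomputable def ray (i : Fin 3) (s : Fin 2) (a : A2) : ZMod 2 := if s = si i ∧ ∃ k, a = w i ^ (k + e i) then 1 else 0

theorem dt_ne {b a : A2} (h : dt b a ≠ 0) : a = b := by
  by_contra hh; exact h (if_neg hh)
theorem wpow_inj {i : Fin 3} {a b : ℕ} (h : w i ^ a = w i ^ b) : a = b := by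
  have := congrArg (ch i) h
  rw [ch_pow, ch_pow, ch_w] at this; simpa using this
theorem seg_ne {i : Fin 3} {N : ℕ} {s : Fin 2} {a : A2} (h : seg i N s a ≠ 0) : ∃ k < N, a = w i ^ (k + e i) := by
  unfold seg at h
  split_ifs at h with h1
  · obtain ⟨k, hk, h⟩ := Finset.exists_ne_zero_of_sum_ne_zero h
    exact ⟨k, Finset.mem_range.1 hk, dt_ne h⟩
  · exact absurd rfl h
theorem ray_ne {i : Fin 3} {s : Fin 2} {a : A2} (h : ray i s a ≠ 0) : s = si i ∧ ∃ k, a = w i ^ (k + e i) := by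
  by_contra hh; exact h (if_neg hh)

theorem seg_ray {i : Fin 3} {N : ℕ} {s : Fin 2} {a : A2} (h : ch i a < N) : seg i N s a = ray i s a := by
  classical
  unfold seg
  by_cases hs : s = si i
  · rw [if_pos hs]
    by_cases hk : ∃ k, a = w i ^ (k + e i)
    · unfold ray
      rw [if_pos ⟨hs, hk⟩]
      obtain ⟨k, rfl⟩ := hk
      rw [ch_pow, ch_w] at h
      rw [Finset.sum_eq_single k]
      · exact if_pos rfl
      · intro b _ hb
        refine if_neg fun hh => hb ?_
        have := wpow_inj hh
        omega
      · intro hh; exact absurd (Finset.mem_range.2 (by push_cast at h; omega)) hh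
    · rw [show ray i s a = 0 from if_neg (fun hh => hk hh.2)]
      refine Finset.sum_eq_zero fun k _ => if_neg fun hh => hk ⟨k, hh⟩
  · rw [if_neg hs]
    exact (if_neg (fun hh => hs hh.1)).symm

section
variable {S : Type*} [DecidableEq S] {R : Set (FreeGroup S)} {hS : FG.Symmetrized R} {D : Dat hS A2}

theorem dl_add (l m : Fin 2 → A2 → ZMod 2) (a : A2) : D.dl (l + m) a = D.dl l a + D.dl m a := by
  unfold Dat.dl
  rw [← Finset.sum_add_distrib]
  refine Finset.sum_congr rfl fun s _ => ?_
  simp only [Pi.add_apply]; ring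

theorem dl_seg (hg : D.gen = FreeGroup.of) (i : Fin 3) (N : ℕ) (a : A2) : D.dl (seg i N) a = dt 1 a + dt (w i ^ N) a := by
  have h1 : D.dl (seg i N) a = ∑ k ∈ Finset.range N, (dt (w i ^ (k + e i)) a + dt (w i ^ (k + e i)) (a * (FreeGroup.of (si i))⁻¹)) := by
    unfold Dat.dl
    rw [hg, Finset.sum_eq_single (si i)]
    · unfold seg
      rw [if_pos rfl, if_pos rfl, Finset.sum_add_distrib]
    · intro s _ hs
      unfold seg
      rw [if_neg hs, if_neg hs, add_zero]
    · intro hh; exact absurd (Finset.mem_univ _) hh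
  have h2 : ∀ k, dt (w i ^ (k + e i)) a + dt (w i ^ (k + e i)) (a * (FreeGroup.of (si i))⁻¹) = dt (w i ^ k) a + dt (w i ^ (k+1)) a := by
    intro k
    have h3 : dt (w i ^ (k + e i)) (a * (FreeGroup.of (si i))⁻¹) = dt (w i ^ (k + e i) * FreeGroup.of (si i)) a := by
      unfold dt
      simp only [mul_inv_eq_iff_eq_mul]
    rw [h3]
    rcases w_gen i with ⟨h4, h5⟩ | ⟨h4, h5⟩
    · rw [h4, ← h5, add_zero, ← pow_succ]
    · rw [h4, show FreeGroup.of (si i) = (w i)⁻¹ by rw [h5, inv_inv], pow_succ, mul_inv_cancel_right, add_comm]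
  rw [h1, Finset.sum_congr rfl fun k _ => h2 k]
  clear h1 h2
  induction N with
  | zero => simp [CharTwo.add_self_eq_zero]
  | succ N ih =>
    rw [Finset.sum_range_succ, ih]
    have h5 : ∀ x y z : ZMod 2, x + y + (y + z) = x + z := by decide
    exact h5 _ _ _

theorem dl_ray (hg : D.gen = FreeGroup.of) (i : Fin 3) (a : A2) : D.dl (ray i) a = dt 1 a := by
  obtain ⟨N, hN⟩ : ∃ N : ℕ, N = (ch i a).natAbs + 2 := ⟨_, rfl⟩
  have h1 : D.dl (ray i) a = D.dl (seg i N) a := by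
    unfold Dat.dl
    rw [hg]
    refine Finset.sum_congr rfl fun s _ => ?_
    rw [seg_ray (by omega), seg_ray]
    rw [ch_mul, ch_inv]
    have := ch_gen i s
    rw [abs_le] at this
    omega
  rw [h1, dl_seg hg, show dt (w i ^ N) a = 0 from ?_, add_zero]
  refine if_neg fun hh => ?_
  have := congrArg (ch i) hh
  rw [ch_pow, ch_w] at this
  omega

theorem dl_two (hg : D.gen = FreeGroup.of) (i j : Fin 3) : D.dl (ray i + ray j) = 0 := by
  funext a
  rw [dl_add, dl_ray hg, dl_ray hg, CharTwo.add_self_eq_zero]; rfl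

theorem per_aux {i j : Fin 3} (hij : i ≠ j) {N : ℕ} {a : A2} (ha : |ch i a| < N) (ha' : |ch j a| < N) (k : ℤ) (hk : 1 ≤ k)
    (s : Fin 2) : seg i N s ((w j ^ N * (w i ^ N)⁻¹) ^ k * a) = 0 ∧ seg j N s ((w j ^ N * (w i ^ N)⁻¹) ^ k * a) = 0 := by
  rw [abs_lt] at ha
  have e0 : ch i ((w j ^ N * (w i ^ N)⁻¹) ^ k * a) = k * (N * ch i (w j) - N) + ch i a := by
    rw [ch_mul, ch_zpow, ch_mul, ch_inv, ch_pow, ch_pow, ch_w]; ring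
  constructor
  · by_contra hne
    obtain ⟨p, hp, h⟩ := seg_ne hne
    rw [h, ch_pow, ch_w] at e0
    have : (0:ℤ) ≤ ((p + e i : ℕ) : ℤ) * 1 := by positivity
    rcases ch_w' hij with h1 | h1 <;> rw [h1] at e0 <;> nlinarith
  · by_contra hne
    obtain ⟨p, hp, h⟩ := seg_ne hne
    rw [h, ch_pow] at e0
    have h2 : ((p + e j : ℕ) : ℤ) ≤ N := by have := e_le j; omega
    have h3 : (0:ℤ) ≤ ((p + e j : ℕ) : ℤ) := by positivity
    rcases ch_w' hij with h1 | h1 <;> rw [h1] at e0 <;> nlinarith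

theorem per (hg : D.gen = FreeGroup.of) {i j : Fin 3} (hij : i ≠ j) : D.Per (ray i + ray j) := by
  classical
  apply Dat.Per.of
  intro A0
  obtain ⟨N, hN⟩ : ∃ N : ℕ, N = ∑ a ∈ A0, ((ch i a).natAbs + (ch j a).natAbs) + 1 := ⟨_, rfl⟩
  have hA : ∀ a ∈ A0, |ch i a| < N ∧ |ch j a| < N := by
    intro a ha
    have := Finset.single_le_sum (f := fun a => (ch i a).natAbs + (ch j a).natAbs) (fun _ _ => Nat.zero_le _) ha
    constructor <;> rw [Int.abs_eq_natAbs] <;> omega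
  refine ⟨w j ^ N * (w i ^ N)⁻¹, w i ^ N, seg i N + seg j N, ((Finset.range N).image fun k => w i ^ (k + e i)) ∪
    ((Finset.range N).image fun k => w j ^ (k + e j)), ?_, ?_, ?_, ?_, ?_⟩
  · intro k k' h
    have := congrArg (ch i) h
    dsimp only at this
    rw [ch_pow, ch_pow, ch_mul, ch_inv, ch_pow, ch_pow, ch_w] at this
    have h2 : (N:ℤ) * ch i (w j) + -(N * 1) ≠ 0 := by
      rcases ch_w' hij with h1 | h1 <;> rw [h1] <;> omega
    have := mul_right_cancel₀ h2 this
    exact_mod_cast this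
  · intro s a h
    by_cases h1 : seg i N s a = 0
    · have h2 : seg j N s a ≠ 0 := by
        intro h2; apply h; rw [Pi.add_apply, Pi.add_apply, h1, h2, add_zero]
      obtain ⟨k, hk, rfl⟩ := seg_ne h2
      exact Finset.mem_union_right _ (Finset.mem_image.2 ⟨k, Finset.mem_range.2 hk, rfl⟩)
    · obtain ⟨k, hk, rfl⟩ := seg_ne h1
      exact Finset.mem_union_left _ (Finset.mem_image.2 ⟨k, Finset.mem_range.2 hk, rfl⟩)
  · intro a
    rw [dl_add, dl_seg hg, dl_seg hg]
    have h1 : Set.indicator {w i ^ N} (1 : A2 → ZMod 2) a = dt (w i ^ N) a := by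
      simp [Set.indicator_apply, dt]
    have h2 : Set.indicator {w i ^ N} (1 : A2 → ZMod 2) ((w j ^ N * (w i ^ N)⁻¹)⁻¹ * a) = dt (w j ^ N) a := by
      simp only [Set.indicator_apply, dt, Set.mem_singleton_iff, inv_mul_eq_iff_eq_mul, inv_mul_cancel_right, Pi.one_apply]
    rw [h1, h2]
    have h5 : ∀ x y z : ZMod 2, x + y + (x + z) = y + z := by decide
    exact h5 _ _ _
  · intro a ha s
    obtain ⟨h1, h2⟩ := hA a ha
    rw [Pi.add_apply, Pi.add_apply, seg_ray (lt_of_abs_lt h1), seg_ray (lt_of_abs_lt h2)]; rfl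
  · intro k hk a ha s
    obtain ⟨h1, h2⟩ := hA a ha
    rw [Pi.add_apply, Pi.add_apply]
    rcases lt_or_gt_of_ne hk with h | h
    · obtain ⟨q1, q2⟩ := per_aux hij.symm h2 h1 (-k) (by omega) s
      have e1 : (w i ^ N * (w j ^ N)⁻¹) ^ (-k) = (w j ^ N * (w i ^ N)⁻¹) ^ k := by
        rw [zpow_neg, ← inv_zpow, mul_inv_rev, inv_inv]
      rw [e1] at q1 q2
      rw [q1, q2, add_zero]
    · obtain ⟨q1, q2⟩ := per_aux hij h1 h2 k (by omega) s
      rw [q1, q2, add_zero]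

end
end Ry

open Ry

theorem equi_ex {H G : Type*} [Group H] [Group G] (f : H →* G) (hf : Function.Injective f) (χ : H → ℤ)
    (hχ : ∀ a b, χ (a * b) = χ a + χ b) : ∃ z : G → ℤ, ∀ h g, z (f h * g) = χ h + z g := by
  have hrep : ∀ g : G, ∃ h : H, f h = g * (Quotient.out (Quotient.mk (QuotientGroup.rightRel f.range) g))⁻¹ := by
    intro g
    have h1 : (QuotientGroup.rightRel f.range) (Quotient.out (Quotient.mk (QuotientGroup.rightRel f.range) g)) g :=
      Quotient.exact (Quotient.out_eq _)
    rw [QuotientGroup.rightRel_apply] at h1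
    exact h1
  choose hr hhr using hrep
  refine ⟨fun g => χ (hr g), fun h g => ?_⟩
  have h2 : (Quotient.mk (QuotientGroup.rightRel f.range) (f h * g)) = Quotient.mk (QuotientGroup.rightRel f.range) g := by
    apply Quotient.sound
    show (QuotientGroup.rightRel f.range) _ _
    rw [QuotientGroup.rightRel_apply]
    refine ⟨h⁻¹, ?_⟩
    rw [map_inv, mul_inv_rev, mul_inv_cancel_left]
  have h3 : hr (f h * g) = h * hr g := by
    apply hf
    rw [hhr, map_mul, hhr, h2, mul_assoc]
  show χ (hr (f h * g)) = _
  rw [h3, hχ]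

section
variable {S : Type*} [DecidableEq S] {R : Set (FreeGroup S)} {hS : FG.Symmetrized R}

/-- coarse coordinates -/
structure Geo (D : Dat hS A2) where
  z1 : Fin 3 → PresentedGroup R → ℤ
  z2 : Fin 3 → PresentedGroup R → ℤ
  e1 : ∀ j h g, z1 j (D.f h * g) = ch j h.1 + z1 j g
  e2 : ∀ j h g, z2 j (D.f h * g) = ch j h.2 + z2 j g
  κ : ℤ
  κ0 : 0 ≤ κ
  Zf : Finset (PresentedGroup R)
  sup : ∀ i k c, D.Fs (ray i) (ray k) c → ∃ p q : ℕ, (∃ z ∈ Zf, c.1 = D.f (w i ^ p, w k ^ q) * z) ∧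
    ∀ n j, |z1 j ((GX hS).at' c n).1 - p * ch j (w i)| ≤ κ ∧ |z2 j ((GX hS).at' c n).1 - q * ch j (w k)| ≤ κ

theorem Geo.ex (D : Dat hS A2) : Nonempty (Geo D) := by
  classical
  have h1 : ∀ j : Fin 3, ∃ z : PresentedGroup R → ℤ, ∀ h g, z (D.f h * g) = ch j h.1 + z g := fun j =>
    equi_ex D.f D.inj (fun h => ch j h.1) fun a b => ch_mul j _ _
  have h2 : ∀ j : Fin 3, ∃ z : PresentedGroup R → ℤ, ∀ h g, z (D.f h * g) = ch j h.2 + z g := fun j =>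
    equi_ex D.f D.inj (fun h => ch j h.2) fun a b => ch_mul j _ _
  choose z1 e1 using h1
  choose z2 e2 using h2
  have h : ∀ c : PresentedGroup R × RW R, ∃ W : Finset (PresentedGroup R), ∀ i, ((GX hS).at' c i).1 ∈ W := fun c => (GX hS).vtx_fin c
  choose vf hvf using h
  obtain ⟨ZZ, hZZ⟩ : ∃ ZZ : Finset (PresentedGroup R × RW R), ∀ s t, (D.cc s t).support ⊆ ZZ :=
    ⟨Finset.univ.biUnion fun s => Finset.univ.biUnion fun t => (D.cc s t).support, fun s t x hx =>
      Finset.mem_biUnion.2 ⟨s, Finset.mem_univ _, Finset.mem_biUnion.2 ⟨t, Finset.mem_univ _, hx⟩⟩⟩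
  obtain ⟨VV, hVV⟩ : ∃ VV : Finset (PresentedGroup R), VV = ZZ.biUnion vf := ⟨_, rfl⟩
  refine ⟨⟨z1, z2, e1, e2, ∑ v ∈ VV, ∑ j, (|z1 j v| + |z2 j v|), ?_, ZZ.image Prod.fst, ?_⟩⟩
  · exact Finset.sum_nonneg fun v _ => Finset.sum_nonneg fun j _ => by positivity
  · intro i k c hc
    obtain ⟨s, t, z, hz, x, hx1, hx2, g1, g2⟩ := D.PP_supp hc
    obtain ⟨-, p, hp⟩ := ray_ne hx1
    obtain ⟨-, q, hq⟩ := ray_ne hx2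
    have hx : x = (w i ^ (p + e i), w k ^ (q + e k)) := Prod.ext hp hq
    refine ⟨p + e i, q + e k, ⟨z.1, Finset.mem_image_of_mem _ (hZZ s t hz), by rw [← hx]; exact g1⟩, fun n j => ?_⟩
    have hct : c = Dat.tc (D.f x) z := Prod.ext g1 g2
    have h3 : ((GX hS).at' c n).1 = D.f x * ((GX hS).at' z n).1 := by
      rw [hct, ← Dat.tc_at]; rfl
    have hv : ((GX hS).at' z n).1 ∈ VV := by
      rw [hVV]; exact Finset.mem_biUnion.2 ⟨z, hZZ s t hz, hvf z n⟩
    have h4 := Finset.single_le_sum (f := fun v => ∑ j, (|z1 j v| + |z2 j v|)) (fun v _ => Finset.sum_nonneg fun j _ => by positivity) hv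
    have h5 := Finset.single_le_sum (f := fun j => (|z1 j ((GX hS).at' z n).1| + |z2 j ((GX hS).at' z n).1|)) (fun j _ => by positivity) (Finset.mem_univ j)
    have h6 := abs_nonneg (z1 j ((GX hS).at' z n).1)
    have h7 := abs_nonneg (z2 j ((GX hS).at' z n).1)
    rw [h3, e1, e2, hx]
    dsimp only
    rw [ch_pow, ch_pow, add_sub_cancel_left, add_sub_cancel_left]
    constructor <;> linarith

namespace Ry
variable (D : Dat hS A2)

noncomputable def Cf (i j k : Fin 3) (c : PresentedGroup R × RW R) : ZMod 2 := D.PP (ray i + ray j) (ray k) c.1 c.2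
noncomputable def Pf (i k : Fin 3) (c : PresentedGroup R × RW R) : ZMod 2 := D.PP (ray i) (ray k) c.1 c.2
def Kf (i j k : Fin 3) (c : PresentedGroup R × RW R) : Prop := ∀ l, l ≠ k → Cf D i j k c ≠ Cf D i j l c

theorem Cf_eq (i j k : Fin 3) (c : PresentedGroup R × RW R) : Cf D i j k c = Pf D i k c + Pf D j k c := by
  unfold Cf Pf; rw [D.PP_add_left]; rfl

theorem Kf_or (i j : Fin 3) {k l : Fin 3} (hkl : k ≠ l) (c : PresentedGroup R × RW R) :
    (Kf D i j k c ∨ Kf D i j l c) ↔ D.Fs (ray i + ray j) (ray k + ray l) c := by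
  have h1 : D.Fs (ray i + ray j) (ray k + ray l) c ↔ Cf D i j k c ≠ Cf D i j l c := by
    unfold Dat.Fs Cf
    rw [D.PP_add_right]
    have : ∀ x y : ZMod 2, x + y ≠ 0 ↔ x ≠ y := by decide
    exact this _ _
  rw [h1]
  constructor
  · rintro (h | h)
    · exact h l hkl.symm
    · exact (h k hkl).symm
  · intro h
    have h3 : ∀ x y z : ZMod 2, x ≠ y → x ≠ z ∨ y ≠ z := by decide
    obtain ⟨m, hm, hm'⟩ := CX.third k l
    have h4 : ∀ n, n = k ∨ n = l ∨ n = m := CX.fin3 hkl hm.symm hm'.symm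
    rcases h3 _ _ (Cf D i j m c) h with h5 | h5
    · left
      intro n hn
      rcases h4 n with rfl | rfl | rfl
      · exact absurd rfl hn
      · exact h
      · exact h5
    · right
      intro n hn
      rcases h4 n with rfl | rfl | rfl
      · exact h.symm
      · exact absurd rfl hn
      · exact h5

theorem Pf_at (i k : Fin 3) (c : PresentedGroup R × RW R) (n : ℤ) : Pf D i k ((GX hS).at' c n) = Pf D i k c := by
  refine (GX hS).at_ind (fun c' => Pf D i k c' = Pf D i k c) (fun c' h => ?_) (fun c' h => ?_) c rfl n
  · rw [← h]; exact D.PP_nx _ _ _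
  · rw [← h]
    have := D.PP_nx (ray i) (ray k) ((GX hS).nx.symm c')
    rw [Equiv.apply_symm_apply] at this
    exact this.symm
theorem Pf_rv (i k : Fin 3) (c : PresentedGroup R × RW R) : Pf D i k ((GX hS).rv c) = Pf D i k c := D.PP_rv _ _ _

theorem tri (Q : LS (GX hS)) (hC : (GX hS).C6) (hg : D.gen = FreeGroup.of) {i j : Fin 3} (hij : i ≠ j) :
    (GX hS).Tri (Kf D i j) := by
  constructor
  · intro k
    constructor
    · intro c hc l hl
      have := hc l hl
      unfold Cf at *
      rwa [D.PP_nx, D.PP_nx]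
    · intro c hc l hl
      have := hc l hl
      unfold Cf at *
      rwa [D.PP_rv, D.PP_rv]
  · intro k l c hk hl
    by_contra hkl
    obtain ⟨m, hm, hm'⟩ := CX.third k l
    have h3 : ∀ x y z : ZMod 2, x ≠ y → x ≠ z → y ≠ z → False := by decide
    exact h3 _ _ _ (hk l (Ne.symm hkl)) (hk m hm) (hl m hm')
  · intro k l hkl c hc
    have h1 : (fun c => Kf D i j k c ∨ Kf D i j l c) = D.Fs (ray i + ray j) (ray k + ray l) :=
      funext fun c => propext (Kf_or D i j hkl c)
    rw [h1]
    exact Dat.honey Q hC (per hg hij) (per hg hkl) c ((Kf_or D i j hkl c).1 hc)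

/-- cells in a state have a nonzero product coefficient -/
theorem Kf_ne {i j k : Fin 3} {c : PresentedGroup R × RW R} (h : Kf D i j k c) (a : Fin 3) (ha : a ≠ k) :
    ∃ b, b ≠ a ∧ (Pf D i b c ≠ 0 ∨ Pf D j b c ≠ 0) := by
  obtain ⟨m, hm, hm'⟩ := CX.third k a
  have h1 := h m hm
  rw [Cf_eq, Cf_eq] at h1
  by_contra hcon
  push Not at hcon
  obtain ⟨q1, q2⟩ := hcon k ha.symm
  obtain ⟨q3, q4⟩ := hcon m hm'
  exact h1 (by rw [q1, q2, q3, q4])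

end Ry
end

open Ry
namespace Geo
variable {S : Type*} [DecidableEq S] {R : Set (FreeGroup S)} {hS : FG.Symmetrized R} {D : Dat hS A2} (g : Geo D)

theorem pos {i j k : Fin 3} {c : PresentedGroup R × RW R} (h : Pf D i k c ≠ 0) (hij : j ≠ i) : g.z1 j c.1 ≤ g.κ := by
  obtain ⟨p, q, -, h1⟩ := g.sup i k c h
  have h2 := (h1 0 j).1
  rw [CX.at_zero, abs_le] at h2
  have hp : (0:ℤ) ≤ p := by positivity
  rcases ch_w' hij with h3 | h3 <;> rw [h3] at h2 <;> linarith

theorem near {i k : Fin 3} {c : PresentedGroup R × RW R} (h : Pf D i k c ≠ 0) (n : ℤ) (j : Fin 3) :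
    g.z1 j c.1 ≤ g.z1 j ((GX hS).at' c n).1 + 2 * g.κ := by
  obtain ⟨p, q, -, h1⟩ := g.sup i k c h
  have h2 := (h1 0 j).1
  have h3 := (h1 n j).1
  rw [CX.at_zero, abs_le] at h2
  rw [abs_le] at h3
  linarith

theorem fin_v (n : ℤ) : {v : PresentedGroup R | (∀ j, g.z1 j v ≤ n) ∧ ∃ i a i' b c c', a ≠ b ∧ Pf D i a c ≠ 0 ∧ Pf D i' b c' ≠ 0 ∧
    c.1 = v ∧ c'.1 = v}.Finite := by
  classical
  refine Set.Finite.subset (Finset.finite_toSet (Finset.univ.biUnion fun i : Fin 3 => Finset.univ.biUnion fun a : Fin 3 =>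
    ((Finset.range ((n + g.κ).toNat + 1) ×ˢ Finset.range ((2 * g.κ).toNat + 1)) ×ˢ g.Zf).image fun x =>
      D.f (w i ^ x.1.1, w a ^ x.1.2) * x.2)) ?_
  rintro v ⟨hn, i, a, i', b, c, c', hab, h1, h2, rfl, hv⟩
  obtain ⟨p, q, ⟨z, hz, e1⟩, h3⟩ := g.sup i a c h1
  obtain ⟨p', q', -, h4⟩ := g.sup i' b c' h2
  have b1 := (h3 0 i).1
  have b2 := (h3 0 a).2
  have b3 := (h4 0 a).2
  rw [CX.at_zero, abs_le, ch_w] at b1 b2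
  rw [CX.at_zero, abs_le, hv] at b3
  have b4 := hn i
  have hp : (0:ℤ) ≤ p := by positivity
  have hq : (0:ℤ) ≤ q' := by positivity
  have b5 : (q:ℤ) ≤ 2 * g.κ := by
    rcases ch_w' hab with h5 | h5 <;> rw [h5] at b3 <;> linarith
  simp only [Finset.coe_biUnion, Finset.coe_image, Set.mem_iUnion, Set.mem_image, Finset.mem_coe]
  refine ⟨i, Finset.mem_univ _, a, Finset.mem_univ _, ((p, q), z), Finset.mem_product.2 ⟨Finset.mem_product.2 ⟨?_, ?_⟩, hz⟩, e1.symm⟩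
  · rw [Finset.mem_range]; dsimp only; omega
  · rw [Finset.mem_range]; dsimp only; omega

variable {i j i' j' : Fin 3} (T : (GX hS).Tri (Kf D i j)) (T' : (GX hS).Tri (Kf D i' j'))

theorem lh_two {v : PresentedGroup R} {l : S × Bool} (h : T.lh v l ≠ 0) : ∃ i a i' b c c', a ≠ b ∧ Pf D i a c ≠ 0 ∧ Pf D i' b c' ≠ 0 ∧
    c.1 = v ∧ c'.1 = v := by
  obtain ⟨s, hv, -⟩ := T.lh_ex h
  have hvs : ∀ k, (s.1 k).1 = v := fun k => (s.2.2 k 0).1.trans hv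
  obtain ⟨a, -, ha⟩ := Kf_ne D (s.2.1 0) 1 (by decide)
  obtain ⟨k, hk, -⟩ := CX.third a a
  obtain ⟨b, hb, hb'⟩ := Kf_ne D (s.2.1 k) a hk.symm
  rcases ha with ha | ha <;> rcases hb' with hb' | hb'
  all_goals exact ⟨_, a, _, b, s.1 0, s.1 k, hb.symm, ha, hb', hvs _, hvs _⟩

theorem lh_lab {v : PresentedGroup R} {l : S × Bool} (h : T.lh v l ≠ 0) : ∃ i a c, Pf D i a c ≠ 0 ∧ c.1 = v ∧ (WX hS).lab c.2 = l := by
  obtain ⟨s, hv, hl⟩ := T.lh_ex h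
  obtain ⟨a, -, ha⟩ := Kf_ne D (s.2.1 0) 1 (by decide)
  rcases ha with ha | ha
  · exact ⟨_, a, s.1 0, ha, hv, hl⟩
  · exact ⟨_, a, s.1 0, ha, hv, hl⟩

theorem lh_zero {a : Fin 3} (h1 : a ≠ i) (h2 : a ≠ j) {v : PresentedGroup R} (hv : g.κ < g.z1 a v) (l : S × Bool) : T.lh v l = 0 := by
  by_contra h
  obtain ⟨s, hsv, -⟩ := T.lh_ex h
  have hsv : (s.1 0).1 = v := hsv
  obtain ⟨b, -, hb⟩ := Kf_ne D (s.2.1 0) 1 (by decide)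
  rcases hb with hb | hb
  · have := g.pos hb h1; rw [hsv] at this; linarith
  · have := g.pos hb h2; rw [hsv] at this; linarith

theorem Cf_ne_of {k : Fin 3} {c : PresentedGroup R × RW R} (h : Kf D i j k c) : ∃ i a, Pf D i a c ≠ 0 := by
  obtain ⟨m, hm, -⟩ := CX.third k k
  obtain ⟨a, -, ha⟩ := Kf_ne D h m hm
  rcases ha with ha | ha
  · exact ⟨_, _, ha⟩
  · exact ⟨_, _, ha⟩

theorem lh_eq (hC : (GX hS).C6) {a : Fin 3} (hag : ∀ k c, g.κ < g.z1 a c.1 → Cf D i j k c = Cf D i' j' k c)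
    {v : PresentedGroup R} (hv : 3 * g.κ < g.z1 a v) (l : S × Bool) : T.lh v l = T'.lh v l := by
  refine T.lh_local T' hC v (fun c hc hK n c' hc' k => ?_) l
  have hc : c.1 = v := hc
  have hc' : c'.1 = ((GX hS).at' c n).1 := hc'
  obtain ⟨i1, a1, hP⟩ : ∃ i a, Pf D i a c ≠ 0 := by
    obtain ⟨k, hk | hk⟩ := hK
    · exact Cf_ne_of hk
    · exact Cf_ne_of hk
  have h1 := g.near hP n a
  have h2 : g.κ < g.z1 a c'.1 := by rw [hc']; rw [hc] at h1; linarith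
  unfold Kf
  simp only [hag _ c' h2]

theorem agree {a b b' : Fin 3} (h1 : a ≠ b) (h2 : a ≠ b') (k : Fin 3) (c : PresentedGroup R × RW R) (h : g.κ < g.z1 a c.1) :
    Pf D b k c = 0 ∧ Pf D b' k c = 0 := by
  constructor
  · by_contra hh; have := g.pos hh h1; linarith
  · by_contra hh; have := g.pos hh h2; linarith

end Geo

theorem flux {V L : Type*} (Y : V → L → ℤ) (tg : V → L → V) (iv : L → L) (hiv : ∀ l, iv (iv l) = l)
    (htt : ∀ v l, tg (tg v l) (iv l) = v) (hrev : ∀ v l, Y (tg v l) (iv l) = - Y v l) (ψ : V → Prop)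
    (hfin : {d : V × L | ¬ ψ d.1 ∧ Y d.1 d.2 ≠ 0}.Finite)
    (hsum : ∀ v (A : Finset L), (∀ l, Y v l ≠ 0 → l ∈ A) → ∑ l ∈ A, Y v l = 0) :
    ∃ CR : Finset (V × L), (∀ d, d ∈ CR ↔ ¬ ψ d.1 ∧ ψ (tg d.1 d.2) ∧ Y d.1 d.2 ≠ 0) ∧ ∑ d ∈ CR, Y d.1 d.2 = 0 := by
  classical
  obtain ⟨DD, hDD⟩ : ∃ DD : Finset (V × L), ∀ d, d ∈ DD ↔ ¬ ψ d.1 ∧ Y d.1 d.2 ≠ 0 := ⟨hfin.toFinset, fun d => hfin.mem_toFinset⟩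
  refine ⟨DD.filter fun d => ψ (tg d.1 d.2), fun d => ?_, ?_⟩
  · rw [Finset.mem_filter, hDD]; tauto
  have h0 : ∑ d ∈ DD, Y d.1 d.2 = 0 := by
    rw [← Finset.sum_fiberwise_of_maps_to (g := Prod.fst) (t := DD.image Prod.fst) (fun d hd => Finset.mem_image_of_mem _ hd)]
    refine Finset.sum_eq_zero fun v hv => ?_
    have hψ : ¬ ψ v := by
      obtain ⟨d, hd, rfl⟩ := Finset.mem_image.1 hv
      exact ((hDD d).1 hd).1
    have h1 := hsum v ((DD.filter fun d => d.1 = v).image Prod.snd) (fun l hl =>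
      Finset.mem_image.2 ⟨(v, l), Finset.mem_filter.2 ⟨(hDD _).2 ⟨hψ, hl⟩, rfl⟩, rfl⟩)
    rw [Finset.sum_image] at h1
    · rw [← h1]
      refine Finset.sum_congr rfl fun d hd => ?_
      rw [(Finset.mem_filter.1 hd).2]
    · intro a ha b hb hab
      exact Prod.ext ((Finset.mem_filter.1 (Finset.mem_coe.1 ha)).2.trans (Finset.mem_filter.1 (Finset.mem_coe.1 hb)).2.symm) hab
  have h2 : ∑ d ∈ DD.filter (fun d => ¬ ψ (tg d.1 d.2)), Y d.1 d.2 = - ∑ d ∈ DD.filter (fun d => ¬ ψ (tg d.1 d.2)), Y d.1 d.2 := by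
    rw [← Finset.sum_neg_distrib]
    have hmem : ∀ d ∈ DD.filter (fun d => ¬ ψ (tg d.1 d.2)), (tg d.1 d.2, iv d.2) ∈ DD.filter (fun d => ¬ ψ (tg d.1 d.2)) := by
      intro d hd
      rw [Finset.mem_filter, hDD] at hd ⊢
      dsimp only
      rw [htt, hrev]
      exact ⟨⟨hd.2, neg_ne_zero.2 hd.1.2⟩, hd.1.1⟩
    have hinv : ∀ d : V × L, (tg (tg d.1 d.2) (iv d.2), iv (iv d.2)) = d := fun d => Prod.ext (htt _ _) (hiv _)
    refine Finset.sum_nbij' (fun d => (tg d.1 d.2, iv d.2)) (fun d => (tg d.1 d.2, iv d.2)) hmem hmem (fun d _ => hinv d) (fun d _ => hinv d) ?_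
    intro d _
    rw [hrev, neg_neg]
  have h3 := Finset.sum_filter_add_sum_filter_not DD (fun d => ψ (tg d.1 d.2)) (fun d => Y d.1 d.2)
  linarith

open Ry
namespace Geo
variable {S : Type*} [DecidableEq S] {R : Set (FreeGroup S)} {hS : FG.Symmetrized R} {D : Dat hS A2} (g : Geo D)

def ps (v : PresentedGroup R) : Prop := 3 * g.κ < g.z1 1 v

theorem lab_fin (D : Dat hS A2) (v : PresentedGroup R) : ∃ A : Finset (S × Bool), ∀ i a c, Pf D i a c ≠ 0 → c.1 = v → (WX hS).lab c.2 ∈ A := by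
  classical
  refine ⟨Finset.univ.biUnion fun i => Finset.univ.biUnion fun a => (D.PP (ray i) (ray a) v).support.image (WX hS).lab, ?_⟩
  rintro i a c h rfl
  exact Finset.mem_biUnion.2 ⟨i, Finset.mem_univ _, Finset.mem_biUnion.2 ⟨a, Finset.mem_univ _, Finset.mem_image_of_mem _ (Finsupp.mem_support_iff.2 h)⟩⟩

theorem flux01 (hC : (GX hS).C6) (T01 : (GX hS).Tri (Kf D 0 1)) (T02 : (GX hS).Tri (Kf D 0 2)) (T12 : (GX hS).Tri (Kf D 1 2)) :
    ∃ CR : Finset (PresentedGroup R × (S × Bool)), (∀ d, d ∈ CR ↔ ¬ g.ps d.1 ∧ g.ps (d.1 * ev R d.2) ∧ T01.lh d.1 d.2 ≠ 0) ∧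
      ∑ d ∈ CR, T01.lh d.1 d.2 = 0 := by
  classical
  have hiv : ∀ l : S × Bool, ivL (ivL l) = l := fun l => by unfold ivL; simp
  have htt : ∀ (v : PresentedGroup R) (l : S × Bool), v * ev R l * ev R (ivL l) = v := fun v l => by rw [ev_iv, mul_inv_cancel_right]
  have hκ := g.κ0
  obtain ⟨Y, hY⟩ : ∃ Y : PresentedGroup R → S × Bool → ℤ, ∀ v l, Y v l = T01.lh v l - T02.lh v l + T12.lh v l := ⟨fun v l => T01.lh v l - T02.lh v l + T12.lh v l, fun _ _ => rfl⟩
  have r1 : ∀ v l, T01.lh (v * ev R l) (ivL l) = - T01.lh v l := fun v l => T01.lh_rev hC (fun v l => v * ev R l) (fun c => rfl) htt v l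
  have r2 : ∀ v l, T02.lh (v * ev R l) (ivL l) = - T02.lh v l := fun v l => T02.lh_rev hC (fun v l => v * ev R l) (fun c => rfl) htt v l
  have r3 : ∀ v l, T12.lh (v * ev R l) (ivL l) = - T12.lh v l := fun v l => T12.lh_rev hC (fun v l => v * ev R l) (fun c => rfl) htt v l
  have hrev : ∀ v l, Y (v * ev R l) (ivL l) = - Y v l := by
    intro v l; rw [hY, hY, r1, r2, r3]; ring
  have a0 : ∀ v l, 3 * g.κ < g.z1 0 v → Y v l = 0 := by
    intro v l hv
    rw [hY, g.lh_zero T12 (a := 0) (by decide) (by decide) (by linarith), g.lh_eq T01 T02 hC (a := 0) _ hv]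
    · ring
    · intro k c hc
      obtain ⟨q1, q2⟩ := g.agree (a := 0) (b := 1) (b' := 2) (by decide) (by decide) k c hc
      rw [Cf_eq, Cf_eq, q1, q2]
  have a2 : ∀ v l, 3 * g.κ < g.z1 2 v → Y v l = 0 := by
    intro v l hv
    rw [hY, g.lh_zero T01 (a := 2) (by decide) (by decide) (by linarith), g.lh_eq T02 T12 hC (a := 2) _ hv]
    · ring
    · intro k c hc
      obtain ⟨q1, q2⟩ := g.agree (a := 2) (b := 0) (b' := 1) (by decide) (by decide) k c hc
      rw [Cf_eq, Cf_eq, q1, q2]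
  have a1 : ∀ v l, 3 * g.κ < g.z1 1 v → Y v l = 2 * T01.lh v l := by
    intro v l hv
    rw [hY, g.lh_zero T02 (a := 1) (by decide) (by decide) (by linarith), g.lh_eq T01 T12 hC (a := 1) _ hv]
    · ring
    · intro k c hc
      obtain ⟨q1, q2⟩ := g.agree (a := 1) (b := 0) (b' := 2) (by decide) (by decide) k c hc
      rw [Cf_eq, Cf_eq, q1, q2, zero_add, add_zero]
  have hne : ∀ v l, Y v l ≠ 0 → T01.lh v l ≠ 0 ∨ T02.lh v l ≠ 0 ∨ T12.lh v l ≠ 0 := by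
    intro v l h
    by_contra hh
    push Not at hh
    apply h
    rw [hY, hh.1, hh.2.1, hh.2.2]; rfl
  have hlab : ∀ v, ∃ A : Finset (S × Bool), ∀ l, (T01.lh v l ≠ 0 ∨ T02.lh v l ≠ 0 ∨ T12.lh v l ≠ 0) → l ∈ A := by
    intro v
    obtain ⟨A, hA⟩ := lab_fin D v
    refine ⟨A, fun l h => ?_⟩
    obtain ⟨i, a, c, h1, h2, rfl⟩ : ∃ i a c, Pf D i a c ≠ 0 ∧ c.1 = v ∧ (WX hS).lab c.2 = l := by
      rcases h with h | h | h
      · exact lh_lab T01 h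
      · exact lh_lab T02 h
      · exact lh_lab T12 h
    exact hA i a c h1 h2
  choose LL hLL using hlab
  have hsum : ∀ v (A : Finset (S × Bool)), (∀ l, Y v l ≠ 0 → l ∈ A) → ∑ l ∈ A, Y v l = 0 := by
    intro v A hA
    have h1 : ∑ l ∈ A, Y v l = ∑ l ∈ A ∪ LL v, Y v l := by
      refine Finset.sum_subset Finset.subset_union_left fun l _ hl => ?_
      by_contra hh
      exact hl (hA l hh)
    rw [h1]
    simp only [hY, Finset.sum_add_distrib, Finset.sum_sub_distrib]
    rw [T01.lh_sum hC v _ (fun l h => Finset.mem_union_right _ (hLL v l (Or.inl h))),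
      T02.lh_sum hC v _ (fun l h => Finset.mem_union_right _ (hLL v l (Or.inr (Or.inl h)))),
      T12.lh_sum hC v _ (fun l h => Finset.mem_union_right _ (hLL v l (Or.inr (Or.inr h))))]
    rfl
  have hfin : {d : PresentedGroup R × (S × Bool) | ¬ g.ps d.1 ∧ Y d.1 d.2 ≠ 0}.Finite := by
    refine Set.Finite.subset (Finset.finite_toSet ((g.fin_v (3 * g.κ)).toFinset.biUnion fun v => (LL v).image fun l => (v, l))) ?_
    rintro ⟨v, l⟩ ⟨h1, h2⟩
    dsimp only at h1 h2
    rw [Finset.mem_coe]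
    refine Finset.mem_biUnion.2 ⟨v, (Set.Finite.mem_toFinset _).2 ⟨?_, ?_⟩, Finset.mem_image_of_mem _ (hLL v l (hne v l h2))⟩
    · intro j
      by_contra hj
      push Not at hj
      fin_cases j
      · exact h2 (a0 v l hj)
      · exact h1 hj
      · exact h2 (a2 v l hj)
    · rcases hne v l h2 with h | h | h
      · exact lh_two T01 h
      · exact lh_two T02 h
      · exact lh_two T12 h
  obtain ⟨CR, hCR, hs⟩ := flux Y (fun v l => v * ev R l) ivL hiv htt hrev g.ps hfin hsum
  have hYc : ∀ v l, g.ps (v * ev R l) → Y v l = 2 * T01.lh v l := by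
    intro v l h
    have h1 := a1 (v * ev R l) (ivL l) h
    rw [hrev, r1] at h1
    linarith
  refine ⟨CR, fun d => ?_, ?_⟩
  · rw [hCR]
    constructor
    · rintro ⟨h1, h2, h3⟩
      refine ⟨h1, h2, fun h4 => h3 ?_⟩
      rw [hYc _ _ h2, h4]; rfl
    · rintro ⟨h1, h2, h3⟩
      refine ⟨h1, h2, fun h4 => h3 ?_⟩
      rw [hYc _ _ h2] at h4
      linarith
  · have h5 : ∑ d ∈ CR, Y d.1 d.2 = 2 * ∑ d ∈ CR, T01.lh d.1 d.2 := by
      rw [Finset.mul_sum]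
      exact Finset.sum_congr rfl fun d hd => hYc _ _ ((hCR d).1 hd).2.1
    rw [h5] at hs
    linarith

end Geo

theorem CX.even_cells {P V L : Type*} (X : CX P V L) (F : P → Prop) (hat : ∀ c n, F c → F (X.at' c n)) (hrv : ∀ c, F c → F (X.rv c))
    (ψ : V → Prop) (E : Finset P) (hE : ∀ c, c ∈ E ↔ F c ∧ ¬ ψ (X.vtx c) ∧ ψ (X.vtx (X.nx c))) : (E.card : ZMod 2) = 0 := by
  classical
  obtain ⟨B, hB⟩ : ∃ B : P → Set ℕ, ∀ c n, n ∈ B c ↔ 1 ≤ n ∧ ¬ ψ (X.vtx (X.at' c n)) := ⟨fun c => {n | 1 ≤ n ∧ ¬ ψ (X.vtx (X.at' c n))}, fun _ _ => Iff.rfl⟩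
  have hne : ∀ c ∈ E, (B c).Nonempty := by
    intro c hc
    refine ⟨(X.len c).toNat, ?_⟩
    have h1 := X.len_pos c
    rw [hB, show (((X.len c).toNat : ℕ) : ℤ) = X.len c by omega, X.at_len]
    exact ⟨by omega, ((hE c).1 hc).2.1⟩
  have hq : ∀ c ∈ E, 2 ≤ sInf (B c) ∧ ¬ ψ (X.vtx (X.at' c (sInf (B c) : ℕ))) ∧ ∀ m : ℕ, 1 ≤ m → m < sInf (B c) → ψ (X.vtx (X.at' c m)) := by
    intro c hc
    have h1 := (hB _ _).1 (Nat.sInf_mem (hne c hc))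
    refine ⟨?_, h1.2, ?_⟩
    · rcases Nat.lt_or_ge (sInf (B c)) 2 with h | h
      · have h2 : sInf (B c) = 1 := by omega
        rw [h2] at h1
        have h3 := h1.2
        rw [Nat.cast_one, X.at_one] at h3
        exact absurd ((hE c).1 hc).2.2 h3
      · exact h
    · intro m hm hlt
      have := Nat.notMem_of_lt_sInf hlt
      rw [hB] at this
      by_contra hh
      exact this ⟨hm, hh⟩
  have hv : ∀ c (q : ℕ) (m : ℤ), X.vtx (X.at' (X.rv (X.at' c q)) m) = X.vtx (X.at' c (q - m)) := by
    intro c q m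
    have : X.at' (X.rv (X.at' c q)) m = X.rv (X.at' c (q - m)) := by
      rw [X.rv_at, X.rv_at, X.at_at]; congr 1; ring
    rw [this, X.vtx_rv]
  have hmem : ∀ c ∈ E, X.rv (X.at' c (sInf (B c) : ℕ)) ∈ E := by
    intro c hc
    obtain ⟨h1, h2, h3⟩ := hq c hc
    rw [hE]
    refine ⟨hrv _ (hat _ _ ((hE c).1 hc).1), by rw [X.vtx_rv]; exact h2, ?_⟩
    rw [← X.at_one, hv]
    have := h3 (sInf (B c) - 1) (by omega) (by omega)
    rwa [Nat.cast_sub (by omega), Nat.cast_one] at this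
  have hqq : ∀ c ∈ E, sInf (B (X.rv (X.at' c (sInf (B c) : ℕ)))) = sInf (B c) := by
    intro c hc
    obtain ⟨h1, h2, h3⟩ := hq c hc
    obtain ⟨k1, k2, k3⟩ := hq _ (hmem c hc)
    apply le_antisymm
    · apply Nat.sInf_le
      rw [hB, hv, sub_self, X.at_zero]
      exact ⟨by omega, ((hE c).1 hc).2.1⟩
    · by_contra hlt
      push Not at hlt
      rw [hv] at k2
      apply k2
      have := h3 (sInf (B c) - sInf (B (X.rv (X.at' c (sInf (B c) : ℕ))))) (by omega) (by omega)
      rwa [Nat.cast_sub hlt.le] at this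
  rw [Finset.card_eq_sum_ones, Nat.cast_sum]
  refine Finset.sum_involution (fun c _ => X.rv (X.at' c (sInf (B c) : ℕ))) (fun c _ => ?_) (fun c _ _ => X.bar_ne c _) hmem ?_
  · decide
  · intro c hc
    rw [hqq c hc, X.bar_bar]

section
variable {S : Type*} [DecidableEq S] {R : Set (FreeGroup S)}

def Crs (ψ : PresentedGroup R → Prop) (d : PresentedGroup R × (S × Bool)) : Prop := ¬ ψ d.1 ∧ ψ (d.1 * ev R d.2)

open Classical in
noncomputable def crs (ψ : PresentedGroup R → Prop) : ((PresentedGroup R × (S × Bool)) →₀ ZMod 2) →+ ZMod 2 :=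
  Finsupp.liftAddHom fun d => if Crs ψ d then AddMonoidHom.id _ else 0

open Classical in
theorem crs_single (ψ : PresentedGroup R → Prop) (d : PresentedGroup R × (S × Bool)) (a : ZMod 2) :
    crs ψ (Finsupp.single d a) = if Crs ψ d then a else 0 := by
  unfold crs
  rw [Finsupp.liftAddHom_apply_single]
  split_ifs <;> rfl

open Classical in
noncomputable def ind (ψ : PresentedGroup R → Prop) (v : PresentedGroup R) : ZMod 2 := if ψ v then 1 else 0

theorem crs_ech (ψ : PresentedGroup R → Prop) (g : PresentedGroup R) (l : S × Bool) :
    crs ψ (tr g (ech R l)) = ind ψ g + ind ψ (g * ev R l) := by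
  unfold ech
  rw [map_add, map_add, tr_single, tr_single, crs_single, crs_single, mul_one]
  unfold Crs ind
  dsimp only
  rw [ev_iv, mul_inv_cancel_right]
  by_cases h1 : ψ g <;> by_cases h2 : ψ (g * ev R l) <;> simp [h1, h2]
  decide

theorem crs_pc (ψ : PresentedGroup R → Prop) (u : List (S × Bool)) (g : PresentedGroup R) :
    crs ψ (tr g (pc R u)) = ind ψ g + ind ψ (g * evs R u) := by
  induction u generalizing g with
  | nil => rw [evs_nil, mul_one, pc, map_zero, map_zero, CharTwo.add_self_eq_zero]
  | cons l u ih =>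
    rw [pc, map_add, map_add, crs_ech, tr_tr, ih, evs_cons, mul_assoc]
    have h5 : ∀ x y z : ZMod 2, x + y + (y + z) = x + z := by decide
    exact h5 _ _ _

theorem crs_pF (ψ : PresentedGroup R → Prop) (x : FreeGroup S) (g : PresentedGroup R) :
    crs ψ (tr g (pF R x)) = ind ψ g + ind ψ (g * PresentedGroup.mk R x) := by
  unfold pF
  rw [crs_pc]
  unfold evs
  rw [FreeGroup.mk_toWord]

theorem crs_sum (ψ : PresentedGroup R → Prop) (Z : (PresentedGroup R × (S × Bool)) →₀ ZMod 2)
    (Q : Finset (PresentedGroup R × (S × Bool))) (h1 : ∀ d ∈ Q, Crs ψ d) (h2 : ∀ d, Crs ψ d → Z d ≠ 0 → d ∈ Q) :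
    ∑ d ∈ Q, Z d = crs ψ Z := by
  classical
  conv_rhs => rw [← Finsupp.sum_single Z]
  rw [Finsupp.sum, map_sum]
  simp only [crs_single]
  rw [← Finset.sum_filter]
  symm
  refine Finset.sum_subset (fun d hd => ?_) (fun d hd hd' => ?_)
  · rw [Finset.mem_filter, Finsupp.mem_support_iff] at hd
    exact h2 d hd.2 hd.1
  · by_contra hne
    exact hd' (Finset.mem_filter.2 ⟨Finsupp.mem_support_iff.2 hne, h1 d hd⟩)

end

open Classical in
theorem cnv_dt {G H Λ : Type*} [Group G] [Group H] (f : H →* G) (hf : Function.Injective f) (a : H) (Z : (G × Λ) →₀ ZMod 2) (g : G) (l : Λ) :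
    cnv f (fun x => if x = a then 1 else 0) Z g l = tr (f a) Z (g, l) := by
  induction Z using chain_ind with
  | h0 => simp
  | hadd u v hu hv => rw [map_add, map_add, Pi.add_apply, Finsupp.add_apply, Finsupp.add_apply, hu, hv]
  | hs z b =>
    rw [cnv_single, tr_single, Finsupp.single_apply, Finsupp.single_apply]
    have h1 : exf f (fun x => if x = a then (1 : ZMod 2) else 0) (g * z.1⁻¹) = if g * z.1⁻¹ = f a then 1 else 0 := by
      by_cases hx : ∃ x, f x = g * z.1⁻¹
      · obtain ⟨x, hx⟩ := hx
        rw [← hx, exf_app hf]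
        simp only [hf.eq_iff]
      · rw [exf_zero _ _ _ hx, if_neg]
        intro hh; exact hx ⟨a, hh.symm⟩
    rw [h1]
    have h2 : g * z.1⁻¹ = f a ↔ f a * z.1 = g := by
      rw [mul_inv_eq_iff_eq_mul]; exact eq_comm
    simp only [h2, Prod.mk.injEq]
    by_cases q1 : z.2 = l <;> by_cases q2 : f a * z.1 = g <;> simp [q1, q2]

open Ry

theorem bd_ex {α : Type*} (s : Finset α) (f : α → ℤ) : ∃ b : ℤ, ∀ z ∈ s, f z ≤ b := by
  classical
  induction s using Finset.induction_on with
  | empty => exact ⟨0, fun z hz => absurd hz (Finset.notMem_empty z)⟩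
  | insert a s _ ih =>
    obtain ⟨b, hb⟩ := ih
    refine ⟨max b (f a), fun z hz => ?_⟩
    rcases Finset.mem_insert.1 hz with rfl | hz
    · exact le_max_right _ _
    · exact (hb z hz).trans (le_max_left _ _)

namespace Ry
variable {S : Type*} [DecidableEq S] {R : Set (FreeGroup S)} {hS : FG.Symmetrized R} (D : Dat hS A2)

theorem ch01 (a : A2) : ch 0 a = - ch 1 a := by simp [ch]

/-- the path along a finite segment of a ray -/
noncomputable def ZN (i : Fin 3) (N : ℕ) : (PresentedGroup R × (S × Bool)) →₀ ZMod 2 :=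
  ∑ k ∈ Finset.range N, tr (D.f (w i ^ (k + e i), 1)) (pF R (D.xw (si i)))

theorem crs_ZN (hg : D.gen = FreeGroup.of) (ψ : PresentedGroup R → Prop) (i : Fin 3) (N : ℕ) :
    crs ψ (ZN D i N) = ind ψ 1 + ind ψ (D.f (w i ^ N, 1)) := by
  have h1 : ∀ k, crs ψ (tr (D.f (w i ^ (k + e i), 1)) (pF R (D.xw (si i)))) = ind ψ (D.f (w i ^ k, 1)) + ind ψ (D.f (w i ^ (k+1), 1)) := by
    intro k
    rw [crs_pF, D.hx, ← map_mul, Prod.mk_mul_mk, one_mul, hg]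
    rcases w_gen i with ⟨h4, h5⟩ | ⟨h4, h5⟩
    · rw [h4, ← h5, add_zero, ← pow_succ]
    · rw [h4, show FreeGroup.of (si i) = (w i)⁻¹ by rw [h5, inv_inv], pow_succ, mul_inv_cancel_right, add_comm]
  unfold ZN
  rw [map_sum, Finset.sum_congr rfl fun k _ => h1 k]
  clear h1
  induction N with
  | zero =>
    rw [Finset.sum_range_zero, pow_zero, show ((1, 1) : A2 × A2) = 1 from rfl, map_one, CharTwo.add_self_eq_zero]
  | succ N ih =>
    rw [Finset.sum_range_succ, ih]
    have h5 : ∀ x y z : ZMod 2, x + y + (y + z) = x + z := by decide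
    exact h5 _ _ _

theorem B1_seg (hg : D.gen = FreeGroup.of) (i j : Fin 3) (N : ℕ) (v : PresentedGroup R) (l : S × Bool) :
    D.B1 (seg i N) (ray j) v l = ZN D i N (v, l) := by
  classical
  unfold Dat.B1 ZN
  rw [Finset.sum_apply, Finsupp.finsetSum_apply, Finsupp.finsetSum_apply, Finset.sum_eq_single (si i)]
  · have h1 : tens (seg i N (si i)) (D.dl (ray j)) = ∑ k ∈ Finset.range N, fun x : A2 × A2 => if x = (w i ^ (k + e i), 1) then (1 : ZMod 2) else 0 := by
      funext x
      unfold tens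
      rw [dl_ray hg]
      unfold seg
      rw [if_pos rfl, Finset.sum_mul, Finset.sum_apply]
      refine Finset.sum_congr rfl fun k _ => ?_
      unfold dt
      by_cases q1 : x.1 = w i ^ (k + e i) <;> by_cases q2 : x.2 = 1 <;> simp [q1, q2, Prod.ext_iff]
    rw [h1, ← Dat.cnvH_app, map_sum, Finset.sum_apply, Finsupp.finsetSum_apply]
    refine Finset.sum_congr rfl fun k _ => ?_
    rw [Dat.cnvH_app, ← cnv_dt D.f D.inj]
    congr! 5
  · intro s _ hs
    rw [cnv_zero _ _ (fun x => ?_)]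
    · rfl
    · unfold tens seg
      rw [if_neg hs, zero_mul]
  · intro hh; exact absurd (Finset.mem_univ _) hh

theorem B1_add (l l' m : Fin 2 → A2 → ZMod 2) : D.B1 (l + l') m = D.B1 l m + D.B1 l' m := by
  have : ∀ l, D.B1 l m = ∑ s, D.cnvH (pF R (D.xw s)) (tens (l s) (D.dl m)) := fun l => rfl
  simp only [this, Pi.add_apply, Dat.tens_add_left, map_add, Finset.sum_add_distrib]

theorem B2_zero (hg : D.gen = FreeGroup.of) (i j k : Fin 3) : D.B2 (ray i + ray j) (ray k) = 0 := by
  unfold Dat.B2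
  refine Finset.sum_eq_zero fun t _ => ?_
  rw [cnv_zero _ _ (fun x => ?_)]
  unfold tens
  rw [dl_two hg]
  exact zero_mul _

end Ry

namespace Geo
variable {S : Type*} [DecidableEq S] {R : Set (FreeGroup S)} {hS : FG.Symmetrized R} {D : Dat hS A2} (g : Geo D)

theorem N_ex : ∃ N0 : ℕ, ∀ N : ℕ, N0 ≤ N → ∀ (v : PresentedGroup R) (l : S × Bool), Crs g.ps (v, l) → ∀ j : Fin 3, D.B1 (ray 0 + ray 1) (ray j) v l = D.B1 (seg 0 N + seg 1 N) (ray j) v l := by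
  classical
  obtain ⟨ZZ, hZZ⟩ : ∃ ZZ : Finset (PresentedGroup R × (S × Bool)), ∀ s, (pF R (D.xw s)).support ⊆ ZZ :=
    ⟨Finset.univ.biUnion fun s => (pF R (D.xw s)).support, fun s x hx => Finset.mem_biUnion.2 ⟨s, Finset.mem_univ _, hx⟩⟩
  obtain ⟨b, hb⟩ := bd_ex ZZ fun z => |g.z1 1 z.1| + |g.z1 1 (z.1 * ev R z.2)|
  have hκ := g.κ0
  refine ⟨(3 * g.κ + b + 1).toNat, fun N hN v l hc j => ?_⟩
  by_contra hne
  have h1 : D.B1 ((ray 0 + ray 1) + (seg 0 N + seg 1 N)) (ray j) v l ≠ 0 := by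
    rw [B1_add, Pi.add_apply, Finsupp.add_apply]
    have h2 : ∀ x y : ZMod 2, x ≠ y → x + y ≠ 0 := by decide
    exact h2 _ _ hne
  obtain ⟨s, z, hz, x, h2, -, h3, h4⟩ := D.B1_supp h1
  have hbz := hb z (hZZ s hz)
  have c1 : g.z1 1 v ≤ 3 * g.κ := not_lt.1 hc.1
  have c2 : 3 * g.κ < g.z1 1 (v * ev R l) := hc.2
  rw [h3, g.e1] at c1
  rw [h3, h4, mul_assoc, g.e1] at c2
  have n1 := neg_abs_le (g.z1 1 z.1)
  have n2 := le_abs_self (g.z1 1 (z.1 * ev R z.2))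
  have n3 := abs_nonneg (g.z1 1 z.1)
  have n4 := abs_nonneg (g.z1 1 (z.1 * ev R z.2))
  have h01 := ch01 x.1
  have hN' : 3 * g.κ + b + 1 ≤ N := Int.toNat_le.1 hN
  have b0 : ch 0 x.1 < N := by linarith
  have b1 : ch 1 x.1 < N := by linarith
  apply h2
  show ray 0 s x.1 + ray 1 s x.1 + (seg 0 N s x.1 + seg 1 N s x.1) = 0
  rw [seg_ray b0, seg_ray b1]
  exact CharTwo.add_self_eq_zero _

theorem Z_ex (hg : D.gen = FreeGroup.of) : ∃ Z : (PresentedGroup R × (S × Bool)) →₀ ZMod 2, crs g.ps Z = 1 ∧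
    ∀ v l, Crs g.ps (v, l) → D.B1 (ray 0 + ray 1) (ray 0) v l = Z (v, l) := by
  obtain ⟨N0, h0⟩ := g.N_ex
  have hκ := g.κ0
  obtain ⟨N, hN⟩ : ∃ N : ℕ, N = N0 + (3 * g.κ + |g.z1 1 1|).toNat + 1 := ⟨_, rfl⟩
  refine ⟨ZN D 0 N + ZN D 1 N, ?_, fun v l hc => ?_⟩
  · have hz : ∀ i : Fin 3, g.z1 1 (D.f (w i ^ N, 1)) = N * ch 1 (w i) + g.z1 1 1 := by
      intro i
      have := g.e1 1 (w i ^ N, 1) 1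
      rwa [mul_one, ch_pow] at this
    have z0 := hz 0
    have z1 := hz 1
    have c0 := ch01 (w 0)
    rw [ch_w] at c0 z1
    have n1 := neg_abs_le (g.z1 1 1)
    have n2 := le_abs_self (g.z1 1 1)
    rw [show ch 1 (w 0) = -1 by omega] at z0
    have i0 : ind g.ps (D.f (w 0 ^ N, 1)) = 0 := by
      unfold ind ps; rw [if_neg]; rw [z0]; omega
    have i1 : ind g.ps (D.f (w 1 ^ N, 1)) = 1 := by
      unfold ind ps; rw [if_pos]; rw [z1]; omega
    rw [map_add, crs_ZN D hg, crs_ZN D hg, i0, i1]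
    have : ∀ x : ZMod 2, x + 0 + (x + 1) = 1 := by decide
    exact this _
  · rw [h0 N (by omega) v l hc, B1_add, Pi.add_apply, Finsupp.add_apply, B1_seg D hg, B1_seg D hg, Finsupp.add_apply]

noncomputable def Mf (D : Dat hS A2) (v : PresentedGroup R) : RW R →₀ ZMod 2 :=
  D.PP (ray 0 + ray 1) (ray 0) v * D.PP (ray 0 + ray 1) (ray 1) v + D.PP (ray 0 + ray 1) (ray 1) v * D.PP (ray 0 + ray 1) (ray 2) v +
    D.PP (ray 0 + ray 1) (ray 0) v * D.PP (ray 0 + ray 1) (ray 2) v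

theorem Mf_eq (c : PresentedGroup R × RW R) : Mf D c.1 c.2 = Cf D 0 1 0 c * Cf D 0 1 1 c + Cf D 0 1 1 c * Cf D 0 1 2 c + Cf D 0 1 0 c * Cf D 0 1 2 c := by
  unfold Mf Cf
  simp only [Finsupp.add_apply, Finsupp.mul_apply]

theorem par (T01 : (GX hS).Tri (Kf D 0 1)) (v : PresentedGroup R) (l : S × Bool) :
    ((T01.lh v l : ℤ) : ZMod 2) = Finsupp.mapDomain (WX hS).lab (D.PP (ray 0 + ray 1) (ray 0) v) l + Finsupp.mapDomain (WX hS).lab (Mf D v) l := by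
  rw [← Finsupp.add_apply, ← Finsupp.mapDomain_add, mapDomain_count, T01.lh_par]
  have hK : ∀ a : RW R, Kf D 0 1 0 (v, a) ↔ (D.PP (ray 0 + ray 1) (ray 0) v + Mf D v) a ≠ 0 := by
    intro a
    have h1 : Kf D 0 1 0 (v, a) ↔ Cf D 0 1 0 (v, a) ≠ Cf D 0 1 1 (v, a) ∧ Cf D 0 1 0 (v, a) ≠ Cf D 0 1 2 (v, a) := by
      constructor
      · intro h; exact ⟨h 1 (by decide), h 2 (by decide)⟩
      · rintro ⟨h1, h2⟩ l hl
        fin_cases l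
        · exact absurd rfl hl
        · exact h1
        · exact h2
    rw [h1, Finsupp.add_apply, Mf_eq (D := D) (v, a)]
    have : ∀ x y z : ZMod 2, (x ≠ y ∧ x ≠ z) ↔ x + (x * y + y * z + x * z) ≠ 0 := by decide
    exact this _ _ _
  have : {c | Kf D 0 1 0 c ∧ (GX hS).vtx c = v ∧ (GX hS).lab c = l} =
      (fun a => (v, a)) '' {a | (D.PP (ray 0 + ray 1) (ray 0) v + Mf D v) a ≠ 0 ∧ (WX hS).lab a = l} := by
    ext ⟨v', a⟩
    simp only [Set.mem_ofPred_eq, Set.mem_image, Prod.mk.injEq]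
    constructor
    · rintro ⟨h1, h2, h3⟩
      have h2 : v' = v := h2
      subst h2
      exact ⟨a, ⟨(hK a).1 h1, h3⟩, rfl, rfl⟩
    · rintro ⟨a', ⟨h1, h2⟩, rfl, rfl⟩
      exact ⟨(hK _).2 h1, rfl, h2⟩
  rw [this, Set.ncard_image_of_injective _ (fun a b h => (Prod.mk.inj h).2)]

theorem E_ex : ∃ E : Finset (PresentedGroup R × RW R), ∀ c, c ∈ E ↔ Mf D c.1 c.2 ≠ 0 ∧ ¬ g.ps ((GX hS).vtx c) ∧ g.ps ((GX hS).vtx ((GX hS).nx c)) := by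
  classical
  have hfin : {c : PresentedGroup R × RW R | Mf D c.1 c.2 ≠ 0 ∧ ¬ g.ps ((GX hS).vtx c) ∧ g.ps ((GX hS).vtx ((GX hS).nx c))}.Finite := by
    refine Set.Finite.subset (Finset.finite_toSet ((g.fin_v (3 * g.κ)).toFinset.biUnion fun v => (Mf D v).support.image fun l => (v, l))) ?_
    rintro c ⟨h1, h2, h3⟩
    have hκ := g.κ0
    rw [Finset.mem_coe]
    refine Finset.mem_biUnion.2 ⟨c.1, (Set.Finite.mem_toFinset _).2 ?_, Finset.mem_image.2 ⟨c.2, Finsupp.mem_support_iff.2 h1, rfl⟩⟩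
    rw [Mf_eq] at h1
    have h3' : 3 * g.κ < g.z1 1 ((GX hS).nx c).1 := h3
    have hP : ∀ k, Cf D 0 1 k c ≠ 0 → Pf D 1 k c ≠ 0 := by
      intro k hk h
      rw [Cf_eq, h, add_zero, ← Pf_at D 0 k c 1, CX.at_one] at hk
      have := g.pos hk (j := 1) (by decide)
      linarith
    obtain ⟨a, b, hab, ha, hb⟩ : ∃ a b, a ≠ b ∧ Cf D 0 1 a c ≠ 0 ∧ Cf D 0 1 b c ≠ 0 := by
      have : ∀ x y z : ZMod 2, x * y + y * z + x * z ≠ 0 → (x ≠ 0 ∧ y ≠ 0) ∨ (x ≠ 0 ∧ z ≠ 0) ∨ (y ≠ 0 ∧ z ≠ 0) := by decide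
      rcases this _ _ _ h1 with h | h | h
      · exact ⟨0, 1, by decide, h⟩
      · exact ⟨0, 2, by decide, h⟩
      · exact ⟨1, 2, by decide, h⟩
    refine ⟨fun j => ?_, 1, a, 1, b, c, c, hab, hP a ha, hP b hb, rfl, rfl⟩
    by_cases hj : j = 1
    · subst hj; exact not_lt.1 h2
    · have := g.pos (hP a ha) hj; linarith
  exact ⟨hfin.toFinset, fun c => hfin.mem_toFinset⟩

theorem contra (g : Geo D) (hC : (GX hS).C6) (hg : D.gen = FreeGroup.of) (T01 : (GX hS).Tri (Kf D 0 1)) (T02 : (GX hS).Tri (Kf D 0 2))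
    (T12 : (GX hS).Tri (Kf D 1 2)) : False := by
  classical
  obtain ⟨CR, hCR, hs⟩ := g.flux01 hC T01 T02 T12
  obtain ⟨Z, hZ1, hZ⟩ := g.Z_ex hg
  obtain ⟨E, hE⟩ := g.E_ex
  have hEv : (E.card : ZMod 2) = 0 := by
    refine (GX hS).even_cells (fun c => Mf D c.1 c.2 ≠ 0) ?_ ?_ g.ps E hE
    · intro c n h
      rw [Mf_eq] at h ⊢
      simp only [Cf_eq, Pf_at] at h ⊢
      exact h
    · intro c h
      rw [Mf_eq] at h ⊢
      simp only [Cf_eq, Pf_rv] at h ⊢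
      exact h
  obtain ⟨dd, hdd⟩ : ∃ dd : PresentedGroup R × RW R → PresentedGroup R × (S × Bool), ∀ c, dd c = (c.1, (WX hS).lab c.2) := ⟨_, fun _ => rfl⟩
  obtain ⟨Q, hQ⟩ : ∃ Q, Q = CR ∪ Z.support.filter (Crs g.ps) ∪ E.image dd := ⟨_, rfl⟩
  have hQc : ∀ d ∈ Q, Crs g.ps d := by
    intro d hd
    rw [hQ, Finset.mem_union, Finset.mem_union] at hd
    rcases hd with (hd | hd) | hd
    · exact ⟨((hCR d).1 hd).1, ((hCR d).1 hd).2.1⟩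
    · exact (Finset.mem_filter.1 hd).2
    · obtain ⟨c, hc, rfl⟩ := Finset.mem_image.1 hd
      rw [hdd]
      exact ⟨((hE c).1 hc).2.1, ((hE c).1 hc).2.2⟩
  have s1 : ∑ d ∈ Q, ((T01.lh d.1 d.2 : ℤ) : ZMod 2) = 0 := by
    rw [← Int.cast_sum, ← Finset.sum_subset (s₁ := CR), hs, Int.cast_zero]
    · intro d hd
      rw [hQ]
      exact Finset.mem_union_left _ (Finset.mem_union_left _ hd)
    · intro d hd hd'
      by_contra hne
      exact hd' ((hCR d).2 ⟨(hQc d hd).1, (hQc d hd).2, hne⟩)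
  have s2 : ∑ d ∈ Q, Z d = 1 := by
    rw [← hZ1]
    refine crs_sum g.ps Z Q hQc fun d h1 h2 => ?_
    rw [hQ]
    exact Finset.mem_union_left _ (Finset.mem_union_right _ (Finset.mem_filter.2 ⟨Finsupp.mem_support_iff.2 h2, h1⟩))
  have s3 : ∑ d ∈ Q, Finsupp.mapDomain (WX hS).lab (Mf D d.1) d.2 = 0 := by
    rw [← hEv, Finset.card_eq_sum_card_fiberwise (f := dd) (t := Q), Nat.cast_sum]
    · refine Finset.sum_congr rfl fun d hd => ?_
      rw [mapDomain_count]
      congr 1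
      rw [← Set.ncard_coe_finset, ← Set.ncard_image_of_injective _ (f := fun a : RW R => (d.1, a)) (fun a b h => (Prod.mk.inj h).2)]
      congr 1
      ext ⟨v, a⟩
      simp only [Set.mem_ofPred_eq, Set.mem_image, Prod.mk.injEq, Finset.coe_filter, hdd]
      constructor
      · rintro ⟨a', ⟨h1, h2⟩, rfl, rfl⟩
        refine ⟨(hE _).2 ⟨h1, (hQc d hd).1, ?_⟩, Prod.ext rfl h2⟩
        have := (hQc d hd).2
        rw [← h2] at this
        exact this
      · rintro ⟨h1, rfl⟩
        exact ⟨a, ⟨((hE _).1 h1).1, rfl⟩, rfl, rfl⟩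
    · intro c hc
      rw [hQ]
      exact Finset.mem_coe.2 (Finset.mem_union_right _ (Finset.mem_image_of_mem _ (Finset.mem_coe.1 hc)))
  have s4 : ∑ d ∈ Q, ((T01.lh d.1 d.2 : ℤ) : ZMod 2) = ∑ d ∈ Q, Z d + ∑ d ∈ Q, Finsupp.mapDomain (WX hS).lab (Mf D d.1) d.2 := by
    rw [← Finset.sum_add_distrib]
    refine Finset.sum_congr rfl fun d hd => ?_
    rw [par, D.bd_PP, B2_zero D hg, Finsupp.add_apply, hZ d.1 d.2 (hQc d hd), Pi.zero_apply, Finsupp.zero_apply, add_zero]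
  rw [s1, s2, s3] at s4
  exact absurd s4 (by decide)

end Geo

/-- There is no injective group homomorphism from `F₂ × F₂` into a group
with a C(6) small-cancellation presentation. -/
theorem c6_no_injective_hom_F2_prod_F2 {S : Type*} [DecidableEq S]
    (R : Set (FreeGroup S)) (hSym : FG.Symmetrized R) (hC6 : FG.C6 R) :
    ¬ ∃ f : (FreeGroup (Fin 2) × FreeGroup (Fin 2)) →* PresentedGroup R,
        Function.Injective f := by
  rintro ⟨f, hf⟩
  obtain ⟨D, -, hg⟩ := Dat.ex hSym f hf FreeGroup.of
  obtain ⟨g⟩ := Geo.ex D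
  have L := GLift hSym (WX.c6 hSym hC6)
  exact g.contra L.c6 hg (Ry.tri D L.toLS L.c6 hg (by decide)) (Ry.tri D L.toLS L.c6 hg (by decide)) (Ry.tri D L.toLS L.c6 hg (by decide))
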